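/- For every prime number p, there is at least one prime in the interval (p, p + π(p)]; equivalently, π(p + π(p)) - π(p) ≥ 1. -/

import Mathlib

section

open Complex Set Filter MeasureTheory Topology ComplexConjugate

/-! ### Growth of the completed zeta function -/

theorem exists_bound_completedRiemannZeta₀_of_re_mem_Icc (a b : ℝ) :
    ∃ C, ∀ s : ℂ, a ≤ s.re → s.re ≤ b → ‖completedRiemannZeta₀ s‖ ≤ C := by
  set P := HurwitzZeta.hurwitzEvenFEPair 0
  have hconv : ∀ σ : ℝ, IntegrableOn (fun t : ℝ => ‖P.f_modif t‖ * t ^ (σ / 2 - 1)) (Ioi 0) := by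
    intro σ
    have h := (P.isStrongFEPair_toStrongFEPair.hasMellin (σ / 2)).1
    refine IntegrableOn.congr_fun (Integrable.norm h) (fun t ht => ?_) measurableSet_Ioi
    have ht : 0 < t := ht
    change ‖(t : ℂ) ^ ((σ : ℂ) / 2 - 1) • P.f_modif t‖ = _
    rw [norm_smul, norm_cpow_eq_rpow_re_of_pos ht, mul_comm]
    congr 2
    simp
  refine ⟨(∫ t in Ioi (0 : ℝ), (‖P.f_modif t‖ * t ^ (a / 2 - 1) +
    ‖P.f_modif t‖ * t ^ (b / 2 - 1))) / 2, fun s ha hb => ?_⟩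
  have hΛ : completedRiemannZeta₀ s = (∫ t in Ioi (0 : ℝ), (t : ℂ) ^ (s / 2 - 1) • P.f_modif t) / 2 := rfl
  rw [hΛ, norm_div, Complex.norm_two]
  gcongr
  refine norm_integral_le_of_norm_le ((hconv a).add (hconv b)) ?_
  refine (ae_restrict_iff' measurableSet_Ioi).2 (ae_of_all _ fun t ht => ?_)
  have ht : 0 < t := ht
  rw [norm_smul, norm_cpow_eq_rpow_re_of_pos ht, mul_comm, ← mul_add]
  gcongr
  have h1 : (s / 2 - 1).re = s.re / 2 - 1 := by simp
  rw [h1]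
  rcases le_total t 1 with h | h
  · have := Real.rpow_le_rpow_of_exponent_ge ht h (show a / 2 - 1 ≤ s.re / 2 - 1 by linarith)
    have := Real.rpow_nonneg ht.le (b / 2 - 1)
    linarith
  · have := Real.rpow_le_rpow_of_exponent_le h (show s.re / 2 - 1 ≤ b / 2 - 1 by linarith)
    have := Real.rpow_nonneg ht.le (a / 2 - 1)
    linarith

theorem Complex.norm_Gamma_le_Gamma_re {s : ℂ} (hs : 0 < s.re) : ‖Gamma s‖ ≤ Real.Gamma s.re := by
  rw [Gamma_eq_integral hs, Real.Gamma_eq_integral hs]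
  refine norm_integral_le_of_norm_le (Real.GammaIntegral_convergent hs) ?_
  refine (ae_restrict_iff' measurableSet_Ioi).2 (ae_of_all _ fun t ht => ?_)
  have ht : 0 < t := ht
  rw [norm_mul, norm_cpow_eq_rpow_re_of_pos ht, norm_real, Real.norm_of_nonneg (Real.exp_pos _).le]
  simp

theorem Real.Gamma_le_one_add_factorial {x : ℝ} (n : ℕ) (h1 : 1 ≤ x) (h2 : x ≤ n + 1) :
    Real.Gamma x ≤ 1 + n.factorial := by
  have e1 : (1 : ℝ) = Real.Gamma 1 := Real.Gamma_one.symm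
  have e2 : (n.factorial : ℝ) = Real.Gamma (n + 1) := (Real.Gamma_nat_eq_factorial n).symm
  rw [e1, e2, Real.Gamma_eq_integral (by linarith), Real.Gamma_eq_integral one_pos,
    Real.Gamma_eq_integral (by positivity), ← integral_add (Real.GammaIntegral_convergent one_pos)
      (Real.GammaIntegral_convergent (by positivity))]
  refine setIntegral_mono_on (Real.GammaIntegral_convergent (by linarith))
    ((Real.GammaIntegral_convergent one_pos).add
      (Real.GammaIntegral_convergent (by positivity))) measurableSet_Ioi fun t ht => ?_
  have ht : 0 < t := ht
  rw [← mul_add]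
  refine mul_le_mul_of_nonneg_left ?_ (Real.exp_pos _).le
  rcases le_total t 1 with h | h
  · have := Real.rpow_le_rpow_of_exponent_ge ht h (show (1 : ℝ) - 1 ≤ x - 1 by linarith)
    have := Real.rpow_nonneg ht.le ((n : ℝ) + 1 - 1)
    linarith
  · have := Real.rpow_le_rpow_of_exponent_le h (show x - 1 ≤ (n : ℝ) + 1 - 1 by linarith)
    have := Real.rpow_nonneg ht.le ((1 : ℝ) - 1)
    linarith

/-- Riemann's `ξ` function, normalised by `ξ 0 = 1`. -/
noncomputable def riemannXi (s : ℂ) : ℂ := s * (s - 1) * completedRiemannZeta₀ s + 1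

theorem differentiable_riemannXi : Differentiable ℂ riemannXi := by
  have := differentiable_completedZeta₀
  unfold riemannXi
  fun_prop

theorem riemannXi_zero : riemannXi 0 = 1 := by simp [riemannXi]

theorem riemannXi_one_sub (s : ℂ) : riemannXi (1 - s) = riemannXi s := by
  rw [riemannXi, completedRiemannZeta₀_one_sub, riemannXi]
  ring

theorem riemannXi_one : riemannXi 1 = 1 := by simp [riemannXi]

theorem riemannXi_eq {s : ℂ} (h0 : s ≠ 0) (h1 : s ≠ 1) :
    riemannXi s = s * (s - 1) * completedRiemannZeta s := by
  have : 1 - s ≠ 0 := sub_ne_zero.2 h1.symm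
  rw [riemannXi, completedRiemannZeta_eq]
  field_simp
  ring

theorem norm_completedRiemannZeta_le {s : ℂ} (hs : 2 ≤ s.re) :
    ‖completedRiemannZeta s‖ ≤ Real.Gamma (s.re / 2) * ∑' n : ℕ, 1 / (n : ℝ) ^ (2 : ℝ) := by
  rw [completedZeta_eq_tsum_of_one_lt_re (by linarith), norm_mul, norm_mul]
  have h1 : ‖(Real.pi : ℂ) ^ (-s / 2)‖ ≤ 1 := by
    rw [norm_cpow_eq_rpow_re_of_pos Real.pi_pos]
    refine Real.rpow_le_one_of_one_le_of_nonpos (by linarith [Real.pi_gt_three]) ?_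
    simp; linarith
  have h2 : ‖Gamma (s / 2)‖ ≤ Real.Gamma (s.re / 2) := by
    have := norm_Gamma_le_Gamma_re (s := s / 2) (by simp; linarith)
    simpa using this
  have h3 : ‖∑' n : ℕ, 1 / (n : ℂ) ^ s‖ ≤ ∑' n : ℕ, 1 / (n : ℝ) ^ (2 : ℝ) := by
    refine tsum_of_norm_bounded (Real.summable_one_div_nat_rpow.2 (by norm_num)).hasSum fun n => ?_
    rcases Nat.eq_zero_or_pos n with rfl | hn
    · have hs0 : s ≠ 0 := by rintro rfl; simp at hs; linarith
      simp [hs0]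
    · rw [norm_div, norm_one, norm_natCast_cpow_of_pos hn]
      have : (1 : ℝ) ≤ n := by exact_mod_cast hn
      gcongr
  calc _ ≤ 1 * Real.Gamma (s.re / 2) * ∑' n : ℕ, 1 / (n : ℝ) ^ (2 : ℝ) := by gcongr
    _ = _ := by ring

theorem exists_bound_riemannXi : ∃ C : ℝ, 1 ≤ C ∧ ∀ n : ℕ, ∀ s : ℂ, 1 ≤ n → ‖s‖ ≤ n →
    ‖riemannXi s‖ ≤ C * n ^ 2 * n.factorial := by
  obtain ⟨C, hC⟩ := exists_bound_completedRiemannZeta₀_of_re_mem_Icc (-1) 2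
  set Z := ∑' n : ℕ, 1 / (n : ℝ) ^ (2 : ℝ)
  have hZ : 0 ≤ Z := tsum_nonneg fun n => by positivity
  refine ⟨2 * |C| + 18 * Z + 1, by have := abs_nonneg C; linarith, fun n s hn hs => ?_⟩
  have hn' : (1 : ℝ) ≤ n := by exact_mod_cast hn
  have hf : (1 : ℝ) ≤ n.factorial := by exact_mod_cast n.factorial_pos
  have hnf : (1 : ℝ) ≤ (n : ℝ) ^ 2 * n.factorial := by nlinarith [one_le_pow₀ hn' (n := 2)]
  have hC0 := abs_nonneg C
  -- the half-plane `2 ≤ re s`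
  have right : ∀ s : ℂ, 2 ≤ s.re → ‖s‖ ≤ n + 1 → ‖riemannXi s‖ ≤ 18 * Z * n ^ 2 * n.factorial := by
    intro s h2 hs
    rw [riemannXi_eq (by rintro rfl; simp at h2; linarith) (by rintro rfl; simp at h2),
      norm_mul, norm_mul]
    have h3 := norm_completedRiemannZeta_le h2
    have h4 := Real.Gamma_le_one_add_factorial (x := s.re / 2) n (by linarith)
      (by linarith [Complex.re_le_norm s])
    have h5 : ‖s - 1‖ ≤ n + 2 := (norm_sub_le _ _).trans (by simp; linarith)
    calc ‖s‖ * ‖s - 1‖ * ‖completedRiemannZeta s‖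
        ≤ (n + 1) * (n + 2) * ((1 + n.factorial) * Z) := by
          gcongr
          exact h3.trans (by gcongr)
      _ ≤ (3 * n * (3 * n)) * ((n.factorial + n.factorial) * Z) := by
          gcongr <;> linarith
      _ = _ := by ring
  have main : ‖riemannXi s‖ ≤ max (18 * Z * n ^ 2 * n.factorial) ((2 * |C| + 1) * n ^ 2 * n.factorial) := by
    rcases le_total 2 s.re with h2 | h2
    · exact (right s h2 (by linarith)).trans (le_max_left _ _)
    rcases le_total s.re (-1) with h1 | h1
    · rw [← riemannXi_one_sub]
      refine (right (1 - s) (by simp; linarith) ?_).trans (le_max_left _ _)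
      refine (norm_sub_le _ _).trans ?_
      simp; linarith
    · refine le_trans ?_ (le_max_right _ _)
      have h5 : ‖s - 1‖ ≤ n + 1 := (norm_sub_le _ _).trans (by simp; linarith)
      calc ‖riemannXi s‖ ≤ ‖s * (s - 1) * completedRiemannZeta₀ s‖ + ‖(1 : ℂ)‖ := norm_add_le _ _
        _ ≤ n * (n + n) * |C| + 1 := by
          rw [norm_mul, norm_mul, norm_one]
          gcongr
          · linarith
          · exact (hC s h1 h2).trans (le_abs_self C)
        _ = (2 * |C| * n ^ 2) * 1 + 1 := by ring
        _ ≤ (2 * |C| * n ^ 2) * n.factorial + n ^ 2 * n.factorial := by gcongr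
        _ = _ := by ring
  refine main.trans (max_le ?_ ?_)
  · gcongr; linarith
  · gcongr; linarith

/-! ### Splitting off the zeros of an entire function in a disc -/

theorem Multiset.norm_prod_map_sub_le {Z : Multiset ℂ} {c : ℝ} {s : ℂ} (h : ∀ ρ ∈ Z, ‖s - ρ‖ ≤ c) :
    ‖(Z.map fun ρ => s - ρ).prod‖ ≤ c ^ Z.card := by
  induction Z using Multiset.induction with
  | empty => simp
  | cons a Z ih =>
    rw [Multiset.map_cons, Multiset.prod_cons, norm_mul, Multiset.card_cons, pow_succ, mul_comm]
    have := h a (by simp)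
    have h2 := ih fun ρ hρ => h ρ (by simp [hρ])
    have := (norm_nonneg _).trans h2
    gcongr

theorem Multiset.le_norm_prod_map_sub {Z : Multiset ℂ} {c : ℝ} (hc : 0 ≤ c) {s : ℂ}
    (h : ∀ ρ ∈ Z, c ≤ ‖s - ρ‖) : c ^ Z.card ≤ ‖(Z.map fun ρ => s - ρ).prod‖ := by
  induction Z using Multiset.induction with
  | empty => simp
  | cons a Z ih =>
    rw [Multiset.map_cons, Multiset.prod_cons, norm_mul, Multiset.card_cons, pow_succ, mul_comm]
    have := h a (by simp)
    have h2 := ih fun ρ hρ => h ρ (by simp [hρ])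
    gcongr

theorem norm_cofactor_le {f g : ℂ → ℂ} {Z : Multiset ℂ} {M B : ℝ} (hM : 0 < M)
    (hg : Differentiable ℂ g) (hB : ∀ s, ‖s‖ ≤ 3 * M → ‖f s‖ ≤ B) (hZ : ∀ ρ ∈ Z, ‖ρ‖ < M)
    (hfg : ∀ s, f s = (Z.map fun ρ => s - ρ).prod * g s) {s : ℂ} (hs : ‖s‖ ≤ 3 * M) :
    ‖g s‖ ≤ B / (2 * M) ^ Z.card := by
  refine norm_le_of_forall_mem_frontier_norm_le (U := Metric.ball 0 (3 * M)) Metric.isBounded_ball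
    hg.diffContOnCl (fun z hz => ?_) ?_
  · rw [frontier_ball _ (by positivity), mem_sphere_zero_iff_norm] at hz
    rw [le_div_iff₀ (by positivity)]
    have h1 := hB z hz.le
    rw [hfg, norm_mul] at h1
    have h2 := Multiset.le_norm_prod_map_sub (Z := Z) (c := 2 * M) (by positivity) (s := z)
      fun ρ hρ => by linarith [norm_sub_norm_le z ρ, hZ ρ hρ]
    refine le_trans ?_ h1
    rw [mul_comm]
    gcongr
  · rwa [closure_ball _ (by positivity), mem_closedBall_zero_iff]

theorem exists_eq_prod_mul {f : ℂ → ℂ} (hf : Differentiable ℂ f) (hf0 : f 0 = 1) {M B : ℝ}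
    (hM : 0 < M) (hB : ∀ s, ‖s‖ ≤ 3 * M → ‖f s‖ ≤ B) :
    ∃ (Z : Multiset ℂ) (g : ℂ → ℂ), Differentiable ℂ g ∧ (∀ ρ ∈ Z, f ρ = 0) ∧
      (∀ s, f s = (Z.map fun ρ => s - ρ).prod * g s) ∧ (∀ s, ‖s‖ < M → g s ≠ 0) ∧
      ∀ s, ‖s‖ ≤ 3 * M → ‖g s‖ ≤ B * ‖g 0‖ := by
  have key : ∀ (Z : Multiset ℂ) (g : ℂ → ℂ), (∀ ρ ∈ Z, ‖ρ‖ < M) →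
      (∀ s, f s = (Z.map fun ρ => s - ρ).prod * g s) → 1 ≤ M ^ Z.card * ‖g 0‖ := by
    intro Z g hZ hfg
    have h1 := congrArg norm (hfg 0)
    rw [hf0, norm_one, norm_mul] at h1
    rw [h1]
    gcongr
    exact Multiset.norm_prod_map_sub_le fun ρ hρ => by simpa using (hZ ρ hρ).le
  have hB0 : 0 ≤ B := (norm_nonneg _).trans (hB 0 (by simp; positivity))
  by_contra H
  have step : ∀ n : ℕ, ∃ (Z : Multiset ℂ) (g : ℂ → ℂ), Z.card = n ∧ Differentiable ℂ g ∧
      (∀ ρ ∈ Z, ‖ρ‖ < M) ∧ (∀ ρ ∈ Z, f ρ = 0) ∧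
      (∀ s, f s = (Z.map fun ρ => s - ρ).prod * g s) := by
    intro n
    induction n with
    | zero => exact ⟨0, f, by simp, hf, by simp, by simp, by simp⟩
    | succ n ih =>
      obtain ⟨Z, g, hn, hg, hZ, hZ0, hfg⟩ := ih
      have hex : ∃ s, ‖s‖ < M ∧ g s = 0 := by
        by_contra hne
        push Not at hne
        refine H ⟨Z, g, hg, hZ0, hfg, hne, fun s hs => (norm_cofactor_le hM hg hB hZ hfg hs).trans ?_⟩
        rw [div_le_iff₀ (by positivity), mul_pow, mul_assoc]
        refine le_mul_of_one_le_right hB0 ?_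
        have h1 := key Z g hZ hfg
        have h2 : (1 : ℝ) ≤ 2 ^ Z.card := one_le_pow₀ (by norm_num)
        nlinarith
      obtain ⟨ρ, hρ, hgρ⟩ := hex
      refine ⟨ρ ::ₘ Z, dslope g ρ, by simp [hn], ?_, ?_, ?_, fun s => ?_⟩
      · rw [← differentiableOn_univ]
        exact (Complex.differentiableOn_dslope univ_mem).2 hg.differentiableOn
      · simpa using ⟨hρ, hZ⟩
      · simpa using ⟨by rw [hfg, hgρ, mul_zero], hZ0⟩
      · have := sub_smul_dslope g ρ s
        rw [hgρ, sub_zero, smul_eq_mul] at this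
        rw [hfg, Multiset.map_cons, Multiset.prod_cons, ← this]
        ring
  obtain ⟨n, hn⟩ := pow_unbounded_of_one_lt B (one_lt_two : (1 : ℝ) < 2)
  obtain ⟨Z, g, rfl, hg, hZ, hZ0, hfg⟩ := step n
  have h1 := key Z g hZ hfg
  have h2 := norm_cofactor_le hM hg hB hZ hfg (s := 0) (by simp; positivity)
  rw [le_div_iff₀ (by positivity), mul_pow] at h2
  have h3 : (0 : ℝ) < 2 ^ Z.card := by positivity
  nlinarith

/-- The logarithmic derivative of a zero-free function is almost constant near the origin. -/
theorem norm_logDeriv_sub_logDeriv_le {g : ℂ → ℂ} (hg : Differentiable ℂ g) {M G : ℝ} (hM : 0 < M)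
    (hG : 0 < G) (h0 : ∀ s, ‖s‖ < M → g s ≠ 0)
    (hB : ∀ s, ‖s‖ < M → ‖g s‖ ≤ Real.exp G * ‖g 0‖) {s t : ℂ} (hs : ‖s‖ ≤ M / 8)
    (ht : ‖t‖ ≤ M / 8) : ‖logDeriv g s - logDeriv g t‖ ≤ 64 * G / M ^ 2 * ‖s - t‖ := by
  have hd : DifferentiableOn ℂ (logDeriv g) (Metric.ball 0 M) := by
    refine DifferentiableOn.div (hg.deriv.differentiableOn) hg.differentiableOn fun z hz =>
      h0 z (by simpa using hz)
  obtain ⟨q, hq0, hq⟩ := hd.isExactOn_ball.with_val_at 0 0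
  have hq' : ∀ z, ‖z‖ < M → HasDerivAt q (logDeriv g z) z := fun z hz => hq z (by simpa using hz)
  have hexp : ∀ z, ‖z‖ < M → g z = g 0 * exp (q z) := by
    intro z hz
    have hconst : ∀ w ∈ Metric.ball (0 : ℂ) M, HasDerivAt (fun w => g w * exp (-q w)) 0 w := by
      intro w hw
      have hw : ‖w‖ < M := by simpa using hw
      have h1 := (hg w).hasDerivAt.mul ((hq' w hw).neg.cexp)
      refine HasDerivAt.congr_deriv h1 ?_
      rw [logDeriv_apply]
      field_simp [h0 w hw]
      ring
    have h1 := (convex_ball (0 : ℂ) M).is_const_of_fderivWithin_eq_zero (𝕜 := ℂ)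
      (f := fun w => g w * exp (-q w))
      (fun w hw => (hconst w hw).differentiableAt.differentiableWithinAt)
      (fun w hw => by
        rw [fderivWithin_of_isOpen Metric.isOpen_ball hw]
        ext
        simpa using (hconst w hw).deriv) (x := z) (y := 0) (by simpa using hz) (by simpa using hM)
    simp only [hq0, neg_zero, exp_zero, mul_one] at h1
    rw [← h1, mul_assoc, ← exp_add]
    simp
  have hg0 : 0 < ‖g 0‖ := norm_pos_iff.2 (h0 0 (by simpa using hM))
  have hre : ∀ z, ‖z‖ < M → (q z).re ≤ G := by
    intro z hz
    have h1 := hB z hz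
    rw [hexp z hz, norm_mul, norm_exp, mul_comm] at h1
    exact Real.exp_le_exp.1 (le_of_mul_le_mul_right h1 hg0)
  have hqb : ∀ z, ‖z‖ ≤ M / 2 → ‖q z‖ ≤ 2 * G := by
    intro z hz
    have h1 := borelCaratheodory_zero (f := q) (R := M) (z := z) hG
      (fun w hw => (hq w hw).differentiableAt.differentiableWithinAt)
      (fun w hw => hre w (by simpa using hw)) hM (by simpa using (by linarith : ‖z‖ < M)) hq0
    refine h1.trans ((div_le_iff₀ (by linarith)).2 ?_)
    nlinarith
  have hl : ∀ z, ‖z‖ ≤ M / 4 → ‖logDeriv g z‖ ≤ 2 * G / (M / 4) := by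
    intro z hz
    rw [← (hq' z (by linarith)).deriv]
    refine norm_deriv_le_of_forall_mem_sphere_norm_le (by positivity) ?_ fun w hw => hqb w ?_
    · refine DifferentiableOn.diffContOnCl fun w hw => ?_
      rw [closure_ball _ (by positivity)] at hw
      refine (hq' w ?_).differentiableAt.differentiableWithinAt
      have : ‖w - z‖ ≤ M / 4 := by simpa [dist_eq_norm] using hw
      linarith [norm_sub_norm_le w z]
    · have : ‖w - z‖ = M / 4 := by simpa [dist_eq_norm] using hw
      linarith [norm_sub_norm_le w z]
  have hdl : ∀ z ∈ Metric.closedBall (0 : ℂ) (M / 8), ‖deriv (logDeriv g) z‖ ≤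
      2 * G / (M / 4) / (M / 8) := by
    intro z hz
    have hz : ‖z‖ ≤ M / 8 := by simpa using hz
    refine norm_deriv_le_of_forall_mem_sphere_norm_le (by positivity) ?_ fun w hw => hl w ?_
    · refine (hd.mono fun w hw => ?_).diffContOnCl
      rw [closure_ball _ (by positivity)] at hw
      have : ‖w - z‖ ≤ M / 8 := by simpa [dist_eq_norm] using hw
      have := norm_sub_norm_le w z
      rw [mem_ball_zero_iff]
      linarith
    · have : ‖w - z‖ = M / 8 := by simpa [dist_eq_norm] using hw
      linarith [norm_sub_norm_le w z]
  have h1 := (convex_closedBall (0 : ℂ) (M / 8)).norm_image_sub_le_of_norm_deriv_le (f := logDeriv g)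
    (fun z hz => hd.differentiableAt (Metric.isOpen_ball.mem_nhds (by
      have : ‖z‖ ≤ M / 8 := by simpa using hz
      rw [mem_ball_zero_iff]
      linarith))) hdl (x := t) (y := s) (by simpa using ht) (by simpa using hs)
  refine h1.trans_eq ?_
  field_simp
  norm_num [mul_comm]

/-! ### Zeros and logarithmic derivative of `ξ` -/

theorem riemannXi_eq_riemannZeta {s : ℂ} (h0 : 0 < s.re) (h1 : s ≠ 1) :
    riemannXi s = 2 * (s - 1) * riemannZeta s * ((Real.pi : ℂ) ^ (-s / 2) * Gamma (s / 2 + 1)) := by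
  have hs : s ≠ 0 := by rintro rfl; simp at h0
  have hG : Gammaℝ s ≠ 0 := Gammaℝ_ne_zero_of_re_pos h0
  rw [riemannXi_eq hs h1, riemannZeta_def_of_ne_zero hs, Gamma_add_one _ (by simpa using hs)]
  rw [Gammaℝ_def] at hG ⊢
  have hG2 := right_ne_zero_of_mul hG
  field_simp

theorem riemannXi_conj (s : ℂ) : riemannXi (conj s) = conj (riemannXi s) := by
  have right : ∀ s : ℂ, 0 < s.re → riemannXi (conj s) = conj (riemannXi s) := by
    intro s hs
    by_cases h1 : s = 1
    · simp [h1, riemannXi_one]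
    have h1' : conj s ≠ 1 := fun h => h1 (by simpa using congrArg conj h)
    have hpi : ((Real.pi : ℂ) ^ (-conj s / 2)) = conj ((Real.pi : ℂ) ^ (-s / 2)) := by
      rw [show -conj s / 2 = conj (-s / 2) by simp [map_ofNat], cpow_conj _ _ (by
        rw [arg_ofReal_of_nonneg Real.pi_pos.le]; exact Real.pi_pos.ne), conj_ofReal]
    rw [riemannXi_eq_riemannZeta hs h1, riemannXi_eq_riemannZeta (by simpa using hs) h1',
      riemannZeta_conj, hpi, show conj s / 2 + 1 = conj (s / 2 + 1) by simp [map_ofNat], Gamma_conj]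
    simp [map_ofNat]
  rcases lt_or_ge 0 s.re with h | h
  · exact right s h
  · have := right (1 - s) (by simp; linarith)
    rwa [map_sub, map_one, riemannXi_one_sub, riemannXi_one_sub] at this

theorem riemannXi_ne_zero_of_one_le_re {s : ℂ} (hs : 1 ≤ s.re) : riemannXi s ≠ 0 := by
  by_cases h1 : s = 1
  · simp [h1, riemannXi_one]
  have h2 : Gamma (s / 2 + 1) ≠ 0 := Gamma_ne_zero_of_re_pos (by simp; linarith)
  have h3 : (Real.pi : ℂ) ^ (-s / 2) ≠ 0 := by simp [cpow_eq_zero_iff, Real.pi_ne_zero]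
  have := riemannZeta_ne_zero_of_one_le_re hs
  have := sub_ne_zero.2 h1
  rw [riemannXi_eq_riemannZeta (by linarith) h1]
  simp_all

theorem re_mem_Ioo_of_riemannXi_eq_zero {s : ℂ} (hs : riemannXi s = 0) : s.re ∈ Ioo (0 : ℝ) 1 := by
  constructor
  · by_contra! h
    refine riemannXi_ne_zero_of_one_le_re (s := 1 - s) (by simp; linarith) ?_
    rw [riemannXi_one_sub, hs]
  · by_contra! h
    exact riemannXi_ne_zero_of_one_le_re h hs

theorem riemannXi_one_sub_conj {s : ℂ} (hs : riemannXi s = 0) : riemannXi (1 - conj s) = 0 := by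
  rw [riemannXi_one_sub, riemannXi_conj, hs, map_zero]

theorem logDeriv_riemannXi_one_sub_conj (s : ℂ) :
    logDeriv riemannXi (1 - conj s) = -conj (logDeriv riemannXi s) := by
  have h1 : deriv riemannXi (1 - conj s) = -conj (deriv riemannXi s) := by
    have h2 : HasDerivAt riemannXi (conj (deriv riemannXi s)) (conj s) := by
      have h3 := (differentiable_riemannXi s).hasDerivAt.conj_conj
      refine h3.congr_of_eventuallyEq (Eventually.of_forall fun z => ?_)
      change riemannXi z = conj (riemannXi (conj z))
      rw [riemannXi_conj, conj_conj]
    have h4 : HasDerivAt (fun z => riemannXi (1 - z)) (conj (deriv riemannXi s)) (conj s) :=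
      h2.congr_of_eventuallyEq (Eventually.of_forall fun z => riemannXi_one_sub z)
    have h5 := (differentiable_riemannXi (1 - conj s)).hasDerivAt.comp_const_sub 1 (conj s)
    have := h4.unique h5
    rw [this, neg_neg]
  rw [logDeriv_apply, logDeriv_apply, h1, riemannXi_one_sub, riemannXi_conj, map_div₀, neg_div]

theorem logDeriv_riemannXi_one : logDeriv riemannXi 1 =
    (Real.eulerMascheroniConstant - Real.log (4 * Real.pi)) / 2 + 1 := by
  have h : HasDerivAt riemannXi (completedRiemannZeta₀ 1) 1 := by
    have := (((hasDerivAt_id (1 : ℂ)).mul ((hasDerivAt_id (1 : ℂ)).sub_const 1)).mul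
      (differentiable_completedZeta₀ 1).hasDerivAt).add_const 1
    refine this.congr_deriv ?_
    simp
  rw [logDeriv_apply, h.deriv, riemannXi_one, div_one, completedRiemannZeta₀_one]
  push_cast [Complex.ofReal_log (show 0 ≤ 4 * Real.pi by positivity)]
  rfl

theorem Multiset.logDeriv_prod_map_sub (Z : Multiset ℂ) {s : ℂ} (h : ∀ ρ ∈ Z, s ≠ ρ) :
    DifferentiableAt ℂ (fun s => (Z.map fun ρ => s - ρ).prod) s ∧
    logDeriv (fun s => (Z.map fun ρ => s - ρ).prod) s = (Z.map fun ρ => 1 / (s - ρ)).sum := by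
  induction Z using Multiset.induction with
  | empty => simp
  | cons a Z ih =>
    obtain ⟨h1, h2⟩ := ih fun ρ hρ => h ρ (by simp [hρ])
    have ha : s - a ≠ 0 := sub_ne_zero.2 (h a (by simp))
    simp only [Multiset.map_cons, Multiset.prod_cons, Multiset.sum_cons]
    have hd : DifferentiableAt ℂ (fun s => s - a) s := by fun_prop
    refine ⟨hd.mul h1, ?_⟩
    rw [logDeriv_mul (f := fun s => s - a) s ha ?_ hd h1, h2, logDeriv_apply]
    · simp
    · rw [Ne, Multiset.prod_eq_zero_iff, Multiset.mem_map]
      rintro ⟨ρ, hρ, h0⟩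
      exact h ρ (by simp [hρ]) (sub_eq_zero.1 h0)

theorem exists_log_factorial_le {C δ : ℝ} (hC : 1 ≤ C) (hδ : 0 < δ) :
    ∀ᶠ n : ℕ in atTop, Real.log (C * n ^ 2 * n.factorial) ≤ δ * n ^ 2 := by
  have h1 : ∀ᶠ n : ℕ in atTop, ‖Real.log n‖ ≤ δ / 4 * ‖(n : ℝ)‖ :=
    tendsto_natCast_atTop_atTop.eventually (Real.isLittleO_log_id_atTop.def (by positivity : 0 < δ / 4))
  have h2 : ∀ᶠ n : ℕ in atTop, Real.log C / (δ / 4) ≤ n := tendsto_natCast_atTop_atTop.eventually_ge_atTop _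
  filter_upwards [h1, h2, eventually_ge_atTop 1] with n h1 h2 h3
  have hn : (1 : ℝ) ≤ n := by exact_mod_cast h3
  have hf : (n.factorial : ℝ) ≤ (n : ℝ) ^ n := by exact_mod_cast n.factorial_le_pow
  rw [div_le_iff₀ (by positivity)] at h2
  have h4 : Real.log n ≤ δ / 4 * n := by
    have := (le_abs_self _).trans h1
    rwa [Real.norm_of_nonneg (by positivity)] at this
  have h5 : Real.log (C * n ^ 2 * n.factorial) ≤ Real.log (C * n ^ 2 * (n : ℝ) ^ n) :=
    Real.log_le_log (by positivity) (by gcongr)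
  rw [Real.log_mul (y := (n : ℝ) ^ n) (by positivity) (by positivity),
    Real.log_mul (y := (n : ℝ) ^ 2) (by positivity) (by positivity), Real.log_pow, Real.log_pow] at h5
  push_cast at h5
  nlinarith [mul_le_mul_of_nonneg_left h4 (by positivity : (0 : ℝ) ≤ n),
    mul_le_mul_of_nonneg_left hn (by positivity : (0 : ℝ) ≤ δ * n)]

/-- Truncated partial fraction expansion of the logarithmic derivative of `ξ`. -/
theorem exists_logDeriv_riemannXi_approx (K : ℝ) {ε : ℝ} (hε : 0 < ε) :
    ∃ (Z : Multiset ℂ) (c : ℝ), (∀ ρ ∈ Z, riemannXi ρ = 0) ∧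
      (∀ ρ, riemannXi ρ = 0 → ‖ρ‖ < K → ρ ∈ Z) ∧
      ∀ s, ‖s‖ < K → riemannXi s ≠ 0 → ‖logDeriv riemannXi s -
        (Z.map fun ρ => (1 / (s - ρ) + 1 / (s - (1 - conj ρ))) / 2).sum - c * I‖ ≤ ε := by
  obtain ⟨C, hC, hxi⟩ := exists_bound_riemannXi
  set δ := ε / (576 * (|K| + 1)) with hδ
  have hδ0 : 0 < δ := by positivity
  obtain ⟨n, hn1, hn2, hn3⟩ : ∃ n : ℕ, Real.log (C * ((3 * n : ℕ) : ℝ) ^ 2 * (3 * n).factorial) ≤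
      δ * ((3 * n : ℕ) : ℝ) ^ 2 ∧ 8 * (|K| + 1) ≤ n ∧ 1 ≤ n := by
    have h1 : ∀ᶠ n : ℕ in atTop, Real.log (C * ((3 * n : ℕ) : ℝ) ^ 2 * (3 * n).factorial) ≤
      δ * ((3 * n : ℕ) : ℝ) ^ 2 := (tendsto_id.const_mul_atTop' (by norm_num : 0 < 3)).eventually
        (exists_log_factorial_le hC hδ0)
    exact (h1.and ((tendsto_natCast_atTop_atTop.eventually_ge_atTop _).and
      (eventually_ge_atTop 1))).exists
  have hn0 : (0 : ℝ) < n := by exact_mod_cast hn3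
  set B := C * ((3 * n : ℕ) : ℝ) ^ 2 * (3 * n).factorial with hBdef
  have hB0 : 0 < B := by positivity
  set G := δ * ((3 * n : ℕ) : ℝ) ^ 2 with hG
  have hG0 : 0 < G := by positivity
  obtain ⟨Z, g, hg, hZ, hfac, hg0, hgB⟩ := exists_eq_prod_mul differentiable_riemannXi riemannXi_zero
    hn0 (B := B) (fun s hs => hxi (3 * n) s (by omega) (by push_cast; exact hs))
  have hlog := fun {s t : ℂ} => norm_logDeriv_sub_logDeriv_le hg hn0 hG0 hg0 (fun s hs =>
    (hgB s (by linarith)).trans (by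
      gcongr
      exact (Real.log_le_iff_le_exp hB0).1 hn1)) (s := s) (t := t)
  have hK := abs_nonneg K
  have hKn : ∀ s : ℂ, ‖s‖ < K → ‖s‖ ≤ n / 8 ∧ ‖1 - conj s‖ ≤ n / 8 := by
    intro s hs
    have h1 := le_abs_self K
    refine ⟨by linarith, (norm_sub_le _ _).trans ?_⟩
    simp only [norm_one, RCLike.norm_conj]
    linarith
  have hX : ∀ s : ℂ, ‖s‖ ≤ n / 8 → riemannXi s ≠ 0 → logDeriv riemannXi s =
      (Z.map fun ρ => 1 / (s - ρ)).sum + logDeriv g s := by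
    intro s hs h0
    have hne : ∀ ρ ∈ Z, s ≠ ρ := fun ρ hρ h => h0 (h ▸ hZ ρ hρ)
    obtain ⟨h1, h2⟩ := Multiset.logDeriv_prod_map_sub Z hne
    rw [show riemannXi = fun s => (Z.map fun ρ => s - ρ).prod * g s from funext hfac, logDeriv_mul _ _
      (hg0 s (by linarith)) h1 (hg s), h2]
    intro h
    exact h0 (by rw [hfac, h, zero_mul])
  refine ⟨Z, (logDeriv g 0).im, hZ, fun ρ h0 hρ => ?_, fun s hs h0 => ?_⟩
  · have h1 := hfac ρ
    rw [h0, eq_comm, mul_eq_zero, or_iff_left (hg0 ρ (by linarith [(hKn ρ hρ).1, norm_nonneg ρ])),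
      Multiset.prod_eq_zero_iff, Multiset.mem_map] at h1
    obtain ⟨ρ', h2, h3⟩ := h1
    rwa [sub_eq_zero.1 h3]
  obtain ⟨hs1, hs2⟩ := hKn s hs
  have e1 := hX s hs1 h0
  have e2 := hX (1 - conj s) hs2 (by rwa [riemannXi_one_sub, riemannXi_conj, Ne, map_eq_zero])
  have e3 : (Z.map fun ρ => (1 / (s - ρ) + 1 / (s - (1 - conj ρ))) / 2).sum =
      ((Z.map fun ρ => 1 / (s - ρ)).sum - conj (Z.map fun ρ => 1 / (1 - conj s - ρ)).sum) / 2 := by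
    rw [map_multiset_sum, Multiset.map_map, ← Multiset.sum_map_sub, ← Multiset.sum_map_div]
    refine congrArg Multiset.sum (Multiset.map_congr rfl fun ρ _ => ?_)
    simp only [Function.comp, map_div₀, map_sub, map_one, conj_conj]
    rw [show s - (1 - conj ρ) = -(1 - s - conj ρ) by ring, div_neg, ← sub_eq_add_neg]
  have e4 : ((logDeriv g 0).im : ℂ) * I = (logDeriv g 0 - conj (logDeriv g 0)) / 2 := by
    apply Complex.ext <;> simp
  have e5 : logDeriv riemannXi s -
      (Z.map fun ρ => (1 / (s - ρ) + 1 / (s - (1 - conj ρ))) / 2).sum - (logDeriv g 0).im * I =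
      ((logDeriv g s - logDeriv g 0) - conj (logDeriv g (1 - conj s) - logDeriv g 0)) / 2 := by
    rw [e3, e4]
    rw [logDeriv_riemannXi_one_sub_conj] at e2
    have e6 := congrArg conj e2
    simp only [map_neg, conj_conj, map_add] at e6
    simp only [map_sub]
    linear_combination (1 / 2 : ℂ) * e1 - (1 / 2 : ℂ) * e6
  rw [e5, norm_div, Complex.norm_two]
  have b1 := hlog (s := s) (t := 0) hs1 (by simp; positivity)
  have b2 := hlog (s := 1 - conj s) (t := 0) hs2 (by simp; positivity)
  have b3 := norm_sub_le (logDeriv g s - logDeriv g 0) (conj (logDeriv g (1 - conj s) - logDeriv g 0))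
  rw [RCLike.norm_conj] at b3
  have b4 : ‖1 - conj s‖ ≤ |K| + 1 := (norm_sub_le _ _).trans (by
    simp only [norm_one, RCLike.norm_conj]; linarith [le_abs_self K])
  have b5 : 64 * G / (n : ℝ) ^ 2 = ε / (|K| + 1) := by
    rw [hG, hδ]
    push_cast
    field_simp
    norm_num
  rw [b5, sub_zero] at b1 b2
  have b6 : ε / (|K| + 1) * ‖s‖ ≤ ε := by
    rw [div_mul_eq_mul_div, div_le_iff₀ (by positivity)]
    gcongr
    linarith [le_abs_self K]
  have b7 : ε / (|K| + 1) * ‖1 - conj s‖ ≤ ε := by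
    rw [div_mul_eq_mul_div, div_le_iff₀ (by positivity)]
    gcongr
  linarith

/-! ### The digamma function -/

namespace Complex

theorem norm_GammaSeq_le {s : ℂ} (hs : 0 < s.re) {n : ℕ} (hn : n ≠ 0) :
    ‖GammaSeq s n‖ ≤ Real.Gamma s.re := by
  rw [GammaSeq_eq_approx_Gamma_integral hs hn, Real.Gamma_eq_integral hs,
    intervalIntegral.integral_of_le n.cast_nonneg]
  have hGamma := Real.GammaIntegral_convergent hs
  refine (norm_integral_le_of_norm_le (hGamma.mono_set Ioc_subset_Ioi_self) ?_).trans
    (setIntegral_mono_set hGamma ?_ (Eventually.of_forall Ioc_subset_Ioi_self))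
  · refine (ae_restrict_iff' measurableSet_Ioc).2 (ae_of_all _ fun t ht => ?_)
    have h0 : 0 ≤ 1 - t / n := sub_nonneg.2 (div_le_one_of_le₀ ht.2 n.cast_nonneg)
    rw [norm_mul, norm_cpow_eq_rpow_re_of_pos ht.1, norm_real, Real.norm_of_nonneg (by positivity)]
    have := Real.one_sub_div_pow_le_exp_neg ht.2
    have := Real.rpow_nonneg ht.1.le (s.re - 1)
    simp only [sub_re, one_re]
    gcongr
  · refine (ae_restrict_iff' measurableSet_Ioi).2 (ae_of_all _ fun t ht => ?_)
    have : 0 < t := ht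
    simp only [Pi.zero_apply]
    positivity

theorem hasDerivAt_GammaSeq {s : ℂ} (hs : 0 < s.re) {n : ℕ} (hn : n ≠ 0) :
    HasDerivAt (fun s => GammaSeq s n)
      (GammaSeq s n * (log n - ∑ j ∈ Finset.range (n + 1), 1 / (s + j))) s := by
  have hne : ∀ j : ℕ, s + j ≠ 0 := fun j h => by
    have := congrArg re h
    simp at this
    have h2 : (0 : ℝ) ≤ j := j.cast_nonneg
    linarith
  have hP : ∀ m : ℕ, HasDerivAt (fun s : ℂ => ∏ j ∈ Finset.range m, (s + j))
      ((∏ j ∈ Finset.range m, (s + j)) * ∑ j ∈ Finset.range m, 1 / (s + j)) s := by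
    intro m
    induction m with
    | zero => simpa using hasDerivAt_const s (1 : ℂ)
    | succ m ih =>
      simp only [Finset.prod_range_succ, Finset.sum_range_succ]
      refine (ih.mul ((hasDerivAt_id s).add_const (m : ℂ))).congr_deriv ?_
      have := hne m
      simp only [id]
      field_simp
  have hprod : ∏ j ∈ Finset.range (n + 1), (s + (j : ℂ)) ≠ 0 :=
    Finset.prod_ne_zero_iff.2 fun j _ => hne j
  have h1 : HasDerivAt (fun s : ℂ => (n : ℂ) ^ s) ((n : ℂ) ^ s * log n) s := by
    simpa using (hasDerivAt_id s).const_cpow (c := (n : ℂ)) (Or.inl (by exact_mod_cast hn))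
  refine ((h1.mul_const (n.factorial : ℂ)).div (hP (n + 1)) hprod).congr_deriv ?_
  rw [GammaSeq]
  field_simp

theorem tendsto_digamma {z : ℂ} (hz : 0 < z.re) :
    Tendsto (fun n : ℕ => log n - ∑ j ∈ Finset.range (n + 1), 1 / (z + j)) atTop (𝓝 (digamma z)) := by
  set r := z.re / 2
  have hr : 0 < r := by positivity
  set U : Set ℂ := {w | 0 < w.re}
  have hU : IsOpen U := isOpen_lt continuous_const continuous_re
  have hsub : Metric.closedBall z r ⊆ U := by
    intro w hw
    have h1 : ‖w - z‖ ≤ r := by simpa [dist_eq_norm] using hw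
    have h2 := (abs_le.1 ((abs_re_le_norm (w - z)).trans h1)).1
    simp only [sub_re] at h2
    change 0 < w.re
    have : r = z.re / 2 := rfl
    linarith
  have hG : DifferentiableOn ℂ Gamma U := fun w hw => by
    refine (differentiableAt_Gamma w fun m h => ?_).differentiableWithinAt
    have hw : 0 < w.re := hw
    rw [h] at hw
    simp at hw
    have : (0 : ℝ) ≤ m := m.cast_nonneg
    linarith
  have hS : ∀ n : ℕ, n ≠ 0 → DifferentiableOn ℂ (fun s => GammaSeq s n) U := fun n hn w hw =>
    (hasDerivAt_GammaSeq hw hn).differentiableAt.differentiableWithinAt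
  have hmem : ∀ θ, circleMap z r θ ∈ U := fun θ =>
    hsub (Metric.sphere_subset_closedBall (circleMap_mem_sphere z hr.le θ))
  obtain ⟨B, hB⟩ := (isCompact_sphere z r).exists_bound_of_continuousOn
    (f := fun w : ℂ => Real.Gamma w.re) (fun w hw => by
      have h0 : 0 < w.re := hsub (Metric.sphere_subset_closedBall hw)
      refine ContinuousAt.continuousWithinAt (ContinuousAt.comp (g := Real.Gamma) ?_
        continuous_re.continuousAt)
      exact (Real.differentiableAt_Gamma fun m h => by
        have : (0 : ℝ) ≤ m := m.cast_nonneg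
        linarith).continuousAt)
  have key : Tendsto (fun n : ℕ => cderiv r (fun s => GammaSeq s n) z) atTop (𝓝 (cderiv r Gamma z)) := by
    unfold cderiv circleIntegral
    refine Tendsto.const_smul ?_ _
    refine intervalIntegral.tendsto_integral_filter_of_dominated_convergence
      (fun _ => r * ((r ^ 2)⁻¹ * B)) ?_ ?_ (by simp) ?_
    · filter_upwards [eventually_ne_atTop 0] with n hn
      refine Continuous.aestronglyMeasurable ?_
      have h1 : Continuous fun θ => GammaSeq (circleMap z r θ) n :=
        (hS n hn).continuousOn.comp_continuous (continuous_circleMap z r) hmem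
      simp only [deriv_circleMap]
      have h2 : ∀ θ, (circleMap z r θ - z) ^ 2 ≠ 0 := fun θ =>
        pow_ne_zero _ (sub_ne_zero.2 (circleMap_ne_center hr.ne'))
      fun_prop (disch := exact h2 _)
    · filter_upwards [eventually_ne_atTop 0] with n hn
      refine ae_of_all _ fun θ _ => ?_
      have h1 := circleMap_mem_sphere z hr.le θ
      rw [norm_smul, norm_smul, norm_inv, norm_pow, mem_sphere_iff_norm.1 h1]
      have h2 : ‖deriv (circleMap z r) θ‖ = r := by
        simp [deriv_circleMap, abs_of_pos hr]
      rw [h2]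
      gcongr
      exact (norm_GammaSeq_le (hmem θ) hn).trans ((le_abs_self _).trans (hB _ h1))
    · refine ae_of_all _ fun θ _ => ?_
      exact ((GammaSeq_tendsto_Gamma _).const_smul _).const_smul _
  rw [cderiv_eq_deriv hU hG hr hsub] at key
  have h0 : Gamma z ≠ 0 := Gamma_ne_zero_of_re_pos hz
  have h1 := key.div (GammaSeq_tendsto_Gamma z) h0
  rw [digamma_def, logDeriv_apply]
  refine h1.congr' ?_
  filter_upwards [eventually_ne_atTop 0, (GammaSeq_tendsto_Gamma z).eventually_ne h0] with n hn hne
  rw [Pi.div_apply, cderiv_eq_deriv hU (hS n hn) hr hsub, (hasDerivAt_GammaSeq hz hn).deriv]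
  field_simp

end Complex

/-! ### Asymptotics of the digamma function -/

namespace Complex

/-- The summand in the Stirling-type series of the digamma function. -/
noncomputable def digammaTerm (w : ℂ) : ℂ := log (w + 1) - log w - (1 / w + 1 / (w + 1)) / 2

theorem hasDerivAt_digammaTerm_aux {w : ℂ} (hw : 0 < w.re) {u : ℝ} (hu : 0 ≤ u) :
    HasDerivAt (fun u : ℝ => log (w + u) - log w - u / 2 * (1 / w + 1 / (w + u)))
      (-(u ^ 2 / (2 * w * (w + u) ^ 2))) u := by
  have h1 : w + u ∈ slitPlane := Or.inl (by simp; positivity)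
  have h0 : w ≠ 0 := by rintro rfl; simp at hw
  have h2 : w + u ≠ 0 := slitPlane_ne_zero h1
  have hx : HasDerivAt (fun u : ℝ => (u : ℂ)) 1 u := ofRealCLM.hasDerivAt
  have ha : HasDerivAt (fun u : ℝ => w + (u : ℂ)) 1 u := hx.const_add w
  have hl := (ha.clog_real h1).sub_const (log w)
  have hr := (hx.div_const 2).mul (((hasDerivAt_const u (1 : ℂ)).div ha h2).const_add (1 / w))
  refine (hl.sub hr).congr_deriv ?_
  simp only [Pi.div_apply]
  field_simp
  ring

theorem norm_digammaTerm_le {w : ℂ} (hw : 0 < w.re) : ‖digammaTerm w‖ ≤ 1 / (6 * ‖w‖ ^ 3) := by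
  have h0 : w ≠ 0 := by rintro rfl; simp at hw
  have hn : 0 < ‖w‖ := norm_pos_iff.2 h0
  have key := image_norm_le_of_norm_deriv_right_le_deriv_boundary (a := 0) (b := 1)
    (f := fun u : ℝ => log (w + u) - log w - u / 2 * (1 / w + 1 / (w + u)))
    (f' := fun u : ℝ => -((u : ℂ) ^ 2 / (2 * w * (w + u) ^ 2)))
    (B := fun u => u ^ 3 / (6 * ‖w‖ ^ 3)) (B' := fun u => u ^ 2 / (2 * ‖w‖ ^ 3))
    (fun u hu => (hasDerivAt_digammaTerm_aux hw hu.1).continuousAt.continuousWithinAt)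
    (fun u hu => (hasDerivAt_digammaTerm_aux hw hu.1).hasDerivWithinAt)
    (by simp)
    (fun u => (((hasDerivAt_id u).pow 3).div_const _).congr_deriv (by simp; field_simp; ring))
    (fun u hu => ?_) (x := 1) (by simp)
  · simp only [ofReal_one] at key
    refine le_of_eq_of_le ?_ (key.trans_eq (by simp))
    congr 1
    rw [digammaTerm]
    ring
  · have h3 : ‖w‖ ≤ ‖w + u‖ := by
      rw [← sq_le_sq₀ (norm_nonneg _) (norm_nonneg _), ← normSq_eq_norm_sq, ← normSq_eq_norm_sq,
        normSq_apply, normSq_apply]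
      simp
      nlinarith [mul_nonneg hw.le hu.1, sq_nonneg u]
    simp only [norm_neg, norm_div, norm_pow, norm_mul, norm_real, Real.norm_of_nonneg hu.1,
      Complex.norm_ofNat]
    refine div_le_div_of_nonneg_left (sq_nonneg u) (by positivity) ?_
    calc 2 * ‖w‖ ^ 3 = 2 * ‖w‖ * ‖w‖ ^ 2 := by ring
      _ ≤ _ := by gcongr

theorem re_digammaTerm_ofReal_nonpos {x : ℝ} (hx : 0 < x) : (digammaTerm x).re ≤ 0 := by
  have h := antitoneOn_of_deriv_nonpos (convex_Icc (0 : ℝ) 1)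
    (f := fun u : ℝ => (log ((x : ℂ) + u) - log x - u / 2 * (1 / (x : ℂ) + 1 / (x + u))).re)
    (fun u hu => (Complex.continuous_re.continuousAt.comp
      (hasDerivAt_digammaTerm_aux (w := x) (by simpa) hu.1).continuousAt).continuousWithinAt)
    (fun u hu => ?_) (fun u hu => ?_)
  · have := h (left_mem_Icc.2 zero_le_one) (right_mem_Icc.2 zero_le_one) zero_le_one
    refine le_of_eq_of_le ?_ (this.trans_eq (by simp))
    rw [digammaTerm]
    congr 1
    simp only [ofReal_one]
    ring
  all_goals rw [interior_Icc] at hu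
  all_goals have hd0 := hasDerivAt_digammaTerm_aux (w := x) (by simpa) hu.1.le
  all_goals have hd := (reCLM.hasFDerivAt (x := _)).comp_hasDerivAt u hd0
  · exact hd.differentiableAt.differentiableWithinAt
  · refine hd.deriv.trans_le ?_
    rw [reCLM_apply]
    have : (-((u : ℂ) ^ 2 / (2 * x * (x + u) ^ 2))) =
      ((-(u ^ 2 / (2 * x * (x + u) ^ 2)) : ℝ) : ℂ) := by push_cast; rfl
    rw [this, ofReal_re]
    have := hu.1
    rw [neg_nonpos]
    positivity

theorem tendsto_sum_digammaTerm {z : ℂ} (hz : 0 < z.re) :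
    Tendsto (fun n : ℕ => ∑ k ∈ Finset.range (n + 1), digammaTerm (z + k)) atTop
      (𝓝 (digamma z - (log z - 1 / (2 * z)))) := by
  have hne : ∀ n : ℕ, z + n ≠ 0 := fun n h => by
    have := congrArg re h
    simp at this
    have h2 : (0 : ℝ) ≤ n := n.cast_nonneg
    linarith
  have hsum : ∀ n : ℕ, ∑ k ∈ Finset.range (n + 1), digammaTerm (z + k) =
      log (z + (n + 1)) - 1 / (2 * (z + (n + 1))) - (log z - 1 / (2 * z)) -
        ∑ k ∈ Finset.range (n + 1), 1 / (z + k) := by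
    intro n
    induction n with
    | zero =>
      have := hne 0
      have := hne 1
      simp only [Nat.cast_zero, Nat.cast_one, add_zero] at *
      simp [digammaTerm]
      field_simp
      ring
    | succ n ih =>
      rw [Finset.sum_range_succ, ih, Finset.sum_range_succ _ (n + 1), digammaTerm]
      have := hne (n + 1)
      have := hne (n + 2)
      push_cast at *
      rw [show z + (n + 1 : ℂ) + 1 = z + (n + 2) by ring, show (n : ℂ) + 1 + 1 = n + 2 by ring]
      field_simp
      ring
  have h1 : Tendsto (fun n : ℕ => ((z + 1) / n + 1 : ℂ)) atTop (𝓝 1) := by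
    have : Tendsto (fun n : ℕ => (z + 1) * ((n : ℂ))⁻¹ + 1) atTop (𝓝 ((z + 1) * 0 + 1)) :=
      (tendsto_inv₀_cobounded.comp tendsto_natCast_atTop_cobounded).const_mul _ |>.add_const _
    simpa [div_eq_mul_inv] using this
  have h2 : Tendsto (fun n : ℕ => log (z + (n + 1)) - log n) atTop (𝓝 0) := by
    have h := (continuousAt_clog (x := 1) (by simp)).tendsto.comp h1
    rw [log_one] at h
    refine h.congr' ?_
    filter_upwards [eventually_gt_atTop 0] with n hn
    have hn' : (0 : ℝ) < n := by exact_mod_cast hn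
    have hq : (z + 1) / n + 1 ≠ 0 := by
      have := hne (n + 1)
      have hnc : (n : ℂ) ≠ 0 := by exact_mod_cast hn.ne'
      push_cast at this
      rw [div_add_one hnc]
      refine div_ne_zero ?_ hnc
      rwa [show z + 1 + (n : ℂ) = z + (n + 1) by ring]
    have hl := log_ofReal_mul hn' hq
    have hnc : (n : ℂ) ≠ 0 := by exact_mod_cast hn.ne'
    have e : ((n : ℝ) : ℂ) * ((z + 1) / n + 1) = z + (n + 1) := by
      push_cast; field_simp; ring
    rw [e] at hl
    rw [Function.comp, hl, ofReal_log hn'.le]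
    push_cast
    ring
  have h3 : Tendsto (fun n : ℕ => 1 / (2 * (z + (n + 1)))) atTop (𝓝 0) := by
    refine squeeze_zero_norm (fun n => ?_) (tendsto_one_div_add_atTop_nhds_zero_nat (𝕜 := ℝ))
    have h5 : (n + 1 : ℝ) ≤ ‖z + (n + 1)‖ := by
      refine le_trans ?_ ((le_abs_self _).trans (abs_re_le_norm _))
      simp [hz.le]
    rw [norm_div, norm_one, norm_mul, Complex.norm_ofNat]
    gcongr
    linarith
  have h4 := ((tendsto_digamma hz).add (h2.sub h3)).sub_const (log z - 1 / (2 * z))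
  simp only [sub_zero, add_zero] at h4
  refine h4.congr fun n => ?_
  rw [hsum]
  ring

theorem sum_inv_norm_pow_three_le {z : ℂ} (hz : 0 < z.re) (n : ℕ) :
    ∑ k ∈ Finset.range (n + 1), 1 / (6 * ‖z + k‖ ^ 3) ≤
      1 / (6 * ‖z‖ ^ 3) + Real.pi / (12 * ‖z‖ ^ 2) := by
  have h0 : z ≠ 0 := by rintro rfl; simp at hz
  set R := ‖z‖ with hR
  have hR0 : 0 < R := norm_pos_iff.2 h0
  have hterm : ∀ k : ℕ, 1 / (6 * ‖z + k‖ ^ 3) ≤ 1 / (6 * R) * (1 / (R ^ 2 + k ^ 2)) := by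
    intro k
    have h1 : R ^ 2 + k ^ 2 ≤ ‖z + k‖ ^ 2 := by
      rw [hR, ← normSq_eq_norm_sq, ← normSq_eq_norm_sq, normSq_apply, normSq_apply]
      simp
      nlinarith [mul_nonneg hz.le k.cast_nonneg (α := ℝ)]
    have h2 : R ≤ ‖z + k‖ := by
      refine le_of_sq_le_sq ?_ (norm_nonneg _)
      nlinarith [sq_nonneg (k : ℝ)]
    rw [div_mul_div_comm, one_mul]
    refine div_le_div_of_nonneg_left zero_le_one (by positivity) ?_
    calc 6 * R * (R ^ 2 + k ^ 2) ≤ 6 * ‖z + k‖ * ‖z + k‖ ^ 2 := by gcongr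
      _ = _ := by ring
  have hd : ∀ u : ℝ, HasDerivAt (fun u => Real.arctan (u / R) / R) (1 / (R ^ 2 + u ^ 2)) u := by
    intro u
    refine ((((hasDerivAt_id u).div_const R).arctan).div_const R).congr_deriv ?_
    simp only [id]
    field_simp
  have hat : ∀ n : ℕ, ∑ k ∈ Finset.range (n + 1), 1 / (R ^ 2 + (k : ℝ) ^ 2) ≤
      1 / R ^ 2 + Real.arctan (n / R) / R := by
    intro n
    induction n with
    | zero => simp
    | succ n ih =>
      rw [Finset.sum_range_succ]
      have hm := (convex_Icc (n : ℝ) (n + 1)).mul_sub_le_image_sub_of_le_deriv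
        (f := fun u => Real.arctan (u / R) / R) (C := 1 / (R ^ 2 + (n + 1 : ℝ) ^ 2))
        (fun u _ => (hd u).continuousAt.continuousWithinAt)
        (fun u _ => (hd u).differentiableAt.differentiableWithinAt) (fun u hu => ?_) n (by simp) (n + 1) (by simp) (by simp)
      · push_cast
        linarith
      · rw [interior_Icc] at hu
        rw [(hd u).deriv]
        have : (0 : ℝ) ≤ n := n.cast_nonneg
        have := hu.1
        have := hu.2
        gcongr
        linarith
  calc _ ≤ ∑ k ∈ Finset.range (n + 1), 1 / (6 * R) * (1 / (R ^ 2 + (k : ℝ) ^ 2)) :=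
        Finset.sum_le_sum fun k _ => hterm k
    _ = 1 / (6 * R) * ∑ k ∈ Finset.range (n + 1), (1 / (R ^ 2 + (k : ℝ) ^ 2)) := by
        rw [Finset.mul_sum]
    _ ≤ 1 / (6 * R) * (1 / R ^ 2 + (Real.pi / 2) / R) := by
        gcongr
        refine (hat n).trans ?_
        gcongr
        exact (Real.arctan_lt_pi_div_two _).le
    _ = _ := by field_simp; ring

theorem norm_digamma_sub_le {z : ℂ} (hz : 0 < z.re) :
    ‖digamma z - (log z - 1 / (2 * z))‖ ≤ 1 / (6 * ‖z‖ ^ 3) + Real.pi / (12 * ‖z‖ ^ 2) := by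
  refine le_of_tendsto (tendsto_sum_digammaTerm hz).norm (Eventually.of_forall fun n => ?_)
  refine (norm_sum_le _ _).trans (le_trans (Finset.sum_le_sum fun k _ => ?_)
    (sum_inv_norm_pow_three_le hz n))
  exact norm_digammaTerm_le (by simp; positivity)

theorem re_digamma_ofReal_le {x : ℝ} (hx : 0 < x) :
    (digamma x).re ≤ Real.log x - 1 / (2 * x) := by
  have h := le_of_tendsto ((continuous_re.tendsto _).comp
    (tendsto_sum_digammaTerm (z := x) (by simpa))) (b := 0) (Eventually.of_forall fun n => by
      simp only [Function.comp, re_sum]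
      refine Finset.sum_nonpos fun k _ => ?_
      have := re_digammaTerm_ofReal_nonpos (x := x + k) (by positivity)
      simpa using this)
  have e : (log (x : ℂ) - 1 / (2 * x)) = ((Real.log x - 1 / (2 * x) : ℝ) : ℂ) := by
    push_cast [ofReal_log hx.le]; rfl
  rw [e, sub_re, ofReal_re] at h
  linarith

end Complex

/-! ### Sums over zeros of `ξ` -/

/-- The symmetrised contribution of a zero `ρ` to the logarithmic derivative of `ξ`. -/
noncomputable def xiPair (ρ s : ℂ) : ℂ := (1 / (s - ρ) + 1 / (s - (1 - conj ρ))) / 2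

theorem xiPair_one_sub_conj (ρ s : ℂ) : xiPair (1 - conj ρ) s = xiPair ρ s := by
  simp only [xiPair, map_sub, map_one, conj_conj, sub_sub_cancel]
  rw [add_comm]

theorem re_one_div_sub (s ρ : ℂ) :
    (1 / (s - ρ)).re = (s.re - ρ.re) / ((s.re - ρ.re) ^ 2 + (s.im - ρ.im) ^ 2) := by
  rw [one_div, inv_re, normSq_apply]
  simp [sq]

theorem re_xiPair (ρ s : ℂ) : (xiPair ρ s).re =
    ((s.re - ρ.re) / ((s.re - ρ.re) ^ 2 + (s.im - ρ.im) ^ 2) +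
      (s.re - (1 - ρ.re)) / ((s.re - (1 - ρ.re)) ^ 2 + (s.im - ρ.im) ^ 2)) / 2 := by
  rw [xiPair, show (2 : ℂ) = ((2 : ℝ) : ℂ) by norm_num, div_ofReal_re, add_re, re_one_div_sub,
    re_one_div_sub]
  simp

theorem sum_re_xiPair_le {κ : ℝ} (hκ : 0 ≤ κ) {s s₁ : ℂ} (hs : 1 ≤ s.re) (hs₁ : 1 ≤ s₁.re)
    (hpos : ∀ ρ, riemannXi ρ = 0 → 0 ≤ (xiPair ρ s).re - κ * (xiPair ρ s₁).re)
    (F : Finset ℂ) (hF : ∀ ρ ∈ F, riemannXi ρ = 0) :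
    ∑ ρ ∈ F, ((xiPair ρ s).re - κ * (xiPair ρ s₁).re) ≤
      (logDeriv riemannXi s).re - κ * (logDeriv riemannXi s₁).re := by
  refine le_of_forall_pos_le_add fun ε hε => ?_
  obtain ⟨Z, c, hZ, hZF, hX⟩ := exists_logDeriv_riemannXi_approx
    (∑ ρ ∈ F, ‖ρ‖ + ‖s‖ + ‖s₁‖ + 1) (ε := ε / (1 + κ)) (by positivity)
  have hnn : 0 ≤ ∑ ρ ∈ F, ‖ρ‖ := Finset.sum_nonneg fun _ _ => norm_nonneg _
  have hFZ : F.val ≤ Z := by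
    refine (Multiset.le_iff_subset F.nodup).2 fun ρ hρ => hZF ρ (hF ρ hρ) ?_
    have := Finset.single_le_sum (f := fun ρ : ℂ => ‖ρ‖) (fun _ _ => norm_nonneg _) hρ
    have := norm_nonneg s
    have := norm_nonneg s₁
    linarith
  obtain ⟨Y, rfl⟩ := Multiset.le_iff_exists_add.1 hFZ
  have key : ∀ t : ℂ, ‖t‖ ≤ ‖s‖ + ‖s₁‖ → 1 ≤ t.re → |(logDeriv riemannXi t).re -
      ((F.val + Y).map fun ρ => (xiPair ρ t).re).sum| ≤ ε / (1 + κ) := by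
    intro t ht ht1
    refine le_trans ?_ (hX t (by linarith) (riemannXi_ne_zero_of_one_le_re ht1))
    refine le_of_eq_of_le ?_ (abs_re_le_norm _)
    have : (((F.val + Y).map fun ρ => xiPair ρ t).sum).re =
        ((F.val + Y).map fun ρ => (xiPair ρ t).re).sum := by
      have := (reAddGroupHom).map_multiset_sum ((F.val + Y).map fun ρ => xiPair ρ t)
      simpa using this
    simp only [sub_re, mul_re, ofReal_re, I_re, ofReal_im, I_im, mul_zero, zero_mul, sub_zero]
    rw [← this]
    rfl
  have h1 := abs_le.1 (key s (by linarith [norm_nonneg s₁]) hs)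
  have h2 := abs_le.1 (key s₁ (by linarith [norm_nonneg s]) hs₁)
  have h3 : ((F.val + Y).map fun ρ => (xiPair ρ s).re).sum -
      κ * ((F.val + Y).map fun ρ => (xiPair ρ s₁).re).sum =
      ((F.val + Y).map fun ρ => (xiPair ρ s).re - κ * (xiPair ρ s₁).re).sum := by
    rw [Multiset.sum_map_sub, Multiset.sum_map_mul_left]
  have h4 : 0 ≤ (Y.map fun ρ => (xiPair ρ s).re - κ * (xiPair ρ s₁).re).sum := by
    refine Multiset.sum_nonneg fun x hx => ?_
    obtain ⟨ρ, hρ, rfl⟩ := Multiset.mem_map.1 hx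
    exact hpos ρ (hZ ρ (Multiset.mem_add.2 (Or.inr hρ)))
  rw [Multiset.map_add (fun ρ => (xiPair ρ s).re - κ * (xiPair ρ s₁).re), Multiset.sum_add] at h3
  change _ = ∑ ρ ∈ F, ((xiPair ρ s).re - κ * (xiPair ρ s₁).re) + _ at h3
  have h5 := mul_le_mul_of_nonneg_left h2.2 hκ
  have h6 : ε / (1 + κ) + κ * (ε / (1 + κ)) = ε := by field_simp
  linarith

theorem re_xiPair_pos {ρ s : ℂ} (hρ : riemannXi ρ = 0) (hs : 1 ≤ s.re) : 0 ≤ (xiPair ρ s).re := by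
  have h := re_mem_Ioo_of_riemannXi_eq_zero hρ
  rw [re_xiPair]
  have h1 : 0 ≤ s.re - ρ.re := by linarith [h.2]
  have h2 : 0 ≤ s.re - (1 - ρ.re) := by linarith [h.1]
  positivity

theorem logDeriv_riemannXi {s : ℂ} (hs : 1 < s.re) : logDeriv riemannXi s =
    1 / (s - 1) + logDeriv riemannZeta s - Complex.log Real.pi / 2 + digamma (s / 2 + 1) / 2 := by
  have h1 : s ≠ 1 := by rintro rfl; simp at hs
  have hζ := riemannZeta_ne_zero_of_one_lt_re hs
  have hd := differentiableAt_riemannZeta h1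
  have hz : 0 < (s / 2 + 1).re := by simp; linarith
  have hG : Gamma (s / 2 + 1) ≠ 0 := Gamma_ne_zero_of_re_pos hz
  have hGd : DifferentiableAt ℂ Gamma (s / 2 + 1) := differentiableAt_Gamma _ fun m h => by
    rw [h] at hz
    simp at hz
    have : (0 : ℝ) ≤ m := m.cast_nonneg
    linarith
  have hpi : (Real.pi : ℂ) ≠ 0 := by exact_mod_cast Real.pi_ne_zero
  have heq : riemannXi =ᶠ[𝓝 s] fun s =>
      2 * (s - 1) * riemannZeta s * ((Real.pi : ℂ) ^ (-s / 2) * Gamma (s / 2 + 1)) := by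
    filter_upwards [(isOpen_lt continuous_const continuous_re).mem_nhds hs] with w hw
    have hw : 1 < w.re := hw
    exact riemannXi_eq_riemannZeta (by linarith) (by rintro rfl; simp at hw)
  have e1 : HasDerivAt (fun s : ℂ => 2 * (s - 1)) 2 s := by
    simpa using ((hasDerivAt_id s).sub_const 1).const_mul 2
  have e2 : HasDerivAt (fun s : ℂ => (Real.pi : ℂ) ^ (-s / 2))
      ((Real.pi : ℂ) ^ (-s / 2) * Complex.log Real.pi * (-1 / 2)) s :=
    ((hasDerivAt_id s).neg.div_const 2).const_cpow (Or.inl hpi)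
  have e3 : HasDerivAt (fun s : ℂ => Gamma (s / 2 + 1)) (deriv Gamma (s / 2 + 1) * (1 / 2)) s :=
    hGd.hasDerivAt.comp s (((hasDerivAt_id s).div_const 2).add_const 1)
  have e := (e1.mul hd.hasDerivAt).mul (e2.mul e3)
  rw [logDeriv_apply, heq.deriv_eq, heq.eq_of_nhds]
  have e' := e.deriv
  simp only [Pi.mul_def] at e'
  rw [e', logDeriv_apply, digamma_def, logDeriv_apply]
  have hp : (Real.pi : ℂ) ^ (-s / 2) ≠ 0 := by simp [cpow_eq_zero_iff, hpi]
  have hs1 : s - 1 ≠ 0 := sub_ne_zero.2 h1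
  generalize (Real.pi : ℂ) ^ (-s / 2) = p at hp ⊢
  generalize Gamma (s / 2 + 1) = g at hG ⊢
  generalize deriv Gamma (s / 2 + 1) = g'
  field_simp
  ring

/-! ### Low zeros, the Stechkin lemma and the trigonometric inequality -/

theorem Real.div_le_log_of_pow_le {a : ℝ} (ha : 0 < a) {m n : ℕ} (hn : 0 < n)
    (h : (2.7182818286 : ℝ) ^ m ≤ a ^ n) : (m : ℝ) / n ≤ Real.log a := by
  have h1 : Real.exp m ≤ a ^ n := by
    rw [← Real.exp_one_pow]
    exact (pow_le_pow_left₀ (Real.exp_pos 1).le Real.exp_one_lt_d9.le m).trans h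
  have h2 := (Real.le_log_iff_exp_le (by positivity)).2 h1
  rw [Real.log_pow] at h2
  rw [div_le_iff₀ (by exact_mod_cast hn)]
  linarith

theorem Real.log_le_div_of_pow_le {a : ℝ} (ha : 0 < a) {m n : ℕ} (hn : 0 < n)
    (h : a ^ n ≤ (2.7182818283 : ℝ) ^ m) : Real.log a ≤ (m : ℝ) / n := by
  have h1 : a ^ n ≤ Real.exp m := by
    rw [← Real.exp_one_pow]
    exact h.trans (pow_le_pow_left₀ (by norm_num) Real.exp_one_gt_d9.le m)
  have h2 := (Real.log_le_iff_le_exp (by positivity)).2 h1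
  rw [Real.log_pow] at h2
  rw [le_div_iff₀ (by exact_mod_cast hn)]
  linarith

theorem Real.log_pi_gt : 1.1425 ≤ Real.log Real.pi := by
  have h := Real.div_le_log_of_pow_le (a := 3.14) (by norm_num) (m := 8) (n := 7) (by norm_num)
    (by norm_num)
  have := Real.log_le_log (by norm_num) Real.pi_gt_d2.le
  norm_num at h this ⊢
  linarith

theorem two_point_five_lt_abs_im {ρ : ℂ} (hρ : riemannXi ρ = 0) : 2.5 < |ρ.im| := by
  have h := sum_re_xiPair_le (κ := 0) le_rfl (s := 1) (s₁ := 1) (by simp) (by simp)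
    (fun ρ hρ => by simpa using re_xiPair_pos hρ (s := 1) (by simp)) {ρ} (by simpa using hρ)
  rw [Finset.sum_singleton, logDeriv_riemannXi_one, re_xiPair] at h
  have h01 := re_mem_Ioo_of_riemannXi_eq_zero hρ
  obtain ⟨hb0, hb1⟩ := h01
  have hγ := Real.eulerMascheroniConstant_lt_two_thirds
  have hl : Real.log (4 * Real.pi) = 2 * Real.log 2 + Real.log Real.pi := by
    rw [Real.log_mul (by norm_num) Real.pi_ne_zero, show (4 : ℝ) = 2 ^ 2 by norm_num, Real.log_pow]
    norm_num
  have hl2 := Real.log_two_gt_d9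
  have hlp := Real.log_pi_gt
  have e1 : ((((Real.eulerMascheroniConstant : ℂ) - Real.log (4 * Real.pi)) / 2 + 1 : ℂ)).re =
      (Real.eulerMascheroniConstant - Real.log (4 * Real.pi)) / 2 + 1 := by
    rw [← ofReal_sub, show (2 : ℂ) = ((2 : ℝ) : ℂ) by norm_num, ← ofReal_div, add_re, ofReal_re,
      one_re]
  rw [e1, hl] at h
  simp only [one_re, one_im, zero_mul, sub_zero, sub_sub_cancel, zero_sub, neg_sq] at h
  by_contra! hc
  have hsq : ρ.im ^ 2 ≤ 6.25 := by
    rw [← sq_abs]; nlinarith [abs_nonneg ρ.im]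
  have k1 : (1 - ρ.re) / 7.25 ≤ (1 - ρ.re) / ((1 - ρ.re) ^ 2 + ρ.im ^ 2) := by
    have : 0 < 1 - ρ.re := by linarith
    gcongr
    nlinarith
  have k2 : ρ.re / 7.25 ≤ ρ.re / (ρ.re ^ 2 + ρ.im ^ 2) := by
    gcongr
    nlinarith
  norm_num at *
  linarith

theorem stechkin_inequality {κ S S₁ d y : ℝ} (hκ : 0 < κ) (hκ5 : 5 * κ ^ 2 = 1) (hS : 1 / 2 < S)
    (hS₁ : 0 < S₁) (h : S₁ ^ 2 = S ^ 2 + S + 1 / 2) (hd : |d| < 1 / 2) :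
    κ * (((S₁ - d) / ((S₁ - d) ^ 2 + y ^ 2) + (S₁ + d) / ((S₁ + d) ^ 2 + y ^ 2)) / 2) ≤
      ((S - d) / ((S - d) ^ 2 + y ^ 2) + (S + d) / ((S + d) ^ 2 + y ^ 2)) / 2 := by
  have form : ∀ S : ℝ, 1 / 2 < S →
      ((S - d) / ((S - d) ^ 2 + y ^ 2) + (S + d) / ((S + d) ^ 2 + y ^ 2)) / 2 =
        S * (S ^ 2 + y ^ 2 - d ^ 2) / ((S ^ 2 + y ^ 2 - d ^ 2) ^ 2 + 4 * d ^ 2 * y ^ 2) := by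
    intro S hS
    have h1 : 0 < S - d := by linarith [(abs_lt.1 hd).2]
    have h2 : 0 < S + d := by linarith [(abs_lt.1 hd).1]
    have h3 : (S - d) ^ 2 + y ^ 2 ≠ 0 := by positivity
    have h4 : (S + d) ^ 2 + y ^ 2 ≠ 0 := by positivity
    have h5 : (S ^ 2 + y ^ 2 - d ^ 2) ^ 2 + 4 * d ^ 2 * y ^ 2 =
      ((S - d) ^ 2 + y ^ 2) * ((S + d) ^ 2 + y ^ 2) := by ring
    rw [h5]
    field_simp
    ring
  have hS₁' : 1 / 2 < S₁ := by nlinarith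
  rw [form S hS, form S₁ hS₁']
  have he : d ^ 2 < 1 / 4 := by nlinarith [abs_lt.1 hd]
  have hκS : κ * S₁ ≤ S := by
    refine le_of_sq_le_sq ?_ (by linarith)
    nlinarith
  set A := S ^ 2 + y ^ 2 - d ^ 2 with hA
  set B := S₁ ^ 2 + y ^ 2 - d ^ 2 with hB
  have hA0 : y ^ 2 < A := by nlinarith
  have hB0 : 1 + y ^ 2 ≤ B := by nlinarith
  have hy := sq_nonneg y
  have hAp : 0 < A := by linarith
  have hBp : 0 < B := by linarith
  have hAB : 0 ≤ B - A := by rw [hA, hB]; nlinarith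
  have hq : 0 ≤ d ^ 2 * y ^ 2 := by positivity
  have hmain : B / (B ^ 2 + 4 * d ^ 2 * y ^ 2) ≤ A / (A ^ 2 + 4 * d ^ 2 * y ^ 2) := by
    have p1 : 0 < B ^ 2 + 4 * d ^ 2 * y ^ 2 := by positivity
    have p2 : 0 < A ^ 2 + 4 * d ^ 2 * y ^ 2 := by positivity
    rw [div_le_div_iff₀ p1 p2]
    have k1 : 4 * d ^ 2 * y ^ 2 ≤ A * B := by
      have : 4 * d ^ 2 * y ^ 2 ≤ y ^ 2 := by nlinarith
      nlinarith
    nlinarith [mul_nonneg hAB (sub_nonneg.2 k1)]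
  calc κ * (S₁ * B / (B ^ 2 + 4 * d ^ 2 * y ^ 2)) = κ * S₁ * (B / (B ^ 2 + 4 * d ^ 2 * y ^ 2)) := by
        ring
    _ ≤ S * (A / (A ^ 2 + 4 * d ^ 2 * y ^ 2)) := by gcongr
    _ = _ := by ring

theorem stechkin_xiPair {κ σ σ₁ t : ℝ} (hκ : 0 < κ) (hκ5 : 5 * κ ^ 2 = 1) (hσ : 1 < σ)
    (hσ₁ : 1 < σ₁) (h : σ₁ ^ 2 - σ₁ = σ ^ 2) {ρ : ℂ} (hρ : riemannXi ρ = 0) :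
    0 ≤ (xiPair ρ (σ + t * I)).re - κ * (xiPair ρ (σ₁ + t * I)).re := by
  obtain ⟨h0, h1⟩ := re_mem_Ioo_of_riemannXi_eq_zero hρ
  have hd : |ρ.re - 1 / 2| < 1 / 2 := by rw [abs_lt]; constructor <;> linarith
  have key := stechkin_inequality (y := t - ρ.im) hκ hκ5 (S := σ - 1 / 2) (S₁ := σ₁ - 1 / 2)
    (by linarith) (by linarith) (by nlinarith) hd
  rw [re_xiPair, re_xiPair]
  simp only [add_re, ofReal_re, mul_re, I_re, mul_zero, ofReal_im, I_im, sub_self,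
    add_zero, add_im, mul_im, mul_one, zero_add]
  rw [show σ - (1 - ρ.re) = σ - 1 / 2 + (ρ.re - 1 / 2) by ring,
    show σ₁ - (1 - ρ.re) = σ₁ - 1 / 2 + (ρ.re - 1 / 2) by ring,
    show σ - ρ.re = σ - 1 / 2 - (ρ.re - 1 / 2) by ring,
    show σ₁ - ρ.re = σ₁ - 1 / 2 - (ρ.re - 1 / 2) by ring]
  linarith

/-- At the height of a zero off the critical line, that zero contributes fully. -/
theorem one_div_le_re_logDeriv_sub {κ σ σ₁ : ℝ} (hκ : 0 < κ) (hκ5 : 5 * κ ^ 2 = 1) (hσ : 1 < σ)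
    (hσ₁ : 1 < σ₁) (h : σ₁ ^ 2 - σ₁ = σ ^ 2) {ρ : ℂ} (hρ : riemannXi ρ = 0) (h2 : ρ.re ≠ 1 / 2) :
    1 / (σ - ρ.re) ≤ (logDeriv riemannXi (σ + ρ.im * I)).re -
      κ * (logDeriv riemannXi (σ₁ + ρ.im * I)).re := by
  obtain ⟨h0, h1⟩ := re_mem_Ioo_of_riemannXi_eq_zero hρ
  have hne : ρ ≠ 1 - conj ρ := fun h => h2 (by
    have := congrArg re h
    simp at this
    linarith)
  refine le_trans ?_ (sum_re_xiPair_le hκ.le (by simp; linarith) (by simp; linarith)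
    (fun ρ' hρ' => stechkin_xiPair hκ hκ5 hσ hσ₁ h hρ') {ρ, 1 - conj ρ} (by
      simp [hρ, riemannXi_one_sub_conj hρ]))
  rw [Finset.sum_pair hne, xiPair_one_sub_conj, xiPair_one_sub_conj, re_xiPair, re_xiPair]
  simp only [add_re, ofReal_re, mul_re, I_re, mul_zero, ofReal_im, I_im, sub_self,
    add_zero, add_im, mul_im, mul_one, zero_add]
  set η := 1 - ρ.re with hη
  have p1 : 0 < σ - ρ.re := by linarith
  have p2 : 0 < σ - η := by linarith
  have p3 : 0 < σ₁ - ρ.re := by linarith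
  have p4 : 0 < σ₁ - η := by linarith
  have e : ∀ x : ℝ, 0 < x → x / (x ^ 2 + 0 ^ 2) = 1 / x := fun x hx => by field_simp; ring
  rw [e _ p1, e _ p2, e _ p3, e _ p4]
  have key : κ * (1 / (σ₁ - ρ.re) + 1 / (σ₁ - η)) ≤ 1 / (σ - η) := by
    have e1 : 1 / (σ₁ - ρ.re) + 1 / (σ₁ - η) = (2 * σ₁ - 1) / ((σ₁ - ρ.re) * (σ₁ - η)) := by
      field_simp
      ring
    rw [e1, ← mul_div_assoc, div_le_div_iff₀ (by positivity) p2]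
    have e2 : (σ₁ - ρ.re) * (σ₁ - η) = σ ^ 2 + ρ.re * η := by rw [hη]; nlinarith
    have k1 : κ * (2 * σ₁ - 1) ≤ σ := by
      refine le_of_sq_le_sq ?_ (by linarith)
      nlinarith
    rw [e2]
    nlinarith
  linarith

theorem hasSum_re_logDeriv_zeta {σ : ℝ} (hσ : 1 < σ) (t : ℝ) :
    HasSum (fun n : ℕ => ArithmeticFunction.vonMangoldt n * (n : ℝ) ^ (-σ) *
      Real.cos (t * Real.log n)) (-(logDeriv riemannZeta (σ + t * I)).re) := by
  have hs : 1 < ((σ : ℂ) + t * I).re := by simpa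
  have h := (ArithmeticFunction.LSeriesSummable_vonMangoldt hs).LSeriesHasSum
  rw [LSeriesHasSum, ArithmeticFunction.LSeries_vonMangoldt_eq_deriv_riemannZeta_div hs] at h
  have h := Complex.hasSum_re h
  rw [neg_div, ← logDeriv_apply, neg_re] at h
  convert h using 2 with n
  rcases eq_or_ne n 0 with rfl | hn
  · simp
  have hn0 : (0 : ℝ) < n := by positivity
  have hnc : (n : ℂ) ≠ 0 := by exact_mod_cast hn
  rw [LSeries.term_of_ne_zero hn, div_eq_mul_inv, ← cpow_neg, re_ofReal_mul, mul_assoc]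
  congr 1
  rw [cpow_def_of_ne_zero hnc, exp_re, Real.rpow_def_of_pos hn0,
    show (n : ℂ) = ((n : ℝ) : ℂ) by simp, ← ofReal_log hn0.le]
  have hre : (((Real.log n : ℝ) : ℂ) * -((σ : ℂ) + t * I)).re = Real.log n * -σ := by
    rw [re_ofReal_mul]; simp
  have him : (((Real.log n : ℝ) : ℂ) * -((σ : ℂ) + t * I)).im = -(t * Real.log n) := by
    rw [im_ofReal_mul]; simp; ring
  rw [hre, him, Real.cos_neg]

theorem trig_polynomial_nonneg (φ : ℝ) : 0 ≤ 11.1859356 + 19.073344 * Real.cos φ +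
    11.67618784 * Real.cos (2 * φ) + 4.7568 * Real.cos (3 * φ) + Real.cos (4 * φ) := by
  rw [Real.cos_three_mul, show 4 * φ = 2 * (2 * φ) by ring, Real.cos_two_mul (2 * φ),
    Real.cos_two_mul]
  have := sq_nonneg ((0.9126 + Real.cos φ) * (0.2766 + Real.cos φ))
  have := Real.neg_one_le_cos φ
  have := Real.cos_le_one φ
  nlinarith

theorem sum_re_logDeriv_zeta_nonneg {κ σ σ₁ t : ℝ} (hκ : κ ≤ 1) (hσ : 1 < σ)
    (hσ₁ : σ ≤ σ₁) {f : ℝ → ℝ} (hf : ∀ t : ℝ, f t = -(logDeriv riemannZeta (σ + t * I)).re -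
      κ * -(logDeriv riemannZeta (σ₁ + t * I)).re) :
    0 ≤ 11.1859356 * f 0 + 19.073344 * f t + 11.67618784 * f (2 * t) + 4.7568 * f (3 * t) +
      f (4 * t) := by
  have hs : ∀ t, HasSum (fun n : ℕ => ArithmeticFunction.vonMangoldt n * ((n : ℝ) ^ (-σ) -
      κ * (n : ℝ) ^ (-σ₁)) * Real.cos (t * Real.log n)) (f t) := fun t => by
    rw [hf]
    refine ((hasSum_re_logDeriv_zeta hσ t).sub ((hasSum_re_logDeriv_zeta
      (hσ.trans_le hσ₁) t).mul_left κ)).congr_fun fun n => ?_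
    ring
  refine (((((hs 0).mul_left 11.1859356).add ((hs t).mul_left 19.073344)).add
    ((hs (2 * t)).mul_left 11.67618784)).add ((hs (3 * t)).mul_left 4.7568)).add
    (hs (4 * t)) |>.nonneg fun n => ?_
  rcases eq_or_ne n 0 with rfl | hn
  · simp
  have hn1 : (1 : ℝ) ≤ n := by exact_mod_cast Nat.one_le_iff_ne_zero.2 hn
  have h1 := trig_polynomial_nonneg (t * Real.log n)
  have h2 : 0 ≤ (n : ℝ) ^ (-σ) - κ * (n : ℝ) ^ (-σ₁) := by
    have h3 : (n : ℝ) ^ (-σ₁) ≤ (n : ℝ) ^ (-σ) := Real.rpow_le_rpow_of_exponent_le hn1 (by linarith)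
    have h4 : 0 ≤ (n : ℝ) ^ (-σ₁) := by positivity
    nlinarith
  have h5 := mul_nonneg (mul_nonneg (ArithmeticFunction.vonMangoldt_nonneg (n := n)) h2) h1
  simp only [mul_assoc] at h5 ⊢
  simp only [zero_mul, Real.cos_zero]
  linarith

/-! ### An explicit zero-free region -/

theorem neg_re_logDeriv_riemannZeta {s : ℂ} (hs : 1 < s.re) : -(logDeriv riemannZeta s).re =
    (1 / (s - 1)).re - Real.log Real.pi / 2 + (digamma (s / 2 + 1)).re / 2 -
      (logDeriv riemannXi s).re := by
  have h := congrArg re (logDeriv_riemannXi hs)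
  rw [← ofReal_log Real.pi_pos.le, show (2 : ℂ) = ((2 : ℝ) : ℂ) by norm_num, add_re, sub_re,
    add_re, ← ofReal_div, ofReal_re, div_ofReal_re] at h
  push_cast at h
  linarith

theorem re_digamma_bounds {x y : ℝ} (hx : 0 < x) {R : ℝ} (hR : 0 < R) (h : R ^ 2 = x ^ 2 + y ^ 2) :
    |(digamma (x + y * I)).re - (Real.log R - x / (2 * R ^ 2))| ≤
      1 / (6 * R ^ 3) + Real.pi / (12 * R ^ 2) := by
  have hn : ‖(x + y * I : ℂ)‖ = R := by
    rw [← sq_eq_sq₀ (norm_nonneg _) hR.le, h, ← normSq_eq_norm_sq, normSq_add_mul_I]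
  have key := norm_digamma_sub_le (z := x + y * I) (by simpa)
  rw [hn] at key
  refine le_trans (le_of_eq ?_) ((abs_re_le_norm _).trans key)
  rw [sub_re, sub_re, log_re, hn, one_div, inv_re, normSq_eq_norm_sq, norm_mul, hn]
  congr 3
  simp
  field_simp

theorem riemannZeta_combination_zero_le {κ σ σ₁ : ℝ} (hκ : 0.447 < κ) (hκ' : κ < 0.4473)
    (hσ : 1 < σ) (hσ' : σ ≤ 1.061) (hσ₁ : 1.618 ≤ σ₁) (hσ₁' : σ₁ ≤ 1.673)
    (hX : κ * (logDeriv riemannXi σ₁).re ≤ (logDeriv riemannXi σ).re) :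
    -(logDeriv riemannZeta σ).re - κ * -(logDeriv riemannZeta σ₁).re ≤ 1 / (σ - 1) - 0.97 := by
  rw [neg_re_logDeriv_riemannZeta (by simpa), neg_re_logDeriv_riemannZeta (by simp; linarith)]
  have e1 : ∀ x : ℝ, (1 / ((x : ℂ) - 1)).re = 1 / (x - 1) := fun x => by
    rw [show (1 / ((x : ℂ) - 1)) = ((1 / (x - 1) : ℝ) : ℂ) by push_cast; rfl, ofReal_re]
  have e2 : ∀ x : ℝ, ((x : ℂ) / 2 + 1) = ((x / 2 + 1 : ℝ) : ℂ) := fun x => by push_cast; rfl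
  rw [e1, e1, e2, e2]
  have hlp : 8 / 7 ≤ Real.log Real.pi := by
    have h := Real.div_le_log_of_pow_le (a := 3.14) (by norm_num) (m := 8) (n := 7) (by norm_num)
      (by norm_num)
    have := Real.log_le_log (by norm_num) Real.pi_gt_d2.le
    norm_num at h this ⊢
    linarith
  have d1 : (digamma ((σ / 2 + 1 : ℝ) : ℂ)).re ≤ 0.102 := by
    have h1 := re_digamma_ofReal_le (x := σ / 2 + 1) (by linarith)
    have h2 : Real.log (σ / 2 + 1) ≤ 3 / 7 := by
      have h := Real.log_le_div_of_pow_le (a := 1.5305) (by norm_num) (m := 3) (n := 7)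
        (by norm_num) (by norm_num)
      have := Real.log_le_log (x := σ / 2 + 1) (y := 1.5305) (by linarith) (by linarith)
      norm_num at h this ⊢
      linarith
    have h3 : 1 / (2 * 1.5305) ≤ 1 / (2 * (σ / 2 + 1)) := by
      apply one_div_le_one_div_of_le <;> linarith
    norm_num at h1 h3 ⊢
    linarith
  have d2 : 0.207 ≤ (digamma ((σ₁ / 2 + 1 : ℝ) : ℂ)).re := by
    have h1 := (abs_le.1 (re_digamma_bounds (x := σ₁ / 2 + 1) (y := 0) (by linarith)
      (R := σ₁ / 2 + 1) (by linarith) (by ring))).1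
    simp only [ofReal_zero, zero_mul, add_zero] at h1
    have h2 : 16 / 27 ≤ Real.log (σ₁ / 2 + 1) := by
      have h := Real.div_le_log_of_pow_le (a := 1.809) (by norm_num) (m := 16) (n := 27)
        (by norm_num) (by norm_num)
      have := Real.log_le_log (x := 1.809) (y := σ₁ / 2 + 1) (by norm_num) (by linarith)
      norm_num at h this ⊢
      linarith
    have h3 : 1 / (6 * (σ₁ / 2 + 1) ^ 3) ≤ 1 / (6 * 1.809 ^ 3) := by
      gcongr; linarith
    have h4 : Real.pi / (12 * (σ₁ / 2 + 1) ^ 2) ≤ 3.1416 / (12 * 1.809 ^ 2) := by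
      have := Real.pi_lt_d4
      gcongr
      linarith
    have h5 : (σ₁ / 2 + 1) / (2 * (σ₁ / 2 + 1) ^ 2) ≤ 1 / (2 * 1.809) := by
      rw [show (σ₁ / 2 + 1) / (2 * (σ₁ / 2 + 1) ^ 2) = 1 / (2 * (σ₁ / 2 + 1)) by
        field_simp]
      gcongr; linarith
    norm_num at h1 h2 h3 h4 h5 ⊢
    linarith
  have d3 : 0.664 ≤ κ * (1 / (σ₁ - 1)) := by
    rw [mul_one_div, le_div_iff₀ (by linarith)]
    nlinarith
  nlinarith

theorem digamma_combination_numerics {κ D D₁ l l₁ a b u p P P₁ X X₁ : ℝ} (hκ : 0 < κ)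
    (hκ' : κ < 0.4473) (hD : D - (l - a) ≤ 0.0915) (hD₁ : -0.0915 ≤ D₁ - (l₁ - b))
    (hl : l ≤ l₁) (hlu : l ≤ u - 0.69) (hab : κ * b ≤ a) (hP : P ≤ 0.01) (hP₁ : 0 ≤ κ * P₁) :
    P - p / 2 + D / 2 - X - κ * (P₁ - p / 2 + D₁ / 2 - X₁) ≤
      (1 - κ) / 2 * (u - p) - (X - κ * X₁) := by
  have m1 := mul_le_mul_of_nonneg_left (show l₁ - b - 0.0915 ≤ D₁ by linarith) hκ.le
  have m2 := mul_le_mul_of_nonneg_left hl hκ.le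
  have m3 := mul_le_mul_of_nonneg_left hlu (show 0 ≤ 1 - κ by linarith)
  linarith

theorem digamma_combination_numerics' {κ D D₁ l l₁ a b u p P P₁ X X₁ : ℝ} (hκ : 0 < κ)
    (hκ' : κ < 0.4473) (hD : D - (l - a) ≤ 0.0001) (hD₁ : -0.0001 ≤ D₁ - (l₁ - b))
    (hl : l ≤ l₁) (hlu : l ≤ u + 0.0001) (hab : κ * b ≤ a) (hP : P ≤ 0.0001) (hP₁ : 0 ≤ κ * P₁) :
    P - p / 2 + D / 2 - X - κ * (P₁ - p / 2 + D₁ / 2 - X₁) ≤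
      (1 - κ) / 2 * (u - p) + 0.001 - (X - κ * X₁) := by
  have m1 := mul_le_mul_of_nonneg_left (show l₁ - b - 0.0001 ≤ D₁ by linarith) hκ.le
  have m2 := mul_le_mul_of_nonneg_left hl hκ.le
  have m3 := mul_le_mul_of_nonneg_left hlu (show 0 ≤ 1 - κ by linarith)
  norm_num at *
  linarith

theorem exists_stechkin_point {σ : ℝ} (h : 1 < σ) (h' : σ ≤ 1.061) :
    ∃ σ₁, σ ≤ σ₁ ∧ 1.618 ≤ σ₁ ∧ σ₁ ≤ 1.673 ∧ σ₁ ^ 2 - σ₁ = σ ^ 2 := by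
  set w := √(1 + 4 * σ ^ 2) with hw
  have hw2 : w ^ 2 = 1 + 4 * σ ^ 2 := Real.sq_sqrt (by positivity)
  have hw0 : 2.236 ≤ w := Real.le_sqrt_of_sq_le (by nlinarith)
  have hw1 : w ≤ 2.346 := Real.sqrt_le_iff.2 ⟨by norm_num, by nlinarith⟩
  have hw3 : 2 * σ ≤ w := Real.le_sqrt_of_sq_le (by nlinarith)
  exact ⟨(1 + w) / 2, by linarith, by linarith, by linarith, by linarith⟩

theorem exists_stechkin_constant : ∃ κ : ℝ, 5 * κ ^ 2 = 1 ∧ 0.4472 < κ ∧ κ < 0.44723 := by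
  have h5 : √5 ^ 2 = 5 := Real.sq_sqrt (by norm_num)
  have h5a : 2.236 < √5 := Real.lt_sqrt_of_sq_lt (by norm_num)
  have h5b : √5 < 2.2361 := (Real.sqrt_lt' (by norm_num)).2 (by norm_num)
  refine ⟨1 / √5, by rw [div_pow, h5]; norm_num, ?_, ?_⟩
  · rw [lt_div_iff₀ (by linarith)]; linarith
  · rw [div_lt_iff₀ (by linarith)]; linarith

set_option maxHeartbeats 1000000 in
theorem riemannZeta_combination_le {κ σ σ₁ t U : ℝ} (hκ : 0 < κ) (hκ' : κ < 0.4473)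
    (hσ : 1 < σ) (hσ' : σ ≤ 1.061) (hσ₁ : σ ≤ σ₁) (hσ₁' : σ₁ ≤ 1.673)
    (ht : 2.5 ≤ |t|) (hU : 3400 ≤ U) (htU : |t| ≤ U) :
    -(logDeriv riemannZeta (σ + t * I)).re - κ * -(logDeriv riemannZeta (σ₁ + t * I)).re ≤
      (1 - κ) / 2 * (Real.log (U / 2) - Real.log Real.pi) + 0.001 -
        ((logDeriv riemannXi (σ + t * I)).re - κ * (logDeriv riemannXi (σ₁ + t * I)).re) := by
  rw [neg_re_logDeriv_riemannZeta (by simpa), neg_re_logDeriv_riemannZeta (by simp; linarith)]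
  have ht2 : 6.25 ≤ t ^ 2 := by rw [← sq_abs]; nlinarith
  have htU2 : t ^ 2 ≤ U ^ 2 := by rw [← sq_abs t]; nlinarith [abs_nonneg t]
  have e1 : ∀ x : ℝ, (1 / ((x : ℂ) + t * I - 1)).re = (x - 1) / ((x - 1) ^ 2 + t ^ 2) := fun x => by
    rw [re_one_div_sub]; simp
  have e2 : ∀ x : ℝ, ((x + t * I : ℂ) / 2 + 1) = ((x / 2 + 1 : ℝ) : ℂ) + (t / 2 : ℝ) * I := fun x => by
    push_cast; ring
  rw [e1, e1, e2, e2]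
  set x := σ / 2 + 1 with hx
  set x₁ := σ₁ / 2 + 1 with hx₁
  set R := √(x ^ 2 + (t / 2) ^ 2) with hR
  set R₁ := √(x₁ ^ 2 + (t / 2) ^ 2) with hR₁
  have hR2 : R ^ 2 = x ^ 2 + (t / 2) ^ 2 := Real.sq_sqrt (by positivity)
  have hR₁2 : R₁ ^ 2 = x₁ ^ 2 + (t / 2) ^ 2 := Real.sq_sqrt (by positivity)
  have hx0 : 1.5 < x := by linarith
  have hxx : x ≤ x₁ := by linarith
  have hx2 : x ^ 2 ≤ 2.4 := by
    calc x ^ 2 ≤ 1.5305 ^ 2 := by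
          gcongr
          linarith
      _ ≤ _ := by norm_num
  have hU2 : 3400 ^ 2 ≤ U ^ 2 := by gcongr
  have hR0 : 1.95 ≤ R := by
    refine Real.le_sqrt_of_sq_le ?_
    have : 1.5 ^ 2 ≤ x ^ 2 := by gcongr
    clear * - this ht2
    norm_num at *
    linarith
  have hRR : R ≤ R₁ := by
    refine Real.sqrt_le_sqrt ?_
    gcongr
  have d1 := (abs_le.1 (re_digamma_bounds (x := x) (y := t / 2) (by linarith) (by linarith) hR2)).2
  have d2 := (abs_le.1 (re_digamma_bounds (x := x₁) (y := t / 2) (by linarith) (by linarith) hR₁2)).1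
  have k1 : κ * (x₁ / (2 * R₁ ^ 2)) ≤ x / (2 * R ^ 2) := by
    have hx' : 0 < x := by linarith
    have hx₁' : 0 < x₁ := by linarith
    rw [hR2, hR₁2, ← mul_div_assoc, div_le_div_iff₀ (by positivity) (by positivity)]
    have q1 : κ * x₁ ≤ x := by
      have := mul_le_mul hκ'.le (show x₁ ≤ 1.85 by linarith) hx₁'.le (by norm_num)
      norm_num at this hx0 ⊢
      linarith
    calc κ * x₁ * (2 * (x ^ 2 + (t / 2) ^ 2)) ≤ x * (2 * (x₁ ^ 2 + (t / 2) ^ 2)) := by gcongr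
      _ = _ := by ring
  have k3 : 0 ≤ κ * ((σ₁ - 1) / ((σ₁ - 1) ^ 2 + t ^ 2)) := by
    have : 0 ≤ σ₁ - 1 := by linarith
    positivity
  have l1 : Real.log R ≤ Real.log R₁ := Real.log_le_log (by linarith) hRR
  rcases le_or_gt (2 * |t|) U with hc | hc
  · have htU2 : 4 * t ^ 2 ≤ U ^ 2 := by rw [← sq_abs t]; nlinarith [abs_nonneg t]
    have hE : ∀ r : ℝ, 1.95 ≤ r → 1 / (6 * r ^ 3) + Real.pi / (12 * r ^ 2) ≤ 0.0915 := by
      intro r hr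
      have h3 : 1 / (6 * r ^ 3) ≤ 1 / (6 * 1.95 ^ 3) := by gcongr
      have h4 : Real.pi / (12 * r ^ 2) ≤ 3.1416 / (12 * 1.95 ^ 2) := by
        have := Real.pi_lt_d4
        gcongr
      norm_num at h3 h4 ⊢
      linarith
    have E1 := hE R hR0
    have E2 := hE R₁ (by linarith)
    have k2 : (σ - 1) / ((σ - 1) ^ 2 + t ^ 2) ≤ 0.01 := by
      rw [div_le_iff₀ (by positivity)]
      have := sq_nonneg (σ - 1)
      linarith
    have l2 : Real.log R ≤ Real.log (U / 2) - 0.69 := by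
      have h1 : R ≤ U * (1001 / 4000) := by
        refine Real.sqrt_le_iff.2 ⟨by linarith, ?_⟩
        clear * - hx2 hU2 htU2
        linarith
      have h2 := Real.log_le_log (by linarith) h1
      have h3 : Real.log (U * (1001 / 4000)) = Real.log (U / 2) + Real.log (1001 / 1000) -
          Real.log 2 := by
        rw [show U * (1001 / 4000) = U / 2 * (1001 / 1000) / 2 by ring,
          Real.log_div (by positivity) (by norm_num), Real.log_mul (by positivity) (by norm_num)]
      have h4 := Real.log_le_sub_one_of_pos (x := 1001 / 1000) (by norm_num)
      have h5 := Real.log_two_gt_d9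
      norm_num at h4 h5 ⊢
      linarith
    refine (digamma_combination_numerics hκ hκ' (d1.trans E1) ((neg_le_neg E2).trans d2) l1 l2 k1 k2 k3).trans (by norm_num)
  · have ht3 : (1700 : ℝ) ^ 2 ≤ t ^ 2 := by rw [← sq_abs t]; gcongr; linarith
    have hR1 : 850 ≤ R := by
      refine Real.le_sqrt_of_sq_le ?_
      clear * - ht3
      linarith [sq_nonneg x]
    have hE : ∀ r : ℝ, 850 ≤ r → 1 / (6 * r ^ 3) + Real.pi / (12 * r ^ 2) ≤ 0.0001 := by
      intro r hr
      have h3 : 1 / (6 * r ^ 3) ≤ 1 / (6 * 850 ^ 3) := by gcongr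
      have h4 : Real.pi / (12 * r ^ 2) ≤ 3.1416 / (12 * 850 ^ 2) := by
        have := Real.pi_lt_d4
        gcongr
      norm_num at h3 h4 ⊢
      linarith
    have E1 := hE R hR1
    have E2 := hE R₁ (by linarith)
    have k2 : (σ - 1) / ((σ - 1) ^ 2 + t ^ 2) ≤ 0.0001 := by
      rw [div_le_iff₀ (by positivity)]
      have := sq_nonneg (σ - 1)
      linarith
    have l2 : Real.log R ≤ Real.log (U / 2) + 0.0001 := by
      have h1 : R ≤ U / 2 * 1.0001 := by
        refine Real.sqrt_le_iff.2 ⟨by linarith, ?_⟩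
        clear * - hx2 hU2 htU2
        linarith
      have h2 := Real.log_le_log (by linarith) h1
      rw [Real.log_mul (by positivity) (by norm_num)] at h2
      have h4 := Real.log_le_sub_one_of_pos (x := 1.0001) (by norm_num)
      norm_num at h2 h4 ⊢
      linarith
    exact digamma_combination_numerics' hκ hκ' (d1.trans E1) ((neg_le_neg E2).trans d2) l1 l2 k1
      k2 k3

theorem zero_free_region_numerics {κ η l f₀ f₁ f₂ f₃ f₄ x₁ x₂ x₃ x₄ : ℝ} (hl : 65 / 8 ≤ l)
    (hη : 0 < η) (hκ0 : 0.4472 < κ) (hκ1 : κ < 0.44723)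
    (key : 0 ≤ 11.1859356 * f₀ + 19.073344 * f₁ + 11.67618784 * f₂ + 4.7568 * f₃ + f₄)
    (h₀ : f₀ ≤ 1 / (3.27 * η) - 0.97)
    (h₁ : f₁ ≤ (1 - κ) / 2 * (Real.log 1 + l - Real.log 2 - Real.log Real.pi) + 0.001 - x₁)
    (h₂ : f₂ ≤ (1 - κ) / 2 * (Real.log 2 + l - Real.log 2 - Real.log Real.pi) + 0.001 - x₂)
    (h₃ : f₃ ≤ (1 - κ) / 2 * (Real.log 3 + l - Real.log 2 - Real.log Real.pi) + 0.001 - x₃)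
    (h₄ : f₄ ≤ (1 - κ) / 2 * (Real.log 4 + l - Real.log 2 - Real.log Real.pi) + 0.001 - x₄)
    (hx₁ : 1 / (4.27 * η) ≤ x₁) (hx₂ : 0 ≤ x₂) (hx₃ : 0 ≤ x₃) (hx₄ : 0 ≤ x₄) :
    1 ≤ 9.65 * η * (l - 2.5) := by
  have hlp : 8 / 7 ≤ Real.log Real.pi := by
    have h := Real.div_le_log_of_pow_le (a := 3.14) (by norm_num) (m := 8) (n := 7) (by norm_num)
      (by norm_num)
    have := Real.log_le_log (by norm_num) Real.pi_gt_d2.le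
    norm_num at h this ⊢
    linarith
  have hl2 := Real.log_two_lt_d9
  have hl2' := Real.log_two_gt_d9
  have hl3 : Real.log 3 ≤ 11 / 10 := by
    have h := Real.log_le_div_of_pow_le (a := 3) (by norm_num) (m := 11) (n := 10)
      (by norm_num) (by norm_num)
    norm_num at h ⊢
    linarith
  have hl4 : Real.log 4 = 2 * Real.log 2 := by
    rw [show (4 : ℝ) = 2 ^ 2 by norm_num, Real.log_pow]; norm_num
  rw [Real.log_one] at h₁
  rw [hl4] at h₄
  rw [← one_div_mul_one_div, one_div η] at h₀ hx₁
  set Λ := (1 - κ) / 2 with hΛ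
  have hΛ1 : Λ ≤ 0.2764 := by rw [hΛ]; linarith
  have hΛ0 : 0.27638 ≤ Λ := by rw [hΛ]; linarith
  have c1 : Λ * (19.073344 * (0 + l - Real.log 2 - Real.log Real.pi) +
      11.67618784 * (Real.log 2 + l - Real.log 2 - Real.log Real.pi) +
      4.7568 * (Real.log 3 + l - Real.log 2 - Real.log Real.pi) +
      (2 * Real.log 2 + l - Real.log 2 - Real.log Real.pi)) ≤
      Λ * (36.506332 * l - 52.3) := by
    refine mul_le_mul_of_nonneg_left ?_ (by linarith)
    norm_num at hl2 hl2' hl3 hlp ⊢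
    linarith
  have c2 : Λ * (36.506332 * l - 52.3) ≤ 0.2764 * (36.506332 * l) - 0.27638 * 52.3 := by
    have := mul_le_mul_of_nonneg_right hΛ1 (show 0 ≤ 36.506332 * l by positivity)
    linarith
  have hi : 0 ≤ η⁻¹ := by positivity
  have main : 1.046 * η⁻¹ ≤ 10.09035 * (l - 2.5) := by
    clear_value Λ
    norm_num at *
    linarith
  have main2 : 1.046 ≤ 10.09035 * (l - 2.5) * η := by
    calc 1.046 = 1.046 * η⁻¹ * η := by field_simp
      _ ≤ _ := by gcongr
  have : 0 ≤ (l - 2.5) * η := by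
    have : 0 ≤ l - 2.5 := by norm_num at hl ⊢; linarith
    positivity
  norm_num at *
  linarith

theorem riemannXi_zero_free_region {T : ℝ} (hT : 3400 ≤ T) {ρ : ℂ} (hρ : riemannXi ρ = 0)
    (hρT : |ρ.im| ≤ T) : 1 ≤ 9.65 * (1 - ρ.re) * (Real.log T - 2.5) := by
  obtain ⟨hb0, hb1⟩ := re_mem_Ioo_of_riemannXi_eq_zero hρ
  have hlT : 65 / 8 ≤ Real.log T := by
    have h := Real.div_le_log_of_pow_le (a := 3400) (by norm_num) (m := 65) (n := 8)
      (by norm_num) (by norm_num)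
    have := Real.log_le_log (by norm_num) hT
    norm_num at h ⊢
    linarith
  set η := 1 - ρ.re with hη
  have hη0 : 0 < η := by linarith
  rcases le_or_gt 0.0186 η with hη1 | hη1
  · have : 0.0186 * 5.625 ≤ η * (Real.log T - 2.5) := by
      exact mul_le_mul hη1 (by norm_num at hlT ⊢; linarith) (by norm_num) (by linarith)
    norm_num at this ⊢
    linarith
  obtain ⟨κ, hκ5, hκ0, hκ1⟩ := exists_stechkin_constant
  have hκp : 0 < κ := by linarith
  obtain ⟨σ, hσd⟩ : ∃ σ, σ = 1 + 3.27 * η := ⟨_, rfl⟩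
  have hσ : 1 < σ := by linarith
  have hσ' : σ ≤ 1.061 := by linarith
  obtain ⟨σ₁, hσσ, h₁a, h₁b, hq⟩ := exists_stechkin_point hσ hσ'
  have hσ₁ : 1 < σ₁ := by linarith
  have hγ := two_point_five_lt_abs_im hρ
  have hpos : ∀ t : ℝ, 0 ≤ (logDeriv riemannXi (σ + t * I)).re -
      κ * (logDeriv riemannXi (σ₁ + t * I)).re := fun t => by
    simpa using sum_re_xiPair_le hκp.le (s := σ + t * I) (s₁ := σ₁ + t * I)
      (by simpa using hσ.le) (by simpa using hσ₁.le)
      (fun ρ hρ => stechkin_xiPair hκp hκ5 hσ hσ₁ hq hρ) ∅ (by simp)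
  have f0 := riemannZeta_combination_zero_le (κ := κ) (by linarith) (by linarith) hσ hσ' h₁a h₁b
    (by simpa using hpos 0)
  have fj : ∀ j : ℝ, 1 ≤ j → -(logDeriv riemannZeta (σ + (j * ρ.im : ℝ) * I)).re -
      κ * -(logDeriv riemannZeta (σ₁ + (j * ρ.im : ℝ) * I)).re ≤
      (1 - κ) / 2 * (Real.log j + Real.log T - Real.log 2 - Real.log Real.pi) + 0.001 -
        ((logDeriv riemannXi (σ + (j * ρ.im : ℝ) * I)).re -
          κ * (logDeriv riemannXi (σ₁ + (j * ρ.im : ℝ) * I)).re) := by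
    intro j hj
    have hj0 : 0 < j := by linarith
    rw [← Real.log_mul hj0.ne' (by positivity), ← Real.log_div (by positivity) (by norm_num)]
    refine riemannZeta_combination_le hκp (by linarith) hσ hσ' hσσ h₁b ?_ ?_ ?_
    · rw [abs_mul, abs_of_pos hj0]
      calc (2.5 : ℝ) ≤ 1 * |ρ.im| := by linarith
        _ ≤ _ := by gcongr
    · calc (3400 : ℝ) ≤ 1 * T := by linarith
        _ ≤ _ := by gcongr
    · rw [abs_mul, abs_of_pos hj0]
      gcongr
  have hz := one_div_le_re_logDeriv_sub hκp hκ5 hσ hσ₁ hq hρ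
    (by intro h; rw [hη, h] at hη1; norm_num at hη1)
  have key := sum_re_logDeriv_zeta_nonneg (κ := κ) (σ := σ) (σ₁ := σ₁) (t := ρ.im)
    (f := fun t => -(logDeriv riemannZeta (σ + t * I)).re -
      κ * -(logDeriv riemannZeta (σ₁ + t * I)).re) (by linarith) hσ hσσ (fun _ => rfl)
  have f1 := fj 1 le_rfl
  rw [one_mul] at f1
  rw [show σ - ρ.re = 4.27 * η by rw [hσd, hη]; ring] at hz
  rw [show σ - 1 = 3.27 * η by rw [hσd]; ring] at f0
  simp only [ofReal_zero, zero_mul, add_zero] at key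
  exact zero_free_region_numerics hlT hη0 hκ0 hκ1 key f0 f1 (fj 2 (by norm_num))
    (fj 3 (by norm_num)) (fj 4 (by norm_num)) hz (hpos _) (hpos _) (hpos _)

open scoped Nat

/-! ### A differential functional which localises `log n` -/

/-- On a Dirichlet series `∑ a n * n ^ (-s)` this functional has the effect of weighting `a n`
by `(h ^ 2 - (log n - m) ^ 2) * (log n) ^ k * n ^ (-(1 + r))`, up to normalisation. -/
noncomputable def bump (m h r : ℝ) (k : ℕ) (F : ℂ → ℂ) : ℂ :=
  ((r ^ (k + 1) / k ! : ℝ) : ℂ) * ((-1) ^ k * (-iteratedDeriv (k + 2) F ((1 + r : ℝ) : ℂ) -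
    2 * m * iteratedDeriv (k + 1) F ((1 + r : ℝ) : ℂ) -
      (m ^ 2 - h ^ 2) * iteratedDeriv k F ((1 + r : ℝ) : ℂ)))

section

variable {m h r : ℝ} {k : ℕ} {F G : ℂ → ℂ}

theorem bump_congr (hFG : F =ᶠ[𝓝 ((1 + r : ℝ) : ℂ)] G) : bump m h r k F = bump m h r k G := by
  simp only [bump, hFG.iteratedDeriv_eq]

theorem bump_add (hF : AnalyticAt ℂ F ((1 + r : ℝ) : ℂ)) (hG : AnalyticAt ℂ G ((1 + r : ℝ) : ℂ)) :
    bump m h r k (fun s => F s + G s) = bump m h r k F + bump m h r k G := by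
  simp only [bump, iteratedDeriv_fun_add hF.contDiffAt hG.contDiffAt]
  ring

theorem bump_const_mul (c : ℂ) : bump m h r k (fun s => c * F s) = c * bump m h r k F := by
  simp only [bump, iteratedDeriv_const_mul_field]
  ring

theorem bump_const (c : ℂ) (hk : k ≠ 0) : bump m h r k (fun _ => c) = 0 := by
  simp [bump, iteratedDeriv_const, hk]

theorem analyticAt_multisetSum {f : ℂ → ℂ → ℂ} {a : ℂ} {Z : Multiset ℂ}
    (hf : ∀ ρ ∈ Z, AnalyticAt ℂ (f ρ) a) : AnalyticAt ℂ (fun s => (Z.map fun ρ => f ρ s).sum) a := by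
  induction Z using Multiset.induction with
  | empty => simpa using analyticAt_const
  | cons ρ Z ih =>
    simp only [Multiset.map_cons, Multiset.sum_cons]
    exact (hf ρ (by simp)).add (ih fun ρ' hρ' => hf ρ' (by simp [hρ']))

theorem norm_bump_multisetSum_le {f : ℂ → ℂ → ℂ} {Z : Multiset ℂ}
    (hf : ∀ ρ ∈ Z, AnalyticAt ℂ (f ρ) ((1 + r : ℝ) : ℂ)) :
    ‖bump m h r k (fun s => (Z.map fun ρ => f ρ s).sum)‖ ≤
      (Z.map fun ρ => ‖bump m h r k (f ρ)‖).sum := by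
  induction Z using Multiset.induction with
  | empty => simp [bump]
  | cons ρ Z ih =>
    have hf' : ∀ ρ ∈ Z, AnalyticAt ℂ (f ρ) ((1 + r : ℝ) : ℂ) := fun ρ' hρ' => hf ρ' (by simp [hρ'])
    simp only [Multiset.map_cons, Multiset.sum_cons]
    rw [bump_add (hf ρ (by simp)) (analyticAt_multisetSum hf')]
    exact (norm_add_le _ _).trans (by gcongr; exact ih hf')

theorem iteratedDeriv_one_div_sub (j : ℕ) (ρ s : ℂ) :
    iteratedDeriv j (fun s => 1 / (s - ρ)) s = (-1) ^ j * j ! * (1 / (s - ρ)) ^ (j + 1) := by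
  have := congrFun (iter_deriv_inv_linear_sub j 1 ρ) s
  simp only [one_mul, one_pow, mul_one] at this
  simp only [one_div, iteratedDeriv_eq_iterate, this]
  rw [show (-1 - j : ℤ) = -((j + 1 : ℕ) : ℤ) by push_cast; ring, zpow_neg, zpow_natCast, inv_pow]

theorem bump_one_div_sub (hr : r ≠ 0) (hk : r * m = k + 1) (ρ : ℂ) :
    bump m h r k (fun s => 1 / (s - ρ)) = (r / ((1 + r : ℝ) - ρ)) ^ (k + 1) *
      (h ^ 2 - m ^ 2 * (1 - r / ((1 + r : ℝ) - ρ)) ^ 2 - m / r * (r / ((1 + r : ℝ) - ρ)) ^ 2) := by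
  simp only [bump, iteratedDeriv_one_div_sub]
  have hr' : (r : ℂ) ≠ 0 := by exact_mod_cast hr
  have hk' : (r : ℂ) * m = k + 1 := by exact_mod_cast hk
  have e0 : (r : ℂ) / ((1 + r : ℝ) - ρ) = r * (1 / ((1 + r : ℝ) - ρ)) := by ring
  rw [e0]
  set w := 1 / (((1 + r : ℝ) : ℂ) - ρ)
  have f1 : ((k + 1)! : ℂ) = r * m * k ! := by rw [hk', Nat.factorial_succ]; push_cast; ring
  have f2 : ((k + 2)! : ℂ) = (r * m + 1) * (r * m) * k ! := by
    rw [hk', Nat.factorial_succ, Nat.factorial_succ]; push_cast; ring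
  have f0 : (k ! : ℂ) ≠ 0 := by exact_mod_cast Nat.factorial_ne_zero k
  have s1 : ((-1 : ℂ) ^ k) * (-1) ^ k = 1 := by rw [← mul_pow]; simp
  rw [f1, f2]
  push_cast
  calc _ = ((-1 : ℂ) ^ k * (-1) ^ k) * ((r : ℂ) ^ (k + 1) / k ! * (-((r * m + 1) * (r * m) * k ! *
        w ^ (k + 2 + 1)) + 2 * m * (r * m * k ! * w ^ (k + 1 + 1)) -
        (m ^ 2 - h ^ 2) * (k ! * w ^ (k + 1)))) := by ring
    _ = _ := by
      rw [s1]
      field_simp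
      ring

theorem norm_bump_le {R C : ℝ} (hm : 0 ≤ m) (hr : 0 < r) (hhm : |h| ≤ m) (hR : 0 < R)
    (hF : DiffContOnCl ℂ F (Metric.ball ((1 + r : ℝ) : ℂ) R))
    (hC : ∀ s ∈ Metric.sphere ((1 + r : ℝ) : ℂ) R, ‖F s‖ ≤ C) :
    ‖bump m h r k F‖ ≤ (r / R) ^ k * r * C *
      ((k + 2) * (k + 1) / R ^ 2 + 2 * m * (k + 1) / R + m ^ 2) := by
  have c := fun j => norm_iteratedDeriv_le_of_forall_mem_sphere_norm_le j hR hF hC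
  have hC0 : 0 ≤ C := by
    refine (norm_nonneg (F (((1 + r : ℝ) : ℂ) + R))).trans (hC _ ?_)
    simp [abs_of_pos hR]
  have hh : ‖(m ^ 2 - h ^ 2 : ℂ)‖ ≤ m ^ 2 := by
    rw [show (m ^ 2 - h ^ 2 : ℂ) = ((m ^ 2 - h ^ 2 : ℝ) : ℂ) by push_cast; ring, norm_real,
      Real.norm_eq_abs, abs_of_nonneg]
    · linarith [sq_nonneg h]
    · rw [← sq_abs h]
      have := abs_nonneg h
      nlinarith
  have f0 : (0 : ℝ) < k ! := by exact_mod_cast Nat.factorial_pos k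
  rw [bump, norm_mul, norm_mul, norm_pow, norm_neg, norm_one, one_pow, one_mul, norm_real,
    Real.norm_of_nonneg (by positivity)]
  calc _ ≤ r ^ (k + 1) / k ! * ((k + 2)! * C / R ^ (k + 2) + 2 * m * ((k + 1)! * C / R ^ (k + 1)) +
        m ^ 2 * (k ! * C / R ^ k)) := by
        gcongr
        refine (norm_sub_le _ _).trans (add_le_add ((norm_sub_le _ _).trans (add_le_add ?_ ?_)) ?_)
        · rw [norm_neg]
          exact c _
        · rw [norm_mul]
          refine mul_le_mul (by simp [abs_of_nonneg hm]) (c _) (norm_nonneg _) (by positivity)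
        · rw [norm_mul]
          exact mul_le_mul hh (c _) (norm_nonneg _) (by positivity)
    _ = _ := by
        rw [Nat.factorial_succ, Nat.factorial_succ, div_pow]
        push_cast
        field_simp
        ring

end

open ArithmeticFunction in
theorem hasSum_logMul_vonMangoldt {σ : ℝ} (hσ : 1 < σ) (j : ℕ) :
    HasSum (fun n : ℕ => ((vonMangoldt n * (n : ℝ) ^ (-σ) * Real.log n ^ j : ℝ) : ℂ))
      ((-1) ^ j * iteratedDeriv j (LSeries fun n => (vonMangoldt n : ℂ)) σ) := by
  have ha : LSeries.abscissaOfAbsConv (fun n => (vonMangoldt n : ℂ)) < ((σ : ℂ).re : EReal) := by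
    refine lt_of_le_of_lt (LSeries.abscissaOfAbsConv_le_of_forall_lt_LSeriesSummable
      (x := 1) fun y hy => LSeriesSummable_vonMangoldt (by simpa using hy)) ?_
    exact_mod_cast hσ
  rw [LSeries_iteratedDeriv j ha, ← mul_assoc, ← mul_pow]
  simp only [mul_neg, mul_one, neg_neg, one_pow, one_mul]
  have hs : LSeriesSummable (LSeries.logMul^[j] fun n => (vonMangoldt n : ℂ)) σ :=
    LSeriesSummable_of_abscissaOfAbsConv_lt_re (by
      rwa [LSeries.absicssaOfAbsConv_logPowMul])
  have hl : ∀ (j n : ℕ), (LSeries.logMul^[j] fun n => (vonMangoldt n : ℂ)) n =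
      Complex.log n ^ j * vonMangoldt n := by
    intro j n
    induction j with
    | zero => simp
    | succ j ih =>
      rw [Function.iterate_succ_apply', LSeries.logMul, ih]
      ring
  refine (hs.hasSum).congr_fun ?_
  intro n
  rcases eq_or_ne n 0 with rfl | hn
  · simp
  rw [LSeries.term_of_ne_zero hn, hl, ofReal_mul, ofReal_mul,
    ofReal_cpow (Nat.cast_nonneg n), ofReal_pow, ← natCast_log, ofReal_neg, cpow_neg]
  push_cast
  field_simp

open ArithmeticFunction in
theorem hasSum_bump_zeta {m h r : ℝ} (k : ℕ) (hr : 0 < r) :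
    HasSum (fun n : ℕ => r ^ (k + 1) / k ! * (vonMangoldt n * (n : ℝ) ^ (-(1 + r)) *
      Real.log n ^ k * (h ^ 2 - (Real.log n - m) ^ 2)))
      (bump m h r k (fun s => -logDeriv riemannZeta s)).re := by
  have he : (fun s => -logDeriv riemannZeta s) =ᶠ[𝓝 ((1 + r : ℝ) : ℂ)]
      LSeries fun n => (vonMangoldt n : ℂ) := by
    have : {s : ℂ | 1 < s.re} ∈ 𝓝 ((1 + r : ℝ) : ℂ) :=
      (isOpen_lt continuous_const continuous_re).mem_nhds (by simpa)
    filter_upwards [this] with s hs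
    rw [LSeries_vonMangoldt_eq_deriv_riemannZeta_div hs, logDeriv_apply, neg_div]
  have hσ : (1 : ℝ) < 1 + r := by linarith
  have h0 := hasSum_logMul_vonMangoldt hσ k
  have h1 := hasSum_logMul_vonMangoldt hσ (k + 1)
  have h2 := hasSum_logMul_vonMangoldt hσ (k + 2)
  have := (((h2.neg.add (h1.mul_left (2 * m : ℂ))).sub (h0.mul_left (m ^ 2 - h ^ 2 : ℂ))).mul_left
    ((r ^ (k + 1) / k ! : ℝ) : ℂ)).mapL reCLM
  rw [bump_congr he, bump]
  convert! this using 2 with n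
  · simp only [reCLM_apply, re_ofReal_mul]
    congr 1
    rw [← ofReal_ofNat 2, ← ofReal_mul, ← ofReal_mul, ← ofReal_neg, ← ofReal_pow, ← ofReal_pow,
      ← ofReal_sub, ← ofReal_mul, ← ofReal_add, ← ofReal_sub, ofReal_re]
    ring
  · congr 1
    ring

theorem analyticAt_xiPair {ρ s : ℂ} (h : s ≠ ρ) (h' : s ≠ 1 - conj ρ) :
    AnalyticAt ℂ (xiPair ρ) s := by
  unfold xiPair
  have h1 := sub_ne_zero.2 h
  have h2 := sub_ne_zero.2 h'
  fun_prop (disch := assumption)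

theorem analyticAt_xiPair_of_one_lt_re {ρ s : ℂ} (hρ : riemannXi ρ = 0) (hs : 1 < s.re) :
    AnalyticAt ℂ (xiPair ρ) s := by
  obtain ⟨h0, h1⟩ := re_mem_Ioo_of_riemannXi_eq_zero hρ
  refine analyticAt_xiPair ?_ ?_
  · rintro rfl
    linarith
  · rintro rfl
    simp at hs
    linarith

theorem analyticAt_logDeriv_riemannXi {s : ℂ} (hs : 1 < s.re) :
    AnalyticAt ℂ (logDeriv riemannXi) s := by
  have := differentiable_riemannXi.analyticAt s
  exact this.deriv.div this (riemannXi_ne_zero_of_one_le_re hs.le)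

theorem analyticAt_digamma_half_add_one {s : ℂ} (hs : -2 < s.re) :
    AnalyticAt ℂ (fun s => digamma (s / 2 + 1)) s := by
  have hd : DifferentiableOn ℂ Gamma {z | 0 < z.re} := fun z hz =>
    (differentiableAt_Gamma z fun n h => by
      rw [h] at hz
      simp at hz
      linarith [show (0 : ℝ) ≤ n by positivity]).differentiableWithinAt
  have hz : 0 < (s / 2 + 1).re := by simp; linarith
  have hA : AnalyticAt ℂ Gamma (s / 2 + 1) :=
    hd.analyticAt ((isOpen_lt continuous_const continuous_re).mem_nhds hz)
  have hD : AnalyticAt ℂ digamma (s / 2 + 1) := hA.deriv.div hA (Gamma_ne_zero_of_re_pos hz)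
  exact hD.comp (f := fun s : ℂ => s / 2 + 1) (by fun_prop)

theorem diffContOnCl_ball_of_analyticAt {F : ℂ → ℂ} {a R : ℝ}
    (h : ∀ s : ℂ, a - R ≤ s.re → AnalyticAt ℂ F s) : DiffContOnCl ℂ F (Metric.ball (a : ℂ) R) := by
  refine DifferentiableOn.diffContOnCl fun s hs => (h s ?_).differentiableAt.differentiableWithinAt
  have hs := Metric.closure_ball_subset_closedBall hs
  rw [Metric.mem_closedBall, dist_eq] at hs
  have := (abs_le.1 ((abs_re_le_norm (s - a)).trans hs)).1
  simp at this
  linarith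

theorem norm_bump_logDeriv_riemannXi_le {m h r A W : ℝ} {k : ℕ} (hm : 0 ≤ m) (hr : 0 < r)
    (hhm : |h| ≤ m) (hk : k ≠ 0) (hA : 0 < A) (hW : 0 ≤ W)
    (hb : ∀ ρ, riemannXi ρ = 0 → ‖bump m h r k (xiPair ρ)‖ ≤ W * (xiPair ρ (1 + A)).re) :
    ‖bump m h r k (logDeriv riemannXi)‖ ≤ W * (logDeriv riemannXi (1 + A)).re := by
  refine le_of_forall_pos_le_add fun ε hε => ?_
  set R := r / 2 with hR
  set C := (r / R) ^ k * r * ((k + 2) * (k + 1) / R ^ 2 + 2 * m * (k + 1) / R + m ^ 2) with hC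
  have hR0 : 0 < R := by positivity
  have hC0 : 0 ≤ C := by positivity
  obtain ⟨Z, c, hZ, -, hX⟩ := exists_logDeriv_riemannXi_approx (2 + 2 * r + A)
    (ε := ε / (C + W + 1)) (by positivity)
  set δ := ε / (C + W + 1)
  have hpt : (1 : ℝ) < ((1 + r : ℝ) : ℂ).re := by simpa
  have aP : ∀ s : ℂ, 1 < s.re → AnalyticAt ℂ (fun s => (Z.map fun ρ => xiPair ρ s).sum) s :=
    fun s hs => analyticAt_multisetSum fun ρ hρ => analyticAt_xiPair_of_one_lt_re (hZ ρ hρ) hs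
  set H : ℂ → ℂ := fun s => logDeriv riemannXi s - (Z.map fun ρ => xiPair ρ s).sum - c * I
  have aH : ∀ s : ℂ, 1 < s.re → AnalyticAt ℂ H s := fun s hs =>
    ((analyticAt_logDeriv_riemannXi hs).sub (aP s hs)).sub analyticAt_const
  have hH : ‖bump m h r k H‖ ≤ C * δ := by
    refine (norm_bump_le hm hr hhm hR0 (diffContOnCl_ball_of_analyticAt fun s hs => aH s ?_)
      (C := δ) fun s hs => ?_).trans_eq ?_
    · linarith
    · rw [Metric.mem_sphere, dist_eq] at hs
      have h1 := (abs_le.1 ((abs_re_le_norm (s - (1 + r : ℝ))).trans hs.le)).1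
      simp at h1
      refine hX s ?_ (riemannXi_ne_zero_of_one_le_re (by linarith))
      calc ‖s‖ = ‖(s - (1 + r : ℝ)) + (1 + r : ℝ)‖ := by ring_nf
        _ ≤ R + (1 + r) := by
          refine (norm_add_le _ _).trans (add_le_add hs.le ?_)
          rw [norm_real, Real.norm_of_nonneg (by positivity)]
        _ < _ := by linarith
    · rw [hC]; ring
  have hHc : AnalyticAt ℂ (fun s => H s + c * I) ((1 + r : ℝ) : ℂ) :=
    (aH _ hpt).add analyticAt_const
  have hdec : bump m h r k (logDeriv riemannXi) =
      bump m h r k (fun s => (Z.map fun ρ => xiPair ρ s).sum) + bump m h r k H := by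
    rw [← add_zero (bump m h r k H), ← bump_const (m := m) (h := h) (r := r) (c * I) hk,
      ← bump_add (aH _ hpt) analyticAt_const, ← bump_add (aP _ hpt) hHc]
    congr 1
    ext s
    simp only [H]
    ring
  have hsum : (Z.map fun ρ => (xiPair ρ (1 + A)).re).sum ≤ (logDeriv riemannXi (1 + A)).re + δ := by
    have h1 := hX (1 + A) (by
      calc ‖(1 + A : ℂ)‖ = ‖((1 + A : ℝ) : ℂ)‖ := by push_cast; rfl
        _ = 1 + A := by rw [norm_real, Real.norm_of_nonneg (by positivity)]
        _ < _ := by linarith) (riemannXi_ne_zero_of_one_le_re (by simp [hA.le]))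
    have h2 := (abs_le.1 ((abs_re_le_norm _).trans h1)).1
    have h3 : ((Z.map fun ρ => xiPair ρ (1 + A)).sum).re =
        (Z.map fun ρ => (xiPair ρ (1 + A)).re).sum := by
      have := map_multiset_sum reAddGroupHom (Z.map fun ρ => xiPair ρ (1 + A))
      rw [Multiset.map_map] at this
      exact this
    rw [← h3]
    change -δ ≤ (_ - (Z.map fun ρ => xiPair ρ (1 + A)).sum - _).re at h2
    simp only [sub_re, mul_I_re, ofReal_im, neg_zero, sub_zero] at h2
    linarith
  rw [hdec]
  calc _ ≤ (Z.map fun ρ => ‖bump m h r k (xiPair ρ)‖).sum + C * δ := by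
        refine (norm_add_le _ _).trans (add_le_add (norm_bump_multisetSum_le fun ρ hρ =>
          analyticAt_xiPair_of_one_lt_re (hZ ρ hρ) hpt) hH)
    _ ≤ (Z.map fun ρ => W * (xiPair ρ (1 + A)).re).sum + C * δ := by
        gcongr
        exact Multiset.sum_map_le_sum_map _ _ fun ρ hρ => hb ρ (hZ ρ hρ)
    _ ≤ W * ((logDeriv riemannXi (1 + A)).re + δ) + C * δ := by
        rw [Multiset.sum_map_mul_left]
        gcongr
    _ = W * (logDeriv riemannXi (1 + A)).re + (C + W) * δ := by ring
    _ ≤ _ := by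
        gcongr
        rw [← mul_div_assoc, div_le_iff₀ (by positivity)]
        linarith

theorem bump_neg_logDeriv_riemannZeta {m h r : ℝ} {k : ℕ} (hr : 0 < r) (hk : k ≠ 0) :
    bump m h r k (fun s => -logDeriv riemannZeta s) = bump m h r k (fun s => 1 / (s - 1)) -
      bump m h r k (logDeriv riemannXi) + bump m h r k (fun s => digamma (s / 2 + 1)) / 2 := by
  have hpt : (1 : ℝ) < ((1 + r : ℝ) : ℂ).re := by simpa
  have he : (fun s => -logDeriv riemannZeta s) =ᶠ[𝓝 ((1 + r : ℝ) : ℂ)] fun s =>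
      1 / (s - 1) + ((-1) * logDeriv riemannXi s + ((1 / 2) * digamma (s / 2 + 1) +
        (-Complex.log Real.pi / 2))) := by
    have : {s : ℂ | 1 < s.re} ∈ 𝓝 ((1 + r : ℝ) : ℂ) :=
      (isOpen_lt continuous_const continuous_re).mem_nhds hpt
    filter_upwards [this] with s hs
    rw [logDeriv_riemannXi hs]
    ring
  have a1 := analyticAt_logDeriv_riemannXi hpt
  have a2 := analyticAt_digamma_half_add_one (s := ((1 + r : ℝ) : ℂ)) (by linarith)
  have a0 : AnalyticAt ℂ (fun s : ℂ => 1 / (s - 1)) ((1 + r : ℝ) : ℂ) := by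
    have : (((1 + r : ℝ) : ℂ) - 1) ≠ 0 := by
      push_cast
      simpa using hr.ne'
    fun_prop (disch := assumption)
  have b1 : AnalyticAt ℂ (fun s => (-1) * logDeriv riemannXi s) ((1 + r : ℝ) : ℂ) :=
    analyticAt_const.mul a1
  have b2 : AnalyticAt ℂ (fun s => (1 / 2) * digamma (s / 2 + 1)) ((1 + r : ℝ) : ℂ) :=
    analyticAt_const.mul a2
  have b3 : AnalyticAt ℂ (fun s => (1 / 2) * digamma (s / 2 + 1) + (-Complex.log Real.pi / 2))
    ((1 + r : ℝ) : ℂ) := b2.add analyticAt_const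
  have b4 : AnalyticAt ℂ (fun s => (-1) * logDeriv riemannXi s + ((1 / 2) * digamma (s / 2 + 1) +
    (-Complex.log Real.pi / 2))) ((1 + r : ℝ) : ℂ) := b1.add b3
  rw [bump_congr he, bump_add a0 b4, bump_add b1 b3, bump_add b2 analyticAt_const, bump_const_mul,
    bump_const_mul, bump_const _ hk]
  ring

theorem normSq_div_one_add_sub {r : ℝ} (hr : 0 < r) (ρ : ℂ) (hρ : ρ.re < 1) :
    ‖(r : ℂ) / ((1 + r : ℝ) - ρ)‖ ^ 2 =
      1 / (1 + (2 * (1 - ρ.re) / r + ((1 - ρ.re) ^ 2 + ρ.im ^ 2) / r ^ 2)) := by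
  have h1 : ‖((1 + r : ℝ) : ℂ) - ρ‖ ^ 2 = (1 + r - ρ.re) ^ 2 + ρ.im ^ 2 := by
    rw [← normSq_eq_norm_sq, normSq_apply]
    simp
    ring
  rw [norm_div, div_pow, h1, norm_real, Real.norm_of_nonneg hr.le]
  have : 0 < (1 + r - ρ.re) ^ 2 := by
    have : 0 < 1 + r - ρ.re := by linarith
    positivity
  have h2 : 0 < 1 - ρ.re := by linarith
  rw [div_eq_div_iff (by positivity) (by positivity)]
  field_simp
  ring

/-- The size of the parabolic factor produced by `bump` at a pole with `z = r / (1 + r - ρ)`. -/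
theorem norm_bump_factor_le {m h r : ℝ} (hr : 0 < r) (hm : 0 < m) (hh : m / r ≤ h ^ 2) (ρ : ℂ)
    (hρ : ρ.re ∈ Ioo 0 1) (z : ℂ) (hz : z = r / ((1 + r : ℝ) - ρ)) :
    ‖(h ^ 2 - m ^ 2 * (1 - z) ^ 2 - m / r * z ^ 2 : ℂ)‖ ≤
      h ^ 2 - m / r + m / r / r + (m / r / r + (m / r) ^ 2) * (1 + ρ.im ^ 2) * ‖z‖ ^ 2 := by
  obtain ⟨h0, h1⟩ := hρ
  have hr' : (r : ℂ) ≠ 0 := by exact_mod_cast hr.ne'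
  have hd : ((1 + r : ℝ) : ℂ) - ρ ≠ 0 := by
    intro h
    have := congrArg re h
    simp at this
    linarith
  have e1 : 1 - z = (1 - ρ) * z / r := by
    rw [hz]
    field_simp
    push_cast
    ring
  have hz1 : ‖z‖ ≤ 1 := by
    have h2 := normSq_div_one_add_sub hr ρ h1
    rw [← hz] at h2
    have h3 : 0 < 1 - ρ.re := by linarith
    have h4 : ‖z‖ ^ 2 ≤ 1 := by
      rw [h2, div_le_one (by positivity)]
      have : 0 ≤ 2 * (1 - ρ.re) / r + ((1 - ρ.re) ^ 2 + ρ.im ^ 2) / r ^ 2 := by positivity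
      linarith
    exact (sq_le_one_iff₀ (norm_nonneg _)).1 h4
  have n1 : ‖1 - ρ‖ ^ 2 ≤ 1 + ρ.im ^ 2 := by
    rw [← normSq_eq_norm_sq, normSq_apply]
    simp
    nlinarith
  set S := m / r with hS
  have hS0 : 0 < S := by positivity
  have e2 : (h ^ 2 - m ^ 2 * (1 - z) ^ 2 - m / r * z ^ 2 : ℂ) =
      ((h ^ 2 - S : ℝ) : ℂ) + S * ((1 + z) * ((1 - ρ) * z / r)) - S ^ 2 * (1 - ρ) ^ 2 * z ^ 2 := by
    rw [← e1, hS]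
    push_cast
    rw [show (m : ℂ) ^ 2 * (1 - z) ^ 2 = (m / r) ^ 2 * (1 - ρ) ^ 2 * z ^ 2 by
      rw [e1]; field_simp]
    ring
  rw [e2]
  refine (norm_sub_le _ _).trans ((add_le_add_left (norm_add_le _ _) _).trans ?_)
  have t1 : ‖((h ^ 2 - S : ℝ) : ℂ)‖ = h ^ 2 - S := by
    rw [norm_real, Real.norm_of_nonneg (by linarith)]
  have t2 : ‖(S : ℂ) * ((1 + z) * ((1 - ρ) * z / r))‖ ≤
      S / r + S / r * (1 + ρ.im ^ 2) * ‖z‖ ^ 2 := by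
    rw [norm_mul, norm_mul, norm_div, norm_mul, norm_real, norm_real, Real.norm_of_nonneg hS0.le,
      Real.norm_of_nonneg hr.le]
    have h2 : ‖1 + z‖ ≤ 2 := (norm_add_le _ _).trans (by rw [norm_one]; linarith)
    have h3 : 2 * (‖1 - ρ‖ * ‖z‖) ≤ 1 + (1 + ρ.im ^ 2) * ‖z‖ ^ 2 := by
      have := mul_le_mul_of_nonneg_right n1 (sq_nonneg ‖z‖)
      linarith [sq_nonneg (1 - ‖1 - ρ‖ * ‖z‖)]
    calc S * (‖1 + z‖ * (‖1 - ρ‖ * ‖z‖ / r)) ≤ S * (2 * (‖1 - ρ‖ * ‖z‖ / r)) := by gcongr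
      _ = S / r * (2 * (‖1 - ρ‖ * ‖z‖)) := by ring
      _ ≤ S / r * (1 + (1 + ρ.im ^ 2) * ‖z‖ ^ 2) := by gcongr
      _ = _ := by ring
  have t3 : ‖(S : ℂ) ^ 2 * (1 - ρ) ^ 2 * z ^ 2‖ ≤ S ^ 2 * (1 + ρ.im ^ 2) * ‖z‖ ^ 2 := by
    rw [norm_mul, norm_mul, norm_pow, norm_pow, norm_pow, norm_real, Real.norm_of_nonneg hS0.le]
    gcongr
  rw [t1]
  linarith

theorem one_div_one_add_le_exp {x : ℝ} (hx : 0 ≤ x) : 1 / (1 + x) ≤ Real.exp (-x + x ^ 2) := by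
  have h1 := Real.one_sub_inv_le_log_of_pos (x := 1 + x) (by linarith)
  have h2 : x - x ^ 2 ≤ 1 - (1 + x)⁻¹ := by
    rw [show 1 - (1 + x)⁻¹ = x / (1 + x) by field_simp; ring, le_div_iff₀ (by linarith)]
    nlinarith [pow_nonneg hx 3]
  rw [one_div, ← Real.exp_log (x := (1 + x)⁻¹) (by positivity), Real.log_inv]
  gcongr
  linarith

theorem pow_le_exp_of_sq_le {y x : ℝ} {n : ℕ} (hy : 0 ≤ y) (hx : 0 ≤ x) (h : y ^ 2 ≤ 1 / (1 + x)) :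
    y ^ n ≤ Real.exp (-(n * x / 2) + n * x ^ 2 / 2) := by
  refine (sq_le_sq₀ (by positivity) (by positivity)).1 ?_
  rw [← pow_mul, mul_comm n 2, pow_mul, ← Real.exp_nat_mul]
  calc (y ^ 2) ^ n ≤ Real.exp (-x + x ^ 2) ^ n := by
        gcongr
        exact h.trans (one_div_one_add_le_exp hx)
    _ = _ := by
        rw [← Real.exp_nat_mul]
        congr 1
        push_cast
        ring

/-- Admissible parameters for `bump` when looking for primes between `exp L` and
`exp L * (1 + 0.92 / L)`. -/
structure BumpParams (L m h r : ℝ) (k : ℕ) : Prop where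
  hL : 480 ≤ L
  hm : L ≤ m
  hm' : m ≤ L + 0.001
  hr : 0 < r
  hk : r * m = k + 1
  hS : 0.08447 ≤ m / r * L ^ 2
  hS' : m / r * L ^ 2 ≤ 0.0847
  hh : 0 < h
  hh₁ : 2.5 * (m / r) ≤ h ^ 2
  hh₂ : h ^ 2 ≤ 2.51 * (m / r)

theorem exp_neg_mul_pow_le {L : ℝ} (hL : 480 ≤ L) : Real.exp (-(0.48 * L)) * L ^ 14 ≤ 1 / 10 ^ 50 := by
  have h1 : L ^ 14 ≤ 480 ^ 14 * Real.exp (0.48 * (L - 480)) := by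
    have h2 : L ≤ 480 * Real.exp ((L - 480) / 480) := by
      have := Real.add_one_le_exp ((L - 480) / 480)
      linarith
    calc L ^ 14 ≤ (480 * Real.exp ((L - 480) / 480)) ^ 14 := by gcongr
      _ = 480 ^ 14 * Real.exp (14 * ((L - 480) / 480)) := by
        rw [mul_pow, ← Real.exp_nat_mul]
        norm_num
      _ ≤ _ := by
        refine mul_le_mul_of_nonneg_left (Real.exp_le_exp.2 ?_) (by positivity)
        norm_num
        linarith
  have h3 : Real.exp (-230) ≤ (1 / 2.7) ^ 230 := by
    rw [show (-230 : ℝ) = (230 : ℕ) * (-1 : ℝ) by norm_num, Real.exp_nat_mul]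
    gcongr
    rw [Real.exp_neg, inv_le_comm₀ (Real.exp_pos _) (by norm_num)]
    have := Real.exp_one_gt_d9
    norm_num at this ⊢
    linarith
  calc Real.exp (-(0.48 * L)) * L ^ 14
      ≤ Real.exp (-(0.48 * L)) * (480 ^ 14 * Real.exp (0.48 * (L - 480))) := by gcongr
    _ = 480 ^ 14 * Real.exp (-230.4) := by
        rw [mul_left_comm, ← Real.exp_add]
        congr 2
        ring
    _ ≤ 480 ^ 14 * Real.exp (-230) := by
        gcongr
        norm_num
    _ ≤ 480 ^ 14 * (1 / 2.7) ^ 230 := by gcongr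
    _ ≤ 1 / 10 ^ 50 := by norm_num

namespace BumpParams

variable {L m h r : ℝ} {k : ℕ}

theorem m_pos (p : BumpParams L m h r k) : 0 < m := by linarith [p.hL, p.hm]

theorem S_pos (p : BumpParams L m h r k) : 0 < m / r := div_pos p.m_pos p.hr

theorem S_le (p : BumpParams L m h r k) : m / r ≤ 0.0000004 := by
  have h1 := p.hS'
  have h2 : (480 : ℝ) ^ 2 ≤ L ^ 2 := by
    have := p.hL
    gcongr
  have h3 := mul_le_mul_of_nonneg_left h2 p.S_pos.le
  norm_num at h1 h3 ⊢
  linarith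

theorem S_mul (p : BumpParams L m h r k) : m / r * (k + 1) = m ^ 2 := by
  have := p.hr
  rw [← p.hk]
  field_simp

theorem S_div (p : BumpParams L m h r k) : m / r / r = (m / r) ^ 2 / m := by
  have := p.hr
  have := p.m_pos
  field_simp

theorem le_k (p : BumpParams L m h r k) : 11 * L ^ 4 ≤ k + 1 := by
  have h1 := p.S_mul
  have h2 : L ^ 2 ≤ m ^ 2 := by
    have := p.hm
    have := p.hL
    gcongr
  have h3 := p.hS'
  have h4 := p.S_pos
  by_contra! hc
  have h5 : m / r * (k + 1) < m / r * (11 * L ^ 4) := by gcongr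
  have h6 : m / r * (11 * L ^ 4) ≤ 11 * 0.0847 * L ^ 2 := by
    calc m / r * (11 * L ^ 4) = 11 * (m / r * L ^ 2) * L ^ 2 := by ring
      _ ≤ _ := by gcongr
  have h7 : 0 < L ^ 2 := by
    have := p.hL
    positivity
  norm_num at h6
  linarith

theorem k_le (p : BumpParams L m h r k) : k + 1 ≤ 12 * L ^ 4 := by
  have h1 := p.S_mul
  have hL := p.hL
  have h2 : m ^ 2 ≤ 1.01 * L ^ 2 := by
    have h3 := p.hm'
    have := p.m_pos
    have h4 : m ≤ 1.0001 * L := by norm_num at *; linarith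
    calc m ^ 2 ≤ (1.0001 * L) ^ 2 := by gcongr
      _ ≤ _ := by rw [mul_pow]; gcongr; norm_num
  have h3 := p.hS
  have h4 := p.S_pos
  by_contra! hc
  have h5 : m / r * (12 * L ^ 4) < m / r * (k + 1) := by gcongr
  have h6 : 12 * 0.08447 * L ^ 2 ≤ m / r * (12 * L ^ 4) := by
    calc 12 * 0.08447 * L ^ 2 ≤ 12 * (m / r * L ^ 2) * L ^ 2 := by gcongr
      _ = _ := by ring
  have h7 : 0 < L ^ 2 := by positivity
  norm_num at h6 h2
  linarith

theorem k_large (p : BumpParams L m h r k) : 10 ^ 11 ≤ (k + 1 : ℝ) := by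
  have h1 := p.le_k
  have h2 : (480 : ℝ) ^ 4 ≤ L ^ 4 := by
    have := p.hL
    gcongr
  norm_num at *
  linarith

theorem norm_bump_one_div_sub_le (p : BumpParams L m h r k) {ρ : ℂ} (hρ : ρ.re ∈ Ioo 0 1)
    {y : ℝ} (hy : y = ‖(r : ℂ) / ((1 + r : ℝ) - ρ)‖) :
    ‖bump m h r k (fun s => 1 / (s - ρ))‖ ≤ y ^ (k + 1) * ((h ^ 2 - m / r) + (m / r) ^ 2 / m +
      (1 + 1 / m) * (m / r) * (m / r + m / r * ρ.im ^ 2) * y ^ 2) := by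
  rw [bump_one_div_sub p.hr.ne' p.hk, norm_mul, norm_pow, ← hy]
  have := p.S_pos
  have hm := p.m_pos
  refine mul_le_mul_of_nonneg_left ?_ (by rw [hy]; positivity)
  refine (norm_bump_factor_le p.hr p.m_pos (by linarith [p.hh₁]) ρ hρ _ rfl).trans_eq ?_
  rw [← hy, p.S_div]
  field_simp
  ring

theorem norm_bump_le_of_im_small (p : BumpParams L m h r k) {ρ : ℂ} (hρ : ρ.re ∈ Ioo 0 1) {u : ℝ}
    (hu : u = m / r * ρ.im ^ 2) (huL : u ≤ L) :
    ‖bump m h r k (fun s => 1 / (s - ρ))‖ ≤ 1.00001 * (h ^ 2 - m / r) *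
      (Real.exp (-(L * (1 - ρ.re))) * (Real.exp (-(u / 2)) * (1.0001 + 0.6681 * u))) := by
  obtain ⟨y, hy⟩ : ∃ y, y = ‖(r : ℂ) / ((1 + r : ℝ) - ρ)‖ := ⟨_, rfl⟩
  have hy2 := normSq_div_one_add_sub p.hr ρ hρ.2
  rw [← hy] at hy2
  obtain ⟨x, hx⟩ : ∃ x, x = 2 * (1 - ρ.re) / r + ((1 - ρ.re) ^ 2 + ρ.im ^ 2) / r ^ 2 := ⟨_, rfl⟩
  rw [← hx] at hy2
  have hr := p.hr
  have hη : 0 < 1 - ρ.re := by linarith [hρ.2]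
  have hη1 : 1 - ρ.re < 1 := by linarith [hρ.1]
  have hx0 : 0 ≤ x := by rw [hx]; positivity
  have hy0 : 0 ≤ y := by rw [hy]; positivity
  have hm := p.m_pos
  have hS := p.S_pos
  have hS4 := p.S_le
  have hL := p.hL
  have hLm := p.hm
  have hu0 : 0 ≤ u := by rw [hu]; positivity
  have hnx : (k + 1) * x = 2 * m * (1 - ρ.re) + m / r * (1 - ρ.re) ^ 2 + u := by
    rw [← p.hk, hx, hu]
    field_simp
    ring
  have hnx4 : (k + 1) * x ≤ 4 * m := by
    have : m / r * (1 - ρ.re) ^ 2 ≤ 1 * 1 := by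
      gcongr
      · norm_num at hS4 ⊢; linarith
      · nlinarith
    nlinarith
  have herr : (k + 1) * x ^ 2 / 2 ≤ 0.000005 := by
    have h1 : m / r * ((k + 1) * ((k + 1) * x ^ 2)) ≤ m / r * (16 * m ^ 2) := by
      refine mul_le_mul_of_nonneg_left ?_ hS.le
      calc ((k + 1) * ((k + 1) * x ^ 2) : ℝ) = ((k + 1) * x) ^ 2 := by ring
        _ ≤ (4 * m) ^ 2 := by gcongr
        _ = _ := by ring
    have h2 : (k + 1) * x ^ 2 ≤ 16 * (m / r) := by
      refine le_of_mul_le_mul_right ?_ (pow_pos hm 2)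
      calc (k + 1) * x ^ 2 * m ^ 2 = m / r * ((k + 1) * ((k + 1) * x ^ 2)) := by
            rw [← p.S_mul]
            ring
        _ ≤ _ := h1
        _ = _ := by ring
    norm_num at hS4 ⊢
    linarith
  have hpow : y ^ (k + 1) ≤ 1.00001 * (Real.exp (-(L * (1 - ρ.re))) * Real.exp (-(u / 2))) := by
    refine (pow_le_exp_of_sq_le hy0 hx0 hy2.le).trans ?_
    have h3 : Real.exp 0.000005 ≤ 1.00001 := by
      have := Real.exp_bound_div_one_sub_of_interval (x := 0.000005) (by norm_num) (by norm_num)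
      norm_num at this ⊢
      linarith
    calc _ ≤ Real.exp (0.000005 + (-(L * (1 - ρ.re)) + -(u / 2))) := by
          refine Real.exp_le_exp.2 ?_
          push_cast
          have h4 : L * (1 - ρ.re) ≤ m * (1 - ρ.re) := by gcongr
          have h5 : 0 ≤ m / r * (1 - ρ.re) ^ 2 := by positivity
          linarith
      _ = Real.exp 0.000005 * (Real.exp (-(L * (1 - ρ.re))) * Real.exp (-(u / 2))) := by
          rw [Real.exp_add, Real.exp_add]
      _ ≤ _ := by gcongr
  have hfac : (h ^ 2 - m / r) + (m / r) ^ 2 / m + (1 + 1 / m) * (m / r) *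
      (m / r + m / r * ρ.im ^ 2) * y ^ 2 ≤ (h ^ 2 - m / r) * (1.0001 + 0.6681 * u) := by
    have hm1 : 1 / m ≤ 1 / 480 := by
      gcongr
      linarith
    have h1 : (m / r) ^ 2 / m ≤ m / r * 0.00001 := by
      rw [div_le_iff₀ hm, sq, mul_assoc]
      gcongr
      norm_num at hS4 ⊢
      linarith
    have hy1 : y ^ 2 ≤ 1 := by
      rw [hy2, div_le_one (by positivity)]
      linarith
    have h2 : (1 + 1 / m) * (m / r) * (m / r + m / r * ρ.im ^ 2) * y ^ 2 ≤
        (1 + 1 / 480) * (m / r) * (0.0000004 + u) * 1 := by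
      rw [← hu]
      gcongr
    have h3 : 1.5 * (m / r) * (0.0001 + 0.6681 * u) ≤ (h ^ 2 - m / r) * (0.0001 + 0.6681 * u) := by
      gcongr
      have := p.hh₁
      norm_num at this ⊢
      linarith
    have h4 : m / r * 0.00001 + (1 + 1 / 480) * (m / r) * (0.0000004 + u) * 1 ≤
        1.5 * (m / r) * (0.0001 + 0.6681 * u) := by
      have : 0 ≤ m / r * u := by positivity
      norm_num
      linarith
    linarith
  have hh : 0 ≤ h ^ 2 - m / r := by linarith [p.hh₁]
  refine (p.norm_bump_one_div_sub_le hρ hy).trans ?_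
  calc _ ≤ 1.00001 * (Real.exp (-(L * (1 - ρ.re))) * Real.exp (-(u / 2))) *
        ((h ^ 2 - m / r) * (1.0001 + 0.6681 * u)) := by
        gcongr
    _ = _ := by ring

end BumpParams

namespace BumpParams

variable {L m h r : ℝ} {k : ℕ}

theorem norm_bump_le_of_im_large (p : BumpParams L m h r k) {ρ : ℂ} (hρ : ρ.re ∈ Ioo 0 1) {u : ℝ}
    (hu : u = m / r * ρ.im ^ 2) (huL : L ≤ u) :
    ‖bump m h r k (fun s => 1 / (s - ρ))‖ * (L * (5.1642 + 2.2943 * u)) * L ≤ (1 / 10 ^ 40) * (m / r) := by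
  obtain ⟨y, hy⟩ : ∃ y, y = ‖(r : ℂ) / ((1 + r : ℝ) - ρ)‖ := ⟨_, rfl⟩
  have hy2 := normSq_div_one_add_sub p.hr ρ hρ.2
  rw [← hy] at hy2
  have hr := p.hr
  have hη : 0 < 1 - ρ.re := by linarith [hρ.2]
  have hy0 : 0 ≤ y := by rw [hy]; positivity
  have hm := p.m_pos
  have hS := p.S_pos
  have hS4 := p.S_le
  have hL := p.hL
  have hLm := p.hm
  have hn0 : (0 : ℝ) < k + 1 := by positivity
  have hn := p.k_large
  have hn4 := p.le_k
  have hu0 : 0 < u := by linarith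
  have hyu : y ^ 2 ≤ 1 / (1 + u / (k + 1)) := by
    rw [hy2]
    have h1 : u / (k + 1) = ρ.im ^ 2 / r ^ 2 := by
      rw [← p.hk, hu]
      field_simp
    rw [h1]
    gcongr
    have : 0 ≤ 2 * (1 - ρ.re) / r := by positivity
    have : ρ.im ^ 2 / r ^ 2 ≤ ((1 - ρ.re) ^ 2 + ρ.im ^ 2) / r ^ 2 := by
      gcongr
      nlinarith
    linarith
  have hyu' : y ^ 2 * u ≤ k + 1 := by
    calc y ^ 2 * u ≤ 1 / (1 + u / (k + 1)) * u := by gcongr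
      _ ≤ k + 1 := by
        rw [one_div_mul_eq_div, div_le_iff₀ (by positivity), mul_add, mul_div_cancel₀ _ hn0.ne']
        linarith
  have hy1 : y ^ 2 ≤ 1 := by
    refine hyu.trans ?_
    rw [div_le_one (by positivity)]
    have : 0 ≤ u / (k + 1) := by positivity
    linarith
  obtain ⟨j, hj⟩ : ∃ j, k = j + 1 := by
    refine ⟨k - 1, ?_⟩
    have : k ≠ 0 := by
      rintro rfl
      norm_num at hn
    omega
  have hpow : y ^ j ≤ Real.exp (-(0.48 * L)) := by
    refine (pow_le_exp_of_sq_le hy0 (x := L / (k + 1)) (by positivity) (hyu.trans ?_)).trans ?_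
    · gcongr
    · refine Real.exp_le_exp.2 ?_
      have h1 : (j : ℝ) = (k + 1) - 2 := by rw [hj]; push_cast; ring
      rw [h1]
      have h2 : L / (k + 1) ≤ 0.0001 := by
        rw [div_le_iff₀ hn0]
        have : L * 480 ^ 3 ≤ L * L ^ 3 := by gcongr
        norm_num at this ⊢
        linarith
      have h3 : (k + 1) * (L / (k + 1)) = L := mul_div_cancel₀ _ hn0.ne'
      have h4 : (k + 1) * (L / (k + 1)) ^ 2 ≤ L * 0.0001 := by
        rw [sq, ← mul_assoc, h3]
        gcongr
      generalize L / (k + 1) = w at *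
      have h5 : 0 ≤ w ^ 2 := sq_nonneg _
      norm_num at h2 h4 ⊢
      linarith
  have hfac : (h ^ 2 - m / r) + (m / r) ^ 2 / m + (1 + 1 / m) * (m / r) *
      (m / r + m / r * ρ.im ^ 2) * y ^ 2 ≤ m / r * (3 * (k + 1)) := by
    have h1 : (m / r) ^ 2 / m ≤ m / r * 1 := by
      rw [div_le_iff₀ hm, sq, mul_assoc]
      gcongr
      norm_num at hS4 ⊢
      linarith
    have hm1 : 1 / m ≤ 1 := by
      rw [div_le_one hm]
      linarith
    have h2 : (1 + 1 / m) * (m / r) * (m / r + m / r * ρ.im ^ 2) * y ^ 2 ≤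
        (1 + 1) * (m / r) * (1 + (k + 1)) := by
      rw [← hu]
      calc (1 + 1 / m) * (m / r) * (m / r + u) * y ^ 2 =
          (1 + 1 / m) * (m / r) * (m / r * y ^ 2 + y ^ 2 * u) := by ring
        _ ≤ (1 + 1) * (m / r) * (1 * 1 + (k + 1)) := by
          gcongr
          norm_num at hS4 ⊢
          linarith
        _ = _ := by ring
    have h3 := p.hh₂
    have h4 : m / r * 10 ^ 11 ≤ m / r * (k + 1) := by gcongr
    norm_num at h3 h4
    linarith
  have hw : y ^ 2 * (5.1642 + 2.2943 * u) ≤ 3 * (k + 1) := by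
    calc _ ≤ y ^ 2 * (3 * u) := by
          gcongr
          norm_num
          linarith
      _ = 3 * (y ^ 2 * u) := by ring
      _ ≤ _ := by gcongr
  calc ‖bump m h r k (fun s => 1 / (s - ρ))‖ * (L * (5.1642 + 2.2943 * u)) * L
      ≤ y ^ (k + 1) * (m / r * (3 * (k + 1))) * (L * (5.1642 + 2.2943 * u)) * L := by
        gcongr
        exact (p.norm_bump_one_div_sub_le hρ hy).trans (by gcongr)
    _ = y ^ j * (y ^ 2 * (5.1642 + 2.2943 * u)) * (m / r * (3 * (k + 1)) * L ^ 2) := by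
        rw [hj]
        push_cast
        ring
    _ ≤ Real.exp (-(0.48 * L)) * (3 * (k + 1)) * (m / r * (3 * (k + 1)) * L ^ 2) := by gcongr
    _ ≤ Real.exp (-(0.48 * L)) * (3 * (12 * L ^ 4)) * (m / r * (3 * (12 * L ^ 4)) * L ^ 2) := by
        have := p.k_le
        gcongr
    _ = m / r * 1296 * (Real.exp (-(0.48 * L)) * (L ^ 10 * 1)) := by ring
    _ ≤ m / r * 1296 * (Real.exp (-(0.48 * L)) * (L ^ 10 * L ^ 4)) := by
        gcongr
        exact one_le_pow₀ (by linarith)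
    _ = m / r * 1296 * (Real.exp (-(0.48 * L)) * L ^ 14) := by ring
    _ ≤ m / r * 1296 * (1 / 10 ^ 50) := by
        gcongr
        exact exp_neg_mul_pow_le hL
    _ ≤ _ := by
        norm_num
        linarith

end BumpParams

theorem Real.exp_neg_le_of_pow_le {x c : ℝ} (hc : 0 < c) {m n : ℕ} (hn : 0 < n)
    (h : (1 / c) ^ n ≤ (2.7182818283 : ℝ) ^ m) (hx : (m : ℝ) / n ≤ x) : Real.exp (-x) ≤ c := by
  rw [← Real.le_log_iff_exp_le hc]
  have := Real.log_le_div_of_pow_le (by positivity) hn h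
  rw [one_div, Real.log_inv] at this
  linarith

theorem exp_mul_quadratic_le {u u₀ c q Q : ℝ} (hu : u₀ - 4 ≤ u)
    (hq : q ≤ Q * (1 + (u - u₀) / 4) ^ 2) (hQ : 0 ≤ Q) (hc : Real.exp (-(u₀ / 2)) ≤ c) :
    Real.exp (-(u / 2)) * q ≤ c * Q := by
  have h1 : (1 + (u - u₀) / 4) ^ 2 ≤ Real.exp ((u - u₀) / 2) := by
    calc (1 + (u - u₀) / 4) ^ 2 ≤ Real.exp ((u - u₀) / 4) ^ 2 := by
          refine pow_le_pow_left₀ (by linarith) ?_ 2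
          linarith [Real.add_one_le_exp ((u - u₀) / 4)]
      _ = _ := by
          rw [← Real.exp_nat_mul]
          congr 1
          push_cast
          ring
  calc Real.exp (-(u / 2)) * q
      ≤ Real.exp (-(u / 2)) * (Q * Real.exp ((u - u₀) / 2)) := by
        gcongr
        exact hq.trans (by gcongr)
    _ = Real.exp (-(u₀ / 2)) * Q := by
        rw [mul_left_comm, ← Real.exp_add, mul_comm]
        congr 2
        ring
    _ ≤ c * Q := by gcongr

theorem mul_exp_neg_div_le {L l l₀ : ℝ} (hL : 480 ≤ L) (h₀ : 5 ≤ l₀) (h₀' : l₀ ≤ 8) (hl₀ : 0 < l)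
    (hl : l ≤ l₀ + 1.5 * Real.log (L / 480)) :
    L * (2.992 + Real.log (L / 480) / 2) * Real.exp (-(L / (9.65 * l))) ≤
      480 * 2.992 * Real.exp (-(480 / (9.65 * l₀))) := by
  obtain ⟨w, hw⟩ : ∃ w, w = Real.log (L / 480) := ⟨_, rfl⟩
  have hLw : L = 480 * Real.exp w := by
    rw [hw, Real.exp_log (by positivity)]
    ring
  have hw0 : 0 ≤ w := by
    rw [hw]
    refine Real.log_nonneg ?_
    rw [le_div_iff₀ (by norm_num)]
    linarith
  rw [← hw] at hl ⊢
  have h1 := Real.quadratic_le_exp_of_nonneg hw0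
  have h2 : 480 / (9.65 * l₀) + 4.9 * w ≤ L / (9.65 * l) := by
    have h3 : 1 / l₀ + 0.1 * w ≤ Real.exp w / l := by
      rw [le_div_iff₀ hl₀]
      have h4 : (1 / l₀ + 0.1 * w) * (l₀ + 1.5 * w) ≤ 1 + w + w ^ 2 / 2 := by
        have h5 : 1 / l₀ * l₀ = 1 := by field_simp
        have h6 : 1.5 / l₀ + 0.1 * l₀ ≤ 1 := by
          rw [← le_sub_iff_add_le, div_le_iff₀ (by linarith)]
          nlinarith
        have h7 : 0 ≤ w * (1 - (1.5 / l₀ + 0.1 * l₀)) := mul_nonneg hw0 (by linarith)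
        have h8 : 1.5 / l₀ = 1.5 * (1 / l₀) := by ring
        rw [h8] at h7
        nlinarith
      calc _ ≤ (1 / l₀ + 0.1 * w) * (l₀ + 1.5 * w) := by gcongr
        _ ≤ _ := h4.trans h1
    calc 480 / (9.65 * l₀) + 4.9 * w ≤ 480 / 9.65 * (1 / l₀ + 0.1 * w) := by
          have h3 : 480 / (9.65 * l₀) = 480 / 9.65 * (1 / l₀) := by
            field_simp
          rw [h3, mul_add]
          norm_num
          linarith
      _ ≤ 480 / 9.65 * (Real.exp w / l) := by gcongr
      _ = L / (9.65 * l) := by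
          rw [hLw]
          field_simp
  have h3 : 2.992 + w / 2 ≤ 2.992 * Real.exp w := by
    have := Real.add_one_le_exp w
    norm_num
    linarith
  calc L * (2.992 + w / 2) * Real.exp (-(L / (9.65 * l)))
      ≤ (480 * Real.exp w) * (2.992 * Real.exp w) *
          Real.exp (-(480 / (9.65 * l₀) + 4.9 * w)) := by
        rw [← hLw]
        gcongr
    _ = 480 * 2.992 * (Real.exp w * Real.exp w * Real.exp (-(480 / (9.65 * l₀) + 4.9 * w))) := by
        ring
    _ ≤ _ := by
        rw [← Real.exp_add, ← Real.exp_add]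
        refine mul_le_mul_of_nonneg_left (Real.exp_le_exp.2 ?_) (by norm_num)
        norm_num
        linarith

theorem zero_weight_le {L l l₀ η G c : ℝ} (hL : 480 ≤ L) (h₀ : 5 ≤ l₀) (h₀' : l₀ ≤ 8)
    (hl5 : 5 ≤ l) (hl : l ≤ l₀ + 1.5 * Real.log (L / 480)) (h1 : 1 ≤ 9.65 * η * l)
    (h2 : 1 ≤ 9.65 * (1 - η) * l) (hc : Real.exp (-(480 / (9.65 * l₀))) ≤ c) (hG : 0 ≤ G)
    (hGc : G * c ≤ 0.00129) :
    (Real.exp (-(L * η)) + Real.exp (-(L * (1 - η)))) * G *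
      (L * (2.992 + Real.log (L / 480) / 2)) ≤ 1.859 := by
  have hl0 : 0 < l := by linarith
  have hlog : 0 ≤ Real.log (L / 480) := by
    refine Real.log_nonneg ?_
    rw [le_div_iff₀ (by norm_num)]
    linarith
  have key : ∀ ζ : ℝ, 1 ≤ 9.65 * ζ * l → ζ ≤ 1 / 2 →
      Real.exp (-(L * ζ)) + Real.exp (-(L * (1 - ζ))) ≤
        1.001 * Real.exp (-(L / (9.65 * l))) := by
    intro ζ hζ hζ2
    have h3 : L / (9.65 * l) ≤ L * ζ := by
      rw [div_le_iff₀ (by positivity)]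
      calc L = L * 1 := by ring
        _ ≤ L * (9.65 * ζ * l) := by gcongr
        _ = _ := by ring
    have h4 : L / (9.65 * l) ≤ L / 48 := by
      gcongr
      norm_num at hl5 ⊢
      linarith
    have h5 : Real.exp (-(L * (1 - ζ))) ≤ 0.001 * Real.exp (-(L / (9.65 * l))) := by
      have h6 : Real.exp (-20) ≤ 0.001 :=
        Real.exp_neg_le_of_pow_le (by norm_num) (m := 20) (n := 1) (by norm_num) (by norm_num)
          (by norm_num)
      calc _ ≤ Real.exp (-20 + -(L / (9.65 * l))) := by
            refine Real.exp_le_exp.2 ?_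
            have : L * (1 / 2) ≤ L * (1 - ζ) := by
              gcongr
              linarith
            linarith
        _ ≤ _ := by
            rw [Real.exp_add]
            gcongr
    have h6 : Real.exp (-(L * ζ)) ≤ Real.exp (-(L / (9.65 * l))) :=
      Real.exp_le_exp.2 (by linarith)
    norm_num at h5 ⊢
    linarith
  have hE : Real.exp (-(L * η)) + Real.exp (-(L * (1 - η))) ≤
      1.001 * Real.exp (-(L / (9.65 * l))) := by
    rcases le_total η (1 / 2) with h | h
    · exact key η h1 h
    · have := key (1 - η) h2 (by linarith)
      rw [sub_sub_cancel] at this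
      linarith
  calc _ ≤ 1.001 * Real.exp (-(L / (9.65 * l))) * G *
        (L * (2.992 + Real.log (L / 480) / 2)) := by
        gcongr
    _ = 1.001 * G * (L * (2.992 + Real.log (L / 480) / 2) * Real.exp (-(L / (9.65 * l)))) := by
        ring
    _ ≤ 1.001 * G * (480 * 2.992 * c) := by
        refine mul_le_mul_of_nonneg_left ?_ (by positivity)
        exact (mul_exp_neg_div_le hL h₀ h₀' hl0 hl).trans (by gcongr)
    _ = 1.001 * 480 * 2.992 * (G * c) := by ring
    _ ≤ 1.001 * 480 * 2.992 * 0.00129 := by gcongr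
    _ ≤ _ := by norm_num

theorem zero_weight_le_of_im_le {L u T l₀ u₀ c₀ Q c : ℝ} {ρ : ℂ} (hL : 480 ≤ L)
    (hρ : riemannXi ρ = 0) (hT : 3400 ≤ T) (hρT : ρ.im ^ 2 ≤ T ^ 2) (h₀ : 5 ≤ l₀) (h₀' : l₀ ≤ 8)
    (hl : Real.log T - 2.5 ≤ l₀ + 1.5 * Real.log (L / 480)) (hu : u₀ - 4 ≤ u)
    (hq : (1.0001 + 0.6681 * u) * (5.1642 + 2.2943 * u) ≤ Q * (1 + (u - u₀) / 4) ^ 2) (hQ : 0 ≤ Q)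
    (hc₀ : Real.exp (-(u₀ / 2)) ≤ c₀) (hc : Real.exp (-(480 / (9.65 * l₀))) ≤ c)
    (hQc : c₀ * Q * c ≤ 0.00129) :
    (Real.exp (-(L * (1 - ρ.re))) + Real.exp (-(L * ρ.re))) *
      (Real.exp (-(u / 2)) * ((1.0001 + 0.6681 * u) * (5.1642 + 2.2943 * u))) *
        (L * (2.992 + Real.log (L / 480) / 2)) ≤ 1.859 := by
  have hT' : |ρ.im| ≤ T := abs_le_of_sq_le_sq hρT (by linarith)
  have h1 := riemannXi_zero_free_region hT hρ hT'
  have h2 := riemannXi_zero_free_region hT (riemannXi_one_sub_conj hρ) (by simpa using hT')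
  have h3 : 1 - (1 - (starRingEnd ℂ) ρ).re = ρ.re := by simp
  rw [h3] at h2
  have hlog : 0 ≤ Real.log (L / 480) := by
    refine Real.log_nonneg ?_
    rw [le_div_iff₀ (by norm_num)]
    linarith
  have hl5 : 5 ≤ Real.log T - 2.5 := by
    have h := Real.div_le_log_of_pow_le (a := 3400) (by norm_num) (m := 8) (n := 1)
      (by norm_num) (by norm_num)
    have := Real.log_le_log (by norm_num) hT
    norm_num at h this ⊢
    linarith
  have hg := exp_mul_quadratic_le hu hq hQ hc₀
  have hc₀' : 0 ≤ c₀ := (Real.exp_pos _).le.trans hc₀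
  have := zero_weight_le (η := 1 - ρ.re) hL h₀ h₀' hl5 hl h1 (by rwa [sub_sub_cancel]) hc
    (mul_nonneg hc₀' hQ) hQc
  rw [sub_sub_cancel] at this
  refine le_trans ?_ this
  gcongr

theorem zero_weight_le_of_im_le_mul {L u a τ l₀ u₀ c₀ Q c : ℝ} {ρ : ℂ} (hL : 480 ≤ L)
    (hρ : riemannXi ρ = 0) (hρu : 0.08447 * ρ.im ^ 2 ≤ u * L ^ 2) (huτ : u ≤ τ ^ 2)
    (hτ : 2.06 ≤ τ) (hl : Real.log (3.441 * 480 * τ) ≤ a) (ha : a = l₀ + 2.5)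
    (h₀ : 5 ≤ l₀) (h₀' : l₀ ≤ 8) (hu : u₀ - 4 ≤ u)
    (hq : (1.0001 + 0.6681 * u) * (5.1642 + 2.2943 * u) ≤ Q * (1 + (u - u₀) / 4) ^ 2) (hQ : 0 ≤ Q)
    (hc₀ : Real.exp (-(u₀ / 2)) ≤ c₀) (hc : Real.exp (-(480 / (9.65 * l₀))) ≤ c)
    (hQc : c₀ * Q * c ≤ 0.00129) :
    (Real.exp (-(L * (1 - ρ.re))) + Real.exp (-(L * ρ.re))) *
      (Real.exp (-(u / 2)) * ((1.0001 + 0.6681 * u) * (5.1642 + 2.2943 * u))) *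
        (L * (2.992 + Real.log (L / 480) / 2)) ≤ 1.859 := by
  have hτ0 : 0 < τ := by linarith
  have hlog : 0 ≤ Real.log (L / 480) := by
    refine Real.log_nonneg ?_
    rw [le_div_iff₀ (by norm_num)]
    linarith
  refine zero_weight_le_of_im_le (T := 3.441 * τ * L) hL hρ ?_ ?_ h₀ h₀' ?_ hu hq hQ hc₀ hc hQc
  · have : 3.441 * 2.06 * 480 ≤ 3.441 * τ * L := by gcongr
    norm_num at this ⊢
    linarith
  · have h1 : 0.08447 * ρ.im ^ 2 ≤ τ ^ 2 * L ^ 2 := hρu.trans (by gcongr)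
    have h2 : 0 ≤ τ ^ 2 * L ^ 2 := by positivity
    rw [mul_pow, mul_pow, mul_assoc]
    norm_num at h1 ⊢
    linarith
  · have h1 : 3.441 * τ * L = 3.441 * 480 * τ * (L / 480) := by ring
    rw [h1, Real.log_mul (by positivity) (by positivity)]
    norm_num at hl ⊢
    linarith

theorem zero_weight_le_of_le {L u : ℝ} {ρ : ℂ} (hL : 480 ≤ L)
    (hρ : riemannXi ρ = 0) (hu0 : 0 ≤ u) (hρu : 0.08447 * ρ.im ^ 2 ≤ u * L ^ 2) (huL : u ≤ L) :
    (Real.exp (-(L * (1 - ρ.re))) + Real.exp (-(L * ρ.re))) *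
      (Real.exp (-(u / 2)) * ((1.0001 + 0.6681 * u) * (5.1642 + 2.2943 * u))) *
        (L * (2.992 + Real.log (L / 480) / 2)) ≤ 1.859 := by
  rcases le_or_gt u 4.2436 with h | h
  · refine zero_weight_le_of_im_le_mul (τ := 2.06) (u₀ := 2.16) (Q := 24.8) (c₀ := 0.3397)
      (c := 0.00014725) (l₀ := 122 / 15 - 2.5) (a := 122 / 15) hL hρ hρu
      (h.trans (by norm_num)) (by norm_num)
      (Real.log_le_div_of_pow_le (by norm_num) (by norm_num) (by norm_num)) (by norm_num)
      (by norm_num) (by norm_num) (by norm_num; linarith) (by norm_num; nlinarith [sq_nonneg (u - 2)]) (by norm_num)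
      (Real.exp_neg_le_of_pow_le (m := 27) (n := 25) (by norm_num) (by norm_num)
        (by norm_num) (by norm_num))
      (Real.exp_neg_le_of_pow_le (m := 150) (n := 17) (by norm_num) (by norm_num)
        (by norm_num) (by norm_num)) (by norm_num)
  rcases le_or_gt u 5.0625 with h | h
  · refine zero_weight_le_of_im_le_mul (τ := 2.25) (u₀ := 4.2436) (Q := 57.164) (c₀ := 0.11993)
      (c := 0.0001681) (l₀ := 74 / 9 - 2.5) (a := 74 / 9) hL hρ hρu
      (h.trans (by norm_num)) (by norm_num)
      (Real.log_le_div_of_pow_le (by norm_num) (by norm_num) (by norm_num)) (by norm_num)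
      (by norm_num) (by norm_num) (by norm_num; linarith) (by norm_num; nlinarith [sq_nonneg (u - 2)]) (by norm_num)
      (Real.exp_neg_le_of_pow_le (m := 70) (n := 33) (by norm_num) (by norm_num)
        (by norm_num) (by norm_num))
      (Real.exp_neg_le_of_pow_le (m := 113) (n := 13) (by norm_num) (by norm_num)
        (by norm_num) (by norm_num)) (by norm_num)
  rcases le_or_gt u 6.25 with h | h
  · refine zero_weight_le_of_im_le_mul (τ := 2.5) (u₀ := 5.0625) (Q := 73.555) (c₀ := 0.07959)
      (c := 0.000199) (l₀ := 25 / 3 - 2.5) (a := 25 / 3) hL hρ hρu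
      (h.trans (by norm_num)) (by norm_num)
      (Real.log_le_div_of_pow_le (by norm_num) (by norm_num) (by norm_num)) (by norm_num)
      (by norm_num) (by norm_num) (by norm_num; linarith) (by norm_num; nlinarith [sq_nonneg (u - 2)]) (by norm_num)
      (Real.exp_neg_le_of_pow_le (m := 81) (n := 32) (by norm_num) (by norm_num)
        (by norm_num) (by norm_num))
      (Real.exp_neg_le_of_pow_le (m := 162) (n := 19) (by norm_num) (by norm_num)
        (by norm_num) (by norm_num)) (by norm_num)
  rcases le_or_gt u 9 with h | h
  · refine zero_weight_le_of_im_le_mul (τ := 3) (u₀ := 6.25) (Q := 100.98) (c₀ := 0.043955)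
      (c := 0.000259) (l₀ := 247 / 29 - 2.5) (a := 247 / 29) hL hρ hρu
      (h.trans (by norm_num)) (by norm_num)
      (Real.log_le_div_of_pow_le (by norm_num) (by norm_num) (by norm_num)) (by norm_num)
      (by norm_num) (by norm_num) (by norm_num; linarith) (by norm_num; nlinarith [sq_nonneg (u - 2)]) (by norm_num)
      (Real.exp_neg_le_of_pow_le (m := 25) (n := 8) (by norm_num) (by norm_num)
        (by norm_num) (by norm_num))
      (Real.exp_neg_le_of_pow_le (m := 157) (n := 19) (by norm_num) (by norm_num)
        (by norm_num) (by norm_num)) (by norm_num)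
  rcases le_or_gt u 16 with h | h
  · refine zero_weight_le_of_im_le_mul (τ := 4) (u₀ := 9) (Q := 181.09) (c₀ := 0.0111125)
      (c := 0.000381) (l₀ := 44 / 5 - 2.5) (a := 44 / 5) hL hρ hρu
      (h.trans (by norm_num)) (by norm_num)
      (Real.log_le_div_of_pow_le (by norm_num) (by norm_num) (by norm_num)) (by norm_num)
      (by norm_num) (by norm_num) (by norm_num; linarith) (by norm_num; nlinarith [sq_nonneg (u - 2)]) (by norm_num)
      (Real.exp_neg_le_of_pow_le (m := 9) (n := 2) (by norm_num) (by norm_num)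
        (by norm_num) (by norm_num))
      (Real.exp_neg_le_of_pow_le (m := 63) (n := 8) (by norm_num) (by norm_num)
        (by norm_num) (by norm_num)) (by norm_num)
  have hL0 : 0 < L := by linarith
  refine zero_weight_le_of_im_le (T := 3.441 * (L * √L)) (l₀ := 8) (u₀ := 16) (Q := 489.7)
    (c₀ := 0.000336) (c := 0.002) hL hρ ?_ ?_ (by norm_num) (by norm_num) ?_ (by linarith)
    (by norm_num; nlinarith) (by norm_num)
    (Real.exp_neg_le_of_pow_le (m := 8) (n := 1) (by norm_num) (by norm_num)
      (by norm_num) (by norm_num))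
    (Real.exp_neg_le_of_pow_le (m := 143) (n := 23) (by norm_num) (by norm_num)
      (by norm_num) (by norm_num)) (by norm_num)
  · have h1 : 3 ≤ √L := by
      refine Real.le_sqrt_of_sq_le ?_
      linarith
    have h2 : 3.441 * (480 * 3) ≤ 3.441 * (L * √L) := by gcongr
    norm_num at h2 ⊢
    linarith
  · have h1 : 0.08447 * ρ.im ^ 2 ≤ L * L ^ 2 := hρu.trans (by gcongr)
    have h2 : 0 ≤ L * L ^ 2 := by positivity
    rw [mul_pow, mul_pow, Real.sq_sqrt hL0.le]
    norm_num at h1 ⊢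
    linarith
  · have h1 := Real.log_le_div_of_pow_le (a := 3.441) (by norm_num) (m := 26) (n := 21)
      (by norm_num) (by norm_num)
    have h2 := Real.log_le_div_of_pow_le (a := 480) (by norm_num) (m := 142) (n := 23)
      (by norm_num) (by norm_num)
    rw [Real.log_mul (by norm_num) (by positivity), Real.log_mul (by positivity) (by positivity),
      Real.log_sqrt hL0.le, Real.log_div (by positivity) (by norm_num)]
    norm_num at h1 h2 ⊢
    linarith

theorem re_logDeriv_riemannXi_le {L : ℝ} (hL : 480 ≤ L) :
    (logDeriv riemannXi (1 + (5.16 * L : ℝ))).re ≤ 2.992 + Real.log (L / 480) / 2 := by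
  have hs : (1 : ℝ) < ((1 : ℂ) + (5.16 * L : ℝ)).re := by
    simp only [add_re, one_re, ofReal_re]
    linarith
  rw [logDeriv_riemannXi hs]
  have h1 := (hasSum_re_logDeriv_zeta (σ := 1 + 5.16 * L) (by linarith) 0).nonneg fun n => by
    have := ArithmeticFunction.vonMangoldt_nonneg (n := n)
    rw [zero_mul, Real.cos_zero]
    positivity
  have e1 : (((1 + 5.16 * L : ℝ) : ℂ) + (0 : ℝ) * I) = 1 + (5.16 * L : ℝ) := by push_cast; ring
  rw [e1] at h1
  have h2 := re_digamma_ofReal_le (x := (5.16 * L + 3) / 2) (by linarith)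
  have e2 : (((5.16 * L + 3) / 2 : ℝ) : ℂ) = (1 + (5.16 * L : ℝ)) / 2 + 1 := by push_cast; ring
  rw [e2] at h2
  have h3 : Real.log ((5.16 * L + 3) / 2) ≤ 7.125 + Real.log (L / 480) := by
    have h4 : (5.16 * L + 3) / 2 ≤ 1239.9 * (L / 480) := by
      norm_num
      linarith
    have h5 := Real.log_le_log (by linarith) h4
    rw [Real.log_mul (by norm_num) (by positivity)] at h5
    have h6 := Real.log_le_div_of_pow_le (a := 1239.9) (by norm_num) (m := 57) (n := 8)
      (by norm_num) (by norm_num)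
    norm_num at h5 h6 ⊢
    linarith
  have h4 : 0 ≤ 1 / (2 * ((5.16 * L + 3) / 2)) := by
    have : 0 ≤ 5.16 * L := by linarith
    positivity
  replace h2 := h2.trans (sub_le_self _ h4)
  have h5 := Real.log_pi_gt
  have h6 : (1 / ((1 : ℂ) + (5.16 * L : ℝ) - 1)).re ≤ 0.0005 := by
    rw [add_sub_cancel_left, ← ofReal_one, ← ofReal_div, ofReal_re,
      div_le_iff₀ (by linarith)]
    norm_num
    linarith
  have h7 : (Complex.log Real.pi / 2).re = Real.log Real.pi / 2 := by
    rw [← ofReal_log Real.pi_pos.le, ← ofReal_ofNat, ← ofReal_div, ofReal_re]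
  have h8 : (digamma ((1 + (5.16 * L : ℝ)) / 2 + 1) / 2).re =
      (digamma ((1 + (5.16 * L : ℝ)) / 2 + 1)).re / 2 := by
    rw [← ofReal_ofNat, div_ofReal_re]
  rw [add_re, sub_re, add_re, h7, h8]
  norm_num at h1 h2 h3 h5 h6 ⊢
  linarith

theorem one_le_re_xiPair_mul {L u : ℝ} {ρ : ℂ} (hL : 480 ≤ L) (hρ : riemannXi ρ = 0)
    (hρu : 0.08447 * ρ.im ^ 2 ≤ u * L ^ 2) :
    1 ≤ (xiPair ρ (1 + (5.16 * L : ℝ))).re * (L * (5.1642 + 2.2943 * u)) := by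
  have key : ∀ ρ : ℂ, ρ.re ∈ Ioo 0 1 → 0.08447 * ρ.im ^ 2 ≤ u * L ^ 2 →
      1 ≤ (1 / ((1 + (5.16 * L : ℝ) : ℂ) - ρ)).re * (L * (5.1642 + 2.2943 * u)) := by
    clear hρ hρu ρ
    intro ρ hρ hu
    obtain ⟨h0, h1⟩ := hρ
    rw [re_one_div_sub]
    simp only [add_re, one_re, ofReal_re, add_im, one_im, ofReal_im]
    have h2 : 0 < (1 + 5.16 * L - ρ.re) ^ 2 := by
      have : 0 < 1 + 5.16 * L - ρ.re := by linarith
      positivity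
    rw [div_mul_eq_mul_div, le_div_iff₀ (by positivity)]
    have h3 : (1 + 5.16 * L - ρ.re) ^ 2 ≤ (1 + 5.16 * L) ^ 2 := by
      have : 0 < 1 + 5.16 * L - ρ.re := by linarith
      gcongr
      linarith
    have hu0 : 0 ≤ u := by
      by_contra! hc
      have : u * L ^ 2 < 0 := mul_neg_of_neg_of_pos hc (by positivity)
      have := sq_nonneg ρ.im
      norm_num at hu
      linarith
    have h4 : 5.16 * L * (L * (5.1642 + 2.2943 * u)) ≤
        (1 + 5.16 * L - ρ.re) * (L * (5.1642 + 2.2943 * u)) := by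
      gcongr
      linarith
    refine le_trans ?_ h4
    have h5 : 0 ≤ L * (L - 480) := mul_nonneg (by linarith) (by linarith)
    norm_num at hu ⊢
    nlinarith
  have hre := re_mem_Ioo_of_riemannXi_eq_zero hρ
  have k1 := key ρ hre hρu
  have k2 := key (1 - conj ρ) (by simpa using hre.symm) (by simpa using hρu)
  have : (xiPair ρ (1 + (5.16 * L : ℝ))).re = ((1 / ((1 + (5.16 * L : ℝ) : ℂ) - ρ)).re +
      (1 / ((1 + (5.16 * L : ℝ) : ℂ) - (1 - conj ρ))).re) / 2 := by
    rw [xiPair, ← ofReal_ofNat, div_ofReal_re, add_re]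
  rw [this]
  linarith

namespace BumpParams

variable {L m h r : ℝ} {k : ℕ}

theorem k_ne_zero (p : BumpParams L m h r k) : k ≠ 0 := by
  rintro rfl
  have := p.k_large
  norm_num at this

theorem norm_bump_xiPair_le (p : BumpParams L m h r k) {ρ : ℂ} (hρ : riemannXi ρ = 0) :
    ‖bump m h r k (xiPair ρ)‖ ≤ (‖bump m h r k (fun s => 1 / (s - ρ))‖ +
      ‖bump m h r k (fun s => 1 / (s - (1 - conj ρ)))‖) / 2 := by
  have key : ∀ ρ : ℂ, riemannXi ρ = 0 →
      AnalyticAt ℂ (fun s => 1 / (s - ρ)) ((1 + r : ℝ) : ℂ) := by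
    intro ρ hρ
    have h1 : ((1 + r : ℝ) : ℂ) - ρ ≠ 0 := by
      rw [sub_ne_zero]
      rintro rfl
      have := (re_mem_Ioo_of_riemannXi_eq_zero hρ).2
      rw [ofReal_re] at this
      linarith [p.hr]
    fun_prop (disch := assumption)
  have h1 : xiPair ρ = fun s => (1 / 2) * (1 / (s - ρ) + 1 / (s - (1 - conj ρ))) := by
    funext s
    rw [xiPair]
    ring
  rw [h1, bump_const_mul, bump_add (key ρ hρ) (key _ (riemannXi_one_sub_conj hρ)), norm_mul]
  norm_num
  have := norm_add_le (bump m h r k (fun s => (s - ρ)⁻¹))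
    (bump m h r k (fun s => (s - (1 - conj ρ))⁻¹))
  linarith

theorem norm_bump_xiPair_le_mul_re (p : BumpParams L m h r k) {ρ : ℂ} (hρ : riemannXi ρ = 0) :
    ‖bump m h r k (xiPair ρ)‖ ≤ 0.93 * (h ^ 2 - m / r) / (2.992 + Real.log (L / 480) / 2) *
      (xiPair ρ (1 + (5.16 * L : ℝ))).re := by
  have hL := p.hL
  have hX : 0 ≤ Real.log (L / 480) := by
    refine Real.log_nonneg ?_
    rw [le_div_iff₀ (by norm_num)]
    linarith
  have hXL : 2.992 + Real.log (L / 480) / 2 ≤ L := by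
    have := Real.log_le_sub_one_of_pos (show 0 < L / 480 by linarith)
    norm_num at this ⊢
    linarith
  have hh := p.hh₁
  have hS := p.S_pos
  have hhS : 1.5 * (m / r) ≤ h ^ 2 - m / r := by
    norm_num at hh ⊢
    linarith
  have hre := re_mem_Ioo_of_riemannXi_eq_zero hρ
  have hre' := re_mem_Ioo_of_riemannXi_eq_zero (riemannXi_one_sub_conj hρ)
  obtain ⟨u, hu⟩ : ∃ u, u = m / r * ρ.im ^ 2 := ⟨_, rfl⟩
  have hu' : u = m / r * (1 - conj ρ).im ^ 2 := by simpa using hu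
  have hu0 : 0 ≤ u := by rw [hu]; positivity
  have hρu : 0.08447 * ρ.im ^ 2 ≤ u * L ^ 2 := by
    calc 0.08447 * ρ.im ^ 2 ≤ m / r * L ^ 2 * ρ.im ^ 2 := by
          gcongr
          exact p.hS
      _ = _ := by rw [hu]; ring
  have hx := one_le_re_xiPair_mul hL hρ hρu
  have hpair := p.norm_bump_xiPair_le hρ
  suffices hs : ‖bump m h r k (xiPair ρ)‖ * (L * (5.1642 + 2.2943 * u)) *
      (2.992 + Real.log (L / 480) / 2) ≤ 0.93 * (h ^ 2 - m / r) by
    have hpos : 0 ≤ (xiPair ρ (1 + (5.16 * L : ℝ))).re := by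
      by_contra! hc
      have := mul_neg_of_neg_of_pos hc (show 0 < L * (5.1642 + 2.2943 * u) by positivity)
      linarith
    rw [div_mul_eq_mul_div, le_div_iff₀ (by positivity)]
    calc _ = ‖bump m h r k (xiPair ρ)‖ * (2.992 + Real.log (L / 480) / 2) * 1 := by ring
      _ ≤ ‖bump m h r k (xiPair ρ)‖ * (2.992 + Real.log (L / 480) / 2) *
          ((xiPair ρ (1 + (5.16 * L : ℝ))).re * (L * (5.1642 + 2.2943 * u))) := by gcongr
      _ = ‖bump m h r k (xiPair ρ)‖ * (L * (5.1642 + 2.2943 * u)) *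
          (2.992 + Real.log (L / 480) / 2) * (xiPair ρ (1 + (5.16 * L : ℝ))).re := by ring
      _ ≤ _ := by gcongr
  rcases le_total u L with huL | huL
  · have h1 := p.norm_bump_le_of_im_small hre hu huL
    have h2 := p.norm_bump_le_of_im_small hre' hu' huL
    rw [show 1 - (1 - conj ρ).re = ρ.re by simp] at h2
    have h3 := zero_weight_le_of_le hL hρ hu0 hρu huL
    have h4 : ‖bump m h r k (xiPair ρ)‖ ≤ 1.00001 * (h ^ 2 - m / r) / 2 *
        ((Real.exp (-(L * (1 - ρ.re))) + Real.exp (-(L * ρ.re))) *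
          (Real.exp (-(u / 2)) * (1.0001 + 0.6681 * u))) := by
      refine hpair.trans ?_
      rw [add_mul]
      linarith
    calc _ ≤ 1.00001 * (h ^ 2 - m / r) / 2 *
        ((Real.exp (-(L * (1 - ρ.re))) + Real.exp (-(L * ρ.re))) *
          (Real.exp (-(u / 2)) * (1.0001 + 0.6681 * u))) * (L * (5.1642 + 2.2943 * u)) *
            (2.992 + Real.log (L / 480) / 2) := by gcongr
      _ = 1.00001 * (h ^ 2 - m / r) / 2 *
          ((Real.exp (-(L * (1 - ρ.re))) + Real.exp (-(L * ρ.re))) *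
            (Real.exp (-(u / 2)) * ((1.0001 + 0.6681 * u) * (5.1642 + 2.2943 * u))) *
              (L * (2.992 + Real.log (L / 480) / 2))) := by ring
      _ ≤ 1.00001 * (h ^ 2 - m / r) / 2 * 1.859 := by
        refine mul_le_mul_of_nonneg_left h3 ?_
        have : 0 ≤ h ^ 2 - m / r := by linarith
        positivity
      _ ≤ _ := by
        norm_num
        linarith
  · have h1 := p.norm_bump_le_of_im_large hre hu huL
    have h2 := p.norm_bump_le_of_im_large hre' hu' huL
    calc _ ≤ (‖bump m h r k (fun s => 1 / (s - ρ))‖ +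
          ‖bump m h r k (fun s => 1 / (s - (1 - conj ρ)))‖) / 2 * (L * (5.1642 + 2.2943 * u)) * L := by
          gcongr
      _ = (‖bump m h r k (fun s => 1 / (s - ρ))‖ * (L * (5.1642 + 2.2943 * u)) * L +
          ‖bump m h r k (fun s => 1 / (s - (1 - conj ρ)))‖ * (L * (5.1642 + 2.2943 * u)) * L) / 2 := by
          ring
      _ ≤ ((1 / 10 ^ 40) * (m / r) + (1 / 10 ^ 40) * (m / r)) / 2 := by gcongr
      _ ≤ _ := by
        norm_num at hhS ⊢
        linarith

theorem abs_h_le (p : BumpParams L m h r k) : |h| ≤ m := by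
  refine abs_le_of_sq_le_sq ?_ p.m_pos.le
  have h1 := p.hh₂
  have h2 := p.S_le
  have h3 : (1 : ℝ) ≤ m ^ 2 := one_le_pow₀ (by linarith [p.hL, p.hm])
  norm_num at h1 h2
  linarith

theorem norm_bump_logDeriv_riemannXi_le (p : BumpParams L m h r k) :
    ‖bump m h r k (logDeriv riemannXi)‖ ≤ 0.93 * (h ^ 2 - m / r) := by
  have hL := p.hL
  have hX : 0 ≤ Real.log (L / 480) := by
    refine Real.log_nonneg ?_
    rw [le_div_iff₀ (by norm_num)]
    linarith
  have hS := p.S_pos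
  have hh : 0 ≤ h ^ 2 - m / r := by
    have := p.hh₁
    norm_num at this
    linarith
  refine (_root_.norm_bump_logDeriv_riemannXi_le (A := 5.16 * L) p.m_pos.le p.hr p.abs_h_le
    p.k_ne_zero (by linarith) (by positivity) fun ρ hρ => p.norm_bump_xiPair_le_mul_re hρ).trans ?_
  calc _ ≤ 0.93 * (h ^ 2 - m / r) / (2.992 + Real.log (L / 480) / 2) *
        (2.992 + Real.log (L / 480) / 2) := by
        gcongr
        exact re_logDeriv_riemannXi_le hL
    _ = _ := by
        field_simp

end BumpParams

theorem Complex.norm_digamma_le {z : ℂ} (hz : 1 / 2 ≤ z.re) : ‖digamma z‖ ≤ ‖z‖ + 8 := by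
  have hn : 1 / 2 ≤ ‖z‖ := hz.trans (re_le_norm z)
  have hn0 : 0 < ‖z‖ := by linarith
  have h1 := norm_digamma_sub_le (z := z) (by linarith)
  have hpi := Real.pi_le_four
  have h2 : 1 / (6 * ‖z‖ ^ 3) + Real.pi / (12 * ‖z‖ ^ 2) ≤
      1 / (6 * (1 / 2) ^ 3) + 4 / (12 * (1 / 2) ^ 2) := by
    gcongr
  have h3 : ‖log z‖ ≤ ‖z‖ + 3 := by
    refine (norm_le_abs_re_add_abs_im _).trans ?_
    rw [log_re, log_im]
    have h4 : |Real.log ‖z‖| ≤ ‖z‖ + 1 := by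
      rw [abs_le]
      constructor
      · have := Real.log_le_log (by norm_num) hn
        rw [one_div, Real.log_inv] at this
        have h5 := Real.log_two_lt_d9
        linarith
      · linarith [Real.log_le_sub_one_of_pos hn0]
    have h5 : |arg z| ≤ 2 := by
      have := (abs_arg_le_pi_div_two_iff).2 (show 0 ≤ z.re by linarith)
      linarith
    linarith
  have h4 : ‖1 / (2 * z)‖ ≤ 1 := by
    rw [norm_div, norm_mul, norm_one, div_le_one (by simpa using hn0.ne')]
    norm_num
    linarith
  calc ‖digamma z‖ = ‖(digamma z - (log z - 1 / (2 * z))) + log z - 1 / (2 * z)‖ := by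
        congr 1
        ring
    _ ≤ ‖digamma z - (log z - 1 / (2 * z))‖ + ‖log z‖ + ‖1 / (2 * z)‖ :=
        (norm_sub_le _ _).trans (by gcongr; exact norm_add_le _ _)
    _ ≤ _ := by
        have := h1.trans (h2.trans (show _ ≤ (3 : ℝ) by norm_num))
        linarith

namespace BumpParams

variable {L m h r : ℝ} {k : ℕ}

theorem m_le (p : BumpParams L m h r k) : m ≤ 1.01 * L := by
  have h1 := p.hm'
  have h2 := p.hL
  norm_num at *
  linarith

theorem r_le (p : BumpParams L m h r k) : r ≤ 12 * L ^ 3 := by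
  have h1 := p.hS
  have hr := p.hr
  have hL := p.hL
  have hm := p.m_pos
  have h2 : m / r * L ^ 2 * r = m * L ^ 2 := by
    field_simp
  have h3 : 0.08447 * r ≤ m * L ^ 2 := by
    rw [← h2]
    gcongr
  have h4 : m * L ^ 2 ≤ 1.01 * L ^ 3 := by
    calc m * L ^ 2 ≤ (1.01 * L) * L ^ 2 := by
          gcongr
          exact p.m_le
      _ = _ := by ring
  have h5 : 0 < L ^ 3 := by positivity
  norm_num at h3 h4
  linarith

theorem exp_mul_le (p : BumpParams L m h r k) : Real.exp (-(0.48 * L)) * L ^ 12 ≤ (1 / 10 ^ 48) * (m / r) := by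
  have h1 := p.hS
  have hL := p.hL
  have h2 := exp_neg_mul_pow_le hL
  have h3 : 0 < L ^ 2 := by positivity
  refine le_of_mul_le_mul_right ?_ h3
  calc Real.exp (-(0.48 * L)) * L ^ 12 * L ^ 2 = Real.exp (-(0.48 * L)) * L ^ 14 := by ring
    _ ≤ (1 / 10 ^ 50) := h2
    _ ≤ (1 / 10 ^ 48) * 0.08447 := by norm_num
    _ ≤ (1 / 10 ^ 48) * (m / r * L ^ 2) := by gcongr
    _ = _ := by ring

theorem le_r (p : BumpParams L m h r k) : 10 ^ 9 ≤ r := by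
  have h1 := p.S_le
  have h2 := p.hL
  have h3 := p.hm
  rw [div_le_iff₀ p.hr] at h1
  norm_num at h1 ⊢
  linarith

theorem norm_bump_digamma_le (p : BumpParams L m h r k) :
    ‖bump m h r k (fun s => digamma (s / 2 + 1))‖ ≤ (1 / 10 ^ 40) * (m / r) := by
  have hr := p.hr
  have hrl := p.le_r
  have hm := p.m_pos
  have hL := p.hL
  have hk := p.hk
  refine (norm_bump_le (R := r + 2) (C := 2 * r) hm.le hr p.abs_h_le (by linarith)
    (diffContOnCl_ball_of_analyticAt fun s hs => analyticAt_digamma_half_add_one (by linarith))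
    fun s hs => ?_).trans ?_
  · rw [Metric.mem_sphere, dist_eq] at hs
    have h1 := (abs_le.1 ((abs_re_le_norm (s - (1 + r : ℝ))).trans hs.le)).1
    rw [sub_re, ofReal_re] at h1
    have h2 : ‖s‖ ≤ 2 * r + 3 := by
      calc ‖s‖ = ‖(s - (1 + r : ℝ)) + (1 + r : ℝ)‖ := by rw [sub_add_cancel]
        _ ≤ ‖s - (1 + r : ℝ)‖ + ‖((1 + r : ℝ) : ℂ)‖ := norm_add_le _ _
        _ = 2 * r + 3 := by
          rw [hs, norm_real, Real.norm_of_nonneg (by linarith)]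
          ring
    have h3 : (s / 2 + 1).re = s.re / 2 + 1 := by
      rw [add_re, one_re, ← ofReal_ofNat, div_ofReal_re]
    refine (norm_digamma_le (by rw [h3]; linarith)).trans ?_
    have h4 : ‖s / 2 + 1‖ ≤ ‖s‖ / 2 + 1 := by
      refine (norm_add_le _ _).trans ?_
      norm_num
    norm_num at hrl
    linarith
  · have h1 : (r / (r + 2)) ^ k ≤ Real.exp (-(0.48 * L)) := by
      have hx : r / (r + 2) = 1 / (1 + 2 / r) := by field_simp
      have hx1 : r / (r + 2) ≤ 1 := by
        rw [div_le_one (by linarith)]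
        linarith
      refine (pow_le_exp_of_sq_le (x := 2 / r) (by positivity) (by positivity) ?_).trans ?_
      · rw [← hx, sq]
        exact mul_le_of_le_one_left (by positivity) hx1
      · refine Real.exp_le_exp.2 ?_
        have e1 : (k : ℝ) = r * m - 1 := by linarith
        have h2 : 1 / r ≤ 0.0001 := by
          rw [div_le_iff₀ hr]
          norm_num at hrl ⊢
          linarith
        have h3 : -(k * (2 / r) / 2) + k * (2 / r) ^ 2 / 2 =
            -m + 1 / r + 2 * m * (1 / r) - 2 * (1 / r) ^ 2 := by
          rw [e1]
          field_simp
          ring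
        rw [h3]
        have h4 : 2 * m * (1 / r) ≤ 2 * m * 0.0001 := by gcongr
        have h5 := p.hm
        have h6 := sq_nonneg (1 / r)
        generalize 1 / r = w at *
        norm_num at h2 h4 ⊢
        linarith
    have h2 : ((k : ℝ) + 2) * (k + 1) / (r + 2) ^ 2 ≤ 2 * m ^ 2 := by
      rw [div_le_iff₀ (by positivity)]
      have h3 := p.k_large
      calc ((k : ℝ) + 2) * (k + 1) ≤ (2 * (k + 1)) * (k + 1) := by
            gcongr
            norm_num at h3
            linarith
        _ = 2 * m ^ 2 * r ^ 2 := by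
            rw [← hk]
            ring
        _ ≤ _ := by
            gcongr
            linarith
    have h3 : 2 * m * ((k : ℝ) + 1) / (r + 2) ≤ 2 * m ^ 2 := by
      rw [div_le_iff₀ (by positivity), ← hk]
      calc 2 * m * (r * m) = 2 * m ^ 2 * r := by ring
        _ ≤ _ := by
            gcongr
            linarith
    calc _ ≤ Real.exp (-(0.48 * L)) * r * (2 * r) * (2 * m ^ 2 + 2 * m ^ 2 + m ^ 2) := by gcongr
      _ = 10 * Real.exp (-(0.48 * L)) * r ^ 2 * m ^ 2 := by ring
      _ ≤ 10 * Real.exp (-(0.48 * L)) * (12 * L ^ 3) ^ 2 * (1.01 * L) ^ 2 := by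
          have := p.r_le
          have := p.m_le
          gcongr
      _ = 10 * 12 ^ 2 * 1.01 ^ 2 * (Real.exp (-(0.48 * L)) * (L ^ 8 * 1)) := by ring
      _ ≤ 10 * 12 ^ 2 * 1.01 ^ 2 * (Real.exp (-(0.48 * L)) * (L ^ 8 * L ^ 4)) := by
          gcongr
          exact one_le_pow₀ (by linarith)
      _ = 10 * 12 ^ 2 * 1.01 ^ 2 * (Real.exp (-(0.48 * L)) * L ^ 12) := by ring
      _ ≤ 10 * 12 ^ 2 * 1.01 ^ 2 * ((1 / 10 ^ 48) * (m / r)) := by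
          exact mul_le_mul_of_nonneg_left p.exp_mul_le (by norm_num)
      _ ≤ _ := by
          have := p.S_pos
          norm_num
          linarith

theorem le_re_bump_zeta (p : BumpParams L m h r k) :
    0.1 * (m / r) ≤ (bump m h r k (fun s => -logDeriv riemannZeta s)).re := by
  rw [bump_neg_logDeriv_riemannZeta p.hr p.k_ne_zero, bump_one_div_sub p.hr.ne' p.hk]
  have hr0 : (r : ℂ) ≠ 0 := by exact_mod_cast p.hr.ne'
  have h1 : (r : ℂ) / ((1 + r : ℝ) - 1) = 1 := by
    push_cast
    rw [add_sub_cancel_left, div_self hr0]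
  rw [h1, one_pow, one_mul, sub_self]
  have h2 : ((h : ℂ) ^ 2 - m ^ 2 * 0 ^ 2 - m / r * 1 ^ 2) = ((h ^ 2 - m / r : ℝ) : ℂ) := by
    push_cast
    ring
  rw [h2, add_re, sub_re, ofReal_re, ← ofReal_ofNat, div_ofReal_re]
  have h3 := (abs_le.1 ((abs_re_le_norm _).trans p.norm_bump_logDeriv_riemannXi_le)).2
  have h4 := (abs_le.1 ((abs_re_le_norm _).trans p.norm_bump_digamma_le)).1
  have h5 := p.hh₁
  have h6 := p.S_pos
  norm_num at h3 h4 h5 ⊢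
  linarith

end BumpParams

open ArithmeticFunction in
theorem re_bump_zeta_le {m h r a b : ℝ} (k : ℕ) (hr : 0 < r) (ha : 0 < a) (hab : a ≤ b)
    (hm : m = (a + b) / 2) (hh : h = (b - a) / 2)
    (hno : ∀ q : ℕ, q.Prime → a < Real.log q → b < Real.log q) :
    (bump m h r k (fun s => -logDeriv riemannZeta s)).re ≤
      r * h ^ 2 * Real.exp (-a) * (2 * √(Real.exp b) * b) := by
  set C := r * h ^ 2 * Real.exp (-a) with hC
  have hC0 : 0 ≤ C := by positivity
  set s := (Finset.Ioc 0 ⌊Real.exp b⌋₊).filter fun n => ¬n.Prime with hs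
  have hg : HasSum (fun n : ℕ => if n ∈ s then C * vonMangoldt n else 0)
      (∑ n ∈ s, C * vonMangoldt n) := by
    have := hasSum_sum_of_ne_finset_zero (s := s) (L := SummationFilter.unconditional ℕ)
      (f := fun n : ℕ => if n ∈ s then C * vonMangoldt n else 0) (fun n hn => if_neg hn)
    rwa [Finset.sum_congr rfl fun n hn => if_pos hn] at this
  have hle := hasSum_le (fun n => ?_) (hasSum_bump_zeta (m := m) (h := h) k hr) hg
  · refine hle.trans ?_
    rw [← Finset.mul_sum, ← Chebyshev.psi_sub_theta_eq_sum_not_prime]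
    refine mul_le_mul_of_nonneg_left ?_ hC0
    have := Chebyshev.psi_sub_theta_le (x := Real.exp b) (Real.one_le_exp (by linarith))
    rwa [Real.log_exp] at this
  · have hΛ := vonMangoldt_nonneg (n := n)
    have hf0 : (0 : ℝ) < k ! := by exact_mod_cast Nat.factorial_pos k
    have hg0 : 0 ≤ if n ∈ s then C * vonMangoldt n else 0 := by
      split_ifs <;> positivity
    have hlog : 0 ≤ Real.log n := Real.log_natCast_nonneg n
    have hn0 : 0 ≤ (n : ℝ) := n.cast_nonneg
    by_cases hn : a < Real.log n ∧ Real.log n ≤ b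
    · obtain ⟨h1, h2⟩ := hn
      have hn1 : (0 : ℝ) < n := by
        rcases Nat.eq_zero_or_pos n with rfl | h
        · simp at h1
          linarith
        · exact_mod_cast h
      have hns : n ∈ s := by
        rw [hs, Finset.mem_filter, Finset.mem_Ioc]
        refine ⟨⟨by exact_mod_cast hn1, ?_⟩, fun hp => ?_⟩
        · rw [Nat.le_floor_iff (Real.exp_pos b).le]
          rwa [← Real.log_le_iff_le_exp hn1]
        · linarith [hno n hp h1]
      rw [if_pos hns]
      obtain ⟨x, hx⟩ : ∃ x, x = Real.log n := ⟨_, rfl⟩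
      have hnx : (n : ℝ) ^ (-(1 + r)) = Real.exp (-x) * Real.exp (-(r * x)) := by
        rw [Real.rpow_def_of_pos hn1, ← hx, ← Real.exp_add]
        congr 1
        ring
      rw [hnx, ← hx]
      rw [← hx] at h1 h2 hlog
      have h3 := Real.pow_div_factorial_le_exp (r * x) (by positivity) k
      have h4 : h ^ 2 - (x - m) ^ 2 ≤ h ^ 2 := by linarith [sq_nonneg (x - m)]
      calc _ ≤ r ^ (k + 1) / k ! * (vonMangoldt n * (Real.exp (-x) * Real.exp (-(r * x))) *
            x ^ k * h ^ 2) := by gcongr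
        _ = r * h ^ 2 * Real.exp (-x) * vonMangoldt n *
            ((r * x) ^ k / k ! * Real.exp (-(r * x))) := by
            rw [mul_pow]
            ring
        _ ≤ r * h ^ 2 * Real.exp (-a) * vonMangoldt n *
            (Real.exp (r * x) * Real.exp (-(r * x))) := by gcongr
        _ = _ := by
            rw [← Real.exp_add, add_neg_cancel, Real.exp_zero, mul_one]
    · refine le_trans ?_ hg0
      have h1 : h ^ 2 - (Real.log n - m) ^ 2 ≤ 0 := by
        have : h ^ 2 - (Real.log n - m) ^ 2 = (Real.log n - a) * (b - Real.log n) := by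
          rw [hm, hh]
          ring
        rw [this]
        rw [not_and_or, not_lt, not_le] at hn
        rcases hn with h2 | h2
        · exact mul_nonpos_of_nonpos_of_nonneg (by linarith) (by linarith)
        · exact mul_nonpos_of_nonneg_of_nonpos (by linarith) (by linarith)
      exact mul_nonpos_of_nonneg_of_nonpos (by positivity)
        (mul_nonpos_of_nonneg_of_nonpos (by positivity) h1)

theorem exists_bumpParams {L h : ℝ} (hL : 480 ≤ L) (hh : h = Real.log (1 + 0.92 / L) / 2) :
    ∃ r k, BumpParams L (L + h) h r k := by
  have hL0 : 0 < L := by linarith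
  have hx : 0.92 / L ≤ 0.001917 := by
    rw [div_le_iff₀ hL0]
    norm_num
    linarith
  have hh1 : h ≤ 0.46 / L := by
    have := Real.log_le_sub_one_of_pos (show 0 < 1 + 0.92 / L by positivity)
    rw [hh]
    calc _ ≤ (0.92 / L) / 2 := by linarith
      _ = _ := by ring
  have hh2 : 0.459559 / L ≤ h := by
    have := Real.le_log_one_add_of_nonneg (show 0 ≤ 0.92 / L by positivity)
    rw [hh]
    refine le_trans ?_ (div_le_div_of_nonneg_right this (by norm_num))
    rw [div_div, le_div_iff₀ (by positivity)]
    calc 0.459559 / L * ((0.92 / L + 2) * 2) ≤ 0.459559 / L * ((0.001917 + 2) * 2) := by gcongr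
      _ = 0.459559 * ((0.001917 + 2) * 2) / L := by ring
      _ ≤ 1.84 / L := by
        gcongr
        norm_num
      _ = _ := by ring
  have hh0 : 0 < h := lt_of_lt_of_le (by positivity) hh2
  have hhs : h ≤ 0.001 := by
    refine hh1.trans ?_
    rw [div_le_iff₀ hL0]
    norm_num
    linarith
  have hA1 : h ^ 2 * L ^ 2 ≤ 0.2116 := by
    rw [← mul_pow]
    have : h * L ≤ 0.46 := by rwa [le_div_iff₀ hL0] at hh1
    calc (h * L) ^ 2 ≤ 0.46 ^ 2 := by gcongr
      _ ≤ _ := by norm_num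
  have hA2 : 0.211194 ≤ h ^ 2 * L ^ 2 := by
    rw [← mul_pow]
    have : 0.459559 ≤ h * L := by rwa [div_le_iff₀ hL0] at hh2
    calc (0.211194 : ℝ) ≤ 0.459559 ^ 2 := by norm_num
      _ ≤ (h * L) ^ 2 := by gcongr
  have hm : 0 < L + h := by linarith
  obtain ⟨n, hn⟩ : ∃ n, n = ⌈2.5 * (L + h) ^ 2 / h ^ 2⌉₊ := ⟨_, rfl⟩
  have hn1 : 2.5 * (L + h) ^ 2 / h ^ 2 ≤ n := hn ▸ Nat.le_ceil _
  have hn2 : (n : ℝ) < 2.5 * (L + h) ^ 2 / h ^ 2 + 1 := hn ▸ Nat.ceil_lt_add_one (by positivity)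
  have hn0 : (0 : ℝ) < n := lt_of_lt_of_le (by positivity) hn1
  have hnpos : 0 < n := by exact_mod_cast hn0
  rw [div_le_iff₀ (by positivity)] at hn1
  have hn3 : n * h ^ 2 ≤ (2.5 + (1 / 10 ^ 6)) * (L + h) ^ 2 := by
    have h1 : 2.5 * (L + h) ^ 2 / h ^ 2 * h ^ 2 = 2.5 * (L + h) ^ 2 := by field_simp
    have h2 : n * h ^ 2 ≤ (2.5 * (L + h) ^ 2 / h ^ 2 + 1) * h ^ 2 := by gcongr
    have h3 : h ^ 2 ≤ (1 / 10 ^ 6) * 1 := by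
      calc h ^ 2 ≤ 0.001 ^ 2 := by gcongr
        _ ≤ _ := by norm_num
    have h4 : 1 ≤ (L + h) ^ 2 := one_le_pow₀ (by linarith)
    rw [add_mul, h1] at h2
    linarith
  have hS : (L + h) / (n / (L + h)) = (L + h) ^ 2 / n := by field_simp
  refine ⟨n / (L + h), n - 1, ⟨hL, by linarith, by linarith, by positivity, ?_, ?_, ?_, hh0, ?_, ?_⟩⟩
  · rw [div_mul_cancel₀ _ hm.ne']
    norm_cast
    omega
  · rw [hS, div_mul_eq_mul_div, le_div_iff₀ hn0]
    have h1 : 0.08447 * n * h ^ 2 ≤ (L + h) ^ 2 * L ^ 2 * h ^ 2 := by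
      have h2 : 0 < (L + h) ^ 2 := by positivity
      calc 0.08447 * n * h ^ 2 = 0.08447 * (n * h ^ 2) := by ring
        _ ≤ 0.08447 * ((2.5 + (1 / 10 ^ 6)) * (L + h) ^ 2) := by gcongr
        _ ≤ (L + h) ^ 2 * 0.211194 := by
          norm_num
          linarith
        _ ≤ (L + h) ^ 2 * (h ^ 2 * L ^ 2) := by gcongr
        _ = _ := by ring
    exact le_of_mul_le_mul_right h1 (by positivity)
  · rw [hS, div_mul_eq_mul_div, div_le_iff₀ hn0]
    have h1 : (L + h) ^ 2 * L ^ 2 * h ^ 2 ≤ 0.0847 * n * h ^ 2 := by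
      have h2 : 0 < (L + h) ^ 2 := by positivity
      calc (L + h) ^ 2 * L ^ 2 * h ^ 2 = (L + h) ^ 2 * (h ^ 2 * L ^ 2) := by ring
        _ ≤ (L + h) ^ 2 * 0.2116 := by gcongr
        _ ≤ 0.0847 * (2.5 * (L + h) ^ 2) := by
          norm_num
          linarith
        _ ≤ 0.0847 * (n * h ^ 2) := by gcongr
        _ = _ := by ring
    exact le_of_mul_le_mul_right h1 (by positivity)
  · rw [hS, ← mul_div_assoc, div_le_iff₀ hn0, mul_comm (h ^ 2)]
    exact hn1
  · rw [hS, ← mul_div_assoc, le_div_iff₀ hn0, mul_comm (h ^ 2)]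
    refine hn3.trans ?_
    gcongr
    norm_num

theorem exists_prime_log_mem_Ioc {L : ℝ} (hL : 480 ≤ L) :
    ∃ q : ℕ, q.Prime ∧ L < Real.log q ∧ Real.log q ≤ L + Real.log (1 + 0.92 / L) := by
  by_contra! hno
  have hL0 : 0 < L := by linarith
  obtain ⟨h, hh⟩ : ∃ h, h = Real.log (1 + 0.92 / L) / 2 := ⟨_, rfl⟩
  obtain ⟨r, k, p⟩ := exists_bumpParams hL hh
  have h1 := re_bump_zeta_le (m := L + h) (h := h) (a := L) (b := L + Real.log (1 + 0.92 / L)) k p.hr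
    hL0 (by linarith [p.hh]) (by rw [hh]; ring) (by rw [hh]; ring) hno
  have h2 := p.le_re_bump_zeta
  have hb : Real.log (1 + 0.92 / L) ≤ 0.002 := by
    have := p.hm'
    norm_num at *
    linarith
  have hr := p.hr
  have hS := p.S_pos
  have hhh := p.hh
  have h3 : Real.exp (-L) * √(Real.exp (L + Real.log (1 + 0.92 / L))) ≤ Real.exp (-(0.48 * L)) := by
    rw [Real.sqrt_eq_rpow, ← Real.exp_mul, ← Real.exp_add]
    refine Real.exp_le_exp.2 ?_
    norm_num at hb ⊢
    linarith
  have h4 : L + Real.log (1 + 0.92 / L) ≤ 2 * L := by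
    norm_num at hb ⊢
    linarith
  have h5 : r * h ^ 2 * Real.exp (-L) * (2 * √(Real.exp (L + Real.log (1 + 0.92 / L))) *
      (L + Real.log (1 + 0.92 / L))) ≤ (1 / 10 ^ 30) * ((L + h) / r) := by
    calc _ = r * h ^ 2 * 2 * (Real.exp (-L) * √(Real.exp (L + Real.log (1 + 0.92 / L)))) *
          (L + Real.log (1 + 0.92 / L)) := by ring
      _ ≤ (12 * L ^ 3) * 1 * 2 * Real.exp (-(0.48 * L)) * (2 * L) := by
          have := p.r_le
          have : h ^ 2 ≤ 1 := by
            refine pow_le_one₀ hhh.le ?_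
            rw [hh]
            norm_num at hb ⊢
            linarith
          have : 0 ≤ L + Real.log (1 + 0.92 / L) := by linarith
          gcongr
      _ = 48 * (Real.exp (-(0.48 * L)) * (L ^ 4 * 1)) := by ring
      _ ≤ 48 * (Real.exp (-(0.48 * L)) * (L ^ 4 * L ^ 8)) := by
          gcongr
          exact one_le_pow₀ (by linarith)
      _ = 48 * (Real.exp (-(0.48 * L)) * L ^ 12) := by ring
      _ ≤ 48 * ((1 / 10 ^ 48) * ((L + h) / r)) := mul_le_mul_of_nonneg_left p.exp_mul_le (by norm_num)
      _ ≤ _ := by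
          norm_num
          linarith
  have h6 := h2.trans (h1.trans h5)
  norm_num at h6
  linarith

end

/-! ### Chebyshev's lower bound for the prime counting function -/

open ArithmeticFunction in
theorem log_factorial_eq_sum_vonMangoldt {N n : ℕ} (hn : n ≤ N) :
    Real.log n.factorial = ∑ d ∈ Finset.Icc 1 N, vonMangoldt d * (n / d : ℕ) := by
  induction n with
  | zero => simp
  | succ n ih =>
    rw [Nat.factorial_succ, Nat.cast_mul, Real.log_mul (by positivity) (by positivity),
      ih (by omega), ← vonMangoldt_sum]
    have hd : (n + 1).divisors = (Finset.Icc 1 N).filter (· ∣ n + 1) := by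
      ext d
      simp only [Nat.mem_divisors, Finset.mem_filter, Finset.mem_Icc]
      refine ⟨fun h => ⟨⟨Nat.pos_of_dvd_of_pos h.1 n.succ_pos,
        (Nat.le_of_dvd n.succ_pos h.1).trans hn⟩, h.1⟩, fun h => ⟨h.2, n.succ_ne_zero⟩⟩
    rw [hd, Finset.sum_filter, ← Finset.sum_add_distrib]
    refine Finset.sum_congr rfl fun d _ => ?_
    rw [Nat.succ_div]
    split_ifs <;> push_cast <;> ring

theorem log_factorial_sub_le_psi (n : ℕ) :
    Real.log n.factorial + Real.log (n / 30).factorial - Real.log (n / 2).factorial -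
      Real.log (n / 3).factorial - Real.log (n / 5).factorial ≤ Chebyshev.psi n := by
  have h (k : ℕ) := log_factorial_eq_sum_vonMangoldt (Nat.div_le_self n k)
  rw [log_factorial_eq_sum_vonMangoldt le_rfl, h, h, h, h, Chebyshev.psi, Nat.floor_natCast,
    ← Finset.sum_add_distrib, ← Finset.sum_sub_distrib, ← Finset.sum_sub_distrib,
    ← Finset.sum_sub_distrib]
  refine Finset.sum_le_sum fun d _ => ?_
  have hq : n / d + n / d / 30 ≤ n / d / 2 + n / d / 3 + n / d / 5 + 1 := by omega
  have hc (k : ℕ) : n / k / d = n / d / k := by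
    rw [Nat.div_div_eq_div_mul, Nat.div_div_eq_div_mul, mul_comm]
  rw [hc, hc, hc, hc]
  have hq' : ((n / d : ℕ) : ℝ) + (n / d / 30 : ℕ) ≤
      (n / d / 2 : ℕ) + (n / d / 3 : ℕ) + (n / d / 5 : ℕ) + 1 := by exact_mod_cast hq
  have := mul_le_mul_of_nonneg_left hq' (ArithmeticFunction.vonMangoldt_nonneg (n := d))
  linarith

theorem log_factorial_le {n : ℕ} (hn : n ≠ 0) :
    Real.log n.factorial ≤ n * Real.log n - n + Real.log n / 2 + 1 := by
  have h1 : Real.log (Stirling.stirlingSeq n) ≤ Real.log (Stirling.stirlingSeq 1) := by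
    obtain ⟨k, rfl⟩ := Nat.exists_eq_succ_of_ne_zero hn
    exact Stirling.log_stirlingSeq'_antitone (Nat.zero_le k)
  have hn' : (0 : ℝ) < n := by positivity
  rw [Stirling.log_stirlingSeq_formula, Stirling.stirlingSeq_one, Real.log_div (by positivity)
    (by positivity), Real.log_div (by positivity) (by positivity), Real.log_exp,
    Real.log_sqrt (by norm_num), Real.log_mul (by norm_num) (by positivity)] at h1
  linarith

theorem mul_log_sub_self_mono {x y : ℝ} (hx : 1 ≤ x) (hxy : x ≤ y) :
    x * Real.log x - x ≤ y * Real.log y - y := by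
  have hx0 : 0 < x := by linarith
  have hy0 : 0 < y := by linarith
  have h2 := Real.log_le_sub_one_of_pos (show 0 < x / y by positivity)
  rw [Real.log_div (by positivity) (by positivity)] at h2
  have h3 : y * (Real.log x - Real.log y) ≤ y * (x / y - 1) :=
    mul_le_mul_of_nonneg_left h2 (by linarith)
  have h4 : y * (x / y - 1) = x - y := by field_simp
  have h5 := mul_nonneg (sub_nonneg.2 hxy) (Real.log_nonneg hx)
  linarith

theorem log_factorial_div_le {n k : ℕ} (hk : 0 < k) (hkn : k ≤ n) :
    Real.log (n / k).factorial ≤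
      n / k * (Real.log n - Real.log k) - n / k + (Real.log n - Real.log k) / 2 + 1 := by
  have h0 : 0 < n / k := Nat.div_pos hkn hk
  have h1 : ((n / k : ℕ) : ℝ) ≤ n / k := Nat.cast_div_le
  have h2 : (1 : ℝ) ≤ (n / k : ℕ) := by exact_mod_cast h0
  have h3 := log_factorial_le h0.ne'
  have h4 := mul_log_sub_self_mono h2 h1
  have h5 := Real.log_le_log (by linarith) h1
  have hk' : (0 : ℝ) < k := by exact_mod_cast hk
  have hn' : (0 : ℝ) < n := by exact_mod_cast hk.trans_le hkn
  rw [Real.log_div hn'.ne' hk'.ne'] at h4 h5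
  linarith

theorem le_log_factorial_div {n k : ℕ} (hk : 0 < k) (hkn : k ≤ n) :
    n / k * (Real.log n - Real.log k) - n / k - (Real.log n - Real.log k) ≤
      Real.log (n / k).factorial := by
  have h0 : 0 < n / k := Nat.div_pos hkn hk
  have hk' : (0 : ℝ) < k := by exact_mod_cast hk
  have hn' : (0 : ℝ) < n := by exact_mod_cast hk.trans_le hkn
  have h1 : ((n / k : ℕ) : ℝ) ≤ n / k := Nat.cast_div_le
  have h2 : (n : ℝ) / k ≤ (n / k : ℕ) + 1 := by
    rw [div_le_iff₀ hk']
    exact_mod_cast (Nat.lt_mul_of_div_lt (Nat.lt_succ_self (n / k)) hk).le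
  have h3 := Stirling.le_log_factorial_stirling h0.ne'
  have h4 : (1 : ℝ) ≤ (n / k : ℕ) := by exact_mod_cast h0
  have h5 : 0 ≤ Real.log (2 * Real.pi) := Real.log_nonneg (by linarith [Real.pi_gt_three])
  have h6 := Real.log_nonneg h4
  generalize ((n / k : ℕ) : ℝ) = m at *
  rw [← Real.log_div hn'.ne' hk'.ne']
  generalize (n : ℝ) / k = x at *
  have hx : 1 ≤ x := h4.trans h1
  have h7 := Real.log_le_sub_one_of_pos (show 0 < x / m by positivity)
  rw [Real.log_div (by positivity) (by positivity)] at h7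
  have h8 : m * (Real.log x - Real.log m) ≤ m * (x / m - 1) :=
    mul_le_mul_of_nonneg_left h7 (by linarith)
  have h9 : m * (x / m - 1) = x - m := by field_simp
  have h10 := mul_nonneg (show 0 ≤ m + 1 - x by linarith) (Real.log_nonneg hx)
  linarith

theorem le_psi_of_le {n : ℕ} (hn : 65536 ≤ n) : 0.92 * n ≤ Chebyshev.psi n := by
  have h := log_factorial_sub_le_psi n
  have h1 := Stirling.le_log_factorial_stirling (show n ≠ 0 by omega)
  have h2 := log_factorial_div_le (n := n) two_pos (by omega)
  have h3 := log_factorial_div_le (n := n) three_pos (by omega)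
  have h5 := log_factorial_div_le (n := n) (show 0 < 5 by norm_num) (by omega)
  have h30 := le_log_factorial_div (n := n) (show 0 < 30 by norm_num) (by omega)
  have l30 : Real.log 30 = Real.log 2 + Real.log 3 + Real.log 5 := by
    rw [← Real.log_mul (by norm_num) (by norm_num), ← Real.log_mul (by norm_num) (by norm_num)]
    norm_num
  have l3 : 19 * Real.log 2 ≤ 12 * Real.log 3 := by
    have := Real.log_le_log (by norm_num) (show (2 : ℝ) ^ 19 ≤ 3 ^ 12 by norm_num)
    rw [Real.log_pow, Real.log_pow] at this
    exact_mod_cast this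
  have l5 : 65 * Real.log 2 ≤ 28 * Real.log 5 := by
    have := Real.log_le_log (by norm_num) (show (2 : ℝ) ^ 65 ≤ 5 ^ 28 by norm_num)
    rw [Real.log_pow, Real.log_pow] at this
    exact_mod_cast this
  have l2 := Real.log_two_gt_d9
  have l2' := Real.log_two_lt_d9
  have hpi : 0 ≤ Real.log (2 * Real.pi) := Real.log_nonneg (by linarith [Real.pi_gt_three])
  have hn' : (65536 : ℝ) ≤ n := by exact_mod_cast hn
  have hlog : Real.log n ≤ 11.1 + n / 65536 := by
    have := Real.log_le_sub_one_of_pos (show (0 : ℝ) < n / 2 ^ 16 by positivity)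
    rw [Real.log_div (by positivity) (by positivity), Real.log_pow] at this
    norm_num at this ⊢
    linarith
  push_cast at h2 h3 h5 h30
  rw [l30] at h30
  have hA : 0.9208 ≤ 14 / 30 * Real.log 2 + 9 / 30 * Real.log 3 + 5 / 30 * Real.log 5 := by
    norm_num at *
    linarith
  have hA' := mul_le_mul_of_nonneg_left hA (show (0 : ℝ) ≤ n by positivity)
  norm_num at l2 l2' hlog hA' h30 ⊢
  linarith

theorem le_primeCounting_mul_log {n : ℕ} (hn : 65536 ≤ n) :
    0.92 * n ≤ n.primeCounting * Real.log n :=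
  (le_psi_of_le hn).trans (Chebyshev.psi_le_primeCounting_mul_log n)

theorem div_le_primeCounting {N b : ℕ} (hN : 65536 ≤ N) (hb : N < 2 ^ b) :
    N / (6931472 * b / 9200000 + 1) ≤ N.primeCounting := by
  have h := le_primeCounting_mul_log hN
  have hN' : (0 : ℝ) < N := by
    norm_cast
    omega
  have hl : Real.log N ≤ b * 0.6931472 := by
    have h1 := Real.log_le_log hN' (show (N : ℝ) ≤ 2 ^ b by exact_mod_cast hb.le)
    rw [Real.log_pow] at h1
    refine h1.trans (mul_le_mul_of_nonneg_left ?_ b.cast_nonneg)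
    have := Real.log_two_lt_d9
    norm_num at *
    linarith
  have hd : 6931472 * b ≤ 9200000 * (6931472 * b / 9200000 + 1) := by omega
  generalize 6931472 * b / 9200000 + 1 = D at *
  refine Nat.div_le_of_le_mul ?_
  have hd' : (6931472 : ℝ) * b ≤ 9200000 * D := by exact_mod_cast hd
  have h1 : N.primeCounting * Real.log N ≤ N.primeCounting * (0.92 * D) := by
    refine mul_le_mul_of_nonneg_left (hl.trans ?_) (Nat.cast_nonneg _)
    norm_num
    linarith
  have h2 : (N : ℝ) ≤ D * N.primeCounting := by
    norm_num at h h1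
    linarith
  exact_mod_cast h2

namespace PrimeLadder

/-- Every `p` from `a` up to `b` is followed by a prime not exceeding `p + π p`. -/
def Covers (a b : ℕ) : Prop := ∀ p, a ≤ p → p < b → ∃ q, q.Prime ∧ p < q ∧ q ≤ p + p.primeCounting

theorem Covers.self (a : ℕ) : Covers a a := fun _ h h' => absurd h' (not_lt.2 h)

theorem Covers.trans {a b c : ℕ} (h : Covers a b) (h' : Covers b c) : Covers a c := fun p h1 h2 =>
  (lt_or_ge p b).elim (h p h1) fun h3 => h' p h3 h2

theorem Covers.of_prime {a q : ℕ} (hq : q.Prime) (h : q ≤ a + a.primeCounting) : Covers a q :=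
  fun p h1 h2 => ⟨q, hq, h2, h.trans (by have := Nat.monotone_primeCounting h1; omega)⟩

theorem Covers.of_isChain {g : ℕ → ℕ} {a : ℕ} (hg : ∀ N, a ≤ N → g N ≤ N.primeCounting)
    {l : List ℕ} (hl : ∀ q ∈ l, q.Prime) {N : ℕ} (haN : a ≤ N)
    (hc : (N :: l).IsChain fun p q => p ≤ q ∧ q ≤ p + g p) : Covers N (l.getLastD N) := by
  induction l generalizing N with
  | nil => exact Covers.self N
  | cons q l ih =>
    rw [List.isChain_cons_cons] at hc
    rw [List.getLastD_cons]
    have hq := hl q List.mem_cons_self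
    refine (Covers.of_prime hq (hc.1.2.trans (Nat.add_le_add_left (hg N haN) N))).trans
      (ih (fun r hr => hl r (List.mem_cons_of_mem _ hr)) (haN.trans hc.1.1) hc.2)

theorem div_log_two_sub_two_le_primeCounting {N : ℕ} (hN : 3 ≤ N) :
    N / (N.log2 + 1) - 2 ≤ N.primeCounting := by
  have h := Chebyshev.pi_ge N
  have hN' : (3 : ℝ) ≤ N := by exact_mod_cast hN
  have hl : 0 < Real.log N := Real.log_pos (by linarith)
  rw [div_le_iff₀ hl] at h
  have h1 : Real.log N ≤ (N.log2 + 1 : ℕ) * Real.log 2 := by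
    rw [← Real.log_pow]
    exact Real.log_le_log (by linarith) (by exact_mod_cast Nat.lt_log2_self.le)
  have h2 : Real.log (N + 1) ≤ 2 * Real.log N := by
    rw [two_mul, ← Real.log_mul (by linarith) (by linarith)]
    exact Real.log_le_log (by linarith) (by nlinarith)
  have h3 : (N : ℝ) * Real.log 2 ≤ (N.primeCounting + 2) * (N.log2 + 1 : ℕ) * Real.log 2 := by
    have := mul_le_mul_of_nonneg_left h1 (show (0 : ℝ) ≤ N.primeCounting + 2 by positivity)
    linarith
  have h4 := le_of_mul_le_mul_right h3 (Real.log_pos (by norm_num))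
  have h5 : N ≤ (N.primeCounting + 2) * (N.log2 + 1) := by exact_mod_cast h4
  have h6 := Nat.div_le_of_le_mul (h5.trans_eq (mul_comm _ _))
  omega

theorem covers_two : Covers 2 67 := by
  have h := Covers.of_isChain (a := 2) (g := Nat.primeCounting) (fun _ _ => le_rfl)
    (l := [3, 5, 7, 11, 13, 19, 23, 31, 41, 53, 67]) (N := 2) (by norm_num) le_rfl
    (by decide +kernel)
  exact h

theorem covers_67 : Covers 67 69109 := by
  have h := Covers.of_isChain (a := 67) (g := fun N => N / (N.log2 + 1) - 2)
    (fun N hN => div_log_two_sub_two_le_primeCounting (by omega)) (l :=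
    [73, 79, 83, 89, 97, 107, 113, 127, 139, 151, 167, 181, 199, 211, 233, 257, 283, 311, 337, 367,
     401, 443, 487, 523, 571, 619, 677, 739, 809, 887, 971, 1063, 1153, 1249, 1327, 1439, 1567,
     1699, 1847, 2011, 2179, 2357, 2551, 2753, 2971, 3209, 3469, 3739, 4027, 4357, 4679, 5023, 5407,
     5813, 6257, 6733, 7247, 7793, 8389, 8971, 9601, 10273, 11003, 11783, 12619, 13513, 14461,
     15473, 16573, 17669, 18839, 20089, 21419, 22817, 24329, 25943, 27653, 29483, 31397, 33487,
     35573, 37783, 40129, 42611, 45263, 48079, 51071, 54251, 57637, 61231, 65053, 69109]) (N := 67) (by norm_num) le_rfl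
    (by decide +kernel)
  exact h

theorem covers_69109 : Covers 69109 35184439 := by
  have h := Covers.of_isChain (a := 65536)
    (g := fun N => N / (6931472 * (N.log2 + 1) / 9200000 + 1))
    (fun N hN => div_le_primeCounting hN Nat.lt_log2_self) (l :=
    [74419, 80141, 86297, 92927, 100069, 107761, 116047, 124951, 134513, 144103, 154387, 165397,
     177211, 189859, 203419, 217937, 233489, 250153, 268013, 285871, 304907, 325231, 346903, 370021,
     394673, 420977, 449011, 478943, 510847, 544903, 578959, 615137, 653579, 694427, 737819, 783931,
     832919, 884959, 940259, 999023, 1061453, 1127773, 1198247, 1273127, 1352669, 1437203, 1527023,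
     1622449, 1723837, 1831523, 1945991, 2067587, 2196809, 2326033, 2462851, 2607721, 2761111,
     2923523, 3095483, 3277559, 3470353, 3674459, 3890591, 4119419, 4361737, 4603999, 4859759,
     5129737, 5414719, 5715527, 6033047, 6368209, 6721993, 7095437, 7489619, 7905707, 8344891,
     8808491, 9272041, 9760039, 10273723, 10814423, 11383579, 11982703, 12613351, 13277179,
     13975961, 14711507, 15485783, 16300793, 17158699, 18061759, 19012373, 20012999, 21066299,
     22175039, 23342141, 24570653, 25863839, 27225091, 28657987, 30166289, 31753963, 33425221,
     35184439]) (N := 69109) (by norm_num) (by norm_num)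
    (by decide +kernel)
  exact h

end PrimeLadder

/-! ### Proth's primality test -/

theorem Nat.prime_of_proth {n k m : ℕ} (hn : n = 2 ^ m * k + 1) (hk : k < 2 ^ m) (hn1 : n ≠ 1)
    (hm : 1 ≤ m) (h : 3 ^ (k * 2 ^ (m - 1)) ≡ 2 ^ m * k [MOD n]) : n.Prime := by
  by_contra hp
  set q := n.minFac with hq
  have hqp : q.Prime := Nat.minFac_prime hn1
  have : Fact q.Prime := ⟨hqp⟩
  have hqn : q ∣ n := Nat.minFac_dvd n
  obtain ⟨l, rfl⟩ : ∃ l, m = l + 1 := ⟨m - 1, by omega⟩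
  have hq2 : q ≠ 2 := by
    intro h2
    rw [h2, hn, pow_succ, mul_assoc, mul_left_comm] at hqn
    omega
  have h1 : ((3 : ZMod q) ^ k) ^ 2 ^ l = -1 := by
    have h2 := (ZMod.natCast_eq_natCast_iff _ _ _).2 (h.of_dvd hqn)
    have h3 : ((n : ℕ) : ZMod q) = 0 := (ZMod.natCast_eq_zero_iff _ _).2 hqn
    rw [hn] at h3
    push_cast at h2 h3
    rw [← pow_mul]
    rw [h2]
    linear_combination h3
  have hne : (-1 : ZMod q) ≠ 1 := by
    have : Fact (2 < q) := ⟨lt_of_le_of_ne hqp.two_le (Ne.symm hq2)⟩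
    exact ZMod.neg_one_ne_one
  have hord : orderOf ((3 : ZMod q) ^ k) = 2 ^ (l + 1) := by
    apply orderOf_eq_prime_pow
    · rw [h1]; exact hne
    · rw [pow_succ, pow_mul, h1]; norm_num
  have hdvd : 2 ^ (l + 1) ∣ q - 1 := by
    rw [← hord]
    apply ZMod.orderOf_dvd_card_sub_one
    intro h0
    rw [h0, zero_pow (by positivity)] at h1
    exact one_ne_zero (neg_eq_zero.1 h1.symm)
  have hle := Nat.le_of_dvd (by have := hqp.two_le; omega) hdvd
  have hsq := Nat.minFac_sq_le_self (n := n) (by omega) hp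
  rw [← hq] at hsq
  have hA : 2 ^ (l + 1) + 1 ≤ q := by omega
  generalize 2 ^ (l + 1) = A at *
  nlinarith

/-! ### A kernel-friendly ladder of Proth primes -/

namespace PrimeLadder

/-- Call-by-value application, for the benefit of kernel reduction. -/
def force (x : ℕ) (f : ℕ → ℕ) : ℕ := Nat.rec 0 (fun n _ => f n) (Nat.succ x)

/-- `24 * t` modular squarings. -/
def squarings (N t y : ℕ) : ℕ :=
  Nat.rec y (fun _ y =>
    Nat.mod (Nat.pow (Nat.mod (Nat.pow (Nat.mod (Nat.pow (Nat.mod (Nat.pow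
      (Nat.mod (Nat.pow (Nat.mod (Nat.pow (Nat.mod (Nat.pow (Nat.mod (Nat.pow y
        8) N) 8) N) 8) N) 8) N) 8) N) 8) N) 8) N) 8) N) t

/-- `t` modular squarings. -/
def squaringsOne (N t y : ℕ) : ℕ := Nat.rec y (fun _ y => Nat.mod (Nat.pow y 2) N) t

/-- `3 ^ k` modulo `N`, where `k` has at most `t` digits in base `4096`. -/
def powThree (N k t : ℕ) : ℕ :=
  Nat.rec 1 (fun i y => Nat.mod (Nat.mul
    (Nat.pow (Nat.mod (Nat.pow (Nat.mod (Nat.pow (Nat.mod (Nat.pow y 8) N) 8) N) 8) N) 8)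
    (Nat.pow 3 (Nat.mod (Nat.div k (Nat.pow 4096 (Nat.sub t (Nat.succ i)))) 4096))) N) t

/-- One rung: `k` for the candidate `M * k + 1` determined by `digit`, or `0` if it fails the
test. -/
def step (u r m M Q i W T digit L : ℕ) : ℕ :=
  force (Nat.mul Q (Nat.add (Nat.mul 3 (Nat.sub
    (Nat.div (Nat.sub L (Nat.succ (Nat.mul M (Nat.mul Q i)))) (Nat.mul 3 (Nat.mul M Q)))
    (Nat.mul W digit))) i)) fun k =>
  force (Nat.succ (Nat.mul M k)) fun n =>
    bif Nat.ble n L && (Nat.ble (Nat.succ L) T && (Nat.ble 131072 L && (Nat.ble (Nat.succ k) M &&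
      Nat.beq (squaringsOne n r (squarings n u (powThree n k (Nat.div (Nat.add m 11) 12))))
        (Nat.mul M k))))
    then k else 0

/-- The first success among the `t` candidates starting at `t * c`. -/
def search (t c : ℕ) (f : ℕ → ℕ) : ℕ :=
  Nat.rec 0 (fun i r => force r fun r =>
    bif Nat.beq r 0 then f (Nat.add (Nat.mul t c) i) else r) t

/-- The product of the first `n` primes from `5` on. -/
def primorial (n : ℕ) : ℕ :=
  Nat.rec 1 (fun j a => Nat.mul a (Nat.mod (Nat.div 0x616ff7bbadbecf61aed6ea34b9ece66f3392c6e331587c360f017dbc5dee972b8dbed363b1582bf5aacd5aa751a752e9545a25067f389b4d66732984b253279248e431e8ec6a2f158a44a1f0e85c26110682c0e05 (Nat.pow 512 j)) 512)) n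

/-- A chain of `c` rungs below `2 ^ b`, with digits in base `B` packed in `d`. -/
def block (b n B c d N : ℕ) : ℕ :=
  force N fun N =>
  force (bif Nat.ble b 149 then Nat.div b 2 else
    Nat.mul 24 (Nat.div (Nat.add (Nat.div (Nat.add b 2) 2) 22) 24)) fun m =>
  force (Nat.pow 2 (Nat.succ m)) fun M =>
  force (primorial n) fun Q =>
  force (Nat.succ (Nat.div (Nat.mul 6931472 b) 9200000)) fun D =>
  force (Nat.mod (Nat.mul M Q) 3) fun i =>
  force (bif Nat.ble b 119 then 1 else 512) fun W =>
  force (Nat.div m 24) fun u =>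
  force (Nat.mod m 24) fun r =>
  force (bif Nat.ble b 59 then 1 else bif Nat.ble b 119 then 2 else bif Nat.ble b 197 then 8 else
    bif Nat.ble b 301 then 4 else bif Nat.ble b 417 then 2 else 1) fun t =>
  force (Nat.add (Nat.pow 2 b) (Nat.div (Nat.pow 2 b) D)) fun T =>
  Nat.rec (fun N => N) (fun j f N =>
    force (Nat.add N (Nat.div N D)) fun L =>
    force (search t (Nat.mod (Nat.div d (Nat.pow B j)) B) fun digit =>
      step u r (Nat.succ m) M Q i W T digit L) fun k =>
    f (Nat.succ (Nat.mul M k))) c N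

theorem force_eq (x : ℕ) (f : ℕ → ℕ) : force x f = f x := rfl

theorem squarings_modEq (N t y : ℕ) : squarings N t y ≡ y ^ 2 ^ (24 * t) [MOD N] := by
  induction t with
  | zero => simpa [squarings] using Nat.ModEq.refl y
  | succ t ih =>
    have h8 : ∀ {a c : ℕ}, a ≡ c [MOD N] → Nat.mod (Nat.pow a 8) N ≡ c ^ 8 [MOD N] :=
      fun h => (Nat.mod_modEq _ _).trans (h.pow 8)
    have := h8 (h8 (h8 (h8 (h8 (h8 (h8 (h8 ih)))))))
    rw [← pow_mul, ← pow_mul, ← pow_mul, ← pow_mul, ← pow_mul, ← pow_mul, ← pow_mul, ← pow_mul]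
      at this
    rw [mul_add, pow_add]
    exact this

theorem squaringsOne_modEq (N t y : ℕ) : squaringsOne N t y ≡ y ^ 2 ^ t [MOD N] := by
  induction t with
  | zero => simpa [squaringsOne] using Nat.ModEq.refl y
  | succ t ih =>
    refine ((Nat.mod_modEq _ _).trans (ih.pow 2)).trans (congrArg (· % _) ?_)
    rw [← pow_mul, pow_succ]

theorem powThree_modEq {N k t : ℕ} (hk : k < 4096 ^ t) : powThree N k t ≡ 3 ^ k [MOD N] := by
  have key : ∀ i ≤ t, (Nat.rec 1 (fun i y => Nat.mod (Nat.mul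
      (Nat.pow (Nat.mod (Nat.pow (Nat.mod (Nat.pow (Nat.mod (Nat.pow y 8) N) 8) N) 8) N) 8)
      (Nat.pow 3 (Nat.mod (Nat.div k (Nat.pow 4096 (Nat.sub t (Nat.succ i)))) 4096))) N) i : ℕ)
      ≡ 3 ^ (k / 4096 ^ (t - i)) [MOD N] := by
    intro i hi
    induction i with
    | zero => simp [Nat.div_eq_of_lt hk, Nat.ModEq.refl]
    | succ i ih =>
      have h8 : ∀ {a c : ℕ}, a ≡ c [MOD N] → Nat.mod (Nat.pow a 8) N ≡ c ^ 8 [MOD N] :=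
        fun h => (Nat.mod_modEq _ _).trans (h.pow 8)
      have h := (h8 (h8 (h8 (ih (by omega))))).pow 8
      refine ((Nat.mod_modEq _ _).trans (h.mul_right _)).trans (congrArg (· % _) ?_)
      have e : k / 4096 ^ (t - i) = k / 4096 ^ (t - (i + 1)) / 4096 := by
        rw [Nat.div_div_eq_div_mul, ← pow_succ]
        congr 2
        omega
      change ((((3 ^ (k / 4096 ^ (t - i))) ^ 8) ^ 8) ^ 8) ^ 8 *
        3 ^ (k / 4096 ^ (t - (i + 1)) % 4096) = _
      rw [← pow_mul, ← pow_mul, ← pow_mul, ← pow_mul, ← pow_add, e]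
      congr 1
      omega
  have h := key t le_rfl
  rwa [Nat.sub_self, pow_zero, Nat.div_one] at h

theorem Covers.one {a : ℕ} (ha : 0 < a) : Covers a 1 := fun _ h h' => by omega

theorem Covers.step {a b D u r m Q i W digit N : ℕ} (hD : ∀ N, 65536 ≤ N → N < 2 ^ b →
      N / D ≤ N.primeCounting) (hm : m = 24 * u + r + 1) (ha : 0 < a) (h : Covers a N) :
    Covers a (2 ^ m * step u r m (2 ^ m) Q i W (2 ^ b + 2 ^ b / D) digit (N + N / D) + 1) := by
  rw [PrimeLadder.step, force_eq, force_eq]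
  generalize Nat.mul Q _ = k
  obtain rfl | hk := Nat.eq_zero_or_pos k
  · rw [Bool.cond_self]
    exact Covers.one ha
  rw [Bool.cond_eq_ite]
  split_ifs with hc
  · simp only [Bool.and_eq_true, Nat.ble_eq, Nat.beq_eq] at hc
    obtain ⟨h2, h3, h4, h5, h6⟩ := hc
    have h3 : N + N / D < 2 ^ b + 2 ^ b / D := h3
    have h1 : N < 2 ^ b := by
      by_contra! hN
      have := Nat.div_le_div_right (c := D) hN
      omega
    have h4 : 65536 ≤ N := by
      have := Nat.div_le_self N D
      omega
    refine h.trans (Covers.of_prime ?_ (h2.trans ?_))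
    · refine Nat.prime_of_proth (k := k) (m := m) rfl h5 ?_ (by omega) ?_
      · have := Nat.mul_pos (Nat.two_pow_pos m) hk
        change 2 ^ m * k + 1 ≠ 1
        omega
      have h7 : k < 4096 ^ (Nat.div (Nat.add m 11) 12) := by
        refine lt_of_lt_of_le (show k < 2 ^ m from h5) ?_
        rw [show 4096 = 2 ^ 12 by norm_num, ← pow_mul]
        refine Nat.pow_le_pow_right (by norm_num) ?_
        change m ≤ 12 * ((m + 11) / 12)
        omega
      have h8 := (squaringsOne_modEq _ r _).trans (((squarings_modEq _ u _).trans
        ((powThree_modEq (N := Nat.succ (Nat.mul (2 ^ m) k)) h7).pow _)).pow _)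
      rw [h6] at h8
      refine (congrArg (· % _) ?_).trans h8.symm
      rw [← pow_mul, ← pow_mul, ← pow_add, hm, Nat.add_sub_cancel]
    · have := hD N h4 h1
      omega
  · exact Covers.one ha

theorem Covers.search {a t c : ℕ} {f g : ℕ → ℕ} (h0 : Covers a (g 0))
    (h : ∀ d, Covers a (g (f d))) :
    Covers a (g (search t c f)) := by
  rw [PrimeLadder.search]
  generalize Nat.mul t c = s
  induction t with
  | zero => exact h0
  | succ t ih =>
    dsimp only
    rw [force_eq]
    cases Nat.beq _ 0
    · exact ih
    · exact h _

theorem Covers.block {a b n B c d N : ℕ} (ha : 0 < a) (h : Covers a N) :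
    Covers a (block b n B c d N) := by
  simp only [PrimeLadder.block, force_eq]
  generalize (bif Nat.ble b 149 then Nat.div b 2 else
    Nat.mul 24 (Nat.div (Nat.add (Nat.div (Nat.add b 2) 2) 22) 24)) = m
  generalize Nat.mod (Nat.mul (Nat.pow 2 (Nat.succ m)) (primorial n)) 3 = i
  generalize primorial n = Q
  generalize (bif Nat.ble b 59 then 1 else bif Nat.ble b 119 then 2 else
    bif Nat.ble b 197 then 8 else bif Nat.ble b 301 then 4 else
    bif Nat.ble b 417 then 2 else 1) = t
  induction c generalizing N with
  | zero => exact h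
  | succ c ih =>
    refine ih (Covers.search (g := fun k => Nat.succ (Nat.mul _ k)) ?_ fun _ =>
      h.step (fun N h1 h2 => div_le_primeCounting h1 h2) (by
      change m + 1 = 24 * (m / 24) + m % 24 + 1
      omega) ha)
    exact Covers.one ha

end PrimeLadder

namespace PrimeLadder

/-- A Proth number. -/
def rung (m n k : ℕ) : ℕ := 2 ^ m * (primorial n * k) + 1

theorem ladder_26 :
  block 125 7 3 265 0x41b11ffd71ca4749ca0da9234f21e8c15d85a4690e7463e00aeefc7f2e407cb4313af9e9004a5139d1b1e5a49676fc09bedd130a1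
  (block 121 6 3 257 0x39d50fada48be488d2bd70b5ea8a24accf92e4d482cd1ea5fdb642e79b773102395c2d32e31b18017416d5638d092f00fed17f
  (block 117 8 27 248 0x37589323070e3644974d69137dea2a0c5fb689c979e811a4a01e99e98da59db565c9ecfdcee84915283f15b82ca9cdfbb6c150bd486a96a936697478370654aa5a7e82808f77310b921fac203c7e4d5abf02e13127d770fb5c33c60816705cbf8a3b2fc3204bb3dc83fa1f907d71ad6dcf5887eb6cb7c9b84fa6ed7bf15b0b00c1e9ae38819f6cd1f2db38201a36d95b6386fcd
  (block 113 7 27 240 0x41be3c4904cbf6f3bb4bdb9ee4c76d681e5a942b8c97362c8813e49228bfe59119165ce0d9e6e2b805aad4202d46a23d965de911a332151b19778c1752be8e7f18c57b9dc2f48d84c313e88d840358e6505162d807d2689bd6fb517e980ea1a7dbbb44bbbd3bbd0a0314b91f8a12c3549863e192cae2ed912e2786c2e58ab0247fb23c9f7564f1d3fdd578b1fa43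
  (block 109 7 26 231 0x24c851e606a3c2b2744f4743ed65d3c14fd3288bc57e01c37af3c793b72e2a69e4b6e229cd87a0f5b883c2b647d720f5752f0d8912c3641f62296626965fecd9341b73e3509a33e30c4be8abfc21ed62c802705cb29377287d836ebc724e11deb1ebb6a5f5771eb22ad942fc381ed7a5119cea17ed1cef0e8155aa0ab004a421ea338b42312c2c2
  (block 105 7 25 223 0x591ee581208df5fb1c5e581b203c9bceafe67478da3e83cc3da08b3ed2407b78bbadb3d47e59e1cc955d3b8e405ba9f5694b844e9b3a792f6d1a2c0db35d5a4326b46f6267de2dbb12bf10de0c6dd60811d6b8a408b77111834acdb90ae9474c36ca7056f6f67e14963bfff7c634ce019c91b7eb7095344418878dbc4fe7a833ff7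
  (block 101 6 25 215 0x11a72c39a521d544d3c8c50079381cb85c8ab149aeab37ecd205e6257a95e91f1bd7c1cbd4f505221b3cecdabda613b0402f65f53f65fff705de849c660889914fee9e9fe0457193809c40f2dfc647282bb9ebd3d3e4f1052dc11096502ff343f87a57d786f66d9be29982e8acc3ead40fbd1d07906a0b3e71ced1bd85
  (block 97 6 25 207 0x12c0fc79fee368b44bb7f9db35fe0e5d3bfddfed9ce8e797ccd47cf28caca1db6dfd3e61b1b1af2617bf23a3d1c0742c5298976101fe7622ca12f7015fcf9e6bfb3bdbad912c80d1551fabd1d2763cd86125de96c6490f59ddf4736a697d7dd3529d0b5c18f841b8e747e862a30a75211b124ba1565b3d925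
  (block 93 5 25 198 0xbed66fd210936b6d786a450ec9db418a337d27effc1fe85e362a6ddd5d24bfc3c239ae099296038d8f6512dff89d09be06ed5614d8396e6613207b7eadf3f338ae971e85554f6d8201a76fc65c663afee98fc1f7d372efac3f35e26069d69e363feb9673e83e23b6c134980c127129791d8a
  (block 89 5 24 190 0xcca09fc5cc99e95679d6f3775356217d051243d3e02bb5d650b4b3e19b3e3dc94555eccc2a558f1bca6f51a54669fcfcd4043ef139b7c0dcd4ab0fccab97e8c0f9e0449764b025e6f346b0c8be8c161fa75c745edb6c7c995e8d894c3f85260df45a8486702ab841922c09d12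
  (block 85 4 24 181 0x28db17813d15aaab2c4e3d44f8548287e1deb161ab9540e92ea42129d2f787bc464bff4658c2ca781edcb2f5abc9f548fd4b4d00a9334fa16ce06976179f6f0441cb7a0b019d672ea1a9a70ef4e523e175dd014fc013d9a74a97656e92b2d3148f8c7d93ca132e8
  (block 81 4 23 174 0x1271d44990e7431768780118d2409baaae77b39280d06552bd3e9c28c4149b2293daa520c222cfc246aab2c90a5cdc48c9d3f8aac0fb2a4227c582653461eec64312d4fb637feb2c29aeda9088621e53406861b3061e4d880e11ed0f8e14b5fa6c73f
  (block 77 3 24 165 0x4fc2b3f4a768b2152be22f4f368fcf49ccaafb4e253ff7c19da7cb7f24ddedc9ff16b5f05efcf8b56cdf5cc3508b51ead40be9589e8f74cb7e781683c836890584546d624bc026bcfe040cf22d6fb523af5acd2d06f7ef520b13409f26c98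
  (block 73 3 23 154 0x56d3a4e999f640172d8185b2aceae7f44551762cf926be527657e344a2ead50adb9c70a47fd459e10eef0a336203ee26737841d7c8b67a5d99a0367bf4d52cd89787a5314c697ddbd8344694138478c970d8762427151d
  (block 69 2 23 145 0x1526a23427ae1b2a5a6f37fbdbaab35c02517900a5f2a3b6fff6382e645ef9b2a2e82c28bab32e3162465592c5ca875aba15400f5716a14be36e8a76ff26de3c28b2dcebbe233188da2a712e5d1818ddb387
  (block 65 2 22 137 0x105d03351e010b74378fb988204adea2a5f65fb08ac1952aa8c9e61c64108c34fa8a5762ecfbd7c1c49ca71107289c1bb417396713cb6b6c59e88278215526ea4c71a36a0b01ebcaf71cdabb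
  (block 61 2 21 65 0x9fa7c08f3d2c9e2477e794719155374e98f5f66c6f486399012ccb9054ea46ab828d36e
  (block 59 2 47 31 0x17db48a1f3b72c9b55ef4d8811257613d8a0ed2d795
  (block 58 1 54 31 0x4fd80e249386dffb1ffe7541a1d501fb2bf7964777ff
  (block 57 1 53 30 0x86dac5710cb2d7da534615638905b5ba05410db9f84
  (block 56 1 52 30 0x207e56e533808c9fed52fce41fa51ed37e691c8ae43
  (block 55 1 51 30 0x9fd23f9efffa861860de2bb6bb71f32ed4d8c57fb7
  (block 54 1 50 29 0x3a6c3eb361811fdcb8b035e765d591040d9b9b077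
  (block 53 1 49 28 0x118e55048828be28c03875ca69b91af3790ab9a8
  (block 52 0 61 28 0x57a43fdcb534e2cb4cf8c124fa835384aa4b34cb9
  (block 51 0 59 27 0xae623bcab2a6e305c31899c498d0d3cdd1154f1
  (block 50 0 58 27 0x127b2ac1ed084f1339992c8ab898497f59d898e1
  (block 49 0 57 26 0x3a9590440fa6ea1b4dbb79fe505d31313c71d
  (block 48 0 56 26 0xe7c0ebe6c2f82cdb81bd6d77507e7a4a712c4
  (block 47 0 55 25 0xd88186a4690ce2f8fa0a65fde8fa668e6d8
  (block 46 0 54 25 0x43482fbefc89436dfaeb2842e481fe4c154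
  (block 45 0 52 24 0x5f56680926c6555af58bfc83be62b02949
  (block 44 0 51 23 0xfbde34a75e5fcbc07a814b5dfe23a493
  (block 43 0 50 24 0x121684cf291c5f8d66021d769ba3b64c99
  (block 42 0 49 22 0x38a441d23ea6e805347c31e3ad420a1
  (block 41 0 48 22 0x111adb020387149667094b99c4cbc97
  (block 40 0 47 22 0x1006c378af6856c3509c70873fec853
  (block 39 0 46 21 0x6b2d7e3aa7c4aaabc1ed3d452bae8
  (block 38 0 44 21 0x718e8fbfb9d5f04db101917b855d
  (block 37 0 43 19 0x16ff719bb719617ae357a4d256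
  (block 36 0 42 20 0x12cbee7c799e41a9e2dd83292ea
  (block 35 0 41 19 0x582a01b173ba20dcc05fd4b1f
  (block 34 0 40 19 0x110499e9ecfbb61ab8207c0d6
  (block 33 0 39 18 0x42a61ad699bb48f5789d91c
  (block 32 0 37 18 0x187f13fad6bb056691089f9
  (block 31 0 36 17 0x69a96517fac42fb93ce28
  (block 30 0 35 17 0x34286f9533e35629b51531
  (block 29 0 34 16 0xda805784d0366e12f938
  (block 28 0 33 17 0x887f2e7178a15f30156cf
  (block 27 0 32 15 0x219c411808620920
  (block 26 0 31 16 0xac00ea25c3676bc256a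
  (33554432))))))))))))))))))))))))))))))))))))))))))))))))))) =
  rung 63 7 125249449343 := by
  decide +kernel

theorem ladder_129 :
  block 177 10 4 373 0x1c6dd80da50e3a10e8f624539e58608899302409591066433060dc1f988c2a7a06824120087d794299b22072321a0c1a225e6b08801bddf217bc4ce88afe03839c3480a609324154a11a3475a5d46c00a3922b908e00801540922040545
  (block 173 10 4 365 0x368305828004ee253ab440780530b11e20f28d088204618434544020f5a5054a60a47630d881d011b7808ea954d3154bed3e40f1481af31ad015c1b1c53415934bf20021b09521e44ccd9e0792bdea34e48f99800c5792368562d73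
  (block 169 9 4 356 0x1c5270110dd3326c9d86d460119fe0b0a31e4408411c5cc6388c68eea9813ad600c44155001cd11418101205e94463813c81993218a45c4071a49e9912ca1451518405cb1967280858001860226a60318ad038e050615f509c
  (block 165 8 4 348 0xb51e74019e4e4542c1c54535080971405261e1b6e4485145840c94006415a9a6b2696211118530042c48880f7484c2006a0f07b5250023052221125242c6bd08543328a20e21293c658a0541c46808880fa474851011a6
  (block 161 7 4 340 0x4261d4ce5114e1d50498c67d65c13c64024222d20cf1f9d40002709c575a44404209bc0960551964d0981cc1e517640009192101851980a95b84cdf33f00355ac0ac619270e92200923d8592d0978dd1852e0d5bff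
  (block 157 6 4 331 0x36189a45c154603b13473a743988449542114b3d69fc53930140986361d9f3e35040724bda0b715309d02ae5500e4d0b3412044141640ccbf241504a213158481621dca5ce220018f57206bece45721ac91995
  (block 153 6 4 323 0x12b09245b5490111dfca0f81021748002d24018d1010a2c14640410d0010840461d6ae54430504724f325d9c321da2846bb41c16801120094bc851bd6157b14285211821aee08f51c6019a0b0131205171
  (block 149 9 3 315 0x1e48c37bcd955e4f32a945441408e7a2c2e46fa9e76f49a94eccb03516eb4896c85bb350016ab4dcadfc3c8e3bbceb0ffa3b66202be56aec35abb234eca03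
  (block 145 9 3 306 0x1623365394910f5ef5f827e157fd70b1c68ad27e17bb2fa6e86fe0f663075fb1a22da18174f2b5fd247dd0568b33d43ffacb2adc4b163e98fef82893c8
  (block 141 9 3 298 0x25b8dfe931f5340187b981093818b01c97a1de8b4d03fee66f73cecb55db3d841a6647ac18122508438f16cee65cc20d80b54fe47d5e7427cf6cb7
  (block 137 8 3 290 0xc120b7a4a1cf0f6feec352657a6b241fec72593d306922f22ca5cc3682cd0deb5993a96a4008e4e8613bb01bfc60f1eb3f35f64ae309d848b8
  (block 133 8 3 281 0x2247bc1bc094944b6dcb1dacbfedb5cba92c6fe4e2fbe81a5374cdc4c197ef64410cee0558abd8e064fd02282bbc13f4f0c93a2f704187aa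
  (block 129 7 3 273 0x177d78c4a0521bfa508392e93e6c41865bddb1e54746e79a3e74a5afab9743528cac41550da87d1652ee07d2765005055f8f853dcd7c5
  ((rung 63 7 125249449343)))))))))))))) =
  rung 97 10 982592546017 := by
  decide +kernel

theorem ladder_181 :
  block 217 13 7 456 0xf029df8b43f7bd87524e2fabab8d84672494fee061228d50bfeb2994f857d179775059300a53393c4ecf73e56cd73f4e41d73be86e3fe14b22659f77df30f7b7e954443ba7979a6b91abcbcbd71af073222a4bbcebe968777847b37ef7605b0b05f49f6c121105cb29378d938377b6814beaa968f8e073e69d8588dbf22c7a70b01c8987b09b3c99d0834c0e637bacd466293213006abf2b4977ed1b8bc910a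
  (block 213 13 7 448 0x1c01531094f9fc2e64097d899b579b6080487cb5b32710af15242f55f3559445bf7cb00fb5190dffa2e0040a7931aa973d7a2048084260c7dca824a749f07925a878c318ead48a9c68e2994787c0645fc09fa9a65f4f342f6bbbf808fdb14ca8562cad5f9b5d8b37fd4cea5717ccecfd4dd3d35258cda2014624966bd21db7be1bef07487b46e1f5d0de57a64c7ea8262e2f3fc6f60d1b146a72cad65e7
  (block 209 12 7 440 0x3f4cf1f7f95613cd68cd23c9b759c21f2c9d5c9d5c4eebbaee8289f3dc0c35b5a8d4aaaceacf7dbd1dc07a2177bb25b98ecac7366423676dd9a2b1408a7cb7399bf08cddc8db41decf1f9e2f153755ad025cae57ae4e538ddb2fa8a039738501e4379aff0517ef155722154e05d116b24c84af6deb3ad5150ca8bd27efd30bde73f3af956951e27e4d3782147df4473f702f61855370e8c4b138a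
  (block 205 11 7 431 0x3890ee752774a7005932d2ecf5df47050df1f50c93c425a4fee0e3551168ee2e9601886f12a36cdce300ef3a1984a14f30d416437790811a6d31be21c51cf7fef32c748daaaab7b4638e01faa671a6f6a7657cfc091509acfc8f00bf45c63f8c346cd477caea69fa526fcf936b0dfbfd020337fe993eec43d0728e505833e2fef0a9fbdf08e9b3e9a61abf178ba6e7d246968df40243988
  (block 201 10 7 423 0x5c910e6fcea25a22608b76c0edc18315922ee98d19593444c3622564f4436a4c3fcf6a67f7ed3e00f7aa087a1c3a40187557762a13b6e260379888a6a4a208c82215a07b5b192cb7b5158160f13a9c210339d7023c7253bd45d2f4e9b169f60ffa80c38d210d636f4149778f24c767484ed00581ec46ba0e2e100a2b37801f75f27a1e7e09d7e8efa2df40a7416e348a8f1626e0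
  (block 197 10 4 414 0x14520fe03556668dc4ab5c9516000753803a243362551c400b2338fce610acab5950318289236e17087e8501b421dbb31bf0241013550d17401720f7291999562de0418a76c04d2a79b1c079cb126acd410b7e02b00806d6c0399180d510542846248d1b440df10
  (block 193 13 4 406 0x8061e02c6c53220605980a5728a2ab04380505f8ca6b6512a1741808c4e182d0a8dc516315b81968a8505e933001cd439c4584094a968403293444148719007a25624cb443cfc703b8460071a354dd25bb470616d6951038c44e41604c914610242842c0c56
  (block 189 13 4 398 0x1667c45836c212edcc191dc339cc20add61060a1254e62213c1cd470044204b4ab31125026156d024cde290990dfd26582163d416549e00390c1d5326e009a001a73e0eed5320f0835a814d9113f25340d40e62ecacb1453311d1ad013229a0d5871941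
  (block 185 12 4 390 0x748bb68998356551d18ec00d1c12297c40751ee4c9e0284a5267381ae51d0f4132450051610a669309a5501874104746846117d5510301846464ed8107ccd9120454178b505ef6181e2d59c0850a0048d7c80ba50080915304c3e5b02b9002c2e9f
  (block 181 11 4 381 0x1444530c1a159e0e5a45d77a5e45d5244b814647f060d203840283de964af14549c35b437015ee5443650013402822b6da8e9af0687279d30023041cbf95a19426aac41d8305852ac04c05850264145ba32083777188407b81000cd9466804
  ((rung 97 10 982592546017))))))))))) =
  rung 121 13 776395966279 := by
  decide +kernel

theorem ladder_221 :
  block 253 15 8 531 0x2866017618dfcc2e107a1699f330ee40c76a33926ee20e93cd3a65972397518506e3e61605b2bb3acf249761b7cb25766d2583a9a9381781f58766b6d225ce042bb4723a03997e9b624301d5d0d3baea33742454c378191531629e0a241993f9619213d008e2804d056780902f9dbb70f1823325b12e9960cf71d2063989ef69db0fb72354835e7f7f96c2c6b24a0f8b395f070a495d246c75c162af9b6e58e42cd7c3618a6bcfc0a422586c5e88b0713433201b31199471c8ae9679646a1b2283615b3033823b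
  (block 249 15 8 522 0x2c4704844a5486f048392fbbb27f839935abda4f110dac41bb37b2a2f8c1e468944722deaa29a89a43f668703ac93614dcae9b2a008d4b811b795e7b402536df0f1c19a4e21cb432be28a66003cb4ae390023c93767c29a04175a1c89a193ebc10b804d11caac04112330113ec215932cfa0baf5909b4c74ad2b92be6ffcd833e8a00944534c03917991d1d60e1535a329817f853520613f126817189a52f451f261e93a7185762448d2d3575de6ab455c1187c802c85ad5225a63649b4e4480f2836558
  (block 245 14 8 515 0x185b6dc00510473559ae9c8aea52b6f144cded4e177e470df85d0954c624d65005592661ed1ca13121128809c3bf68ac2ca962443e9846a2b31867eab5c3acd130d635af428ba42337d19744d72edd4233442d132008985bf4dde974800104d0f8ede4a4318a4e72e03d5a1c3c9512e80d7fed790aaa70667d1814731751a5512e47b8313582a7a3060779361bfb004ead52e149bdc41d8206da175a588d4f81dfdc59b9741280da325f361b2c12ec92d025bd94ec4ba1901693a8cbeddc96ec8f3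
  (block 241 17 7 506 0x1355c287d118eb564a4936610ad4c079850553bde7bf6ed70b7b4020d81b25389ab17c5e3a56a646f59eb7ec5612ff28837816ce028fb93fe369397c98aeeb145733db6089134c9bb301fd6e9860a5bfb0e6c3caf6ac3169d02f90c2c2d84c25baa076f5ad37290a04e620a8a2899ad2d60aa503fd234153d4c06507086dba61f8fd43520758f6535a7f468aa0526259b7d707c770b7d05aecb9942a34283f74a8b18e1eefeb55fa5c6f7e7d107dca425876
  (block 237 17 7 497 0x67778a0ab59d19d9c8b5095b21d884c553f6214aeaa6e211a0dc90c3d28648a0cd048f4d59d4a2fccd75b523c2988fa0cc93976521ba0d6deddd0fecb80c84a165c953c5025920d4b0b174009e8d85207eb92f2f412c2c9d31f6655b545e7db681c00e30f45432a2a8068804536e0a76b6a78d306843efed80977394e8eaf144607192b19c1403a1c91d8db8d13c404fe1cb1fa20a4090f80ffe92c89756cf2aa777c00f0dc548a9969a3ac362a87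
  (block 233 16 7 490 0x9bffb54ea2a37252263e494a0d96a1f0c7eb17be514768f3949e2cfa655f71dbae19d125a052fbbbe5a4fe33067583df26752695b14c3da8168ea770763ebc352dc167ad6439e90f1586f07ff1faf01d66260ba9e2b9eeb8a0c52f188fe26745e7131d06a953a80c033925acc4ed9467d804659a1bd4b35125936d7c122c9786edb9fada4910df8f9431bbe1b001077e15022b138c00782b0e44c6181a468a0bbdef4f6db465897502c9bc1d
  (block 229 15 7 481 0x246df53fc53643e4a6e9b9d669c82bab1f0272c47b7c4b7e9667e17242fd92e1729762ad4643a18e6837b54a385b2690a8810056a8e8fd9e931090c9c030d9a8a665b895e4cb419ddec085645976b78a4c731702c1bb9ee31acd88ed84864da2e9af346402198fcb810053d566cb1b6b0c96c92bac33b203b3a67ee35766c4e1f4c09e395e168aa1edebb557e1538bb2fe753c06124cd49921962215daaeaa858ba57f9397841f5353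
  (block 225 15 7 473 0x8a5627afc019f1bf43f481fe836ad5cb1a03db6c61c56f4fb94d88b538757cdd3f5e8f42fd42e6a0bb2be40e696bd7930b64d9497ab5e6f420aabac791018c1aee98d85cab717b3f8e8da89ff420ddf680842bad1c1eba072da33c603c380bdd09850fea873a06298a9b5bd2cff97b54b32bba6fda3f497c815e591e522edcd4dbeff5ffc7d2f2449f81999d7b64d240a0a8251b9d60eccde0e310ea17617289cbe312f27ddd
  (block 221 14 7 464 0x178bc972688d5014ad6cbe41cb412acd5aac0df5bfc0c1a141ca30d54ced28c78ffd70fb35754457090d35f738166a7514fb617d1e975637237c134b947c8a93eb81de5628e3aaf0e947c3974e9cd8cbe5d6b024dcfc326a5af33136a289fe51c19256120f0ec06341fcc51d430d98692aa400b48a8782077cc654ee14335f7aceed4f5ee56340742623844fc76e8ebe6110f00778f25ae33a345c75350a4873b56458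
  ((rung 121 13 776395966279)))))))))) =
  rung 145 15 1013066809912 := by
  decide +kernel

theorem ladder_257 :
  block 285 20 8 597 0x69e50974a03ce999748f4da539e2b813a12178694462b0d89ec8e46184d5c50b054e3384733485e43892cf657bacee03437ea89cf766e6ad02525124f0034cac949ae5fb363828e4bd9b8c146639f1838ef1ab766af4758821af559f2c52eb042110ab114aa2ac1a3956c6adce071982cc24bb4a30a6413767a0cc152b23628948017e8da7e423b2c1225615db2c4d7a55d85c52f90d7f013de94f67be50091908408a9d215e0375213e712efe90fe1b575b47056a91b2028e82de01d09dce017885d72cf89e1293e28360663941ae295d5a0fdea3cce42518d80855ca4adccf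
  (block 281 20 8 590 0x2bb57c4226bbdb6a4254e60752472e56af9f4c8cadbe1c0887f2f890440bd3151785f7d78d9992cdb366c3815c96486539d0ae0f8717b45cd185067d9241003042ca104d2f62b15cbf35728e447ae92b232e099231f0800bad969fc49b3c99e8001853e000c1401cb86e45b0048593c87b42c8f408bbe3a6c32410a62c93af680b1f84fa814fadf762ac5b90f531b6ffc79630e1cf05c96bd62b6f05d3c91f089c873171f08678f46872ac2a1922c4d7e0f06aad60516818428ae94d0b944261d8552ad9d74636eb147cf8a301d4ad3fa28e7116d6a29c8ec4014614ac3
  (block 277 19 8 581 0x13fd314d4ce8b7d3268dd1e9141b3c1b81ce5093401e580b10d26cea631f186b6c9eb8c2f97f0bea4d887662aa17f8174de776d6ebb62e8f53450091f157c80b2a7b00fb3d12ce63273c4ae4a26a55fa85d4db3ce6c2042dc730c8508ad9a8ff0532094c3b3f2259a3d30b70172c6df0b3f8a441fb48c9bd8e9d5235d207060fc3afde3198ca43d42e9af965629b4db03c6ee955ae06528d594a50b7fa0dfca7ab69b4cd6db0de8421b41a709927065dc914bb456f4e7240b057ab5ff45a062871103a9c0ed15d77e5c1446b229a14a32ee5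25eb086c2055fa4b
  (block 273 19 8 572 0x2f35c8247f854885f2241a00c59198e1020d6272a0d64488689bfa4b73dc9410ba67b7f22764c05c76513c40b9f9ac5ce83c113f3f087087910b4b513d9ac6ed4e4b404b80cab2a5a18435fd746d36c332493a77ecc6fca2534b739c532f1830300080023658c4e57420b0ed57567e49424fc7520185623ded3c944b8371d45081ac6081094555121240e1574168b43aa32d6adf9e75f34d5f0c4297c8353c5dc3ee02eb686617f9c9dbb06be25a79b8ea9f59c2d0eefe08a5fb2591008821467252a608cfacf885dd94302306be14d6180e2a80fb428
  (block 269 18 8 565 0x4f415458436c5965ae3a8f7970c25b004ddfa68882394873127109079270f8046081fc464f08e7374587788369448efc1c6ab8dbe092833203361d8322fb431de318070071b0db603b53f092fae8be7ecc243400829928a28a33b8898e6474982419cfb6413f0c4c47209e4192f53624f9d085a04834313d22c289a1e5d73942f22152e5575b64dae1ce9ee63630876a909089bb26c42c06940ebd6dc91939d0980166f92825536d8958e0dc3f9887606934c8b6bf00220298b5082195540c8d8134d0664dd77218d1c5aa007407f40443110e37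
  (block 265 17 8 556 0x18c6505676089a93c027bd022734f91d817639313263f69e0ddf10c8580d29c82527d03400d5867936ad220cf40e5093ff20647b5ad93f723c02f84093a5ca064482c63ce8886ffa172d40a96269dab60b348a047e35df01634ce2249322c1695586a5895ae7bf809712d7c1fb39abb443b929e2cf12ba843d046eb483b2480517202c9eb2a8d3164db554c4187df5fcd67508088f1dd38204e986f8ac9825651d086a874d19ff43e405bbb0e225ff8aa6a573e745aeb1c0cf71a3672d27986baf12866e4c86d1e8e666b00648ab2c96c
  (block 261 17 8 547 0xfbe2c43f16b4fa85df45390c338a60c3e6200461975ec32798e590f4c8980e441245e15f13ef75831b266187d4b86a5171000483129f74067e822a248c9fa644945b90a85334500a162f294148a32d016070a4e60910286ba181accca2c20b37c4ec9c64a040520a69b1dcfa485d3da0f600a68b82540a682039a87d94203f52901526605a89d8c2299189670344d682d25c4940a881f41780a3a7c35ddf6ebafd308346a7ca1d53cfb086d34facf52b9b49dc8d4a704ac8bf8cc40610a9386781f83c42eba4aca53517651c19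
  (block 257 16 8 540 0x74b1c998c78d05eb8f18b289b04616511041cbc892205e1e1d505b72f3c81b490117c7e494cb8d95e0b72adada950340c61cfc008cd4262820926c8e80df615433a1065df31360c9bc083daa3465255edd6c612292d584e4b3882d1844cb16862a64bdf2ab47188d46ac1f32c4f2164001a074cc08fa59cbc16391fac00c418050bcd217845afadcaef972104a299a24b5046d290ce1f6143523907c99637649a10d4ad3df314a6da01714050a0c538c06c74051e103916d399817c2d985d27aa414048aa67fcb48fd877
  ((rung 145 15 1013066809912))))))))) =
  rung 145 20 2603852433515 := by
  decide +kernel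

theorem ladder_289 :
  block 313 21 17 656 0xbd02945ca9cfa9cd34a71213276e4f212fa2f1337f5166b5600e7de8823df8b644d572f6c919bbd04e1ad3ba8acee26f4d7c6882e9dc9ebd4118d79f84f3d6dc037e46b4a18117cc2024b396a43056ce768948d1ef8f2309374ef083504d8f124a703e5749bf4584e25dd40ee9dbb9223c80239e1aa1f54fface4336a2c2a2e4d9ada15fe3cf63ca6835bd0dc07bdf5a005a881f9122e2316b33273758caa75f61d10c0497ef438ac52946f24ad4dddf9140b6a8646bba6702160a0ef30c49ef05b7cb54eeb18ca2437e153952f9f0ff9a02d8110418a159124a00eccb53086e08f1d7e8a05e22ce972002214d22a5e8c11efe01898c3cc98f97fdc329236389fb087cce508b29dc777bc3abf253c395aa499a397b7cb85eac328e39eba01a718ee4c3d2580868ec7d8e23156c09f076e3cd4f65afe0431103f739402f4cdb18913bb24e2dc0f74f20bcceb7a32c59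
  (block 309 20 17 647 0x5190c5b697ed175aee07531209c590871abf5f5505363964bb2c335927723ee94b58d52f77b29f10967cb4e7cec81527b4559cfe96e5ea37a4af68b4c2686be99e6c0549d896965afcdbce1e50c14e967b775d20ab5cf6662a57cfec18415e9de99eb4e8c84ec77a45357fb03cc98c4c38aed30fc0698bc8049ef87242bc4d20722ba624b51ba82593719ef896f82856cad01880619528bfa2fbd7978396e4f7e892d236f66d482f32a83654643f751349089d0e1e69ee773b2f59691e902f86a6a2dd38ebbbb84f363b74e20e09d0948585f668685aae576152496ca97781916d4045fa1cd50183e2d2e34f1d44192ec399112a17076218b5fcbc66e8ec3f898c45777e3a578f9a6e4cbfebc8624ba090c482a5d2fbf96985f4ba8f86e4a3b56687addd75502cb57a1fe1f398f073b67c34f9872cabed4672f002c8377396379c5764e579774162e9bb8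
  (block 305 20 16 639 0x8160d398d8afa185e2a6970b17a4b5a9168c00b698b47ad703bd86dc8ee6e8a1acdd35a7eec9c15a525385f710ccf54561df1120193192a9757dc8bd04070a13ee041a2cb737eab341dd0dd4bc11bc56dbb9a2cf24d24ac3cf8d3670741b71fdc8171eb7edcee9f0689cc2490696c96700b2487e5122835c958b6cd8701a30628c7f460ea71910dd9ad1f1357582b12b14437c4c86f565aa1d13031e1a6d7bb68e23aab0429082c4b78b00259d48814a69a785425862be7f22426880befe04da10d9b6120741736393eac2d40eb6a6b77789c250254050ca487db7b98ad207880f44fc9d166c83316c34264c83d26b68be204db1ec7ad94b161c7c4b2a0a4e061c04941e28d5fecb1800ebdbcad260dbf9ac60ec01c2810b537d6502299bb23ec52f1240fc02ce257d144081e15616c71a880a62cd8c946348c0684339b55a5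
  (block 301 19 9 631 0x9473b5e54a6fd3d8d9df7978a65f57a0c287b076da6343d98ea981c7c731bcc965a2982e54cbae84707a05e20b4c11fa234253512368f43b96ac5023e2861507e58878214b682bdf08351a93df11a199cd9cc665c687a253ba23c49beb85311775b79073f9b29331be9096cbbe05520e51f02976872f446e440644e68d4fa798740807cf547afe3e331da282839c55d4b38d2d171df013573755f13ab345498ada11a4e40e3e08a6166ce5c64d5e4df01a212077f03c920ee565da6909c788cf4c4e604149be0a1a43d6f7df42a9e934949f1b02edcfd469764177c902f1f4a55e78ce236f6ae89111f59f79da7b2c8f26810530a2b642352c6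
  (block 297 19 9 623 0x113ed5426a4477ad9f61d0a34f919c490ef015679114149e962fceffe848d956e7dfe03d04e7f9744fab1c475a91ae0db9338e83b89abbcaa2c398024174c1a9f68166a1027920034bc7d9ff03aba9b57db14cb9ef81cdf76eab1d621b6fc712f72435daf5af9b7d612e4f05bf24c806262fc5ae3a75fd4c98af651aa8813d4ec18e7b18134c9c893187e96086ae510f751ddbf037684cb8fcc2eb8f04849062bf8c2c33c86f5fcc0db366465d56bbc0bcbc116d2de78dd0d17e2a5f3632528720e6fa7c16a7e1e2b10e1aa405632dba3dbef5274939b53c2cae20b4ea5b8b56a0a6ff895a8e9cbc612e31103fe8ac140f981762151cb2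
  (block 293 18 9 614 0x3e4f083b053f458352f821447c724918a5b9d9fca6cab5630ea9ca1cd7a84351ee5162840856079d74f6dbb64a474b297e6e00de0e444e3ef39b4888daf783cfb12454adfab940c05f784bffe9d8a0b3d992a409167338911936672fcf50e7ccd069f948a81425a4fb8bc250d272f4ebf5b255acc36017b04567adc98dc52a6085896f811e747271aa51d82e258e149ae7299a539162a5ca7de5d6e6ad67b15a754655fcfa808e0ddc40c80e788f8b8ca8431a572f5d607837b67bfce7837f97aa6cfc199d483b7e64207b36ed55b67cb2a374c0bd273d7f8fc7f7932e9fd1f4214a58e13fd15e45261cb696ae10d4eafb0a2e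
  (block 289 21 8 606 0x1232d6b3dbdb2d0697e8ed2528d976019d67d252b700bc13544385dc6a8410732cd0143e8c007a1ab5a3784a8ecdff3c16da02493e841edacc1c38a4042a33ca0092d98454f7bda5b26b31ba44ed29afdc094da77db91d5158d843059471f9739cc124ac4b9e1cfe45012c54dfe94c8ac412d245477a20f0e4c2434c6ae0cd04c4db094d50b820d3d022175b04480d4d4a659e995805c360f0c7f9b802982f6137540e1a0e332fd069385562719ef78f269c5a25e97ab961a04c6b1448359e01340e4e3ce6fbdb5c1ffa48384ddb40ff3ee2843441cc36627c1ec730c9c99544c385617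
  ((rung 145 20 2603852433515)))))))) =
  rung 169 21 501997948126 := by
  decide +kernel

theorem ladder_317 :
  block 337 25 17 706 0x72fc8fa116c161fa552b1ebd532b43ce21332aec2c637085d3ed5613c2d1372d6992aa6ec8a470f58135f7e55b341d842f4da96dd1b47a8081a1b15307ee9f89815970512d152ee05d5bb10fa0c9dc61ce07a0000c75976fb51b85b4ecc0e3b5a61ed82dd541e47d1b88c1c733470b1bb20adc37b00ebb21e3832d083c5e49ac0bcac63c8189ae81cd1eeacfeb85136f987368163c143213c005b6746dc8d6cf3a7473f22b20de43a990cca4e098a061aa0be75f8ee852e9a58d69e9f492b2903be2fa2394e02e5a35f0574c76c3c5e48df52ac854b5b4ea4005c769ca3c3d21507669f76bf4b1bb11dc6769818f9c5ac8b7081a510cc2a902a95a25de52e009eec37d5cb699163eb92e9a96cfdf938112ccf7c2d4c8e2af3cd93dd87168eb9eb5908706e819829e606922e409d88cc2ff4aed6fa22648f33a5339953133840a6a9eb00a89a241e0871feedb91fe1e57b59e8fa385476869f1c100d925775fa158d425fe462cc0d65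
  (block 333 24 17 697 0x135616ba819b64c0bf4b02807a38a113c95a88576089344575dbee365da2eab7068627948d7287f96b9fe592ebdc5418dc1c4ef7b48c112a8f2f90354d1b924e7939c6235126a71b98447ad5fba72b9d51d42b1fae8833640112e23ef4e53abddcea747a22b1ba674e56af3c0d1c5ce0f200e095dc555c155bc3ffaec0f45a47525e2d20318c686983dc2a12cc7a9fb15023746f4966af1c9eb285204178009d9e1b2ea945a0e065100b0c09b114af63fb7cd30819840d40e59a0353fb44a283ede13add94ea7b21c16306c6cbcdc38de073682c7629ce38bca7a85767c5d675aa6d954866c16951c9b6d2b7338139ab72459bb817a598eea2916a1505b14549eda1eb0027475381e68ccf8fd8c4f891598b01d21ae91b910d27be5402f3558b4e6e4b7377b97325e0877ad90eb1c6214b924c7ebe0df2a604764154a7d08f0c25c46b844ce1270ddb9ba28be85e124fa7f719e17f423508abfc4bd685894f3259e64779f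
  (block 329 24 17 690 0xc5f51055dacbaea434798f4b356e9a6ef2a39b49da8bb1dd26564461f01cf73878905953e0af83eaba04ceada46bb3de344eee5e8de723589eebbee28949a17a2af932c87acc5dcdae3cc6b52554742f35d05a5b168c0d83ccdb37efed9731756870f0d2d182f24095b827d2c1ba1dea3d9f46f0dcf109cbdfec695873e95f95652ef284bfc111a105ef38a65d9f8bcc4e6653f45b947866337c504ad54842cd9fa07afb9af6b60613be9b2a9313ad2c1c17d85bc9af48f3d27bb202491e728892d684d507228f071bafd80b51cea6e74b6b738a2b5211bba6e92d8145c12e8dcd62e9a76eef67640de74d29717565284ef086d316512923889bcbf3cef4d7de31397c30c8b3b3433643757136d5e9f7a68b6dee61438440557380bdd4f18989bde9242a7fc35d41a2d9f6514704fe0b6c58da81e1d1b4eb17a28082c21a2f56346fe87ad3eaec9620718808a3737e82b3c6c42521e2ba19382c84c388774cf57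
  (block 325 23 17 680 0x8972eb88f67c12944a7ad94e8af8046dc4d2dcf8f453466872bae7ef33c87bd127173d42c9584ad948b8f7d92fda5bc6b71204c8055c8e133e2cfafc955f0b4e42bbb395181979cb820ee439176e50389ec35469b5f01a34ef9363efbadd202e6abecd6dba0120c11cc804f493a31a80f30ad03ff2ef4cc9bcfb26591a852684f5d117cec27a0f83628a83eea09a9e3ea766e405f6bbbecc9a506902eb39b265670394b274100e592b92f2c15e810f165fa1c047436c690db83efedf6ec41e731eafd593a8dcef8f0647c44468b78ede35228756117503e8e82a5d3b3226e903a6dacccc35b47b196c488d43320859aa3831b0a39bec9fe96745f9a9f432e75f51fe7952056764f516327d233a5affa3b51f7ce90ca68abd48cffdfb86a5b2e8cb861e5bf996a5d8b41d3fed35e2cae895a0b770876e3e2cd0194054103fae6439c6ffc0a1e5a80e5613a4cac5475a3f89441b4b2662fb840862a7e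
  (block 321 22 17 673 0x6a360981ea4191f5f70a15efa11e6990d06d0012fc0e0ddf17c2031cd5b0cf3463b985843f66ff9729b63d2acb68997c4936294d4ecd8d1e595d935976cf3960a3da0d3d96361be80b41b2960f4a03c7ce79400a21f0595bf695ebfb958628bbf64b63d1691666c0816157f3443f4af63481a0f3ff7c2dfaea07c922149abd8b694e03e55ea6e6975209deacb012baff49e8f73649d99df5b68e04e3d29d566d43837f8a3c08315db817a5ee81b761e7fd95b213cd812a7bbb6f0310828f6df726286d6c9714a84b84ba3637d3c9ccfee3bf7cf0225ecac63ce740213417cdbc92f2d5c588ce0344b95f42bbec8f41041dbeed03587912419150668a49bbfad14dd722dc337f6d7296287ae14efc16ad26403fdf40bf8f6be9ec3b5bf1aa66462cb98a4db23bb7389847ee0838e424527a424c82e464ff5fb8210740d9bca3286e0b59a31261a0add9ebcb6acca39506f46a6156c39aa692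
  (block 317 22 17 664 0x49c9ed9e79093d91800a027b763e2035829f2b2feb9dcf2deb710b5ff790179ee3642f037b3e1f4d87d0c6032aac767b506fbe1155147dda0b8612d78798660cded4897eb518dd1c35d290d422cb736c6772fbd4dcc20d4684273b4a82fcef940055451c812d979b91f1d6763aa091b690e22eaad8392f23f4545c891bb58a6c14978a79ad775222441a1da7882245a0d11ef6919a289cd55f72dd3ac2ca020aa642a555be6911904649a1b2313fcfe3fa20ff818472654e307765249d6127c2e6ea3b8f65767e5cdbc9ff311b81be3fd5bb979d84bf94ac97093ba11f973556cebcfdf8dfb7216afd149c77eb6972fab838fc0ba4e6175af189cb60891571f2ea928bab2b6ee1780bac28d311d38a6b0dbee7bbb0650f8a49c915f9579821c520d2e9bdaa4cf1dd9004b19e11e3c4252ada0bb8c9b91703abe605212e6529d1785b21cf4fcdd23d66d3f0dbdc70790d6ca60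
  ((rung 169 21 501997948126))))))) =
  rung 169 25 93712507663 := by
  decide +kernel

theorem ladder_341 :
  block 361 25 18 756 0x11c6a0ce23606106803a026322a69420bad995d08a3a6a1822d6e90593a686aa1ae0ac58878554d54477caa609f3d49117c2ce4a1b9d4d6d082bfc324d60067047e53259d778e7ea52940661025256abb9fd5bd15008cd9bb7a756d17c9959fa8fbe6cbb52fb3359ae90b1a0745d44d5113c9b0f515686f6134211ced13be960aad91d6fd977c3f32647fb0b104bf826a51f6c5e0c905e1e214f2852a5e51997c3d10bbd9994ef4a0da6961c0f6c845e02a8541e4f69600a1477aed7ac671374fbbe8fab39e23760add9e5ebb1fbea719129ac5683fed2b42b52e9c9e930270d26ce8f4a81018b56b5067ada81355b6e1833d3cb199d93b8dd14d75c1b7f4a859af7688052a13a25481217c3bb6b902f431840ec50c653f9b0b98f9c90a3c56893f8a80f3f13c70131336ce2229904ab945bba9b80234c722ad5662ac38b9839acaa8d1c2068c6666a226f99deb23e560686e4e62c371ea3adcee6c6935203906c7c25ce978c16fcaed3df26f83640251eccb32d195b4713c3943699f1dc818551a0cd7f77a204c5b2dd4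
  (block 357 24 18 747 0x5a033e771ec10a4ce5d8437ee9bc72077f155a1356f921f721c57daf54cffd9f03982645d0be3f5a51c3985c4f7d24a08b104fe692c7207caaeb7c366797af0bdb76ccfbf3393b04dd3b8e5acc534e43d09658fad19fec43c1fbf5276ca7dfc9209ff6639687425951c81814a274475b2b135267c06beec6681f013f98c75bf411aac7a81b8b161751eb590b8ef3d0944763cdca34492fe13e4317598f0b602a241cc2433e971f27384fa570a48e1b3070d5127fb0ec168a0b74a285a96d04ff093987c14a891756ede2968b86dc5df6a6ba6ff008a09358b611bb663e6fe743676dc91b4cef7e443712c7afccb6fc0c06105a502594ce2e1a05361596a9a0116c2ed8d44a621f1cb67226995ab329dee36b49a5b86ff64cfc7980fcbf6def252c43a71937b23cba57c93e89a2f6062aa3710182877fcc14f3f72d4c2852e15ab12e7c77abbdf587588bdb798e4db6b6592000bd19a8bec5e0b12a285036292d39134fff7ece3737a526ed40a6d2831f03f21e89fc4a6828bda773e6df36117623c5e539ba7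
  (block 353 24 18 740 0x255625cdafdef3995b377fefed6ae83d7763138939e61570108ed2b753a5143aa70cf997cb2832066454d0bf2df11f9b4a2e4c5d96c674b8c405a3b87aec1c315061a5b93de34acc797f9c46d09e922a65b89e5f08b6654f80c2fe5d82a7fb306ec1278b58488e583d5e328d0b8fb189e56a5f6341e2112e2cea69084e6b866ff38b653cba894bc90e91161112b5c0025a8dec14c9da43e374cfea80d08f9eb0160d89757249c5ada10e1e20e546e9e93f7b54c889eae0fa417196540e1049f6634ca64a28915e69d50cb1e65d771f64b132c24a4a260922f84a39d474a2d3812875f1c983708a06ae759aa393a9fee30ee74e92f914f4bf9ae6b407b1e7fcbfdf17ccaff68472d7048d8eff7641a845bb85e4021746cee8f717418e4d7efc2504a8bd0982cabfee88871396fa37ecbc41c7c62ba5867b9776f824cb7abca7ccc432cfcb1baa5fce6911d0a9ddeb9e50bdf0813a8fbfcd4dcb50eccc79fd1dbb11e034af33697c2007dfcd9c570334edc669d66bd2f197f376c398256dacfda0e155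
  (block 349 23 18 730 0x1d0d6b04e226c79fd00ff2224555f2e02ee1e00ec3a5b9f6df62f6d67c7e7255a24f1abb11f78c5f37fca229e86b238b354bb245e64d528c55fe30a69af4a5628b6f68deb22f67f9f814e658f8483f3c6c16fec78e51bc4ec56f7c16892a5e162f843231c1aea0a8316f0820372d87dcbfb6e6424ad32b22a345d0b32b16065da3530cd7991893adfc6d679374f6182f8fef32a74232fa06516ef477dee01e314219c2fefe9600f196a0b1f8e5b119ebf0f1e4b7d8d3ff1bc447c8c49e37ee5c7ab2c87a43b4f68f78155922abc16fb1f3d605d8c22767ac0a08d40b0de5e8ebd3b70d281d1f492cadd4cffb40c9d699f2cc88a624d035e083ccceeb914c35f4e6241b6e2bed951cfe42b8239de08f1096d896fe39e7de602e5a7d1d34e714352462567d386b842f7dbd2ae0e424be27df287102045d999cc30bd6470bd0dffacaa8cf38b84cf9f4ce8bfd060eac1c0ad68ac0af921518dd3373721a44cf43b8f80a803eae45c0044cbcffc7b60049d2f11a27e3131321576d093560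
  (block 345 22 18 723 0x3d7606a8f4c5c1572521c76dcfbbcd3edf9491dee9e7a5f53db1f0c5495e20e761694a42d05ca9cbff0504e7c881df6052755893cb67c5429b0d709999297cd9f68eb3f462b424868d161d3351884645e34bef68bfa5cdafaa624076651bf91ba3fe9fe7149950363a08af3a254fc505bcd91dc32d26593a7ba9753d4633fdcfe91b73bc5cd2a434b63b3fd71794876772ff631e96d12d1458dc69cf3c9784e8c5bda96aa8fcb93c5507358cf0f23a34837c9aee8a1e2ae07f7e6c7f287f3bc7efe270c9cb2ef5d4ba169e3cc6e0be9519803a34b7865531ce85ae4237b2b576f5dcf980a667357a01385d1505523e5d3c4a9e37dd19960e3430448b070f9f93bae51090c575e1ebd6a6da91645d63577e44ca2d697346bb0dc940607c48cc0224fa7b03d77de7f9e7b45be9aab3017fcb34c1728a0f4d1053c4122a72361117e81d82bfd2842c83639b9e14e6b4f239ce3c01e99cdcb7912f3745b7d7d46d364a2191d245c0c13128fab8b2040f47654de3dd01a65229757f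
  (block 341 22 18 714 0x25e93419746fc863974660adb3e0075db71f87a8eb3a5e7147781132004c9d6fbb2191a601446ad85f2288fe6a9a95e1cb05e119ef479bf5638d4268c40435536465e2a014fbf5fa337533781948b50a4ab8a5fbace735a9c50fdf1b9803658c3dfa16844b2da022d7b14fbef0c79b330e0d44e45f9938d229218f2b0f7c20555065065f991711b942e442bf0971e06a5bb0fcc198e58305f9b24135ae6967e20a8da6085030a6c6798af0ce013cef74a0269957e0a7b32bef68867f0922beac2b971e85230c280aa2857edef4823a0f9d63b62c7d352917559c8ec65252b0ab8c5d0f8f67e2816b58439a511452887190b433a9568a5842e818c2410f28b3b22597f9f382dba975185b09a01e86d18816ec40fa06b61ba3845e0802561dd2fb83bbaaabbd4b63bdf366f4b97faca89f0fee9ab0a398f01339054674390d8d33fc83e9ea53c1c03e5c5b13d0b4f807606d46bc3896b6de8d81c2834b9d9b471c998041df3e5512dd6be4f11b211a106aecf3e305d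
  ((rung 169 25 93712507663))))))) =
  rung 193 25 93757683874 := by
  decide +kernel

theorem ladder_365 :
  block 385 28 19 808 0x11cca075fc88e5eface8a5d31db899987dd442807a1a7d8486973eff13135e29a254c45d935babcb5c4f12fa76fe82efb3f6a64aaf7655ffcb4daeee8e7d8bed0c1dbc20d86bfea9d6383618c8636b8491c91e23ec3a835886b4619c53a0c5e8c3cecfd4aadfe3ee71745022f95905b545ee094ced4a79e862e479096f76cd0fdc1ffa4b742dc65e7c440fd006b27b1babaf5096bc6272badb5f5181055512f6aba39425f44ddafca7dd02f56ea2793eeaf321ce7bee566ec77abc3844872356d1198f3b4fb3fb1cbbe972b1c2527daa030c389acfd192aa54b6e7a4c4759a6bf43d522e4c63548edc06bf2495a02b70e86b17c9d015ff6c485e67712bf4ae576eb118944ff184e55065a32a48d61c9cee7afd9846f0bd349d0b0c7dada2eff306714b44e2ffb0788f3c50303a7a5c7de611406bb24fced73f3864dc8355d10d437b57d4318ac7fed1c01954d05ed9e26286b50daef4372f9572bb08d49d4182e3c951841574e431443939dd601bb786de4e78fed43b1ff7b0aa2ef70ab141335c508efa1d28e085a9cff05361e44d5b238255e9a673e0a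007a4333d319d8201ba582fca0104d3a3d58be2597
  (block 381 28 19 800 0xe3b75ad16be136d3f757f7c309e2df813febb811a1c2636887b11126e205e25fb0c33f57542238062a38c5672ff8db687a07d19294f67cc733e1a56349a1dfc4f0b0f2c9846664c408abb1bb221a178e26c49fad7e5cb8290e1275073eea7b05d55f7fbbbe3d811b37e4c39ce34c9d056707d80e7c321b5bc5fb29bf2989cb88d0c77a32db5393888e5382688ad2c2677e4f598a220310abfc3c6cacd13b75f6d34e8d293d4660c688f9471f9a455ec7607fd1c5fbb97b641b9964f3be57afef14a8404b13ed8385816c5b0525e05cd4791b6b37466d72b367f057a888fa68e2ac4879e1965eb2509e823ac3becfdfa509fc5bca2380f65f9517c683065084894263799b2be9e50a035983424eec9e80730b8f809fa2812936866cf65642c5bb1f39d96615f58354f7fdd184b5e93d1d2a162fdca3639045cd3d05bc8d6aefa2320e2f58439d981f309d338db5e56bd77e444fbdb3027fb692a04458fbbdd8478a067737e794bfef369f1c580e0f70d467499542ca89863a6085352936cbc028e044a2af2b64b5bae91cd2dd2775eda47f57890da506a227909a072060a992ff22a5bfebed5f7471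
  (block 377 27 19 792 0xdb79c2df1746bd3ccbb7d3f9270b7a03ca6e2d3c6184edba07741abae043b0ec006ea7b810cfc39c1d6c20fa694a2dd5b9933fd9278445603e40989aa058f8c446038006786eab0e0064eed6b9e0816fe4f2db81d0ff1dca12de78b9def185047f636146bcd067e81a5334feaf3411763be3dbcab761916f2474746145571ccd7ce74abb38c0e97ac114700a6217a60fd9cbb42ccd68d669b871735066d8863a1fd1985540927aa04996f20562a8f94169372324ed02d58f63863e06c9b61b5a25214425a8b713c5486b72731918adfc2b772bf3805795d2c40e49787e074d5083592533c38be1b2a8e31fbb87e4e7f0807c6243abf120254cbffec175f487b7204aee5ead20a8fe2dbe0623afdaafb7290052e3ab6fc663056f4eecd87236932058399f41d3a763021c213e0426cc734280b57c59978050c42192d06bad632dea522bd563e7758a6364738ab5a14f923c1669c5bdcc6ceff561d03e947ad4784c46c617d406e44eb88b9b85e1805b85c95f6e1c19f28c4031d71033d5cf07462c9e062b32e7d379dd9e573a4f715fa9638073b616463d063d8598fb9b3ec814046a59636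
  (block 373 26 19 783 0x4eb9944d04d98771f90a6c1930682291b11c89d79dd4eeeafc024317dad553c5d81bfd33bd8c24acc22680ea52fb7d22bbd8dc7d823a088da43396b209bca55070074730b1a0f78258a2dedf793a509f09c30eb6613e39b5f8dd909a98043cc0c0e18fe199d5cfc77caf946bd0cc776d12d2bec384fac47ebd2338ba53c3f85e7d3d0b22e7c59ff750a294653c61922cc16c5ffe4e1417788fedd96ccb55ef1e1381f693949362a388eaaecc9be013e83f617ab77eccc6aef728d751bae91c9831fbb35687e282ac4873796c11ac05ce1452cd384bae2a1eca14c7e8d18262c7ddf852ea05d98e21849370c38052ee45152fb52ce9351407fa7f6d17cab09cae9cf1384e96f7a9b4104d1ca1454bfef4afe557f9689b8259d6a00e83f8378b813172afcc8b50423613f6b9a02fb8b3900274dc86daac30daa29f708e52e801c2d78a9b3779c6497be6fd9c56a883d302a5ef960b426758d029d96252a909539f3681415405d729daa57d7c687b177933f2c24b679acc8cf215332e739e34b9d857a1bd63bcb7126659445717abd137c90ba82714e0f8d73cd6e26d63d5df6ac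
  (block 369 26 18 775 0x9370494acfd9707ec7f837851c3431d7a76e8497f4f7b052d3bd387bc84b9e238d02db740bea22f6b25b90e4f1033e307505d8d22629eb2920dba7f23d26c1229ce2d422bd0033457071e4aa2f04c8dfb02b95b2e31f095e672375f818daebbd5e5f99166498b9f62b2386b0fafe7d5cebb2341542e73f13723c8197ac036f89f8d0e45466b58554163d5d81e50c50c6ae2429ba37418e13af5e4ac45429167e75edb7210a9371844f21113ebce75f11b850ab1bb308959356506e543f38274925b424e6179e4bf6518b1001488f295625dba2a9f9f14d776713a81b1e2015e4a34f01245ddb8710452c48f7f31f905f84ddd121dad54e92d6a0007efcb50cb4e7bfde0d9ace940084e56c2f0c8331a1089ad558e4b0b190fc0c6ad9cf60b6f4273ec9f7ad0be76622dfc3ec7b74e1cfdedac1e119aa3e981fa1fabdacd42f6a4b99dee280c8c08fe652ef5decb0324fee8b34f2219e1c6be59964b01d5813bcf4d75dd09023b935c38cc94c4c3c6bb313810222ba21e7089ecd3e32b1572f0d8a24ebb80de6d987abb393d3033ecbff26df5921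
  (block 365 25 18 764 0x13a017d6ef9908248449dbf45ea72cef74573e447dfa91934d6650ef7de0e8798c050cbb6f2172065c1c0de6699d00f382b9b4a1f4d0e7aa91abe9bc440a1d4e0f2567d715f65558676a4e54b7245606382e5961019a10afe3df657236722f0020244e9b5dfd132c059768c3bd2c490d05033b21f104d517bb2829114b0b53c5729d1c20ea11ea44f583b27ec903898a47abaf342d53d4b5251089f2e2da13efad07274eaaeeb3e67e41e37cf069be10c02e7e681cc107271479bd53ed87ea3f037fddb21666b62570b307a2b6ed42fa9c634edf65ac221dcdc36a4261e11b36511dd12e2b666c6024a5a3a50400f34cfb21e0fe7af1635cdbe575b353d5dfd1179497ee1f96820a805dce15191e0a75aeba8cf70773b22df455a9aeabde765d95a5fd7c3a6f57d986fb90f3525359ea5f5ba0d5c4263ab86efd26bde42497c062b74749d2e9f817ed82ce33a496a5fd61834fe89a0f14f7a229885e565b045ba3f7924437086b15ec116cf2f37f1dd7fc49407d0ac4ef2ad7bf2db41e7c1555a8d29e19ed5f903a6125c6c0a4102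
  ((rung 193 25 93757683874))))))) =
  rung 193 28 1191939655681 := by
  decide +kernel

theorem ladder_389 :
  block 405 28 20 850 0xf7eb2b8b2947ad59fc9b889cc75d2e5d6caa18f5951e2f4893b32b373534702aaba60e3c1bf7400ad0923156fe459604a25a2fd5f2f00050d50d9a1d597b1f128fce511b038155db84d7107e2897887058a1d079afcbd3075ebeff0b5e1713cce00723f249c79496b4499fe62bbd6850cffb700d9cc9412b67a716b73678643723fcf4b5c76705bf24a25a351efa9208ae7722f2179a4c7af8051246d2b914c481944ce43420a8ad2aba5cb44bd77bba1141ee70eb0068fa31fb75f062ee01207e2f7d581fbb1d2245e95d43c26522f9920fb60bb0223c15785a088c199285251eaca366ee5063d1b77964b0aa8362b9cb88d9869093ac382d7d4d25cf4a34af25c60d2e91430a019a85179f80d058d24db28469d94a8873d6f1d37764fd90e8e675015ef3f2dc4bf6594e1444363dab7207a5ba7cc9d4e1802e96f5027908bbbf19243a7d22e8a23679957e381b810cd3572082426717c9244f7715971f290ee184bc8232c5673f2723033bd2d8518d5e163b3a28d2a6e2c160c39380e650726898ea4174bc2a2ccd4b16edad000125b0935b5269ce8bebdb21f46ecace39f9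9792ab94fbde48081bddb17a1d21ef5ceea1160a7a3af65c8c2fb48a483d0d6726760ae671c6d72708cf28
  (block 401 27 20 842 0x5eb6e7bb41fe464262e5785e4187b2adff8ab4c06ffe53929de988fa70a161cac00fc521a061f8d1062101465d18a1a315fdacc9697df4ce426dd9e55edfb150e138b1be69edc23e8f3390f67c6e140db5629e374578d394bc54c22db71d23329e17376ee87ab93a4ef0b216dbdc3eb42f8d0242de7b4b8cd6432126a881afcb5acd2235689d0e1a5c131322d9d1580968bd1f8191ddb5a5f45812463f8032fba4751024908e686b03f0f5b3e4feb8fa91c014c65f3fcad68ffe48e21b584d628279755a61496748f930113155f1d448aa09fdb8cf8d2d7c3fa57c72b2e066ac73196641241c83335875597031855852618933037d3f5213289fef2e633f9a1908d24b4c39511476b92e9b96a36b6a2fa2b2b548ed8bea40b9c3f76ae9e9e693423be3cd06d3d02f96ed2c835d41a92304bab06965255e2c3f71618fefcb93c33d4021942d04d5dc22462b0921f196d1dcdfafbf86089b15d1e96eab6625e8872af4432c8343ca6726c2984fe6c521cdf2f6f9a60fe310490285d3acce9b5a899f74805e140634dd3684b488a42ea777e0433b98daaaa32f197fcb9274d9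a283b20bea42a93a413c87c91d50dba01aae97e8b18b0d42c78ac0ed71deecf2f6f3f9d0990c791756
  (block 397 26 20 833 0x93db0ef182a545b730ae2ee88e845e3d442ad3abde63423b5000303a4241f632696a92862c8555d8da4251fb34db3c89be414465495cac9db9ff06616e1c506d77377c2c5ffef3fb817192e34e7f14c2c7c344de8e8fb0f73262ddba4aa3b1bd6b9657436073a4f96bc37fd7d38915bcd83d5a8c360b162d4c493aefb2d5bdb7dea12a061468a5362e3a7f497842e31420955ab18a7116b233581f3792c8ff5620cd531b72c4751ea1b8377e9f52b20fcce4ac3c48385d4860469b7536325761351959e3068b2c81787cc9fccb1dff3b64633956536923a6351d7ea5834c5d2889e99d44072d0ac6e69f6ec84170b43c480170ba08fff960cdda561949d11d1205d3c4db962c56f597f22ce47f88bfe2750f5f66986c9a813dc700489aaad845a96eeeb41ef4c6dad3dae5009014b625320e6062553df06470372d45ae7fba5c50bcf85842b1ddd64594ff53224a249a5e218f7a42eca65810283b0d724b8f5d10c8f61f13eb98a2f11c84444a8188adf2774d3af1a396f98ee1774f70903baf14e602a2151cb7caa5487ef72ba2f5a054fea8f36cf87741d33bfb2719f01836afa30d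d1753b5a29a9a7954fb6e92d96c3ca28eeae8b62f0bfd96918648e1b884ccd
  (block 393 26 20 825 0x2f24fd5a19188171061217c693760d630cf15b2a0ed8a2446932a7f38a7755f3f2c8ffa616824b21e02034284b41c6215ab6544bbea9105485781b8dd6404c97de57895f85de4a848cbad52a70cbfa4184ed35c8f07d01e15c8c5acb1a830f07b868242c0423ea3bbbf9e997c16ddffb9fbd7ecd29157f771f88ecb06f00e199e3cd47452a507c5e05d4b5fe4c25f76f3c11a914ac6f6405f586816bac89cbe3bec2f46e2cdaebd5a2f25e207de81a06eae641d8c3a1c8207fab40b8990daee6c11db08cb32b84672a6e6825dbb3180250f6d3522c112fb5318f8e89ed82445a2959e05551138a955c56a8e218ed21774d5a7da47a386820c3c7b4e76f77fd6596c0116209f2bf8bf900ac5174210c5d5a61855666f628840217e81ee80dcbfbac807f87a0a6b55ccac46c45cb1ce948e821f6e7d1ca3ff9bbabde38a618ab9f5323435023c53449bd1b393f05e2758e71386d3de1179f7fe9ed83d9b697b93a7a950ef01ca7a5b07dcc31641972055bb1c406c23e5f42fc0d686740d5498e94db8efd1fdeeaff11b3de76a985a9f79ea3d776e2e544c137a7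befa64c2f5488a4ea3de9dbe0bd3962c7e2a5c1d81ae51803eb08762fcd4115c06e3ecd38a
  (block 389 25 20 817 0x6d310883f3abed173ecfb86828cd2a27e7a36217828b514fdc722e66c8ac4e474eb230a9b89553bca28b9121acdc1fa3b61e1cff41557d93cd132ede8540ab4c01378e6e06a44a27bcefeaf61435608ba1558ba4b3abad677df5cb9e6bbea7e6cabdc302015bc1461e763b7c0bb98ae414afd6ee74d06467b5028d5a0494c78523dde10a1778d2738b9768d8a087623fef12f2525ed6a808d51100cd80924fc457ae171a0d5cc2b0a3a768b8e8e93b9061efaff7a823afdeb3e806e3a0f633b205c19faf52bcc9c1624afd9f78b4c316b501deda6c340d01579d48fce518f3835d7f2c08c91885f9120e9ac2a2897e5f9bdb4560fa8b4603acafdd128987df6ffb3988e41f5525c55fb767762065d89ac49b73bb45c953394bb8fcfa5fdb8db2c8aa5b7348c0e84030707e4df2c7eebb786dbaf114fa9f73d5da143760b83eaf8a8d960af6b267444e4583d9bccfe9546fa833cb6e1b344ccbec82df963d1b629a9c8e999a65ca53c60faa8f919b4f009e8478fdb08db4f04ebbbd263749527c408745337a2fb1cfec4e33bad0d8fa8f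ed153729eec86ff194ff636f66c9a36913f520b4f9d298e10ef09e5909eedf73a4e5363708e37ec99dc
  ((rung 193 28 1191939655681)))))) =
  rung 217 28 74598679327 := by
  decide +kernel

theorem ladder_409 :
  block 425 30 40 891 0x2394b464829e6497930424df66287ed7786480b0ee3c1d26d400d28066492a49813e2fb440e89bef2746f3e0f5a9c0ba5b0fe4167cf5323764724db1c8b194456f06a1e2222ec9085cc6a45ebbe6495b58e3a50f2ef89af29ef9337e5adf611935111b51a8ce026d0f9423c54f70dcc054c90158d266301db801d8b03f9b220452f5885e41c561adb4cd144a760a3ff227afe9c883a7de45ae2ff7e8e8428391a66eb675ee785adbae615daacf46dbcab339cd97a604a738ec3c1a2c160047a8673458f7ff3e8abe1240b9583c2b27e9cb596fd8ab4cbdfe03a5c8450a4c5ffb2be77eb7267e6ff890739e491f4e2cc46aa388c9119a5e2c262abde4066d8107e25a507a1a65b6d8ed73e84d95985f3e8370232d78b80030bf18cc0ab1d2f17c3862e2e5e46f48df9eadb13bcae178ae1859fe251e9ff418dbe94049f1404ec09501936969f74a731607a5b781a0e3e3a08039b307b056a27c8a6f26bee34bad68df6f9f9831211cd19fee06787b7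f1c00e481617e11cd06df754f1a086096642c32a80945598c5e09ac143f1b22f1c6a673999913c84134e1418160e9db70a177a9e3eedfa903193c5766a00c7ea50ccc5137496cb34b973b8ba64055bad2d96ad9a8e562f655865bff9df30c5267805f2bebe375dafb1b656625b211008b6c84b2219a1899cce00c1aa80d98b09fdd747283adc40123e469b9791ebcfc440815689bd73e22586da3af603804ac9207347f611673b4a0bd5a7e011c00e7e05599d047638e032313289424339fa0d0db6d2a2626e2c20ae2ffd1a344a8d059784e336d678ac269ac8790264024fe8427f7
  (block 421 30 39 883 0x2b55705611bf0c660972a2a29a753cb7867422524717364a4e150b08ab8ddbef8b331e7ae3aa8c43d7d266bc882178ba4d91f2f46e59c4a6a361a0800949799227817219dbcabde67d910dbbfa0f4f0af8937a20bb3c21515fcc75ca9c853c9651e6ac24b17f7156c861eeeb7179419aec1e1a62b97ba46c7ef99c9538bf88236e706b73c48d88c26bec64f0f64fd7e69b2781d55317db8efcda0a44308aaccb441c0912dd0595c35337231ab1393a074c6527e7a733e9ae1f312439236527bb3dba65335e265a6ea49c41e5660003136c33c4b2852deafe5b95faa10342b40a51a92c7db8de02a57a9f74cec86b5691652a8ae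4783cb55e6d6414dc17fcfa8006cc9ba918acf3247df71911378e3769b1d2b6fd711ca293e12dcb8b02f1d94b99130991a1072b62b216ba193afbb53b349b4721f49712b4616d5505fa0ea4141da7a230924124e78c2e162942babf99487ae26cb31fa43ca82f849c9bdcb461609d33c84b0ae6a737ebcd7ad7482e9b3a316790b629c74894416178b611210d0ff64e72f0e98b21a6bbac3ca981888fcc0f10e05dceb2f053241f069f62344f42b3b9f8529436504cc37982b5122a7e51ac6553df6d4c04f8512687d49dca17432ebf9553673281c1221c6e56686ac09494a5e376cc512b220958ef086223142886782013b26b6dc43b877e4cdc21a8441e28138c12bddf0267e225b1d95e7bcdffbfe55904b60d978cf75c1d7e12a855a6e8ecf55a23ebb3a220d3a7c6af0bbd6f73739ae1ce28459308faa693a7147d672f99070f4d2e9a712dfe10b1c44b7a0cf0ba0afcb0f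
  (block 417 29 20 875 0x753766abf29e5f589054dc5e20e288daca906963867c3b9e392900042406bc6a6fcd6256e98ecc30d9e59c4e4f7965631941882a81e0c97cb04aa8937c46ce2d65803b3090d61b097a7a438f0f9061ecff667d6fcff98277ffd33949737c8adc68c7fcd8e561cd9727dc9fbb01a90b5ad923be2a79d035a5794388b513976e71769ba57e40d6eaeab19bfc31e9cbf1d68916ca87ce9c920edf0257c04b268e4cefabeb0073d7a95ded7106d1cd4c7035c723b7bbe449fb1462e0d6821c5ba1f3a8c27b4c827df0f62e7a4501a9b71500d32aa2b614968e60b1f4ed7fd27cdf8014c4eddcccae7228e5a1b777a8894b91c4f948861e0ae3c2d6e315679e2d8bc92f27594b19497df281dcead70d4703fa9e2928b5a33bc3ae4931d2c309c591dcec81e741ee21de26a4fe2445606a17059af6184418745e641175c0014e5b81ac29e643fbf5f33078310c2c108cfcc425ef8e085a79b856abf30a50395fc98e7620594bb109a901b75ee517380b10715730f4fc420b6d7fabc25a5629abbbf57194318ad8bd38868567fb67ef778a5086ce9a4d43c1b1b3f1a16c915fba89ac1804aa8be4c028a8944214452fb2542d54c00d5196029273c81a5186e8f2d6305469bb67fb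c009f4c4224388b7eb83768687dd28db615e9e199
  (block 413 29 20 867 0x578651e392bb6de799212375118bfee3128a38f78f0082acc4a1d537fa18ca5241425e12965d894dd7650d51469aef7ea5074639f519b607fb91518517000588bbb4e61ad9fef7573c0ba368bdd509cdbc1e62274a1e08c60f3ed6ab1902c38518d74c74ba05b8755761a63dc87b40757490cbbbcc65a277a7d54475a70c5b0a99ffb7face35bb6523bf94abccaa0236bfcf401f15a71f3ff8e9f89537d1510a628a5a99208865d594006204986f6bebbb1c2295461b02c774304845aa88e897905f875e54d0fea9cebf0fb96fd12211edd525f6495282981d5bd680ff2575e79ab86e993fcb62882f116c7d899b75e19e5bf09c9a0f994257644f62c5a2afe85c68bc8a187ce727047c2f19a84363a48e9f855957517f59ed6665b7710659cdcf3db35c29451eb1cf27b5102f583b4f2172edaad7f1d7675315b6e5d1baa483ba4bbcf6233480f55d02d3c3d54d8a4f89b74a2b6944581b771bd9967b7178b6d44248c94dfcb5cf5ebe3cfe8968db0c237be2a50679e5046bddf38e28926e368978dee1751595d445c0446f76e439b6299ded7eede7d675d30a5623597edc91c5adacda463b67b0b87cebff0f83e5a407c1e108ab9e3dd13a87744734b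e2cf9d7b47e0b595a0722c168db4c4d960e22028cc9cc7
  (block 409 28 20 858 0xc8aa119c1be646c7a8463d819fe606818dbfcb7fb3c7ddfd987da9f9109b622cd86b22f29d1787f171cf42df7470ab700b6ad05ca8faacc96e75ce56575910e1cac0023bae6221b396aa5c2725267ea9eb494437da63505769d94bad33ccff1ee3eb1e941dea77af58a5864240c1ccfa0e50b8d380cdf0c3f6b3e660fa2564d74734522bdf9dbf1a198fee82505f6f2e653ff3ffffc3c5f71d661d9bb7c3c08551f76106ddea8ec94fecbeabb942cedc381fbf31889399b76067bc6ce6ca6baf24cd1dab20dbe27d655b0bd50741a98e513a7f76b31d42722a8e1462ef186780f93a66e008992ea11fb36b9699c7c091503dd92be719a902d8d3adc61f3583f5e22117042ef0fef0d6a1e8f51e3e3367c4c2765d23f4473eddc3434a8002be51674c0355c150971d49ef1feae0ba23f44be591a1551d19c0bb51d3631ec47127c0bfd10af72aa5953222729bb88dd37824da39396c88985c8928c0a072c6eecfe94413305a9b1ca8f3777cdc1dec6f65f44c6400d5a05193f69c6707396c73bc85938044fed028392ce367da4267c55155c4142cdbce7c90667ccc2b071b9fa434f86de4cda524fe0f1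15424a82a064d66f3ebb3e765b2fc03c5462a54aa63adfcbf3be8ba0cb23a6fa6da51a1a98c7
  ((rung 217 28 74598679327)))))) =
  rung 217 30 4698252560360 := by
  decide +kernel

theorem ladder_429 :
  block 445 30 42 933 0x5abcca901b3c27101488479c33175f97c61ce1d0e214a03210601dcf73243ef439dcc50714e9f9febe06c8b2d4ff1af8decd36e1afa8190417fae6342cc0ce53d39b83d3adfc1836d4cf3982837403ff2e74887db381a6e293c9574ffafe3b0ec322c7ec8ce527edf73240c1224d83cfaa84bf1954574df87bfd7c252969d0c4407c71d65ce6f79f88600bce063dc6d34766833425ee17503c7a48772a7cb2c27a8298310ac9b26381161ed018da0084283bac8d243b9b6d5b27196064197508e09a0a9aff73bf7c08c7870a21fc06d5717d28fd3c4e4a727411d413e9261f564622f43f92e1021058a081dd168bc01b7e5c1bc6c957475b817d2aa77d8bbe0d507b19cb13652b7ff6d6eb98997feb6ef82b421e6acb8cc1bf54b715ef0becd5c7a59f6a93764683e76ce25b3c583d0326f55da042a50598895208d674fac0205b2ee8dd3f0e8417dc943ff6de0c8398835fa10b91dbb59fb6e57477832da730816ec37f4fcee2eae864375666ff7351547a7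3b7f96145f33d5e3ac71c6f71f59aa7d4d459068f4069e67ae1b03ceaa591384823d25f71a926a9da4337805ad3d0d0c12d0a38eace805a6562d6c20e0bff5c20ee48df1e09d255a6ad05e139ea01de6a26287dc0c6f6345375c7955010bfe4aaf3595ccf8edaf5b941e353bb88608f73bc48156c894183eabd5c0bf4ad6c4e7502fa0761620c5614ae669a19c4dcfa2fc4083ca6fa9ad3f554e0c2e71c66d00e311a45710f010abba3251f6c9b5aa9f2ea1f5debde7011767527ee9f45ec467a7ce8e1ec82b22c79accb4fb870d3b5f2a79efa607c6a7e440e26eaadb9b33633fb5d6c6453dc583c67644f852a0341ca1a009b78d526f54a5c8961071885bbdd6051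
  (block 441 29 42 925 0x1a1779c7de9e1732630c22af18d67c1f813436e1a94a2816723bb2e311438bca1e8948f559267f574701c04bdcaade2335b0ea7487325d1ca58416d54c2ea638b592288150aeba10a7969d75b9b86436760d1d050e7ef7b3167f762064cca8f29dff3c09639635542ef5ee1b1a96ad5c8628df8fc09581fd6727d5e1a1ed30b8f6b788eafdc7d1bb2c235887aef2651c81a34f688cf7f03d28e703fab992fecd74dbfe5c6f6ccd73cd886c4d3a4f7304238834ae447fec59bb99c1fa54eaf3e386464a63462efef4cc62b331a5a1af0125ad2fec59c30c1ba296b6c24737dac55f3c7b3044faa65d59eb9858587db4e7b533434eb752fa2939f57e855137e09a75683d6a44e9d62b719317bcbaaf1a768b8f6477d2189c161dc69f532296b68e62fabb8b52631c97e468b736d4aac107b36718788d74e6db64beb7be1c5b3634ecfe48abc41c0823d4bcbc76313695053ccedcd8ddae24edab377e8b602069aaf60065641274f8d8c346a8464c906c35b7fb6aba577146ba6cfe55790c76a4745a5fb547b790c5b8b2aa0d31df601f3ebbed4d615034d4d93c878b19d4242a8e36ba1a349cdb1c01fe08146886acc9d3b0527ec1d8f841b58236765b10b3e3b9e4a7e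43384b28b10eedbf298da8f1e49fd819219a4d313b2bfae1132ba831048cc3006c8f253e42c833decb17342930304539c03f470df0d3a764388c07a828d720d7c19879de3d9a6da33d0dbdb1a4c6e55049d7d35c17047fd73d843f7110eac1579eaffb8d771354e1ad60cbe142bf4ca231d624c8ebd92ab85fb7e27ff9570c77a2e40742c254bc954fd0bffe5963106a269f50810484566e163cc2683b36a13bd7e3bf5840c9cf68e66827170
  (block 437 29 41 916 0x654cb809dd2fb82cd977f7b07933b71ef0f78cf451ef53c46b9adaecc020a9fd4d136f42a8ec0802bdb112d0efcf6402044e0bfc1b867ee4f80dbe7bdeb7e7540911201ceeaa7b2d631206922b2cb62927d2f0e9b1a48ae10aabe5c62571fae1198edc7da43fb2461672f4d0b488e0a4f57d2fce9931623aa9b5f875dbadfff958770ccea504c28ba85d272dc6a1487acf6910821d620525da81424ccdec066e0c4c5f2cb54fc1040ec843df72d197c3f7c4c92ee1ee12754e6e3710db1a3bf7d860285f6084bf52d986061e98a0aed8f7455b35f2526a4436b41d7248fd67405128713a2e3fb6bb71bd88279bf770fabbeb8dd581e2b6744efc4db26132b92e8b8936d7c9267e2c9ef66250e99411f61e3b9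f4c6cbb6f94cec4e10751262f5b7bc2b4bb131dabdde4c443838d50449f0318ba29f53468b1e55cb6633d33f1998198a575e5944e7ae083346e0f18db37f60d1111089e38653aea667fb8c9499aef1ae96d25a5b4526ff9086f199f966ddc78e984319d7d606df8a179de9a240634be8dc680f0706b1766030df8db364a0316a60bf619dbf86ee48c3808468b1acac780547c72987410c26d39c8968a497d432a812d1ec988ec40e49e3dde1dca276482e17b29043cadad1be916d056a728fe3a5e3fe7173415b111d329b69cfbe0dd460f2912ebd9ba67759a7db02deaf0b6f6346b5098639b395b0793c41244b3311eafdde394edffac7c1d0b706b6fcd7c97bba0f8afabf9c042b53e77ab25e52bdbade38813c9b7d703b4d19efa714cfe775722e07c2a881889c2d8c67634447ca2d0950be6c33f3c14d99cd2b20f27750d2115f8fca63ccc4b4fec1803d18c79d403031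
  (block 433 32 40 909 0x2878283ae276d0f35d48723e8394c0a84c280bed14af62652e7842d92aec17b09117ce1a31fa83f0863ca3b41b4410a2778aa6d14ddb7fc6880def37cdb8ecc20c1de54bbb55e73954c6e0d0e02107c3f455ecff57026f0b473ba99c74756418983a48c89f5a78591303a4bd978be36fce59fa56e9e0ea395b339ef287ccca0f0773cffa34fa740ffa8dc0fa7d4a56238754677bd10679774fe3226b4191accb219294596e7485a5a97a88d6f9f04447d5570f45516f8ef4c92a94de6942c4845270e56ff79390215f4a8be7c362a9c27c780a9dcfd3105074bbef8c6fcf1f0f3c186ef2fbd7d3594b749aef48bcfd6dff53b1912ecf3eb66469dca1dcd3ea2d624b188fa1c81a815fce3f0aba58d9c65bc0a0609d8d86ac435fde7c276c163cc5d7014de44ba7a7a9ab30a1e826ce62786f9f87d727ec94f1793cad8544fb9193833ab18e6a92e643f5cb6b212d40354fd316f5ab771a56e415e38d3e51b604f28021dceb86cd16a1f71b7cd2f282185bb652c3591840652535daf75a5d09709c949bc869f12cbc2adaedb3a3f09034d5253d9b7b84cadab3296d0f181a91458565c5b797abfcd88c87ef263a532e3d94d2b6dd41fb6749e009a6351a0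a9392036ebf93528cefd4c71d66bcc55f622648e7f5dfedcda1868e777dfecdc146ec269968ff1c04b91c27f797bc4d99b35e40f461bae9fb5c5972bd6505f7fb8eb53bef9415c667565543564c5939b216e0caf62399aab73a018c720dd143a490bee4b7de40f083f28f4e4bce20d33717fd13a5531849a5c2dd3135eaf8eab698d1f60238e0c3ce0355e758a7a6f1e95e8eb2feb88b313e685a59a00d90a6
  (block 429 31 40 900 0x49cbc8c5dc8eeb972404b61b91a76f19c6c6894ae2c7f8c03446d06024ee50101f94d69b0acda05f16c257ae32409f517d5bed056b8e1a7cbdb5421ce9e188c0376bda91589fa584d4da12655fb96408f3e781a63c5f9750c2abb771ea8c14f270996672cff9286d7e04764e56a0769c820fa9bfd04c2cb9fa1249bdbdc926bcc669b28b791a32ab625a233a5788db576af73fbff1b6ffc446a37b6d45528a9434d1fdc697025529002f468094737d0e86bcd046263560f272ec8a1a7514ed3b1fcca5814fe9e2d072440e2453bc3257cf257648e05d2a62f6b61e232395d99c94f0a1bed33197da72d921afc76db738e5528d23ba6883f0c0b6896b2d1ab1debafc69b824049bad7e9d3c38e39f20dc5521c2466c504a3506771f3e1352fd7a01dd5bc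e0c44e454a7d549e52f5c562d2b2a39ff2d82972fe72d17cc46a39ef1ba8fdb5835571090ee54505fbe5727eda859ecd4731da677cdb7417ff91ddd5fd36ea6d884eafb228b7a3bcd5961531f37f9cea6688e6bf1d6bb692cad69860f25d5af553d52fa77fa670c1259d32414957d3ba9cdc9b3f2237fde9254e1e74d0185e7b6e17ce1ff9735164a579f1150a90e54cf74a19be33b759ed703cb58b3d978be96233d21793d64ad70cd23b02fa209caba7480c316ad8bc69281ec642ae16b919ac85d8b298c8c2cfe74c6837ddeea0d1c03a044baece18b3f759cc9d06e1ea20c3da4e2b5f68a47478401f31b94b929178f7e47ad1e791e8f0e0914ff8fd3bd39e5272d65f0363f0e252948ea7da25d14d4651650a9ed19d237d2d6716d322d29f63f80f3f3b5bb90eec150f0e7d936e5045fe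
  ((rung 217 30 4698252560360)))))) =
  rung 241 30 293624258672 := by
  decide +kernel

theorem ladder_449 :
  block 465 33 43 975 0x3b11e7f1f18e4f975c6120e7154cb9c2338fbe797d20f5527be26bbdb3f51935e1b9fc1b803404fc8725ad3f67d38e4651d23d35404e927bb5f7ca7162a70f84ad3e7896dae3c1641d6acf0c0102eaee0b9b2627c6900a4b837509fbc50fd24aab3c5d857d93ac29613a4a5d4e59b277dab2d55c2081af30670464fd8f3c3570f9464efc4d2e89939195f391780073377d171a7e07ae83d1db9b0a582ef5f3960808b1f8ad1e651714fdaabbdd03541382c96875ef5c19bba6d383b7d77c5d2e5df9c5b2e31149759a7c63cf66bc5790064fae2212909109d55a3760ffc7d3bc69393a674fd51855f1af489e98963f6e072de8d3e3877932b03f7c6dee2213791cdf37b87f88fda3cc938e572c77fdf509ac8b0c3a3093482a6fb6c8e4b9873f9060c2dc6d86733970a70d9f8ba04020ff3aff830d57757c368ecfbdf2e37a833bc54f550d48a07c25e4990da034b61e8e52aac5eede4fa97b14f6073fae7c9aa3c6dcffe109d3bf89cbf7de386a8b385d1b418f723c849c1b3ae704f836811f0c9e777f4d930b101c5ce5af8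076c92b5584ac176145119a792915542b9418703b4b145f09107c44ea5e5278e037065e629e0bd2a06d0a927daf699dbe4a3ffde7be3556a8ba96c1dff832261dbd3cbbdc29a0dc629d8a4ca86f06612a8028507f5023eb33516cb5c8e4512922e2f77c184a052c1554af868bb420acd211adec40a3b4f9f9424b43a94db1d1b2eb84043666813e5e21e15b9e4c967c3a63716ba3c7a83a0cd34055996b6287a51c4cb38b194086bba3d741b47b7ddbd3394de0d0dfced4c0186d60a945d715a0985bc4f7b8929c2ee38d030f5e13a36df67f3e2faf8dba40b56e735e125a724cb2b5b3de303b08edefca3e9838957e01dd86ebe60f817e93befbce8fad958b5a96c182487d0393b7e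
  (block 461 32 42 966 0x119824ba3e19c562529a262366a29a941fdc6734fb3f0b852dad391fcb69724eedb72168a8eb491f9cab5abd2fd38fba66c92087dbb21ad2e1812f9d7c80f83614603ad65d2fc829e534463d73189985b75b2e986cd52fc08b37e9e766bbb3a0d0a9f29c9111be2f560f2dd781fc543b9ee041c57b32674ee67294dbf1ca6754c873f03f375ba42ebe54e029f005669345995d5e0be731ff592bb1527024855c88df6426dde5e6f8ce177ff264bfe2361586b6c631bd5ad7209424759145899e1960c351a3e54f68d248565dd3cca2071d3dd7da2720427fd26ab2b10f57e03561f10f6416c92d04cb143f18047442b81eddd73e2535532f8c105fa934a2ffaf63cd761559dfe0312dad895bb3281976918c01e27cf4dd90d5cbbc110a892b09f5cc19e325f20f5b986eecf2ec8474d13de56cb0ae6c1c497f9ad67061108319dbbc21b9a971b36be8871d88501e2a0d5be46aa2d08778594c211673575720bb36131ca9a98dcdf25f2c1a1758aeb2c1ea6111415b86952eed9b6589a4932fb34a022b008375ebe0da13a3be649fd108e7e4b18ad42e138d81ec06acf38efef730673d725a28efbcf4cb631eebf0d9f1968944f72fefbac990cffce7c08b365052abf6dec3e0451412905e0f8be8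b84325e25990c5161a52a0a14b177c65f9ed52479722c23820df77ec6929b2865926a71f3248f3f91fb49e2666647575e81d971f2bbcdd11be28c7ffcc0ed9aef9b121f9f41992fc58d3bdf512a7673d9c592c2ac3458676485c8bdec2dd08d3769ee917924b7d5703e6ccf789f64ff18f58c738f06bce6cc9dc57ed216b6c10c72e1b60a1753aefcb713c670d79e69d9abdcae6cacc482b11c473e81abd0c1b24fe9a9d286f0e070c7e316660775fe47429dd4ea56cd0efe3ab660ba94
  (block 457 32 42 959 0x1692918444cd858281b2407566b7fe909af4f9f2b16a44505d6ee587e1e7a1979248c980add5bb8b52ead0d3c36b26065f1badcd62b410f2a9f5f7afd50f5856b2d5ea6abe07b04b7dabca3d863ea16f4c46ce81342a4f84a0f36e38957ef5a10cc02b2e4b9486436bd7ed962674e0daacec9756e08c0daef693eb2876165303521c7b85f28f0522719bb4bd491b341de7da7ece7bd105f07c8330c9017e62938858fd1819e4fd2b892c7287f9bb333ade83ad05f04f454a9a4a665c25575bdbbc49ea34cb1d06608ae8532144c9a769992fba7148636c24dfe7839e23ac57351e74829857ebca4eeebd83e612fa406071049e4fb0adce771b1258f6599d24fa45082b6a3133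f5b8ecb8fe8bf47fa51d820fa4e6b14c1b44fbb3f33da8fcfae8d1130c7bb130c348dc8eda98b3540bef11a2640ed26cc7a4cc9025bdd03767839fa9e617b3ee8d67e7d87237cd284e4f2d55f4a7f1ac46e6821b6fdd556a7fa3be2a8d84d76ff9485413f37cba2fd72992167d4e88ff3ae9c5138a20f713e35b656f14ab53b6e3848cba6e5bfaa1ee6e0ad9e80638714aa22bddfb0690337cdc54abb1af88cdce036f5d0be3cd0c4866e7f2806c836b02894897de19174880c8f911ae223857245abc40860f325db074c2aa1e509babca7e9f1dac65ffaa58893d99fb947b2042de5849b2fb20426cd06e351bda896daa711c05f37caa41c242c7ea5a0c487cda614edf36ab7fc12326530d9c5ee7a6276aa543562f8f8a9124f580d6b4f2883ac85b84179935bfb7d546537631710fd77513750a1c2c30a11e1c651c4ed9581217e1ff1db9847971969465571dddb63dc5137767f4e3b8fd54c7e4b8bcfe1dea3346a8747130a3e0e2ad0b5dc29b970146db36d2e0c18293dbc5930e6bf680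
  (block 453 31 42 950 0x449f0c6c0b4870b4745a3cfba07f471166b2c6bc34d7b76b996a500466173027f4e9a4473284a1004cbb245c2ab9e93d4531b8bca623265999774ece0a8785ff6ac8df0ee535fd317e0db16a36a4a48f496451703f09389d293db00a98087bea51acdb611ce07eeae19a727f702ef504f792bd1d8870beeabc385d5411adb637d9ece57176d935a536c8f23f23c0662fce4f6afa3e4d2f7c09953fac893d1cf8f0650fd5399a88dc7761e3b385c7ab142f1ad48cc1b5eb5c4549821244143ab76b0233dd01fb380e5fbcf93da7a8de6a2baa9b422466f10c5487738339654db10f959fda00d4dfe0c4f77ccbc313a3c5fe5d312940c5135aca4489b8ee464f64bd6e04f0fd779c0dbd250dd313070f896c45edf0c49ba788546ef4b864ceb543851476c9c72df5a6a978fda5cfa088cf19cdb4d45286510b70bfc8da464c9d9bc8909c685ec87943ac5002e88e27f71fd84dc14c1d91f71894af99a6cddad90a39ea2453479858576a828fa460a611b3f8a8dc12ddcc47052b3a5764e900990be71008d3ced5c6982ed7c226c2063a20d2f1c3bc50bc10009153568841a79e712997e27e0696b0e8289324055d73d5dab9333d7a2f94f6753493f7495b892c4b8d29d3059bd73ea0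a4b2631276fd54cc286140d5f819fb66f241546a64a5afb35f26c61b68e818a1aa925b0137ac2d88a0a5c54f43190dd2bc5f25a0339abf09906698133b79af9de543df745e96de5e02474b826a940e9704e198850cc9b67d70a52eef5a557172739ce656975732631e53c87a622ece8aa3e794628bbfbc45dde154004a8f96442968c48969b006f9373bc31e4139e2182a469d133b2304021e11b5a9a5a3c1083ea318cf9bc0ee3494faa98f3a7df980739b281b390d92fe6
  (block 449 30 42 941 0x1951a516511a7a3155a0a7ede5f2458c6af453c78981b6a574be8a8b1bdeb1575652fa983bf29fe129ffdaa3c8f659cda6ba3091351a695145e8e196f14427d6b43cc67831a68f547d9d28573b2e1b9dc6bdd819a8fe866e957f704c9a288f712729ce4c10aec4f25e64d2cbebd7ff160a8574803c4e4b4414078ae163dfb7334275c7abf7c13f134b5e0d7f4e704f5cf677c48dacdfa471f49fb1f12e91de008eb772945eac40fa8c350db59252a3e59b576244c9ab5aac7518c4206f5c4b7537fd358cdcfdf0c074a3ea7c87f29c51921a2b4ed7166acd596a2d1cbef6382702d47293dff56e2eb71642c741929825724fa1b66793f8d1f86facc2cf748b52f9adbf89ecbadda026e5f18221438053985811c159c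0665af1f71f148119d59146854f0ee979f02acd3a83c606d4b56abd0bc39bda9e559b2a1e2db3a432bf769599c72d312f784010f27288ce741d59a4496f7d347f4b8d2727ba559ceefcc8e6b8491e081fb374c3bca5a442987f296b04a194ce310fae78d194ccec8c33b1bdad37f448bf16ced77a20cc8722d8feaea54062755fb137e66dde709b4739d5dc0b28067bc3169618856d0d1ed220af135be8ab97b241c796e14fa7221d2428bd99ec190e52f6447d4443314e12b1fc8c45f327a757e87d1157643b3462a90992ab61d9e47bcb6abf3d596ff273a0a982be8edc5d1cfd5a54cf836ebcbc227115adc197ab84223933c2acbef71637d928c1eb0818c11edb65fd61d273125a9a10e8b272f53c2da352a211f584a9cb6696d469e1335af383a3124c0aca9fe44227ae5434081a1319df52de7de7f7114d63ecccd7e5c8fc6a9c82f31a61693a0e54fd141bbfffdf45866c3cb8c768598fd5f55650a3b1d35abbfea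
  ((rung 241 30 293624258672)))))) =
  rung 241 33 108478854899 := by
  decide +kernel

theorem ladder_469 :
  block 485 32 45 1016 0xec0849cdf345cb1b55aaf4d04a764b4aa7d7e0f6515fa366301727de1c2fbaa3fca85b2205e307005403d68297902e58893f5dab3b37adc48efdcda2824b4838ea791e255d193849561d13351f6b636303c93c048aeec0c27f0210853abd65e28b9c058eeebf54bbed462f884d308f5f1fce3cbdd58a4050b693c56bb3222729af1bfee331c591bdcfaf09e53fed6efb356386f026145d8877983f46c6301209062cf5717eb1e8c7fc53a402af86996e063b83b4235fc4e5ac7d987f51ef71aa7a08bb15ff574398497985d84d05322f7f82f4b7b17e2426825f093eea83317a03e1b26eda8961c4a82203a9d585536880e99ddba4e44e880d5ab5848cc777d1ebbb1d177572cd71ecbf1d8ab5220cdd6f6790c3e6f04ef7f20abfd40a47243a898b1d1ee1a437bb63eebc08bc65fe09829f800d03226b15468d422bef9510617fec6d4f17052b00bb8de4c547fb7cb314d9c62692d7db681254190da53c8d3a108e5377aa30442c1907b0822cb558badfbb476775c83132ee66d444d927edfeed67352e8c9f4202ce84cc4aa6456fc537d16ffd883ebdcbbbc7f71ecb4073ac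218152032ddd9790c499a4eb7c555bb90ae3ad3cc359ab396247bf2db67404c484a707c88d83ea9abec9a6cdfb04df5cd41b4404fd6fda7e4554c60c3d5a25907c926b3c581a84bded1dfb4b2efa1929715ca3752d81a0e5be9d672bb3554e5368d92bf25a6b03e2c6a151a5107dded950bbc941573b589162e5e2180a70397c2a3437b113f6d5fb1affaea8670d2b650be9d67730843eddc3286b7bd9d8d1a1ba7d7cdde4b02f13a57592fe4b1ee204a8539f45949943a7ba6f032281dafffac59b111a57229a2c1afd5f0d55f25445c9862fb3227f08294ac7ca59f1d257e53fbe04235c90602f13b7615b12920b58073f939196e8c62848bf094ca0e6cb3f838d1f2ea058cf05fe2da2f147b6c434f266b21879926edb75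
  (block 481 35 43 1008 0x1767a291f6ed14e1c6f612d1dffa0da4499d254cfc1b7590d2e3af3b3cb81606487ce3c7875e8eac4ebe22658cb4f42c85af1beb03d85c636bc66bf4a0f080f99b03f152b0b075d51f24815ff1fb70dd5421344b302ab983dc55cd3ff6b402cf039d9ca19e5914f84ebdfc7909821f1530afaf5231904d6b748b5c678e8c06d4f4a72c0531acb61634b62be17fc96ee205a4886847775b373d5fd9ee2e22d981e1f56933ebca37aa620190441325f3ba205db810035ade0489aa8c750bf2e51a84580aeeed95979834e82c90ac4c9defa0a2604959b0c53a60bc4f3d70bd7be9e18cf32ff56d032a6b4a4c7c83c95e653e30319cf72ab66f981322ac51097c3223c28fbeacd8de003a53a8a1ff6898527259aac73c3350048517ec1aecdbab36fce3e5e2296c87a1e49cb1310200dfd91bfabdefd03c8793a32ba824579928685fcc990679e735561d407b3ba2b357506ba3e97e16cbfcc4b5e72ae6c7a3f1fd330f8e47f1def9852834565f9a38fbce9cba539dd8ef406e9f0e677970833ced3c9a12263fd5d40c93634c3ef7bb5f402598bbcdc7cf873258a2c48b87ec4ce18678aa83be2dbc40ad712b30a412c679f8015f487ffb30bb6941348158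7169d5acf01bbfbaad2f2a073dac4e73cd6629b5b2d15514ddbc924f1af221fab7e6b03329af2e754c318a6bdc7805472732e327d927c2d4155318ba8372ebcf8ed35204ecb834a78cda8e5b7e82d4e13b93dec86b6a3ffc42b524770809dcb38528eed00eb0d27e3b4f4c7c9d4ab39fa90916f8aa62e23abd117cca32f31dd1f4bfdbbf8b4f91fda44e35c523557816ab9849c72d9877e0a202e3d6bed5f1b21dbc7f5e2c021022e537fdb382f6a035ff4dab4787d628fd82754884a04352e0e4b0834c394e61915a404e561cf55de31c9c0645d36869d73cc97136de027f87770c7970ec4c8653cfddec82ebb5cd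
  (block 477 34 43 999 0xa2494300ee076fc94de707096af8fe25bef0818d7c92749c981f7cc4ef10606e97757b30b2399bc48208af4e570bf2bc8d1848466f1c6e6da2e7c4eb0dea875252412ecfd8667bb446d64b61da3d1e34ba3501951064cabe366e914e3989b9e6dad93cd95af2f28a917d7d8f492df9517ababeee6571d7bf7ad9532ea63bdf7bb0ecb904e6ed4b21ea3749fa637d25cc37d6d8482b755d9022ddd8135210a8aada55c61de9c85a9c7008af5ab73148fcebef2d1d96ec1c365cfae8cdfc1df59c51318ecc61f214ac40748a4e968d46711d078e22427626bcc32c83ba5f35b09f9087bb2a9fc6987547585c1dda9eef3d343f2ab76c60c15d72dd2fb7cfda7d26fbba3c4d6213373676b3f61f211fac790cc6cd788ba23dee2f4370cd65a3f723309cf09244feaf3956420ffc6e2d2b5069c9080b280f612e5fdc8415fe520d5c46853703bf46936b0d01bb41517745e31167802aa4defe1bee39d0b239f2547605fedf1d4c7dff1c5ac25e09569762c5293e8484e655528b5676580401d639eb19183b917b5fc87eaa781eb8f50412014f1474c64ea840fd50a1dd9b3cb52231cfdb5cf67c2b504f3589d756dd44d1c04d7fd22358da66e3646231e015e0bd186b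7f1916bacef6b22efa284a4e50fa29854a0ad444dad993807d938d000db7afe42b160842a5b4a7a623422a1c7d9c131933380938a49295f96fedcc2a47eb3da29cffa8fec8041fdc25b8412cbd85e70bf5c7a268d79e4763be363f190f32b6e75b0f3ac76e911ebcae94f2d58c3692e4a65168ad51b50caa49d2c90aa5e0c917ea1fa16ce262e78cc9ed3d90e318c4fd3d8fa5f84bf712c31127716fa385130b374b7f6aefd7ce2b8ba79cf54066f7240978bc0615544743046e8a834a41c9caa25b7449a59f301761cc08a8be4a8c116cff5446d1ee3ff563b7a9c6d035d179d722f24a3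
  (block 473 34 43 992 0x4d38ab7933dc55940124820afd781fa3d9f507bd03df8fddf72a4330b7c29bc861383a53e5db16f97f4d28b154d37f981429d6e1594f0b53f5727c9c1c43d4982c670686ba969b6cc85c265b3941781aef7f156fa05a39e97511a615bf4487457b3d67fcd20e7e55dc5d9d5134324e2121d07f456d7e78c643214951a2e1879e737393d6320794171a7a50c89fb95be7c278f98c818a3699210d366d0cb31d3720e22018924cdea192e671d5dcef46553d245592332f57fa9ddd11ee32b9ec81a0b5d655fe955131ef9c0d470bffdd1948b8e5199032a411fc30e5f2da4ef80685a47007a42d5a60ae3f5940d9459e4df7c9c0b8f8c0291291499e4c82fb5bd6115bc6b6a7e012c2e2001da7f1fb97f3591df4746cd274396ff82e5ef156e3d826a38b03d28d81ccbf1c90c2d0c3241510b47ba9e4cd4ff5177b0f819cfc7a943f26fd5c751d92450a9ab6db707e26e7a840f915bfda1344574d8f20af652f39d404b4ea70c7a179ab8cb1d575f2f7f289d7011e54f4b06d2d56cc5b2cf04d593dbd0a1625f5255e8253cc14c8624554c17dfb2957109340c324298a4ba3275f206f0b383008a917879e587fcdabfa14e11b389d7bdc9d91e9c543f2393d8db7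d4f1ec27a932454915de383e3ec718d1fb0db21147645be1209ff864a7019e23927e0b5e972f22b954553c14e5e6ea52fcca5977f23c03dd1a485a9c60bc75bbc5226e7cc67a0b5fb9add444c4bffc58ef88f8b0f585eb575e26641fef168ae2ac127d1af9e2b7f669af15510de08916fc31be63dcf438be9037bdf7e93eb3651b3c2a66ae411dab7f80a2fbdd3b3019b6bf8d89f1b548a642246db47e762bb5a097fdaa0322a72920d88ed13d5867c42a14ccf0cd310610274f8c2f6e9ca21755bf902cdacc556a3a1b44b39263dac103d581a867a0f9d0e6f9eacbd6196d6c84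
  (block 469 33 43 983 0x1cf704d3f297b3624b4f1e9fd36b86f26812070100e0234ac26ff284e64182607a90c68f716311cd3104aae016b77949499738b7837bcb8e6c6189d731754e420731fab0a6002dc14e011ced560cec90dd786e2e77892f8405ee336ba4adbb2c5e049bc8c12c7d68d1d941feb9db5b94bd512097c2777e7820c0fe24663d7e63c5bed3b5a16d84222734a60f9c0f27f6dcdb76358a51763b48a8c1b945b62402b4220ec4c7a47efbf70d9f474006c7dba249207a9311a93eea97015e1b4b295d5e140b5f3fdb0bce846a3def909df0879673b475bcb7d3007e24a16e257befd20e97d5e40eaebe8a2a56e9b12c5abcf65676ed3193488c149d8d2b61e9c7442fa300ec23c63bf4216355f3c0354573c22736546ec8e62c24b77a55763b2f9e102fa7e976975046dab223692d441f2329113ca24a69363bce7673b51ff1559af0f88addb5b347d14b1c2edabf5df6d8365eac1461cdd14c521b0f30208509547f7b18879f8dfd88a986f8d5c786103c114bd74abf1620e5b1af4adf90eb50c8a68dabb3f1852ae231c9bd1dbd0e30352fe85604694f12913e4c59f4804a25e421d6fbf66c71a2410a1079b7a47fc4e75b495dff0835c8519d4d0d4a24728daea28b242fe074f3a2e5b3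a9dafd93e0d23e093d8671a03a74ecbe5b6694e4265908e204bf9c2d831ca23bd329da07042b1210987c5db8bf2d5ee1dd8ddecd1375a4496eb81276c6069df5244867806874456ed398c13b31e480934745d44d72753cecbe9243054c6650c2b6f15cbfa44f92dbe013a613b5a6f47d70d3e1f16bbc89e633937c49001842f50507d1f867fb4157b8f7e783e2aa9621a4ae0057cf5a8d606a6d6b8f7c5fdbd2bab3a81b52de7429533dbc6bd6a4c60f13ca7d57187aa11d72c831b69b202fee6b779c30a26de113344c9f7724afa5944aee
  ((rung 241 33 108478854899)))))) =
  rung 265 32 1009661705782 := by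
  decide +kernel

theorem ladder_489 :
  block 501 34 46 1049 0x183d5390743a5070d23b3136ac67039896ec284519db7ddf5e9387b1735b2df86421efd3042ba92c036828ab483428eb381b80b807859eb8cedff6b4f5585d21b40e578a4960839de81063598ac0a961bb8d11b35e24cec519bd5d91102ca1fc0722e851883b363fad8cbdd42413a571bae69c38d5bc41aa38c1be7fbc1e00dd6202d43a2cf2b4609a3466aceda9a99f3839a7ad0b0f753d824b4c0d2005e368272fc753ae5f6cc1866f33dc2b35e574c98250ddce49261730e9ac8512a7c3e84f6069ebc3e4b68edb87892026186abcdfb8421985e911a8dd97b4ee959fdad9d0e3e4e52015038bfd1be9d86d95e282cb45d7ac61022cf734d325f8b6e16113511f81d53b3605c118cb2989e23b4b78edbd7d4dd5117418730661d31792ae3367b56a69270a569722030501ac2f3b8b404d07efde03648773abf385bdeb4f1dac29b74add7716b8b9759048723a9c1b0348682a2646da8203534553af750687d204466738bb4fc3a25711572857e082e25189b20dd6bcf9ecf827723b049f57a32d42d18da6c3d42b8eafe9c50dbc2ef3c8f7887b81f527df0a3db3943c696d054d8c8cf12c935a471982f3019e5fdb8decd29b9dbb65e7c58899bc68e162f1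ab1575fc902fbd623de86ec401b156b9ff8fde5d9dd938b14fc4a829208e08603616db1592c60dad99213039b6153b0b357c93624f1866cf4b4e9b9240101e54465342793e103a1bc8e6637f555f45c9ae0b23a1a48d177d85d5b5d8d40700e64b199f924e70b1a71efbe732d9f3b0f27daf99762c0c2ad2ae4308bd6f92cb366fa58b7a74e448c38d8872e6520436111493510d356ca10c70ba8b2108bba5a804ef53e725e366f0b9745ad592166006d1a30a665aa2f9a1f9b9331f0c49cf6f7c8dbeff0212e2b66d18e3bd08b4c522116bcf5862d60c3342fcef4821ab6d0540fb50b78d23938c6deaf1e39be29e21d21668df82ba2e7cf38ed3ab26310b5d234380fbb2176bd4d52b32dcc162cc8d2b4217714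
  (block 497 34 45 1042 0x193bf3c9143c8f92fedbb747cfed56253e8f930c5c376c1a15820080e59376ccc0aab0ae4927f989348cb98e2ca508dfcec7e21541f91df257a0bd3d0124b3d5625043e53424a7f82da6ebe6dac5a5bd3384209eac4e82e88cf15716b4753209355e58352a467e38f9c6d3c68f85afcfb8aba394dbecd5fa72129c581b5a94d11f649a5bdddf2d24e2ff3746988b2e00d262a95195b5da38c0bd315e8c309f2fb238ff3c33fbcdb0448245669562562044aac2403ab7aac8cffcc35567cf73a1196cbce25c10ed5ca3fbc3d10ce15332a85904267de9491514db638717dbd3b71e54a35c44bc3a011d02a3a84890860ba8be265ea9e0f71e953c4086e7eb8f9bc124ac3146a94b9c25495248ccb46b80aba5bd424cd29f354d82e29ac01fe9ecc224444676b041d0de056873721ca1d2e66ddb8327baee594af35009f3dfbf2810512fa17c338c974ef6e7d8d04feb0a6d45e03ff2e9644f5ef6e7958b7af60aeff1c988ec213f3830fce7bfa8acd533a4ccbb5120102b023ae7102922506bcb91c5edf32a6a0cb29a13fc4777f9f90b5a06dcc4603475e73b480ddc234853228475c720ab47c062a0966478b15fcf8ba67dcdb462e02627358613a5e7a32ccb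491bcff122d857439306ca4d26723e07b8485ea0ae803cb59329c93c7bc815a1f3b9eaf96eee4a18fdf5828b6b94e1d30a56173d277f59109a3660654da7387b6fa71b90bb9e9d0a42b5913a630ba07df7fb241e3754cccaaee0ab5a8e2703d2c89cd509c7b29af332e8b3706ea5541420b3a2f70e5561d7e932da8bc1ff3eb03faa363ab892986d393928b03f5dc039cf7c844d8a625238928d5653247eecb1a437107676a38b2759c9ac47b97b1413dfdfcc99851d99fae9454b9ca72886214c12a7592cbfebc58100763671d6e531e587ed370a48759e81db56083199d52cf23f3772b0b404ffd3739a25ba5c927d80a98f037534c7c2aa98ef18a23f6c9d53d031301100ba1608c140f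
  (block 493 33 45 1032 0x802521905ffeae831eaf8899147ca69cc415df13ad0527108683291c1b7ff1ce606862de1f759f32953eedb84dff947b5df215c9cedc3dcb6b79991409f43dac847c63f162abdd747564dc0bd6cfa5cbf7fb641ba53c07bfeb992c6dc63a12709e4def6fc4311cd0d2dcb2089955a35a37f4a388cf1313b98174cf9d4cef18dabf49cec48fc8931c2a9a61c56e0d32eef309f1f368dc987582c542840285fc03c00522dffb0a083d0eabaf1c73978eb4deadc7fb7b20f20fdc904cf310a59fd7f6f674673aa635776a3e1dc9cce1c7977c2ec21c1e0aa30449e272f443ce8dacd0533f938a234704e59cea5548813e01747ae29cf13db2ea1a088ee51f9624d6b72f5498422e75c4147a50da7494d1e8ffd43f87f5325c5b4bd7429421d456b56998dd42079103b64401e85770705e3e9b7f03cf9a0e9f194d7235818010cb04032c7be2b2e527b7b8f3e07942c54b5e8f2080cf3c34231cf13bc068962eb775a7b98b810b99b51de1aa7ff63f8d20e0129cad8a34548674d953ffe2dd763363a7a5ad28335f0ac226b62a61679caaf9258cc5fe393baf1ba0641743d7edaf3f802a8ce901a78e0005481a32b1b0e4253b89d699502eebe69be8172cd5e4a29fb5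7bfd06e3defc7135aab84129dac1b0be62862da3cb46f58c5e4540e81d5922de48d949f5e2c4eb79a6d7813d0497f065b5f998dcaa92f886e74a6b6b3342ed502939acbdb36d110daab53ac159ac517233915a02796a0258dab20a236b1bd6804558ba28517923b3c2d82cf544aca134d1e0995e6ff647cb4217d289b5ccd71c9ebdbcbcbe4f81f98c2c07ecdacd7464e7af4801d855e08a5bbf496a6493806c4bd9435711ecb6e0b238c6034b590cc86c9332a3350bb798521217094a0f7cca9a49e8d1dafa9073b459d65cdad00ca7e0af9e857b88c8b189f3de9702e3b56e9c9772861ef7066ffea04cef7dd4334cb7ae728f965f40c9bd190a6e73cfc72eca1c3eb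
  (block 489 33 45 1026 0x1d81af725b150674acaed25cad3e69b2d3dc95916429d26ad91544ef8f0ac30ca621adfabae51c84a35d5e02ed6fb2aae9ed053e05df67b1eaac97604e522f3a98d4bded5a16f4154ad068d11aecba7f62a5af561fe97f938834e91886d58dd1a9d729be62cf53e90cd7e941388da92b1fa74beee3ebdb93f6bad723106d7a8be10d2cb17f62365bc286bd12e0e7834e875f8aab72535e549650ef92041de60d9298e382f2d85ab1307ed64020030f122e2cccbc33ca7646836e399a3990a03eb8d44a558b12dc875c70338d139b0588a420083a317a3069bf3c18ff317d1aa6918ef8a5d9c95b65f77d4b955d577e315dd84a8dd37d25f0d4914b68e4ebdef207400267aae31601c99840d2cedc3999456728dc886b7dbaea9b3850b2c4289964ed97225aae0e19a0fc5f4ffce54c1a82abadd67d250677f3c9a89039f3ae737cec2b5cf633e07538974a87ee52c5be70aa138f83d50b72eca1b3610f71cbd5644ba9de8f715f11554e2432c779adc0ac3e207063b96813afabf2122de30facf099f34eca5e74df19165bb471ab6759d030d7bb7cbfd614b00856009ea49fa3d0f70f22a559d29560ff42362e140670155fa25b196c9cd55804c80bd85599768c3271ea29023c8d57538a6d485589f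1931005e0a30557711cf543f40be4c632312a3d922775c9adefef8649441321397e3c3a672b5402597158387e0e087fdec30bf794ab4f670d0488bc0a255ad4e8d253fcbd0a36bdebdd9767b26b36e11120bb5d4fe7e42c141abde93aaf68c664bc60a545de3bfc678058fd6c32dfb77db2924d2ad0fb226962fcc04e64b27e509dc41313543de443023238d98ac9f45889d5cdae0e75d345b12050a167983533cd8673cd1fa7e8a6e144ab7ce1056d9ba79100e214a4a5309214b632503b98eaa1e10bf4e7c655881683b23f35a6d7970e35b619f8e1b959c64d3f4f24701627a6f9f733b011ba2f5a235c77aca972989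
  ((rung 265 32 1009661705782))))) =
  rung 265 34 2942657530814 := by
  decide +kernel

theorem ladder_505 :
  block 517 37 46 1084 0x8cef7ae7f2a7eb9d809dab1571ed8aaa6926d6503396e1e174b6927d7e4683e568f64a6b2dfcf0355ed1fe4faaee5bdb6d3eceee7974463d4a94fe3440b0b6e8975a4fceb81545fe81743a294c26b97cefa30f891e2af5f87a54eefe80ddad1c4e4053c3f257182be74fe5872d0c9c9e6d36d52f0b5678f47f124b66ae0ac72a23d6648450c4fe7ce9420809809f32c0629d6cc5a34a37a16ffd3ed24299106ad75bc29fd1b3c5c2979d595a14a4d584a7ac427ce6355f3b03d22778df246d92390b709b1a9a44a82e4f248b2f60033b6a6928aad032c53001b257c9e84e326a0b4f5551b7fa33250c111798aad15e5005566fa01859acdd45962f8a1646af8abd61fe7d2f307cb77b8618ef5f27e4d1d23a6a14c4c43e813ca2282b626a2eb149c57442254b37c5a581e78368881abbe5cb608687b1d1a55169754ded1fc814a63c2f397786566af108c6d502a569c426dc19c9c9b75e03d3628a770c8a8e06e30440c1098643d95454561c8239839c9bb207652e6578746a18d71168b2ba6055168d734b2425939b3f6757e7c7a0e4733c18909814a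42050622a053c46084ea81ea094446445d57bdfe9ecb655e5a5bef69a5885a1427c4c9ea6de6afb0799557ad45a896ae9b5a88e5d2a54e4d374b7b81990293792dde5502815ba4b65a83873ec92a8584cefb2e91dfcc8823d500b7ab9a2f90d66d0f2101c527b48b11b1e90a0e8de8b85cc9e4e56613031819be13b7cdb2fea4c8b191194125bf2380b985ef6bb97bc4997b7405b7f3764b315eb070fbf67692cc636a13fe8ec929a8be9f7cddec912cb2f3a81112c8884968e3d9e4d6d46f9729d45158c0cc00d630fdb66363788fe820d357b2ba390f0292edcf2bee6fab16a11065c7cfb310a587cd6060dfc27c53ff443736a8cb793210760d48a9f77a0fbf69f158111b1a89894a39934e4f689d196cc6a292505fe0fbfa91c7509d85bd00f9928313f8aedd68a26a36f4207e733091ac877cfe2d2a3ab1f70c736c706b47524c93033dd48dabe5104695fa83c2d65cd7493b19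
  (block 513 36 46 1075 0xf5620395d8b3361ee8e5d53d8402d8cf491664cdf055611b8efe58bff48f4c838299bc99a1fdfd5da5e4b65144249caf6e1b49179495bcc6ad9c867eeb098421c214db9222f215296bad819c3eccaca9de90b8cd93be9fbacf319ccdbe0e1943991a0fafe58585728efa44fe35b3e2d57091076d799e10cc2bb0087e2e75a0a886b5b53848f54046bfec11a27506b66bc748970804d76f9e0a070d82b02d05af392a778d885756f343d38998dab71f4b92fbd4d1816bb5900cc41429bc8e836d0681f0013b2ba4ec7fee5b0d42415c36105fbeb33a4d62d1c1794032cdad076c2ab6123e309815f7081b03e04c35694f7a20024e0146b4a775032b563bef9c3a32404ab965642057f98f2cf2e626e2921e2c670dacb83a8fd1fe731ec35700f489a3fedc7ebd56e96697ff20a7101262150cf49e10bbe4ef8e1ce33874cca9fd0d859d217e0d999de9ba7fcea4afd43d96f0a1a12ad46ad29f66c4026a9fcc503e0735ffdd29092a19673e017036d4180049f9611494926d8f293a0fee1b0aa90698e9530ad74bbec86ef25a1a7846a56289d516ed819f7409c57baf6462be378f32d683ac86831f25900ffcc12c0334beac8d130b48b3b45001ed3cdda6eb08232c77876174e3b2f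64ef9b0067f50df7e038812e15331a9ba7e3df4cd087053eddf248eef3ef746a9b73eebc80cf17da7ce6fb3df654ee87e11916feab62675c10a028a4239790d23e035a75c8513432d76aa1615bc480082a5fa08cae9856c033b45c8465a080bff2c51af23713c9d1824b7c79e23ca692f0d256ab83497ed0452a69a9127fb74fc73be926bd3bbb791bc63dd9fde54188fdb347dd641a1aa01af25bc69b303cfc96a0cdcb12665e66a2349a591eeda0af0085746a10a7af4a5e2ecbd94989dacd65572b22987c701ad2c916c2f6f45eee2e3e02946ef3f5542ae2e9a053a050e75d8d564fc76ae2491c2ff3b8bef6c39bf87271c09e53f55771c8f9991b7446ce7181252e50d656567404fda25d0c6cff899b94c0167e85d69d755c1e515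
  (block 509 35 46 1066 0x6a2f2cadccf4d46567a6486a1923ed76cf28a644f6ef5b38abcb99037ba9f1fda2443701304f60d7c18d6086d4d71646342aacaf81e7a37ca86357ef7d301451a4532f3305b6ca638df73eb8bd2094eab0a455464446584d917ea871c5843998eaa4342d0913bd87faff4dbf10c712e73aa17700d7f797b117b9bd705bb6b97af4a769e940fdf4d8fb4307ada767ca7e22a21b60fdc5e64377b76d2730f653ab828b2353e166ab2117e33c3942875af0ced060f449511804c503f69ea1f22ee4455cd459089fc28b3341b7b8935e4fd90d71f7f6eb767227e6b6e754e8f9f6b13709439ee64e9a96338fa7750572e0c579e24e5a671d9e04f8c98e4cd5ad85e7a5568cc637ade654f0f99f8d953456f9eda2aaf0f368891ff081e5246c997e06ca0d4c1b8fd5382fa3c77a83de9391a8129e68c0ae0b987424d834c5b93e910e7c084dc60511524d31bdde8daddb9494c2782c12cc22619e51c1386d7efc95ee12b427ba3fac7735e208c8a289bb2ed0e832742b107b1f4c130069367d7f46e57e263c096708459bdddb1b3a23f9b49e6ad6e1699fe3635ab0865bf76e795bc1ccf0286acd10bd4a72f9c6727c4f1183312a96cb5a4de3aed7dbf4515229542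513ad341bdc80d2a68b9103cb5abdb97fb55ec39ecc3451f02dcc170680d257e428cfbb45117b956c930821c982c69d9b44fe744ae7e69e013424f3f5eb6c939bee9c3c6b3e71274e86d2dea4c9474980edfcb212c5a5f603ff690601389eea44fc8d8d2de39b437039df5ee5bcfcde2ab2bff35de157f1292791a8f80912bcf6b0d69aeab2ff12683fcb3c3cf2b92c67d792e1007642ed0ed4aea4060863ab0bf3a5893d408350fda14e933d0853fd8513f6497cb70fc2f3465ca33c98ac8663f2d34df01ee851541b3fb35da2f510c9c6e67b7ef2b764eecaec27394c1a939dd3641eafa24c8d23e32aef6ea9edd78edef551df9d242ba808433aa0e31a48ff126be8b8a2ad58e70a91f52811080fd3fbeaf20b83a00f150ead1c916c9c4bd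
  (block 505 35 46 1058 0x16fdd25317e544ee287928bc9663477a6147773e64146620a3f9dd39a5054478a76110a2e43b42efa296aafa1a1686b05272297cfd3e5244bcd4cc0fd52f3b7b1e17537d4260d296c3698dcd7a5d51f9b939ff6921f2ad1fa12f1ad8c95f712ceba4c1f5848d131f55b102a5b4abaf557a24d6c0d7579122102597a5d66a501afb5714ef8b6fdd48b264cc7fc2ae7c24cc4ac376e152695ee5b4530d9e65bd696e48c3dbb4d9f3ea16fb3b11fb3a9540e02fe89f446484f8f8fbd3d3fd1500b8ae69b0e60940b26a3a21b7b16a1f4b6f12949f964ba50bd9d140566e9a6b0fbf0b8037d34216698335e5253c72609f84fe6958a311449eb9f13fea33189e812cbf4180d74562b8b4ffdc672aed7e9190970a1f7445d623a8d37334165646ed36d7f23a172f147ad06f51d2f2099aaa00b48d1885018478d86708ccbef5ecb5e28695a55965896271e2fa5339d2ea7a87945dbf6ed347a66e7a98871be81a4b390f199f195f32c6240928b3cbb793836e481aa29e00565905054b4b3fee9281fad4f060b176a1ba57c29fe593271959b0542f5647ff052adf63172de5c9b2c5d7e157bef72871cc8e1474d8edd3dab2b8dfc78fb6f8745cef79e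448719bb887ad82bfca597a6c56ee83dcbcbf9580553391213076b6be4897a2e753731b00e945b2ea12367af99c1e193b9bc74e4b50e9e7c7fdd26d747123beb5cb5340c922a6f61edc6310cae6dc93c2ce434a6c278116862bc7eab0a65638391569c0e1304cb888da614630c3a931dbb380fc11714f1c4452e5ef80329c8f1dacc488953a681c8142814215e84493a883255743ce6cb4e8d3902d30ff77825b3445200077fc05bf7a3b52e60c4c9310d25661626b20c9bca70de887103f8aba741b776fc9f55c948e3a2c5c0717269b0b5c08d643b80642cc92d765fff149dce7f9356d0eba86d52981a991d5ee2c54ea69d8cdb60fa103df4c459180ed44047c41ae8c1a15dc506df5e9fb436ab049a3f27729020e764b2e7c4d9bd25ac96c7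
  ((rung 265 34 2942657530814))))) =
  rung 265 37 45132734383 := by
  decide +kernel

theorem ladder_521 :
  block 533 35 48 1116 0x1b29686df1c4243812bc3f0022b8a80c88ac6550499e9213f0446745559a358f75f1d1bbc56fd9b92dafb9b60f1cbe355936c76934b0c0bc14358a2af7c4bf263d8f407676668646ef766c45d31aba461d2de9b9a0fd2bbade8bbd112a8460ca2a38bf8ffb03838faaf98c19a2a24f468ed915394c7d285d40e3b3d5c09367a7057fb2e1655871c8878d17ced84d3c34fc50b0d01f20e5320440391832566d26bc50bdf4b77890e01b571d2de30863dab16cce6e4ed92a749c9d91549c2d1c29d88e3884eb6846b8805245cb4a64b4dd91bc47f932287a5661c5718464e9190fec4b24e1eb23aa24652360432c505a55ca21bed11ce1791a902dd92c452d6071508bafc2a20d9813c0736ae6f71179cf2f07cde50e888ae31520381af37955b2c0e13308b21a435994acae4d04b7a1b5febcc76bc014e496467ebf23726be5b1bed3c23e9e7251cf8ee709275a03a79b86e3c476d19f1d0a5d46d9e01ee4a78b311f52b8ee5791d3b80b3e5b1f2c61c1d897a735b6e2bab003144aaf3aac4ae2f3d039fdc64806832270d06e35a16c4795934608558f95316a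adfc8cb6d363080900110364e03219e0c037c6efda6e97bf3737447b063d56beadd5fb5b6b8ef8ee94706ad1e5a4ec9fbfabd792dd564692bf7996fb52efbecb235b728e2d03c5a19539b7d9312dbf329117175f7560d544374ae2636159c33b390de9098337f4dcdc80545d89b985db396352ebdcf2466d887d3591c346c4a1f43a86f72e31ab509e604689ca7f90a64745be99ea65705b0cead69d97e5196c98389c6e1e4e290e7bd92c38c50e9fa98b66a36aa1c37e53dc50c245928e788f58a687747eb1357340b2606d61b7da96ff6bf36c3ccb2c4d00527f60d65a1bb63f4c81a37f58dda7d4e749af963be5385921430535b6610148b3c86bd81d75a42953624043b27eb40f57ccfea7bb5213f7319ea4569da51e632db365702ad27395a0d8dac7ddeb21b63de4a479040af86e95df396eb420954f4e31a094d44acffd8f2f71ef2b97a0a6f918ba36cb5973c66965d0cf439da49acfa3f30b116c95c9e6617a5717f43d470b85315b5ff5d6507d9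
  (block 529 38 47 1107 0xdf24e45fdd5c6cc4cead3974d3eba34001af8b7e8e43d2108f3ee26fd4fc1b85b0321e2f31ad53521b36191b2940c24c2a123ecbe4d9b946a27990ff3b5a28beb79cfc8039876dff3c1855805c39e54d6202df28da1c3d46eb4c443bbad5d834c74e4c941e418589c9a1c32a6bbbd250a69efbaf68d99e4860cbf00d069d53973054c5812d73de7cc29371b5d2a75aaee9e64771bdb3b6874d8ee04e21e42dd9054d7df3380baf672847c4b64ea1a4a45b549610083efd8f3558993261d0c6bdbf5fe60b03b09c9d4dfda2c241be51691b596363069bfbdcbf90e93736784f0e7de831e887fea51ed185074e6430f59539e6bd98177276a4035e5925a9fc4971f7f44b47abeff5e12e83bf66b3c51797a36d9048fef08d162838e162027c0b459140b09147e113f20622ff6e930d241da698acbd1776d8f9538f48b7a3e593ce6843b4ab03bc7d396ad2d41864131eecbcee0cc26e2e0fa790463d74db2226346ecc8d26aae1f383ab554506e8da9ee8cb173d0b11f1a7e1a3cc41d11e0aba53086beb176451c652983dfac51f81d5c21925170224cfec8d506f0c675b97e58488fb75ae7f3aedaf0363693e03027251fea4ec6017ccd131cdc79c1d0afc7d2a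2503eb586c727dd7e3596afa0752840381fe8323cf558af6ed1355f1f6075954c3e19b96077b7803e8b6b879d9ff83b122170cb62b9f321663056ada836f220047022f0c5baa1e91f9a5f2e293b0a5b27944fe671564be1c0ec220fb5dd2e4fe085c5485f739712776a0dca27ebb037311d844ca2bf76ae6e8a4f8a1d54eff179a3f795ddfb459b8b6a08c29455bc99d9b1ae0a318500ea9c876064d2f2e9eec3ead428c076a5eb4a1900f15558837cead3ab5ba9c68cfe53c342e4da4d0fb5ca9e60022ba188dcd2706a3e20edb3ab5b61756285efde165d9e26e0fe26e4da365dbaf0111c54e32590603064f2726fee72a985d096aae56fd5d3541078f1f0cfca1abcfb14198a655fae1ec206a0d593a04e2d0bfbb02d48dab080f627d2a716f627a670e503fc98bc452c2311b799cd47603004ace070aff6ca4abe8b5e3ed2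
  (block 525 38 47 1101 0x9da731d6620f1f54041c28348296dff8f7690fde6562c8c9cb26097030c0db20033797a79f9dce1e5e75edea2a93b0c667bf5691ebde3e8893c8245c462afcbacd445e759fe21edbb9a9a098ab6d468269df4954cf1b41dd12e8bda12cd4ebfcc5cee28913ae97cd848d15dbb84d355657fd3ee88e230a3ff22709d98ff551857cf38366618da0076b007f843c9138ca29dd6e94ad1dec731b2fa3af1f20ab361db6542eab1dea0f4708724ba5a2589bb239a6f154133f8a48c1387bb55ba334ca0cc0fc7f95e0eeb9c9a397dfe9e0f79ad40e009a3ab62d3479afb6ded844db039d919d92373741ce76f038af6d6a83e97ecba7b9a253da5fa9436f94ffeca1138a9a5aba5368dac884ef2c5be40f9faf9ef06521168ed0245f4cebc4e625237ecb3f59c11db6ef05d236caaee878cec110e9906f36d7e96449f472b3797087a6e28961e8a655e9a176bcf362c3e712ec4a51a4f30395e3c5758c093898847bf5519960a53a7e2c7fd14eef5ddc0399e6861462a842f876077ed42556391cbb5abb7d19f89927b278a1fb9ce3cc669019cb49d69f174a6b69ed029ed58dc713eaa9cc050fe5ce68d89878e12b2131495ae1b65b29b058f80f77edecd97f1451cc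4d31f3f80e823dd53338af1f5138be2e24542d5e8c4959bb763dfef53b1ecd88e937515a771b0d6168224b2aaf85e49bc6510bda002c49a0face984c7761bcc5f89317e1eb69196d7d328fa034527779188824ab17602a2ecf7e72aef05e11066b35bed1148c5825a391a35a5be110870c3228aad1f381799a388d69d4c3718287ffdc3f0bd0b12ce599801e181346a9697daaf476846378942b20de6446d7ea2f0669fb4fc598606f65d2613ba3e4ba82829281dd42f6ecd0c84e35557bd940a519f7606372347c96020ca6a866e61a17f4c7543860640944e4b4c1673a457d99af09db20dbd345b9c4832441aa5bf1bb016e17a6e1589774b4be2749694a6a67e9566ffae4f3b60e73d217bc1760a40700b3c923a3dab11ebd19739f16810029cb0bb9b86c8148e5ff83fd5a13d28995b0d43bdbb4f61ec288f9c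
  (block 521 37 46 1091 0x3047f3c3b96ea9651e94d472631ef96dd03b1fc8da5de93b9af922945d90e3c48f094c4873fc2c8c36ed2564e24d681ff2f8ba8f59a4557f32ff32a2de5a7adec58a794ca4ffb3f259db581a2f4182f53465b5fce41d0c72d7db52003f1aa0733d4172122d9250b4607e6ce1a94559f596a2bf3079a786d5f4397897fa95aa2745df80138870e198131c40c24e9accb88e3306d57b92a53ad1d56b005a03222573a99ad1eccc5703df5ecd10cf476479b6a87a1a7fc4b4db2b1782dcb7a8170d790710bc42a73a04ffb7b302a225e6335a8b381e66068e495a6e06fc328cd5d55ac732dbc63c316381628c0cb16fb0517f5bcb2a6b9604b727f6a44b74adccc5c84e0e499983faaf2174a63e420eb538d20bccbc2254da807ab11268ae90b6202366484104b5fda0032c863943997113803156786ea93073c8ce8d52fb6f5a56549ac4871808e94931f3276baa6165102db0672201aff9cbc5360c4a0ed4914643d6387819e56206d51e9cc479f6a32bba0fb9ea9073a967e5e74154055e7c25dd825b9d890c7c02fc1a033843fe28c6150001363d33af6726b531530622b1151247d873d7ab6e5575e80b4b8de52d24c26b4742ae0d10666e09f3e61b09996a169677afabcd9e6c23a63d7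1816300afae7559cd05798ff77f04fee28b9efc20b327ae7ca3b2807ad9890cd3293742a4a69f06e0c4d153f67ca6c7e9a97d938df656633f6a1f4eae406ad912c6b1e2262122909ee6bc7485ed09c0badcb87c9a2af809e9ae62492971d717457e09a94bdc9857f6b804723789d39a46499c3823b33ce1592d8ff17eba7ee065c51a50aa6f95ffc8af0866ca3481c0e60df358a41d1f70465daa08387da944e871eeb7c5606f281a70a207edf60b43c542dfb83460ee13bf5b48ed5c164876d6708462a43aec320e88066e0f7428a6a7d564962bf3eb9d8e5a39d8f8b7ce10ff9c4a01d3efdaad969594d1d17ef81348c67825cc64b44ea8be8102b1ecc8b5db2d425bb9177ca3bd5390759df5566986118eda7c8ea139e833361f7d21197e0542bda8a25c7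
  ((rung 265 37 45132734383))))) =
  rung 289 35 4795599154574 := by
  decide +kernel

theorem ladder_537 :
  block 549 38 49 1151 0x39fb7d984eb6a53942eb88cd2ce69fa7c6c71c8d3abf4b134921f3e0cf1ea3f42ed47e4c9a1056c36bd1ad1c07578360f56c969faf44f0d32cf44f18874ac18819c181ecab5083136ab452ad072dfc4bd9e7b2c5c9b57f8bec9917d78e640fd8ba4666e7ae5a2bbd53aa1b25949deb6991a0364acad6c4453a07bf629b277beca71b3f05ad73851e6734fe1a1e3bb2874de5176394661d02a5f602bdc0e15b9c5beb9ae5e0dbacf19cb6ed73413ff7a482fa685db9342f640dcabf5cf698983f96f8f8545f88a1fa7facb44e32b576a3c7bbb7e568b76157322091a2e3ef9d398a7bb0f8455f772ec282fc42ff3b6936fb99b49d2be6aa3df85284887554cc8cc0aba3abd090b54323f916cde59a35fe7a93cb8902974d75d10fcf1112d063fbea5bb8312edec67eaf64f174c0d891cee3c9aa2197376b6cdcd74fd06ce71a5416f74d8f19e5cf55a99513f91c9435a4078e4b51cd68126f6d3dc4302adec5fe19afa014e0232107c30e6fb97bab4ed6cbd64bbfc1b1658842974d595de3fe759b529a975d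6cddc818e2e42708be7f61673855ba2ec9e79ef7b3e9b1c5f7c496aeb78b946ee8b43f1200ef106909b5aada51e5d57331ee84c7f48cde89dc398a0ac9b68ff4ea903c469b3edc15c76494c7580a0a4c86660cbe1ae9fb236060128815d553c7e4f9bcbc7f498a1d4c6847b6fdf3ee22363a69ef103987e9255f0d177b4d4346a1543e5c9cff32671e2f786167ce1fbe4f33dfd899ecbcfc0604eb928bc75c257303c15e8a34c4cbbb099fb926e3db61b560f21dee3bb582f309d16801a86d7e5e4af5152f782ccdafa741e4a404ae93140108126a28204a02f57106cbf318a4f86121845d2d53cdb368fe917026fd6e803e2677b17b9be79f1637ec65e839f27a65c387bb88b37fcc406095624f83449728a73857d1be8e2fc3add516fe95ecb4e4b996456c828f7963cbfcb34f1d96d65619aaec1f33f26df0a4d6364faf8022f30be45cbadcb89deab7d98e06667a4f622021a33340e0d8848d4c9ff16eb92e3bbdf923a09a4f3303097f77ffbe9fce47b275b0adcd5494e62192f1c32bc3d0552b4ee35a37a14d4a31f952214b55168d238ef294c5236c997e55dde727b4debe8f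
  (block 545 37 49 1141 0x5351c9e39534ea33e8e420e3b79424e6fd7f988cd0fe1e093681e8cbae25a65c3293b0505111f8169aea010387871553aecb2ef953ce344b1c25223301f047fae364fb6c4e92f92216b38258870107020ef31325cb235e9bde4a855543376afe4b916895a5b5f8156d23645d0e6073a3524bbe2f041d76782599a5e4acaec584bad028c1ce557a5dfb9871fd814d352b1f1e4d758068dcf0578dd53bc9969c3236f37f73ee17589feef3be56d463385c5e344ee2e3812eca8475f8b025cee0bf7fd194039134b649787e2dd60121c002a6cd3293c62ffc0b68837d2f42ef5b7c90d05c04f8bc2fa7d51ccddbbfa5b60d25316ea4ee92e07a5e95216f68ddcc46afa79a757d67e4ea0933ce95b22d05352276bf937fbba84a493892b020eed2bd7cecba6918f5b46b255757e0d9cd6fd1f249d8389b507fa6964165b3155f0f9b95a8dabf6bd379bf32f4f9f286567d2b6a138b7be6a0dcf42c6f28fcae921dd06a5d62a8b252454a33cdec827b6bdb51c514d01d0ac7dd9b4a74bf94e837d280b8672e55d60ee329980ddd520f66935783dd61f35542732e04017db1b8c993103d376bafb1570cc139033648dc7b88e13ee4563a5bbd9dc46c69e1be2057344190eadf7125ec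71c1d6bcfc8c598318a12b067d15449760737193bb0109a25a3922d37b3c4e1b31d492182dd57aeaa13f1d8bfefb609ee9fb2438fe7604ef778e3c3dca1c6555546d2cee1e5f3f47730b744a801a406de9afcf61dad3d43ec05d3ee1292322c9e409d0d948051ab01ad81c0b9827d72ca682cd7eef917a7ced3601a468a6717a2498c19167bf669e20c5073877d3e11dc29fde309f83e74ccd33f9e6deaee19334df369baa7555a716ac50dde7ded9b68c3ffd880214cf1ffab18c2d8cf5a45a7da59eaed1ca176bb9fbc7d805b8432019bcdfaabee5642de4b09f5c2724f29aba499278cc6648f02f7240f55b1d552915313c214f1105d0112fcd9bfb6353cf72effdf513c292ee4036e78abe5f41f333f1f5da7ba61d6cc05f40a0a1a15484fbaeb880e5fec3e84b0726fd2cf64687a138333b3dfe9d8fc349a9f6cf2418dc795d4cb4bc8d59c72dc3922e24429df9f85eb8413fecea52432d2b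
  (block 541 37 48 1134 0x1eb7dbd1833f7e850e91f6e3ed38814c0e5607de840c91e2af422cfe604d86dd2ffa34df132814747b52139fa0fb767b3ad13e927f7d71869ba2b61a8d42c595bc58efc83d3f8f0697f776bfeeb9987b0eb8c14bac271b7511070732e2f6db81a00767ab306c3f38eaccf1bb3ae7fe9f03beb7e9b9b198d770d84ec3ef3c7d9874d3ad5e0c95e0ba16a9e3255afab9e8bef997a3bb3d6ae24761c6d452c494780efe28d20f1a249a397e7b5085f9389dc92d20985fc3b9c9df837ca545b53e627f4d6ccda5e9aa1291cf1e6c857b1d7675d313a4272a5935f82e09ee7b2dfdc0890b0e5ed6fe57c9d8fcf7ae7593d382bdfc5d2457ca5ff2357c8176d3bef2204218fad254579b0321af6f4b185a8d487e7b1c24d7888bff21726cbfd7809884070b7e046dcc4fe75bc01739bf02d2b790fb650a0c522cc9fb06da47ac3aa2d84af5a33992d9aa47204a860be6647494bd0e607c1471b093a0bb2a5255c0347a2a1869f4e8c0705213cc6722fcc25f0877fe763b1fff151a2cd4665bf92984115c179fcaa39974d10d2d837c15ea1d2b32fd7c3dea6981af495f3c267f3a0637bb109ad22efe3ed1811b3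6af89b11e3b7f8fd89c184187b0ecb4580136f3e9efe2d2c42adea3e22cb3a3887c6a0c09cba572d64a5da3cac2ca86c0ffc84d645248146c2314e2cd859e0da495a45b7f828cc673ebcee213532fca2e334425cd7832d891330f7176b0dbb615ea9ef62976729dc431920ba633ea9a791b9002cb59fa9396181163bcf38eba0a84b8763da9623ba69e8a758f08f58f5d6f9d7f5cb20b2dc8b606bbf482d354b040f290b8e28bbd530eef916a6fb8daf115600eb38e8f2d645dbad746e0dcedc596d93a8a71cc9e8180992a6bf3a136e920bf9616112f36e0a45939332024c0bc64e7f5e6c3da215657ea4e30ada9c11e24298ff2d0a947a72b7143581c78eab24440d7a282405be9d20b8a6b9af7b1c50abf6adccf56cb7dde4cc66f174930a4545ca4a609f6361f4622887f97656e1a8b60b8f7fb393b594a90f78262d77ce2c8217c7ea1d670e550af7692edf30ba61ef870eb39ba2ecbad6b2e57fe224b1b1ae7cb92df6d35898eee8b2aa6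
  (block 537 36 48 1125 0x4b7d706c258c56344e435ca69c5324b5ef1afad436f788c6c80c76881f307e7165a87da15be9baa644056a0a57b347e9f09832c2c7ad67928c20b6ce5e9fd19d8f84038758c840185fc18cb7e91f7970c298bf00e75b4c0d31ef6e3e147b48f1b0352b83dc1669035be258bc67a6c9cab865d360489413c5db4c04b8928f08bf83dbea89924f600b68dc98b12250f711ace097d9985bbf5e109c42e36472e9ae227e172290e732949a838868ffe6415829c983567503c2d753a6014feca9db4e49414f2d2aef337d11142ba35a6e77c9df09a84e12db47d537e621369b88830c712168118daef8b9992ee6e8c31bdf03defa20e92659dd7c2787883ba7bb20ea02a197756b7cc889f7377bddb972d84e159b2a1784896f8d60c0a6993094b7829aa899f000f745c2fcacf53af9aeed70322ea6caa7038fc68d9bec39b9984dfc301c8e42f8665f4041d70287c87097e722041ba8222911c0d4c1938ae4054e427e45802139de6bf3f572261eefeb24198ac8f9dc4fabc92aad51464d6f4a59a49b521e020c2d0f5ecec922838faa006a5f9e1c710f319c95da2936b706729dced59a0de879260929353ddfb462871b74b53b0d99742e0fcf72e40565d6af5c70cd5079a871b637af6c77a4d8c1d363f4d9ca78c8009792d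74055f82272ec23a212251fc235b821e5a45bf2ab00c26ee00f29966f281218e014df191574ac144f5b4782499c80e21b350557d8882ba3843631460639c979e96b43a445552d0074eb59bdb894c3be2417deb5a710e56c3fb0527094cc24e17a803fe9518225853ac5000be0b4dfa6328d0c5c2a9f1154da54ccf04201859e177069877ced947ed8b4fbd4fa063ee936fae784bbfc3cd557abb2d0c5e80051fc877cb7577072c9456a81268158054a4a1ee04158d2d99b77ee05a119df159c2e0b89c122eb88e8b44f24a7c69981c291d58a72f6f18516611a810bf6071210a6f5634eb049c52f6bf76cfd903907be27bc4f2c543bd921ca1e0c4b11fce9553ee355116385c368ed995a41415c49df15ffdbf606ef30eb972284578e54e68b8388b46f412fa52c3b11f6ecfa6f156d8193220b50dbdc22311ac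
  ((rung 289 35 4795599154574))))) =
  rung 289 38 66807599180 := by
  decide +kernel

theorem ladder_553 :
  block 565 40 50 1183 0xc5e9d595acedc3bcbcf4a5a1d91302d8dcbe06a06ffea28b314ae0668304171dbb5bcb9f53d1f94a9fffd964113e18a1517755020daeb9fa74efe37029e39535874ddaf61dad4bc3bbdb81e7f62438d201317faacaf19deee02605317e94a405d434a070db50fe5b8abf836d510cbdcd1bb13b4ffef8c667b909824a98567113647cf44c40c6474ead757ed51bf4a8c83bfc2036ebddd541e52eaa96c3487301dd056674124f42383cc8a2d10cc352b7c1ecaf4e5ccddcbf6181325623353641918a5abb619d4f18574db3c4e1c53ba636fc236234e5b0f38eec629f2f7d8432977c9bbc2b8256b9ba72bcd7728211d2844a3060d39ebb44d8ef3b5669a0dab1706a9a54402120f510136b544ef96f781cd41a108f893be768953097d28eb547f2e9bce693b092cbeda90651b03ee9458fb72799548b5c2fa95869de9b121c5c99183cf2fcc45eecabc25dcd547de3a098959ac0b9bd9b3fe6cf00f61c2c06ad5c904856b58c0f7a5a8751f819e70d2859a9b1fb62926cd3067c2baa35bd91a1f38955a6e40ae8d067d8134a8102939a9b8b219750cb6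2a37acd540f4edb27d7fcef8adf67e60d91c6776f7670f30a32a2b776668a94bbeef322566990d22869f1dc18c9357ebd24d9f0bb4625cdb668be6b551eaaf9ab74ac5d2a5dbab78da90d46a3240717b325ed027dfc0fd8287a70c488b035421bc553f5938d6f34a3bfddd95ba11cf704360fed2ddb71b8b61e858b4a5cc286bee99c93e847b821c8ad23249db4f52903b97afecc50af66e2e13c98e2b751d3f6541466f0e53b3ab31bc540bf61cef285fd9fda57ad30c6fc660042648ab9b1c782d6068365001931ef6ea0366c3bb38c83edd63b1d60397c5b6f8885f0a77276523b2786abe4eb2a5d21470db657534a61187cef6435058c0ab80054fe1d6539e469902cf933b23d81eda53630294e2b82433a469272773eeb7b65d2bd09d594891f00322960f7f943a16ad53ccc854f1bf60c240ce774a4c686b0bc93ecdc239fa9352b6800b1d65f1136ba42f6297ca58bff17a1ef413688a7824bae5f7d9e55be94f57539d60f17a24576f91958008b46376933575350888d34c3e35b62fd68da9a02fb5214ca5d1079257d80a00f6596a4af42bb13ad20e6a26746290c9a0216254ffd6dc646c46cd6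
  (block 561 39 49 1175 0x614614ca9d360757743f8d3aa94ec3ce4f842a82e1c24705d6f21c85764ae7d0bc81e83d2e91faf7febddb3abd93a3496913cf126eb189841f4f91cad5cb0a9e6ebc9b58790ff9c926d4dfd079c69ad5ba4c36e569337c56f59835880bf179044970ad621fcb785a7cef9f4d43ac1bc6208dc008cb880a5017c3456958b4474b9e2c75fbe8b3a661621f8d3a4b8c7e70a51347038072c2ce8256d11d1f1be3507561535e1bf492a2fbdce0c5490f8ea77d4dd9216d272d461c516f613bf08e6e4ed905f61b474b1c7896359c397cf7f2b46a08b6c1ce9c308f912da436326466cfcbe57c52d15484ce200fcd5093c07e4485e382269d4b17d31bcc724be2e28c311df76be46176a3c83dd1cd43c72b9808a5d8e11665e55487605d0ddfd83fca33adeb46087436e8374c5d724f6a41f9a761be4b621b1cb07fc3606d2ff64b56bb38a6daab32a35695a42d7acc13affb3be362717c39f078a79e76421ec3311f7c3edd4880c9e079cab91bf40fb44bfbdf12f6d6495612774fadc65955a0a695f9be9eaab3120c72efa273c1f1088bf74470f27453d445117f501aeba638d81f94beed7ac54ce5d9feb2a2a87b5ca0aa989f121bbf6cdeb84112495a56a7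534072362be0ee40f422260870011f9ae1a1898ac23f014d51b7f9840dafe0880421c8f63e21dac5ae705c4f08b37cc860d07d192a87ae48ea0c316cf769070c5adfc6b9e7f5823290878ab85448c56f105b81cb3ce5cc42b5eb6fceb64fe8ed6284e67e7fca7f55f907dc741a0a5b0712c150ad41e33313c62a732f5fa91c8e64c66ee56336549ce7dc308789dcecf45d267e424352070204c5a58245fcde1c7543246f2c00e898b7ed95f035ca6dc63fbf922251a890d4630f719d80c8d847a4a1303bad54ca39f40216dcd491088dcb64784c22c8b067d8ab2d1ddd701fab0617e534c077c2105cd90ba49fdccb74ee2dbc689c3f6e0fdec001c32655c697681f40a73faa875f10db3379f11e5b41f5095340cdcda549f544220d003ad269f4f2f7ba542c051e3a2ea68a3d67952f9c9250b4b78018a96ab2f36d8d1618b3496c1459edfd076cc40e278da9edd7f26631342891615555b6e517c120dffd5b218b0d68196e257d6e87d5f2fa5cd9e35f4499175ab702e372301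
  (block 557 39 49 1166 0x2f00f32bfd3e660f587bdc6081f4af41d4300bd7928756fa290877b561ecc51f878839c62b15173daa682cb80c6b98e5c365ec1c967ca9726ea0603d5228779d34572804e0b75afceb9ffaa3b8724c4894fd542f739ff95e7532ff6cd6d506bb87af2876137bbdf95beb3ad17aa0a9bb21a4e4df12e1df33536b7a1782964300c171766b06b5a7bbc70cbfa720199e01f973a9e46306e4c01603d29ebdd3d5796658e339c0c337914b4b66a97cf689edb830109439e075036b9c91411e6c84044aa5d9c061cb6974d02adfcd8ffebff2e0cee774b4ed6ca979fad5ae06750c60de9dcc55a726a37153f7b40cedfb04999cdc247429fe5c0202577f9427f6e00726e90459e2c99f6aeae4dc90f124cfe04b332c70d13e4a4beea292d12dc0fe2a5a63866a0331f5a2ae9b21c35f904cac7932c81240afe5094b45a72c954848fbb773726880ac646e01d965085d08393f609940ec5ee089583d184670e116702bab8640fcd6f9069917e0ddb83e9dbf5964abb051ea27de560e1cbc3416ec468388fad9cc527ff16d36bd9a77d7432e269f6b3e64e5ff3bc4538533a5e6acf27e5c0a86d285670dd18690a0746ee6f6ed7f0b715db0d2063b305484ae145c4155f8a845643232efb8b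28f307cb085b11cade4ebdc28ed8803f089e89b00de89e0c140c5228aab0cf72a7ffcef38ce8609ce5d1810c1e60351fafcc2d81eaf732a9266a867d827748997d5d0f514d7c14aa618739b72969b7afcdbff798707f382785729e47a6623e555a9655265f597c684f70197c7a604955bb3f0c0900422f755e87eb9be872e769be911e9967af51cab82eedd11ef8d8330e9f542926d07bd2f96db36ca2da861952953a10c7fa0721420f634a63b5888696f472dec7d8ea53c7b7126a11d2a45ec6bbd491461a5ed7bea27aa366e1e5b06ca0e44e4e14ad4b431cf8905409cacb0d23d6c8b95ee11d4356fc9fe9222c678b39f24ac0d19172c2bf60801e7b23b1f0fcc0316cbde6215be6348fc2516b554cb47c2358e4dd6018045e25edb84307f53a6a171e48428edff7048ad360c4292f6c17a9467a64cc75535eff7a357baf6ea259005109cc2d81bcf9b0f91ffc01524396cbef3daea241b7edff1caff02bf18a363b68bd75e7d13e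
  (block 553 38 49 1158 0x229fe98442a058401102bfc0f882d845de54a623fd252ddd27fd0b2048a170c7fa5222134327ce758dd853a962106e0788993815fb9e207226e9ecb5a0ea41be2b38a91c4cafa456bdb16e9de0b635a9f16644cce362a9920df03258fc096021c8c297655269a3a384e0656dc9bbe1ce803f9d975a788087a5edc9d5649f792d88e1c886836fcfb67792b58776a14eb9b1e69ae16e80acd0a6b7cedc161f24768e9f7d106b40f2b3d4aea06524f36676634f436377dea678c56ab4abc1f5842da95330735ea51729fc54960e2df1831e1c00cb0d61be5a7630cd72cd7e61d42d1592e56e15e0dabe60955e6e3ea705a6323dcc6cf76c1a1718447889478b009bff491a20c7898124a9fd1472d6d6fe8168eed76b58da10155f656116c8f00555676e932873d2b66ad9fc0e1952cc8ce98afd321c64e1ce0646d928e8da6e49ba2dfca769d6fea68f11f9175bdf26328a7f4c77dd46bf42185f9f5c091c78ffb491b193934633c4679b8ac10dca4d1611633a1a7fd7579f035d3ba31df72ed23d617e599472c5af5afe84feb38f0ad9a0d857d1fde7f4ce81d11d08dd6329c22e7662a6ca18577bc1c06b91bdd14052e309d6bb7de81f5dafb61e2127736aedf41b55bbaed13b0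1d51a52fd052db514e874b2559240b25b71d442c69d74ce0936a4a3dcd69e8c5c1681d93faa3040676da879253a3ddc3dac76410ca58bd917706391ec7e92959c01fd2addc043de970f1a067a7171707d90296dce52cecad501f147db0e39816039d0ce2fdcbe54d43307ca5340648b9e01c8c7d7bb43276b874a34ad93f842599719d9a886f7c02d23d55dc23c85914033e2b482937608b7fc1c72f033909465f81fd3640e586aef6382c0316f781b3580e3df84bc8c63a4e8764e51cba2193a8a8b69e6d4d3932df2f270da9234f3a078e6892410aff20ce05c9e740059eb9b266ba6dd9277bbf1dbbf1dd6f4062afcf960d1a23cd070bbb2691a645b021d18260d547d5e08e98e3e1f7cf4f4234d2be30183b5e9501281901a182892f2620dbdd4d7e18e862de23321a7325ae7992341af10465233a02ab5ba0116c98d229311b775950993aa051b6b0b4405c05c4b900443ef65ddba31731d743188ef3edd49ffef0f2692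
  ((rung 289 38 66807599180))))) =
  rung 289 40 135156998968 := by
  decide +kernel

theorem ladder_569 :
  block 581 39 51 1217 0x1170ec96deedaa7ec629e32c8190e9ea7beeb68862fb50b2abcb4c95176388eda7b5a4625bf7f09fcbaff02ba7a91ab67e6d1b7edf7bfbd67592384de09861ecdc251e82c45c1abd9f5945d120e9bb1604a471c6dfd80fa9a02ea4c5f4ad2c5046f55f4ba36e751c878e9e8457a292aec46fd650d64a9eb80c4859389a85c3b980b9843732e4c0051492e2ac86cf3f3b388a2e8ea67c4593c900c0e307ddba15fcc35eb8466c90f6928f5e7c441ed76c8b16686951671a4c5d2f011b7465fb780e7bb021c133969c1a2273026f92ff42cd01b9743169b0705b066923ad1b4a416e91bb88c9fdff6ef6e4624e50a63f95ab15027b7f35499e7d70cf0efdac5eb66ce0d36ce454e1285aef72c9911d41187553cd85f8597f3e7c819393d8d1e29ae6d6bf615efc4ba0db2378490ab4dd00c8fd7edefbda3efb326fdb5d66ddbb3944d8115271cae40d34c5b9ad2f73cac80eb2c1252f95eff7320068fbeceb82b1c98cb44391eef0ec05a967b9b4d248393c95fb5d75d808651497f1bc38a6611888945411abe23793b3d9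8329764b6bf23af2b81c64b0dd559ac9206679bdcf385774bf7c1673cebf55c9821fa153e2d372a1ca27aa27ef6cd16ee2ef004029897b91c5e7241b27dd71491f335efeaa920e626a26d8dcc816026458bbb96e911d97f3b4f567b3e1ad741cde556e35b905b6a04579d00a0ee5f8d5e7d2ac57d00b3dc499cdee91ef1471b969c2d3df00844573ea97c62ed4d9a6522505e512fc7e0c5710c18891a21a133dc64a081eba842c598ce464713b01272ea73f4c3042e79edb6c08314f9665f3df23e72654cea3c5a7f15530de95c24fc8868966a82bc7482801ef0bb6f3af253df57f1cf69ccff4ab913534e6dad702cd0017c283e18d4abca5bd7728df32c6e92f494f24a6097249d88a276d2df7d90fce3076690cf7e50658ff68333aa7584953d1622886c2688bfe6c0c1a3802e6a132e23332fba0fd73d50e42f8e9c79e93d1ab12b6ee6ac2c7af737a7117d20e2fbc5408cb722e1f1a57e32e633bfce638f162692b6901cb53d8756aa3c2d7b7ca922d781317ce699536319d4c4e6135fb0d1a6311848346ee2f0fb513261da77b4a48afadbf1a1f865a3d326d98379a81ff164092d17383fc062447ceacc25e218a6f469b042365763458febeb3a2b0a1b1de54c51b349268a95161df5c3cbcf7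85e8bf2c07
  (block 577 41 50 1208 0x88e15d40075d67d141b14fe4880e1b44b2fbf175eb5162192eb3a0a81a3ee2b68ad7cebb611ce83517f3ecb63c5749f324869a4a32630e3269c453c0ae116ec13776b0d2b89069c4e5e27f0f4a5893a9fa674bedf061e434cbe07264c02ece7462c179a5c79edb26474e8b868f5672db2e6ac533981f75a00ff70a92b08101e5d195af298ec21a7ddad7a1aceddbb1013cc055ebf1bf81308d434c321aaedc68926ba2e04f752cbedc203c148133421eca0bd61e05e5893af3507118f43dd04d233a665c24e2a659a738d5f87c0ad3a63ee1bb91089f501a0367d1a0e41b8ac73169c289e04e48997791db59a6e3549740696b97cec0499bb54850f5f87a14d1973ac12c5b66b9d8a7ba9edae80c9d93549680e16f6c5f9dfdec7c51e79f3d465011196b1741db65e193b078469e2199810ba5962670ddec47a6bfb591e4a39e7ff0605ea7c9ea9417b526d0fb646abdc5e95669e88c278eb1b8fbd728c61c4801f8b8e1e6d24d22694ba7f34213f5b4b9b5f0ac2e895bf8a7df292f9eba8795bdd9f38032b582117db8448326d0d9a02b601ad9327b204839ca329a41d1e91774e7538eaeaeabafa2ed64483eae1cb087ee22952f4d4462c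e5385318f1f63136a7f42a3793259c8c9d4127f2a87d79077dcf1771c7aa9e578c89c305ef144fe851861803621d414024af8cfbca69f91eabf04fe6c28e8a78a8731110e0439ea11c2d8a4efac1c77acb706235510378d41794b1e9c04e22ed6c0fad238707602e05bb87f5861cb0651ff3de41babd811fa4a02d2bcb8d13121ac63809b492004d6997b2c47168c1aa23930f2c1852c551cf1c7f7688a7981cae5b91898e9c4d39e4a26bc1a58d6d773ecefa7f0fa1c2d58eb7ec88ac0314bd0e1032227448fe85879765430e5314b976b26abfec9a7f1fdc1c3d017030e36e64d1a314594a0f6ffbd6f10e285aac439f52b5c5c726e9840b385c417491c2649dd75042bd58f9e1877eda5d3b4bb6157e6ac228b558e4f3caac05d58a422a06f821d250eef73410f9af0bae2f72b22be839e3df4c40b7c0743d2a386d93713b1f00436de46ad3a20ae95bf0686b274cb3dedc5bb78de3270421328c33cffd05972a2caa578a4378ba999921b1921a07a86adbc99b4000319f710a6dd09de645735733177cc7a1b8b7f7338d2722e43b70879ba95453e9c16471e71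
  (block 573 41 50 1199 0x639e8a103e133e7a3c7aee1c6837613299c07a66c4a4c5a3b6a0f6598dae3a5571e52f921a5cbfef4ebce84ab953dcf387c07761f019bcb14d497fc34ab3711f06252ea9b0779fe2f3cb732904e4587ee9faac938920676a9f9711583cf9858ddfc192670af219710d20089d962054bdc051d470d2ebf45011fdb30f0cd3d279fa4a35c032cc60d75c196f99938b9e509a8e07e430f779004dd53dda8bcb64f2f23ba72e57633de7e8ddde9ac08775bc2fac04159a53b7a7226b1a1e6f6b582dea300481888a192beffc70d65176aa2bd41a1d6a18ccf0fb1e670d0d2dff04c1fe2b14ee1ad3587e4bab1e5f02a6e54131dae9ca848ced4a0a55f5e5ec3e4a1126f764c637c009a932ba594ec5b7e4aef3cfe65ea92399d58bd0001d116ed3efbc614da6e17e572810f5aff503ed51ab5b3507b4d32e54b8588d0b1bc9ff84461afe6bd599bd938c653c9f1749df97b7261f4d0c467db60e033dbb6532e403438aaaa56ee159b16f34c141cce42916a23e0bbba29f0809f9b1563f810b1829772ea55136721e829e4bac8f81fb63c0a4316c49f0debca1522cd638f41091c980f439590175b1431af7f077384bb7931519ba4905eac549ff863f96b7ca46db0379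d2f414975f4d132bd3ab79f915bc6646f9c32f39a17c364fd096d424f48152e765de9e26f93b27cfa695b3a2e8d7daec06a3ef294b8657543e948fac0622467e06c25503e3d1cc3fc5a82775056b2039b77000ec7f228171591aeaf2c0bdb65579493ba9e2504a4f642a8136403b4ac78a768bf1d66db638edc8e0e036093d22e60689e835bf9a5c16d62d41c225757437b152eee35a03acb2e6a47a8226976d6df600e16b2cd64307de5c63d0f10531ef28ca50ad6151f4fca5fe898622d44400d72814d3bd6903fdf9436a126ba28e85547bed6e6c49370b70dee6d211a02ec7933e276079a3c67089c95aec9ccf8716ed1963ccca43ce709fee4b7223f303212f36abb19c5e88a1213b6ea8053d39cfe2220504e0b12b8e2b00190e6b43d1dda5c74409b6c10a4cbd54e4300f8d67f07665c4e6fabe5df05206f66faeed32087a797ad57c4dc3d77a3eb6a5cbf86ca2b9bdc395573fce85faa13e7354dcc817ffa1f3763f29897077cbc866234d54854f2dee4dd2737b18b8d4ec939424074e0d28ce1c2548451e31b47ca8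
  (block 569 40 50 1191 0x2afff63ed1a5bb6958fa7b86abef8299f6729bfaa9decc8b87767da17c841a972bebf7540f877b264e8928b0ff2080bc5dcdc7baf6434aa060676501d7006f9d7b35cb759671472c378796a431b2d50649c52a720bc799f2fa1924f85da25c1865af5046634bebec6fb3c8d050dc67c94441105ed3092bcfcc8f7155606311c39b9d91d4fe59c7ad6dbfbd86a1535e1eb6a098fe11c285431a8e40df52f43fef4cec5e14e8e0e4cecefd062656705a9db053f9a3197d484a2d1d9fded6efb277d54db75a879fa4d593d577b2bc28208bfa9101e09beea629f193ee130e2ccb857423ff28e2887f7bf31bfac0832a318a95d0c222dcff84edf5d8295a64b94e40456893c5393d351c85705a804a2dca8828856f1c6b5f6d2cb4f23904c8ca62a82556b252349bf85f1eeafb1a07d641c138b2f93011797bd51070bbba3e25a0ac0846071e9b1dc5612c73a6f15d21663bae17733cd9a80478b977d887432803fe107e66e4408c43eb15522c7d10c11ad834f332955b449b4b8dec52d94c73d9a5b7edbc4a8db69b489324774f897359f06b52f9cd7644fddfc826b2ec11a6e4922757db46008ecb961ed011c37c0a67bdb15d8af637db6cb84ca07d52ca5a8d4e7cf8af9db5b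1aa7cf0261ad0595a1309e534b2e5be37e509f77e20601ea0740028999f1e48304cb314e5c9268e5330c01da2ac7008d0cab1b8271919d9968ec8e0fdd9938f04833dba89e40ef2c402a69d45f98a00571688b3531bf6d1f7f3ac2c07edf674b2c4b06ace4de2961038d7008eef8e072df7d55bf146d1a4e624f90a11518bbf679ef6780393cea419b35c20dab91fc022f4f3033ac1a64a2d6ac5ed6ca05fa9258c2220115df06d804a49c76c8ba09786f099fb501a9257f678acc472a780eec0551630debb0a2b98bc6e40a215abe667325b9eb00a8af4a74c8c704c61b99a45cd233aeaec7331f1f9c1be3df2966e04f5643d711a40f89699e2a1777dbe82b19cdce5997d4a47be2430fb8f4b3818bfc8e51eec0e07ffe6d25dd1a8e1f15cb9fdd0f2cd1299744608bd1782279ee0949bc93a87633c040f1950d0cf33a0f56a6d33f4dff803896a2b5ed465253f7fedb05a37a8cbb947063a2809dd68159aff8e67f6ed49dc6c6a2d9bd7c8009d93f045539b76b6d15f8741a70cac888296163dd70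
  ((rung 289 40 135156998968))))) =
  rung 313 39 95574204595 := by
  decide +kernel

theorem ladder_585 :
  block 597 41 52 1250 0x287ed5dabe7459a60e0d063331bb5d9eebce90c92b3067035b671bf3f16dd5f33f59975ca9b7d5f1a1d619b9828740fa516da69be1ceed602325434914828130253f41fdb19682610a67f60e318ab5145234a6afe0d616b03974e80edbcfc80078e408d019901f5ddd8bc77a87b23a58dca96f90c4964e4e8621044448f4a9cf7ea87cfe03a26b07b0196f2922d98c1f09b6f1e6f59de4bd71e68d24e47e45a5efe4d4168f31c973037ce05dceaa899b9cea23be5fba5f139435227e88466fc54544b278198824031fca1526e4e0a0aede515b454c6eb8e2b06dc0b061a3dcee864152d6cedc19fde76507b5d6ed7f86cf10ca739407112e6222b0fb4ab10ed365f16d0d05e63c68275e8000d115885646a86bd3c0e8b2d0cbf6336cb461878a41306c47c0554506884dca04457bc7795854247ea2025a7ae1905656695bdf4a435855561172ea79b8cf77798be44f8727e2cf11459492a8b9cb2cfa37bfef12271d17d98f35d2e69c8c5f41dc694cef6020bf7f36ffb903224dccaa03ed8456303635eac10cfc7ac267ff0fd9df3332d78d7bac85d34379bcb042530355105cb77a3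a5aa04f1429a76a76754fed8f6cddb6d29be36e90b2a0e63838850b435eb70a92903e46011c722db392a98a9723c23ff744033aa162de18ccd15942e9d6833a0f7b41158a3580c7b1084dd1f5dfc07a17e7861f99bd4e1216c113f9e2f390ace7f17006a193240aa89e9be5d99f87236accf602cb39cf1c74d72e1f7bd3fb991e288da2a8004547126a5aab7644690da747ffa0508e4392e2bffae628d4aa6c308b09ae4f3d8b314e3f79ed6f84d13e3acaba1379645c83568e0c8cda34f860c0f91fe55b690aee4e099c1a0ab6914d5ba5a5467bf0107a45904361aa8145db1110c8ed3c46729b03d80aeba0e257c961e6c3c398f1e9b24f4ff6cba351ce50a61e7a63b29f764e54c5ae1de54f7897870f6381a2f688e8b876294c85c8c72bd479e24b9d6dc24e93206edf708aaab99d1cc2888c06210eb95a7492697125c3858396b01f1793761bb50978872d3453a14e20e9ae2b77237ea4ec5dca3bf598c51520f9c71889bc28cb96cf3ce4502e807cdef6841444798762c1146e4628fa86f3bc5a46d4e9ae8ec7a70c064cdfd3baee83d97180223fccb8f7a29e631460574cd9cfacb7c795347a3697ce839c73ec0f09ee6684e5c294285ade763a0cf6ab6862aaea1870da65447ab5861922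2de75403d78ee9e19bce
  (block 593 40 52 1241 0x3d901d7043d989b453e3edb56caa11c386d697389b30199b115f1f9fad2d4506e04acf292a733043820dc87e63776a8fddc107ad874eb3738adbe754d97f23e9aaa9f0a4a84af02c7da1b4da5cbd31fa707baa1d556bab9d7af4cc674dafad9ac65532b03db2a3d28c1b0aada8ebc7eb2662835009b16841a4a131bd85cf5c40a8a6147fe91a7588de3906a51362da31e4e07da52a4fe8edb7f8c60941041cefbf6626afc09598889859a0c0e4126a608238be50e9350ff2daab0bb14860822ec65f8b4eef7614ec608e55166d0a5a0b1fc4e26b6029c1ad3b5c99d87848403788d4e6354788857488fa8d9f123abeb7c2f85a7abc9f1e0aef04c0bc4d4184fa27a0b01d12f2a3c541dbb466b6a6539c5e019ef0700f984474deb4dd3f92cfc2c8cd6ab4f7f9826919033f5a46d4a3df1d0de8cd12e9ba74212b0cffbc2cf880ce5320682120643529fa89855bef22be1bd51fcaee796f8a3561fc0abdbe57673e765f22262e5e2269a6cd8c2ab91da51fc4ed5b1af4edab8d13a9a9c8c9e64a73e28763220b4294b3fedf98bf9060e658dc9fee1311966b6f25d346af50e2f09ab13cf76108a3bc5c0b9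82a6cbec50923cc06089906fc37d02931eb80976760a042eda5f4d14c10cbba9195e4f6fd0e4821a9d825ad881e588055f7bff9b7f5563eb395390f6b4f0735a72351ff9897209547754a109a67fa3df9af8ca2d7e4a5d6981648a7965ff244c8f4196b20e697a70dc5b2f31216396bc27e94afb914625c76ec430cb0279df5b686b567a133331c90448157075c67acc17059aca54329e7b3e6ebacd099cef6b993277a1a0e08b220b2b73cc921ed42fc7bca3e85d8501794854b5b1bfb0c85b3f01711b8d0b5de2a40657076595f78c2a585adb2905e657a6a10c07a0a4ed656bbd02eecfb8eec51427f3ed09773d8b73b57f8f0fac5bec22b21598dc1157fb1236bac328abdf266b4199add28747e9b45c15eb3a8714dfc7acf530e070707dab35499c70fcd76d99718aa7a594534af98f53ae9175a5aaf6ebccd77639f01494ed3b0331798da9ed0fce436db8930f91db97ff3794251c2df99e17429e4312772d6a20e9665afcc4fc3e99445f78395f2ba8314d4a1f3d5dfedbd3098819536284a25fbdb421f284c1584658cdd4fc464a55a0837de684d0815d41ac064ee9c2a145379edd50733549ff4b31bef45bf940c5fe32d3f45276bd958de6a34f9fa3707afb6d6d1491303f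
  (block 589 40 52 1233 0x159b6a727f647ab0b280ce7e9b398d2afc226d9fe6046152430f21c5abeb82b59a521ca19d74f72a4e9564174c503c7ad0c8d2d8c87d7ecc8cc136279a43bc712e36bed0f641b11d265c9e035707d47b42db0637258e0d9a50762295cc42c20e341c0d05c903f04fabf87d1e132a349256c6fb41c4552cbb78bf6f65e36e38b190093c7feb355ec2d9870f3fdbaa6b1d0fd315f47b6aa6b8ce922ca36de609f857c9ae2357508cda9435fa4238ba2deb0dca3ac3c70b358220541a998cff9259db49a7bfdfca94cd73f7cc467c8f644eb67bf6248c6bf94986d4cadaba5f1327cad12d625c67af5208990494f8a76c46c4e680185e54b32ecc7a9c6acbff31ce8a27a160315c663be59f594b60266cfe16b211fad9d2e3fd4e6b430e212da7177461393456283aa8c716ec0340420dbbd7c7486f03c9c6a71185a1f73d67899e9e9f48478edbfb0116815fa3e172a794571f4ba42f15c00da450809588c8a4203461bca94d0826f0b30458fe399fc47537cb1855ab2247107a0979700405717aa96bf042f6155c62de8e3a3098a33614eb62fb936c430eea74990173910f798696383f5eb1a703307d7486d6cdc3e3abc88456ed92a4fbe1a875f7f0356aa629f08f5f38753d9dd7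7d0506e4131583d556114c07c8002359542b7222ee9867a17aa10e002d0d30cf6f35bcd802ee224db6c4967f89ba333b8d4b23cff216d3caf6260afecfb2a5e8464d3ca446a4e5b7f7e068c4c72b3f53c92d7f9033d5725a38cd2c442be9560aa8498663e79de758be5c6739d780530f1b147db9004345d3016cc68ee895924b5ff4f158ae5b3fb48c20ac4afe2d4192f8a556d93b85857153892788e71ba42f6cf2174f23513259c2f70b38f0b52e159cf8c12bba0d71a61b99b5184de0163bdfb6297084f8759e8436ab635833f946c2b2da93d63a4e9b6dda48858d43360590ec701e6e66632c7be4f98d38a2626d6cd67f136f110636a1f95d4069fb278d3e94fd01450643437e2ae7a2d71be131b1e3c3b454120e8272231dd7dff9eb3b5325de8347c173abbeface21ab5078c7a56c3d034ae2598082222a545fa3e10a08b83bdb21f861fe620dd77a3650dc1d022dec8fe2b9ea7adeee76902c0bd37222ffe22bc414981bf1b88381870ded44ef33bfebfc9b8d8d432abf27adb239a4c3e48b531e7ad90800c21c40351a483b9a1be16c0994956f69c9d5d5d537f554daa6668061b737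
  (block 585 39 52 1224 0x9ec76cbf848c1701ee1bb160193272d0d85990512ffdfa856ff31e3c19e0f4a2e37a263eb0f3394d5e94b59ec7fa1e88f47f8050d10c4acb74c35b15799d14b0b445ef38bc70cea3acf083771e2aa97a0a2bafe5fa21c2294c983c213b50780c23120b5786e33eafaf030d541954257527b7253d9f4cd1b8e8544e009d281f7016f602908f9207eb7ea01882fc39efde8e2d489cd5667215c2667ef3b67e6933c3fe4eda188721d447b94ebe294d43f402c3f9a19e40331037717d5ca185e9a522b0cb15277152c8331b8f6dbcf92036834e9b57fc663dc3823695dc2d8f3a43e2d1556b451b5771080f38a9bc0a4b4a3356fe0c02a43052fc77006a49b97f8b1ede626a9a853d92978315838c7cf6638cb0045d64cc75dd416805fcf530d09a68be751c32b52aaa3921c08bd6af59622a51fcc88a1cdd569af1aed6b29d77fc8d0bf55a05745ae6e958ab697dd75f6b22022961ebf9477c558c1838d1a81077e599a8cf9014ff127e71644cdc8b9d3c736e943d6ebafc9db54a57454ec045ee413f64492f71cae90351ef55438af26e6173f0e9b23b4222a0d18a9bf8ea331690e08151bfd7bf6789f8ad2bf07279b2cd9f88ab2f7bb481f1db98131b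ed81451f3c5f93f6d033a6338ac4de7c89b77954468d7aa9279a98b5a03e4bce67b9c72558752440040180f3ec170506b26c8277447047d2e87dfd3a968f175c48eb53316892095892b3592f21efe99b98eb996b88c8494a8674bebb9bb236a8711ee335aacb71e80db29935a07cde123bc6e850626847868ef834cc464f75e9f3cd72353a8d6088c6e3f9042aae66f6d30673ea759b43253d33db6122fbfde6941ce9fe936c41cc9167deb17518d3d8d6d37969c0cb6ad5ebe3744ba3823a4f03a68c2a5eb81f8e0ffc79f7e3691fe6837db691ca2063e28a9099c919f4aeab3bfed7b27046023938a7806beb07d7babe643b1805d3192508c0d302ca9aac33d99f1a1cb423b8ac157f264d9ef5189c94ff1e6118049f6eb11eebddea7c13576e965cec7cda6bc83b0d3898266543f442cf8bb0486b8955bde31f9b7ebebf041a1045bfe0142ab137e42bd4f3612e075c13b50f26a9ebb4ac07c76a2dbc00b4225d16a71ebe857e8520283c31f80dcacd061910a7d731646923fe8bfc207db3cdf0649cb04f52af8c42d89b80a64117af6b4cd3bb73c5e24ac82f77e002b5b982c211a6c0769cbc17509d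
  ((rung 313 39 95574204595))))) =
  rung 313 41 181240851662 := by
  decide +kernel

theorem ladder_601 :
  block 613 43 53 1283 0x14feb3bcb2e03fa24dfc298fc1995e85dedc6be22fd937c4858433bccdf4a7b0ed4316843417fcf9100b3babf0f4b4d7b9ee327a577558cfa736b6f80869b03105c0c559aefde1652111c7bf6649ec32683eb959b52e57ba3f790472a8ff82c1ca9c2e9c8d80a7d4f20cb84bf144a04eb6a27e4c1a9973564312771df921cbbe0be8cd81828cd3e9fe26024d03b839c134fd561504bd1610957a53b232b71ea795ccf1586287b4124f055df7cd037000c4e4abeb54eb1f39d568d63a74c4dd78b413e5e4b413edaef5c4e7dab005cf9d1ff9fb9fb7ab168ced14163c4864198167dcd4b4886ef8011b736ae22530dfb44a8d332e88a48a54879e526b13af1b91f2095425f4942634dda09310df87d658bd875f39edf4bf314c80da480b97a7c784109f1ed13d58f004d650b882662dcd095e9f3501d7a8fc99f187eec3645e7085049f0218b9f70efe8e2d263351f12c8948285081d6e19c1c7102fb84814d421c306579c04304745a8f2fad31182846cac46f01d57331012dadb648d06cdb956636964ae3b8833ecba03ef856ef9024a27388a3da364c93a50f7e5a2f930d7e3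be8a8da558fd0c0efbcb0ca151c1b04df1ac1b8fa918e190476de74d7c33a1477a0e42143ddb6ed4169ebf404611fc5adb0188c90e81611456de856c310f92c2d505ddaeaa383a45b1626f90b64a30eb422d112948ac747b9d5eac199ec7c38f7fc88cf23ee956c3014186c5ad7687008f31dfd8109ddefa0e0dcc4de03bedd9cfaa478cb474e5aae77a41f54ba3e86c39e68841c6f8e6a66892014296d88a2dafb7be9138ce61b1a2f6d52f7f8df5431458a63310a7d0f4e3ede0e88893553e408bc16e1b42bb0fa832d76d8755359cc3597dc677816dba9517551b9149c1ef9ec258ddda33ac77c898fc2013ac34fed559ba74ce34135e3650a929775d5ff888e20f2fdeace6538d60d740d58ff0d3358ed10efc2e4baef80f461532863f5883324fdd31798afe16a3ed181e2ac33548eb99dd543f660aa8d5d8ca10532b609faa91ba8a1b64a4cba9a353dc412559d87c1ffb8bc181b9f1a1708f6a2860d306c2afb7d158a95a2ed0f8cf08125328267aff1805a775f489b79e67db63a1b8f3aa63f6fe306bb6c7edbf7f4108dd2cede612455504651a0b52fe468c2fb1ed40a1d8397e453487a6351a0ab757db2377f1700ce671f65630e0c7b2264e04a570b6202809840489679791f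27f9aa0015a7f0a2381fc2a173b9c0c0a6533f2b6f28cfb51918d954dee35d3db132bdb9abb37f5d65425a
  (block 609 42 53 1274 0x280b68b471d74c6db2d048e953082d7ece4e07981e5970936886b702dd32b0ea764d5cae03a02458bb9a3af02636b8b4370c4fecf54e325744ef658d792cc9bbe6ccfc5c692247ecd518aa9b5b35c9d2c1e9a336188a642744310f77c510fe2a2714cb1aa56edc356b1598bd037131373cadef136b34b84bd07815a48a2d8f15fca70ee6d05fd5d2ff4d026343b5abd65a445eae45772099a6dbb50a85c3a03f17a72179d7eaff651cf78b987461d607367b79a0ffae9bc3c9b690ca75bc32104fff16531eb307946f98dc44016075311306603b5c21122b7877533e48470b58cb3c3f3e1219cbc58de5b4b9c5baadcf7b3eed5731f70a24ae4d5dd0a197ead7c5d8f72385acf457849fc55dd399b5468f9900b40df0fb464834f748c5dc565f5f9724c1ac8b170d98cbf303fa455ca8c6cc09ef8ddd6668a3246fd9b623589233c56d63ff4cd7835011131bffbc17d636d0fa2f5066c21419f65ecdc15372ca2cf0646b91cd0dc8c7f57873d576c806f5e4b154d6f2ee63149012f1c548b1feac8e96db59b4bfe2cdd72dfa3dc85e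b37891245f3c9a87ecb56526fe214006025f4a28ddf00d1a827a6bad9623669cf3f299a23359e667fa7ba3e3fb7d01d03159b838dacab43521945d0a92367d5641f46ae0af604ace6ba930575099b28cae59bbdd3e3849fbf3e22b5631ebcdc4d84510204901b4007a011406fdc395dd5716e932a0d2673f14243b32b9e77ff19492c4424a6ae4a9438a3913b5f3c134a79b5283c543361739705c8f0ed2e9223d7f5c50fb15d4daad336059b584ead4419c645a8f52df9bc7ed71d6827b2142e5cae865024fe40f956d3af1d35f81624938c92cc0a4ff0031c02ab7a80738686a3cb9bd2f32344ae1567bd6687d4f93893ff1f8ea54a4cf6a682422bb4e27cbd23a58b27337ae6c70e637bf5c66a132dacb3feba3e0f611e435c7ed55c1d8b73c219eebe9666cbdd0f59c37c58b07b15a11a2fd36b0ab85de8e983335005d033bc603a8699232f5b15712598478980b5a22b54249e1f751a9db909dace8f6fc6ff35800c3293a81313f19df61ac06bbca68b90ba0ce0b5c9ce0b7707b6bfc4c906375ec71181504be347ab186744491acae26b41b14ec604518133cdfce6c4a84e0012a86fffc35bdaf26b5b9b53f8095186d5c72c41ea61850a5fc5c9bee2a97e17c5b42186e3318de5a602147a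9dc35bb967450d783089be17f3820e5cbd474a8143c8ea3b2ab5c26d176b62cea03f7d82d7e50735b6549e31adceea885c7484
  (block 605 42 52 1266 0x5c65d50344afe99da4dae9d97b9e00c9e0123e485c04b37833b103d7a76a8bdf61fae7361d523d64bd446643587a456d6c0638ae4b7d67f1c449021ffea6b2ad6d1d116cf7301c87568c3e32ea987748b54e43e0fea9f750ffb615ae7d0eddf7b0917af761cb9533c98917e95e2e36be67187bf26c790d5dd5aa0b86e85ab9c8ce097cd9d7e9c01b332d3251704a2a35fcba910333eeff717a8a8aadae1ea2ae73dcd6cb1e31f48b0900ac529df47aa983b47e1709ee5e9a5da515b9bd0ea0f33a66ab98c1e005016bab2cdcfed2fb604452e59bbf08dd7a0562245e797a786b4c4a216a12ffef0f744cbc65a0a4f4ee2d7e73637765b30f872da24a99abe57b125343c8cb1b4b4171a66c18323b23b76994bc263153845a4c33e286d09b46077b9c8d3a5b619daae6eccfa06770a0fe2e355f11a1a8d7697bdbc4efdc72f7d0f24f893a42c6b70965b37ad36a39f3467d58aabc9966b566c8af8303eb621ff99996a2d9e58f092630ba1f0c1d6ca39e62c0fbff0f7cab7509d8d27ef726c4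e8763e71596467d2c062120b63af59d188c065904c196a62d84d0e374bb192484335613524be0740cadcfecec0300efc5b4836c014a9dd1aa314804b2383bcc67239df458387acaee5ab4dd8166737ed7f861d3a578ec0f639ec35f4ee557d083d3178f5b51205eb4c670e3f7f31c6fac769b212414ae77cc50ff7a602a2b63af1a5311c670b2ca8171952e2f03c6abfbdac3b88ad30d9c3efd2f70e1f6c6df1c78a4f1eee07e74d9684997c0b0983f6e5d8365802b7a19a75ca89bb308589dd31f339641efd2d79ca371b4cf7754c676ae1470dba04010331fdc85f5e479c7490285f78340314673e5261a458c5ff720044824fc624169c01fb478cc2d0f077d2b70af0574298b714ce12ed234d1c6e59ab0d62ffbd0bd1b38b9bfcc10e2688acd855c9b4c2dc7226c0de4d395216b0a7feaf5140d62440646e102e57f495527bb5f774f3dd18390136174ea67b6ee51bd2dfc8fcffa84fd9de59557ad0a19651b65b3f50f87189f98f30587357570ed491fec9dd8ac713c54b3ef3d89daefa34f19ff203ababbd8f9646a84c232a71e60479a0e5828de3a080f66941c81b1aee8345e7c8e357fa457ff225ad278368ce00a7faa6c64f3b0471a7df8741bebf27e1ad6aecf35cc29231cfe489ca7235a232ee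0b7b5fc832ff497b06902b9c213868f5478280421431c32104eaae11c46a2f4261ce99b548bd8237480f735ad297d8897d4bbdb3
  (block 601 41 52 1257 0x1e8b7aebd8c3ec192110dc6e1c6b3378990ce8f38e7a162ec9087923676d65bf14253a39112005b1d09d595e65de2a889d9f9c2ebbef398aff9b0fbf5dce0a895c862bead5fccc163ebbb0830aedf683000f8599dc9fe4427a34f8b405686e0fd5ab8bbc66086fabcda4e6e599237f51b540ec453ab7b8d3219152f954fc925958d4fba8620048ad17dd3c3551681f8002e557bf16e78ae63f61b7c83ac6b3202cac79b712a90cb0fe42a3ab45d507c659134b7eefcaad21eee5f321582e5789fe25abda54d94d324b2e6a9376deb366e00d68728d052ab497ed4a37f4fb177b79bb0e1658d29ddb7a0b344a729eb31fa4251812aaf2ddf448753d841c11c14f40c1784ff9333545875d8906357ae6c401b403f570ea20593159637f546127ff0e5e48fd020df8a1a674782e52329dcc394654a7147ff030e055442f0ad513aa34df7fd014843bfe6b07549f461b12d12912626c3aa0f2346b746c23e44ccbd725789303752d36d197d23e99dae5245f0b9ec64bfcd5471b38a5f0dca6b884b27f8689bb3b146384f00118a05e4fd4bda5346ecf69ef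6849fdaa784e11a3cf3a938ebe66e0801f6e71001b00c3da42307aa36508bffed9cc89ea8e4d2fb8e39e512fec5e39785f57f1b0cc3f410638d8cf3ace117f53c29fabe26d9d7cdffed4415fe121c7c59265081f4a2acc3b0e8188b832b31612e9c1606ee14e94dfc71ed38061b2abb7039bacc23cfaa1a97a942660c779cd0aa7a0ee3880e61ab1257c44e30df78b6239ef09522b61f058cc4613e2ec64f879155c65a2bf8ad3b732f04ca5cafc28dedcc40f55053e7b678dc7a1ad1ea2b343d848a4726bd77f084067e50cbfb9aa570b1e34613967308a4b95a614a7a2c8bd58cd4456a03fe877b37a3b687fbd4e0581fd507ea87d55f62cc6376de259d4dd63fbd396f9e7fab6739701d6cd130f9d67c2bca9760b335e91c505c87ed4c032565c4ff09651da131165dec1022c31f4ad531073803adf441d2ea9a881509977ee319f0f0c5dd1a9a072dc2b4ba9818d5239f52c22b00dc9f0ea8559df8ed4ef4e5c524a403dac522c7e792a95fdd36268dfed7655269559ff7e9c0edfcfc034dcd192e7c6530a92df093ff38a83ba3fe688fed1b58a0e15668ad492136987a964fa850e3cd4dee95140573b68e28a79efee4d7d8ef5e1fa3e4ddf85557b3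51d3b2e7b43ca26f94de62544b1b4eff10b839ba88e071f042a24906d181be0c485232de2bb44b0dd05e008
  ((rung 313 41 181240851662))))) =
  rung 313 43 312183089365 := by
  decide +kernel

theorem ladder_617 :
  block 629 42 54 1316 0x2895ca8f6ea173d4308aa6daddffd1a345a7975696ae08b1c0b9457078710e12224746019b0a44f193aa6754d268e1217f5c7f010fe18b8e9c2bc4b218a7335ec96b4310956675e7ab287e2b15f24deefd455a5ddef52fabeb53a167390624416d6c25651e68fa1b9ac1050fb28b340c2d2fedc4b01602ddd264bfa752ebb3c39a920628ef01dffc1f9ab48e33a9d84997d33b3b4c732324e070f0997ec15769c83a71a2dc09b1aed6f83f6f3d97beeb22ecd135a2e21b739fdb9e02891fb04a2aebf7b08b175ac310a2686ffb87a5bc5b3979b443ccf491c4ea02c58da65230aeefcf46fd045fb27e2c9173054fd5ffd84b62ee4086dc7434e6e6eb724a0679d9451785bdf67251a0739e64fe2935d725e450a6d29fc396485ce022476d4378527dbab5243609069fa95662ca7a02aa1865af6abb3ed99f06ff8389f80418a9343701912a7501316de7666bd5124e505b68a487fa11a21fe8276d792043dc1546ccc3f40f10956dd377f6c0433f6e2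ec5a815f01c90ac0677f8bc0cbd1c3d3f8e66feb82a9fb385c210f26c60f6e55893f495d58102d83873e3d990412e40c91bb12367c60590d3e601b2baf5b4e3c1964badfcdf4c0925dc16a076bf66c48123dc8c504d658c768f3db0a7ffaf3dda0e833713cd43d29222a3313894b4baf30d9356abff7fac1a965445b0e3d9a2d44426d3e1f22cc9648612b3f7af74c7b9fb19f70e496f1ba3b5ee5c782076789bd8b16765093c2511ee9e0862ec18ecdebdee9ba96148440fe8f688862b4d30e2b988b0d2ba60de34bc41b6534f9f15bc21e3d150a9a80fc8c1576dd6546a590a2853b84066d62353499f1f6322a48f710e4c8796c7eabd51d5e146491aac327ab2f640c808eca0dc6bdacf58350995a36701d70f7ae0e0eaf5e6f56737a5d9f9e993779fe0831bfcd402db141bb9ecd474b816801c6c670f3962d79f4a5f57606e93be302c1ef29c02397be1e78bd642780331fbf37291e7a5648925a20cd916b840ee32d824402d7ae9deb217b106f7429469376e0b9bd7d41f1a641193a623db4d6b8d9760a2087615826257496a5287ca80b861b8d568431c3e85caac6f817c9fc4ac39033a384c874f219e8adfcce7200dfbd67f7ea6ad9f0a354c36f6b04b9373e5ce3b77cf4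d2d4627bf3a4c4170b033c99325107fed9ec1312cb83c27ded3b8c24ba5e57f5f533ffb119e48360beb3a0c7c1998c3fe69d602f8d8b896b385ab8ff4b5154f0f8641d19a3735d8934ee42058eaec1cb6e90b0ce9794f18d3a55139815da147e0247a8bcd8636cd5f5d7af8e5955ee3b138187d92a1a6aedbcefe
  (block 625 44 54 1307 0x12ba76b0ef0376f530a915c655b5470d40685d38f40771be898dbaa4b60512052ede2176aab14c3307e3c08c8757a174d65b6a15b8a61c8621ec785f593d8592ace3713555500f32392e444305f022b56f9bde4b52163d9f3f7fd7618b84dbacd4ea57f69414fab2114c2260d7fd5fca3310f3c0969fc7cb8757957d8f28be31bf660fadb1c4689a1edf546f1e967d112fe2f892e9b31dd2a56a093f5b799c25f978df52717e7be14e823314b713bf65dee7f8ebb2341e461800cd3c0bfae6ea2940c4e7631e92b86a22db4ab5fcb41c869114dd4098867f8e1dd7619e6d364d162dded6821db2ab7df80ca1b1e193405d889f728fff30efe3f107e5c1e1dc662f0495cd972035403530a0da62f60868afa373b5ec41c3674b15840680a5c52dc4d9033533f042b56544e5e0e6f18415006bcdab5ef2ed7277c916a967042e66a32397b50dee7e1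84a28940f3c357092dac16677c8375e2ec63bcd2c2caa67fe255c01b54718521d270a4faa47c2e61acef0ef4fe9f78b5bde1d956d58ad1d8d541b30815840d2c3c6490c036e3dcb5aba03eec2aa6df3909b59fdd14cc4c79604b53bcf90169d797ee6d2135d11c4e21be30dfa912fa8a8c75dff6d1be04447c879995be07f400afacef8e3364a7cf25416690d27322d3a7b29001eb4838af9a98f1424688f20b40224feeaa33393eb98bcf0610a7cce5100be55236ee9a5416f4b2918e4140fbd36f9e1254c95039948a804749025e2d750a0ee64f710601159e40528b3409fcf6274d63e90092d216c218b03eb72c473a938300ecfd78e4211c626775e436da8ececa0d768352949ce4d59e7aec77f3cae343a6df285c4fd5cefb8bcf1cd98e47c98378cbc6174e6569989b111eb4c077e4283f87f3dccd30b6f8320021d94667e5e76bb635d55ade39d05b7e845b058378d8a6480f45e9d3c032fe65faaca892b0874c1bf8798968260eb8ee0ed6f7e4e407a5c7e8577f2667b301c3c6d1232b4e4113d670a9e8caefaabb6df026854deab3e4eca2d6c25752792ca0289584c77d285e5f3a774b8806f22fd8b6123b763306937940bcbed9076b49677caf132cbca93f70072cd587f0a2742df34911ffdeb0b53b133ec8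cd0a782849c47f787dab3671a69e11f51c6678d6400157134475388ba8390a137f412526b2775b2aeabc2b6706d4f4a821a0336867022205466b54a5b9c516936c1aaee3874af68c1d076455653fd7c41240f750f8a0a15b682117c1ee38e79602e014ee2aabdf56393ce2bf510f19208d8fea0566f05862143fe4bc603d2586887bf455604197c387e784a8a0
  (block 621 44 53 1299 0x4268b59f197552d19190278fd80b220c19ba8053c010f959f953941608c9e7d0ca41ac9a56e2ff9a692af78b40f59e0ba7cdd067eb97c2309ec307b427dfd16297b6d6072b070f3a253fb72c0693c4d38d084e3fb8385d8f449dc35981264a9b36449ed0812878878642f6a1157b74262935c6ca11b8cf49b5d9369bbb7d67a987494970e4822fc784fca1d2fcafc5199119af1875e2250cb888f228e0ef7f5f64de6a86c60184895cf0d63b05efbef4e0c9faec45aec1de86cfb1942d9bf0ec835a0b2655418bc55143738791efc8f1c8e96a6a6c37b5696e3d2d82e9dbc87a5fefdcc6cd881bcf38fe11b4e2a49b8cfae945e58c9f83b7136eb7063189e9b9b248a13d05840da9631f29422768c410471029b687d115fb3c3d71dda688eaed4cf723bcadb4b2608da5a32071f6f789ecd4bc2d933962e9d72204f673fc5669757c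bd8ad4f6c2da0d8761d847b095f37dd3013dd84350c73f68f97528f468c2ea29e29ae3d6ed713c48c798de4b462adc72f3fb1b183f4ef7b218e225593c778eb0769ff1c6a07e02488cf78650d170b4a0fd8db9b24035284210be92cb78c3bab398761c60cd5bebee629dd54d580b14b8763cca5981bc822b4f4082165e351c1a6fd0a0fc429c2b719180239c8b08398cad4126952ba3fc0daa33e8903911bb9dc866db04514d6fd82aab344de0fbc1f8c3e8c249a1a435a29553028df1546def5c608a822229b4c4e3510f114862aa4aec757ff3ca9e66cf10c7e1460640902f35d690f169a589ba356a5d36412ffda006bdd45961ef548ce3c13a3a1a7f74973a5c0dc953bfdf562f324bb331cb69a7e87ad650c94b443a235b9297365c22f0cc5e7570b3965ec3e4a4c9a9e2e95f2760768715811a5f60a72803a3b566fcaf699dae9698d42cf7c419b88089beb141a3931fd0c75d60846ef851bf65fe26459322a8c59c7702b939464b29c888d525052eb0a4ba626b5862bbbbc1772d8c5246f697bd9c8b58efe63be2d4f03f970d6ec1eb766be8183a4aa84d41f6438aed96abde05535ab7a76e89400753847f36a2c6a98bdf1e5a789beec39a1ff9135d67ca2100615887b4e5c2917924405a34013c2d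d479c43328e120f5e84a63a43ef2d5a7f679715f7e37bef332e97551012617f3ba2427f82461d39a251257f29db7e72f2e671c90ee00f19a7e14e6e4c282df3dec54a99528c92072e81db66ee615ceea01a5737460cbd516d3e08e94c071c629516c0d9171cf56ebd2eaf3755f05d67ee4cd51c67115198163cf893b172447ecf2077588f85c813604a4af4f83
  (block 617 43 53 1291 0x5f028ae4aa791eb63ae62a5bd2376ab3506923f07707359168ac1acbf39b21eaf1f5e33eaa02bd4b5444f08ae3e218d7bd5551aa4d4c3fb04caeb5889dc7bf4c53af8c71c8cfc27f9f74fbe985be6a6229cab1a948120eac840d8c68e2760c838b773df4eb86b7e81d3c203e6f5ee8699755b43497aa1120a43e9f3b25218fdfdde90569c919de1285a99559dd09478b2ba65e632ec52242c78dc0b09c13a2a484b804a90e23cfb273aaaf9287be01f46a77c163ea95102c489146df8dc02aa3dc7991818375cc9625d66bb4112ea32d43f86300a6fdba1e093b5d45461d6e8134cfe571ef1717bc23acbb2bc262d63fded523ef2e4f74b2090383853f8493082f31217e4e624ef2c8db74c18e51c3c1df9cbc64b84fd7120a9d6ea38b594396198a7289a79ca001d9edf8c4ef7bd4f1f227ba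11d84438239b12facb80c1125e6924e89d38ae8f3e07c222cafa12bb4b33c7d5b2598582b6950afcf3c06a1fb02c156a2896e27ad1a95a7457a552a194b704bf185a5d3b9ecaa4ddd27fc6294124c2d84242f1ba4a614f6b603cc48a8658f8e3e4c1c7daf6d11c0032de627dfdeb60170f75cc70d3961bcf748775e1cb8a663bb3d8b2e0b1571240d487c6a405e1a26834391791201a46d7412fd9db7f31f0cd3a31db7cdebdcf690368d2e19dfac781a0d08ffae4a5ca4fc99d7db58aa22632b1237a8e423c1af2961ee3f6b9b8c238f736bc841b92c52716273baf9b5034c73c4033a1543c0e66b0f74f367fa5d3e6a8eb7b6ba081cec27ed880247f6033bdeab006a66111df17bdc29d10d725d30282dde1dad26d076f1821532fcfb59b659544170d50771575594d11869fafaf07034ff987b3a24598b5f6b40d87d548713cb554ad345f4e96b935924212ce4895e66a0d03e3a9e1558bfac6c7a3b6f6831894e7d1b8a43d544058287a8f721d7d50a455ca4e47c83447d546442b0223a16400f7a80f74e9156b3abb2e4512f5f3235321487f020d301c1ed943ef8698f988c121477ceee805873261b9d35f70a697e29c731bbda9539185098e421aeffe69cada21633d0f474f9ee00ce3e6396f0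c74050e738cf1ed7b95228d36bcbd10ebbd0e8286ff3cf600e904967104fa97461e6406b1d150678f5b8b800c2ebced7a60cca4728e58e3952c5c49e458cf6ff72b5fa2761d44f39c1382a8477db5b8c66208cda8ff8ba37efde320632d0116d47b6f078fa865a3fa1b169af21bda9826ee1ea579c49351bc7df04e821626a673a8c6c04c5b4358ab28f75ef52a7e32f5e7c3eccc5bea9c270
  ((rung 313 43 312183089365))))) =
  rung 337 42 240061812704 := by
  decide +kernel

theorem ladder_633 :
  block 645 44 55 1350 0x3b5e247ce915d72343d880c1bc5ecde8da5b9143f1c19cf2d769436f4a50c27ab4bef43ff196e9546e3d43fb1e028a0ef8d956bf92cccdb34eb62668cd11cc2d47b4a7ac687ef11a412eb48dc764d873dac9dd8874ed8623fe644e58e439be80884133c485e41a4dffa1d313a0dc9cfecf47d619206d0fa291b343982f947ddd6a73580725575ba7bf37ba84105e16150f57274f0f7dace14c93c453d9bcc4d2b9fe1abe8e73255feeb3fc83da1494ce281891ef515a223dd51deffd318939ed5c83fbd53a7b1cc9eddd4ff7761b8bd61e8831498e66401527a321faf890a56698f1041490ad610e77d622b7fa5eea5ddb8e62068c0c98df6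8a5d984b0eb51c3e6ee7c3b4c55d1bba0d532efc8fe33a1d1cc9aa8b549f39c2f3f8d3f9b94cdd216cf81d5e57c2e395c8fdfa79c1ecacdf85b1d777e4850f85b7c8a3c82b52ff3a576acd11901b832eb0fc0f599bbe7134a3645c2489c6cf924e3941e74bae5fa3d5f88e1b995e733312dfdc61bac48634c9be0c7c3cd99466d28820edd4ba777f9a9e2b7298bac46b99caa209d5ee5d2fd59902439d636cc303ab89af4eb5c9e8d9b3bd808838755b4bfcd2cb9462a6263cbd8f78abf66bdbc3307863e8bdbc37db21335557fbf3d57b248efdb3af63a6281ff7c844184e1b6ac4c8ca50b20d657fc0ceaedb009415394f5863d5634486c554aa3f2bb3487e01f405fe6ac4b1e9046be6e8cc294ae339a59208dd0a6dd59ed31e991f78e7d2ad9428912ac1ff36f39c187bd581491a4f2f7ccb21ae8974ce7d53b4082c8874d6368d3ddb37c11566ee6eaa0340d4552b487c6fbbec36bc5799f9fcf83c4ffc4a630175ccc0632cb436c7c7a48ee269439e85d182555bab2019afe961a528d644accbd1f376dcac6622761322f19aa492f1677470833a288c76d6a2482b137b08da7abb2f6ac112c1a8a337158080ef770cac463399b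9479bb110924cb9d7ccc6bace735bcb0e9a79d5eb15fd6fd0a09580a82b2f38bf0219d5a554b77a70c44e11f81253421e71340c46ac60b6f66858137a4e68f2574a0173dab99e7f1394d799400f95cb59ae0dfab8b25e9dedd91714235ba02bdc4ed667046f79f26edd00e96e7601576c6123359c38fa720a2864fe7100c3cbf89196f7c5736fbf22b2afc4ade86624d54121aea504bcce14d937da959e93684a051b4a9b371fc5c97414f02d7445cf63314596ea51091b6d197eaf20f4ce318cc2c7ae384fc7dc7e04cb6fb990e46b5b0cc5659240fd20b63187f84c9689391ded6554a77bda783139dcfedca59d09efd4b14f293dd15fb08e9e8e3d5c41c021369678f0c0b7dafc3539f1b1158ba795b7a92ed2f10e6c8211503a5913892de0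
  (block 641 43 55 1340 0x33137477e5027c8e58a6968c417b6895ba9d6890c4cc61a984c55fe2e1910d1ceb78e0e1df527ae34f39401e8f5561c0a9edd603d495dba0841d5842d7a98b795c0c7e13244c2ffad4552f409ce7c99b89f94b6c8c9390ecf910cc3478730ae331ebee0ecd38d8f950505c424bde38ec7928175ca4babba2510d6bc185b666a1a91e2bc463ffac0bc400da7c351405bd2e40a0addffa9938e9198682e8778854c2e4db593ae8349a91dbda6f271c0ed44875b3dcb0d18d9d48e99c041fa362ab9c8f1eaf9cf1bab42d98e63681bff57a9086fd92b305b42b07a9ac4f2dc9411f1522ef3b5752c19f179dd80814f1203846cff97d85cfe0976d9dca04768c9d05e1e3661c8027e1f946e427b05ea0d7b644edf9028094c82171eccca174d9d265693229aafe1339fc929b472d3200f2c8e2039bb5263799441ed9ba779bd0c6718d2945d4550d7b383ed859e8b14255c77436ceb20198a9ff8d0f89c829c0d49d41d3081b1c02c93615e1b3e36a3e5f532bd76ca38d803c8b53a5812bd4e06dcf4f4dc4e008336d7c9f01c1004c958bc01cca72003b16f0553f082f5bbca8a971c612e225881b42c375e0a32f34f56fd5671cdf57a302881fd4c1dd255e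6220043ef411a4db3e26fd143f328938ea80e16c294799cd6a508cc71cd8629f091619eeab625b9ce7ccc05a94c57492c2a1999e6e3a031b1c0fc93e0636acdd9a41023c5b0bd49c17baa5ef64d5c282b5da7f25e23adb55467660148669c78edc7270f02a3ce8845d9594382cd3d78b659540adb7d54bbc53cb0bfca43023a4b4e275cc8b122d7158deced0e412018c46cf0b27b73f9c1de170aeaf7b4bec15e696b3e1c72f71019eac103396f777f987d65a0c760da5e7c2aabe2c846feee54c4c7dd13401d16720020510bef6ccb45cd56371029a6cb95ac3d3632fbac70fc9facbfa6b460c5d6df78701fe07f1e0bde4d347767c2b74f907110eeda50f47b92bcacc11092010c85bfde7f44acd76bece156205aa8505de279052caa24f5407c4cc45f993431e6f43531c634ce5b9ce9b6bf0224df89020524ec19a6eb61ef54feab8110360de22c6e2b62a76943357f33316455294df97a3a93bd82b1f03beec592dad6592c04034578fd6c0b04e904774c6b4b79a4441cd9fde81333ef066d69e4ea19f10650235a92ef8cdd474dd85d7c4a6582a9e61e8e9bc72db3655350b95bccd56a237024d09f099494a788d057df22915c7b6a29cf9ec3d9cad12b9260cfb7f0e3f00a97b39acf27379e791b3471f3b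97a13381fef6eb90e43e14047003ee75afda19f00f379682993c8d4b50e7f82f1747ab558be20ae6110fae45c9dede68ab420def054d5
  (block 637 43 55 1333 0x3c3600fa76271291ef6130705fb7d81b7ed9b41913175a1a6b4eb073a06409c3ff3458ab34080809ed4bcfe6e30db920d8003285c040373152e48abe8406aac8014c252cae40501ba1d61664b28a6711fee1be1a40559cd3487841318d1ffbddc09571d00ecfc7ab88594ff55feef37d7d2d1cd2cf67a605277c64ead4062a141375ab7f5dfdb64a09029ca37e37e7a3fe5927b58ecf21a4b7a2e9b9100a9e6c235a898d1cb9a102ef6326946fb9053564ba80bd3ca89f1a1b2ea0519e37f47a1789ec0a4cb92e6afb8712e2bc1a6fb65736c95be0587a91336d730386058a14d485a907ba836c59eeaf926ec722f380440ba6c0449b1e80b19fad3582be14b544b197686de4088715cdb511270e4be6b560208724e5edb3898bbf62e350d1bdcdb49de9553e59496a34695295cc1c565a2561460e4ffa8a66f1d62867f55e8c5849fbccfefc2716724f436e06facc93e566909ba83d43e1cefd45fd57452626350bdedfe005ba5934fb5c16105867c9727852943a593adcc16ae1d931ecfff88c6deee07ba3df2817ca7e091daa0d379b656340513adcd82c4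e068656c7842a135b04b1f45fa673b01f55694c7162b0abf36afe592e317541d65d526e244f53872dd9313f7169b34154b0903d0f46ba97cd95adcd8c94c3e9a57022fb595a460733caf23ea98fab75806300070b368adde6ff95b84cf31aaad733ddd87de6b6c58d49c52cd02a6f10deaf24d4d9d12a0e3d4c1e5a926d4062d30210ea0344ab2fbe8279537233c9ce19d7c0ffd3170dfdb0708d30ffae87cf3b58a359ce2e4fb963ca9381127b03b94849070c08f2bdfa8a92e836907b7e677b9805f6020ac9b7ab85121eaef3467222cefcd670cacf52adb6f15a7a1de448be2590e75c9a0d0bf305f00298206b0d4e03c35277dde99a8de0cac3642b6bc6fab06d46cbc0bd196318ad83ab273cd916cd153bab90fcc5826d3a1abcc574017edf2d677afb1a4b746edc66df0eb6c5530ccf17cad3ec05e7a12c43b6ef3875743bbd2e47a9d289926f87b4259538a63f193238f012f8a75bce65b021186f63669a44afb1da4991ce04cb6e02312a0adbf000c1cf2df4107344ce34365dfae4e6d8dc50dbf4b3124d67ef22f6948ce89de4ab3668c60c707cc9dcf7312c014178e5582789b46c17bdd770be8291745dd5f5c6e6e81d07057cd6cfe8c09e8a46c992f6fbfb89fa5e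376aad12e6faacf9ab2da588b6b93d2d338d9e2e1db68e607ef1db764fef863075313b13011c92ce13b5be390de4ae5588a44aa3c6d0ea8331ffc1bb113a405993f97e257de1546f5965c07b8869243d7865796526c31248c82be97e5af874feb7ed
  (block 633 42 55 1324 0x4b5c9267df07cbe351d5b6bfe0ed5a90d282650e6a9de68bd4838034017f52a2598b81681a2f01be56b6a378f69838f9eb5629273576e0e3577e32c1e8869fa9ecd6c5d54998be9dfc218a5f3d611faabcb1ed822855049a5c7d0d6da7c9bed806772275bc3298e1aca9ec2e62a57cfaab7e4c8cfee369b091393f9c065af9967ad3c615f722e078337ddc58af4bf66f48fb871a5dfa563b501f80107d496f4993f89e35fa5cd9be104391d54cde75a9657e8b3e881670a2e28bcfd8107d4bd2cc3dbaf99f09b1f1661ac22304150d63dd99389dc28d3afdb0dc4745369879dae18121ef9154243db99d32ab436ac98670f926cb995f84098a3522c202e024092564a8b398fa28da53a25a69c6df0923aa4cb625c97945d056535f4c6d34499233794d9c670a412d075ef77a9bcbc30d00278614b8f74c5e4b83de39a8244d970cffd72a2e83e8e885f6c1c736fde06a554969e3001e566613b80d8396d48e651ad206877b63c161ceba622da1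762b50fc0f0c6b7ef275a7a8ff204c32824b9aa7c946b2e256041f9e751d359e4291f8aac2e41736890666439ae36908f5e4faaf105440a5d7f8c9bf933c87f47964d172b7a4b139a317f04118bc42b7483b4c72f7ee81f980c5d629a3d69cdf9e5aee0a033a02162d4c9f30949b7deab367aa8bae07cbb75076e80862eca12b41322912e563b41d841c852b163865efb3d6086c88ed2426595c1df70369ca6d590f4f6582338fff991ca8c2b326ef4adad517b6a55434375d3dbc76547890ee9c06236a4ceadedfa0df438b0a9b81e9b21ac91b237ae4a05bdb725ffc752e299b995a9bab31bb4ebe25430387e0c4811c41c99336de881041df0314fa31ecad49be48666a0fea721960da429f0691329abb845afc909c03f291998a518e0677fe622f1b37f0fa044e89a42ad7ead0212cf6d03bc556334061653aa718d74b72e8f9b88914432201f0495d945ca9cd18f8821e5000637616c4054e8e7bfc612d599118411e96fda067daf510be5998c6c0bd124d2c8f958db00e5f580db6ec72df8e79ac96fa4db69b08dcb7ca0227722c3e7e955d29d1f166caadcbc3a9e06b043a723802c6e91fd2fef9be4a4f43437720fd78029bdfe8da59751133d20ec2df4788a50f16cf71e198ed47cccb587a74e2bbfc6cb39e7230ec5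f75ed40d1caf36b57d960156500e0dfe4ecdcb9ca336653b6401bfe2935eb9df8248ce97c5a15d6bf7309d8fb16cbef5805c5871aae7f2ab8a859c9ed042b851dcd6b7815be860db8b5b671edfb15eb23f15330634ef013bcd868b6ed0ded9b84ae8474199411c7f58f65a1c7d182897304ad5abc86
  ((rung 337 42 240061812704))))) =
  rung 337 44 401831046865 := by
  decide +kernel

theorem ladder_649 :
  block 657 46 56 1378 0x27760081177ca2add553450f997ca875c64e1956fd9f22635ce42db86ee7085f8fb3e5b79a5e1f1670020c81cbb93f324ca9c145237bb08856a5785195394249a503aa9658d05cf33c5beac44c9483a8f770912c6e84af671eb96d07710dbf12d9862a8983c99f7227a650316f60fa3ddfef206f740de83baa3ab6273fd1e7c2af5f00ff14558b3c1f261d7c14e30cf047c973f10d43546cb236183780da0d045ccf97f2fc644b4812ade67b32eb8137a2bf3a12ac72efe7e60888c417a4c7f0e878b6c024e09489863a11b482308f21574ed6c18b08bc4c0b1fc7d8d59a3f36d9587d974dd0a49f0fbfca6c625dd0a7845191c21870aa40c17162c961ba05c192f66505ab67533f93893eaaa27737d230526cc6078595a20d8cd0306a4eef2391a6da4961cdd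da078a540bcf0fde44076ea5b07b2bad6114a2d3f5642f5a842bf59fecaf918c3ad3e2be15686517192494b3144b993bc4895618a7d7320090451a55686af9cdeb28045d55452f853f87c1753e88439de36299428d23026d6ad8778949a79580bfc19f7b4230e9684bcb66d9d133b1cd20643889588c1e63844e91a46914918a2ae1949ca1d810a83c22e367f027d79a0d768cf59b44d718e4e733944c1dd3e8b9c9097072af0d000b038cba78a53fd869dddaddd7540e65b434de438420bb7c81007a0556c06ed5a0d856bd3c338ce0bf409f7f17d7053f6afb248b1433265133423b3296c03688e7d50620d69aedd522486d2079ce96c4b33484c0534f54701146041d01a913ec5760d5fd0ecb37513888319a5314c25ae4f8644d68f6500f539c01da98775693d4a072b1a6a768ca38fc920f7a8454111fa156a61ce717770be21b7dedb830836f4d5eed82d6d5d73b14a2d5d7877d6a5d08d7967495af206ed3d50ed5ca6b03815419fc912549a58b4ac7d9928f4701927ea1afcce064ca1bad8952ed72e6bc6da89a39fa436ea9bbf04f391689145912f257d2d1720a2ab83ee2b611794c468e4033a6ed2aabc1d901a9cb17897fe8f98604ca26ac3d78da8f7bdb0c97df56857160e2f1b94ea9180b1544229e15dcd616cd03a1a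8e9ecde23e4e81e70df83bfe5938850cd01aa69fe3fdd238eb83afafc1180ccc570e540982990358fc1565bd0e961b16f6907355e187d002ef525078dedbe96021187094cf38be2d876fcb9ade80002dfcfbe3327c3f80413f682e79be4fe15d5c6ca558822ed96e1ea79f8450a916b55188d843f45ec897db4c0f8233cabad743a26bfdc7a8b2f644549a922f6d40e3a80d460df1eb68ecac60462ecf6c9f55ca3dd463a799dea7a9fbed98810ca381151c235239de40c944859d3047108cd9ddfaec416402348ae8c46ce2a925436538b82023c2b3ecd8665306bfeb033e01ba288e1dc
  (block 653 45 56 1366 0xa459d059823072a1fb19610e905f0146b7bb6238d79dbcbe9bef40ec63f68344fabb3914d6ca4c3e418d10f86571dc234c9fb7fec0d168ff721bab9199ba8c359ea4ece9c3ac80d714bd5a6b849379a68d68e3659cd6b6e9f72350420d3fb262c6881e4bc1d5dcd7235ed40c3e147e25499ef40916718f3cc54521cf32154939a09d3446f835a1a4bb229461dd57f8af8d8189e99bb3d1948657534c132347930339ae872a40fd353cb2e04352193b3c8120bf2b91809397b4bd62104e547080499257edf165c75f579fa85ac984f7eeb2341a2ecc6f5037a4a834a1703dbc2b7557b43c9700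0379b7cb858c8982d8d6a807053e2205353a49566c6934f87171928550d956a7e7e15fa2683ff76ce4a5f154cb1f6e403ec0cec726cdc059a909cf65618c8c4c9f9f394e8c8e7869c4a6e060e9af302c9db5ec9803291de054a23719347ea3d3f3d7bbd638787527c865f908b0b294a06a101e34e94e7f99836de0d25590451a0f89003d9e198f8fb99aadc8ec8e27f795203c3a7112ff6d3d0cf29d1aa134f1b79fb0a4109bb31bbf296ef65f8a6f579f3defce050ba6f92d12f9c526787913cae99384a7a9a26ec18f038d57cbe09f3b15d9c1141976ea3b357a151a42470c2b53389cd4327d28d55d887a7aa9eb3e00253f397c4cf7e9398f1969b30a2fec773f70e7eda8c476b5d7c7f36e20f9789900a84727d1b93ca7f771a66c754cb35535bb39783446637fc8256e442691f1d8ad444d51269fdb5c2c51000c0c3aec5f6845b6f3a5c7e99b56628398c20fa5359249707d39537f0f665283c402a35c79c08f79285e61b229b8dd098cc1c672a15aa50d066566c17d9556b23c9cba4444727e401fe183b48a5bfed62aeb151afba64aaf91fda2d6a486d3abcfbf7d569a48a11915109013c54cd30a382f985e6fd26f67cc5d118962a854f47fdfdeb001153317a40c4b74192e356f8a128842edf0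7a0459eb3df66135c5f6720936723f9284d5bec8f38afc94ad87e0a483220783271266494f4da1873f7f71f7ab08b46a6053f489f7b3cf01f1f5de0eaba4605250192e5887e7433c44e28205dc1afdfcd872a4e1f8bb26913146fda4eec79c0a2c7103691a45da35a9c1d89cbaaf766f544227ab17c0774a0d3a7388ad45069255127f4d61037aec7f5fe705f693f43b8cea50c8d5be4fc18bb91ebdb0e913e0da069a4a4648e57a0c49157247779c32769c83fac003c35ca6120d1845bbad7335f5c144106b5549b8e27881d4a385e263373c7c9cbd21bfa9eec46e13e88650f1ba381c93273a5984e2dcaf655d23f997d9cc308add2b9bf5d810601fa674d7c5afd3889622547b5af3d269484c5fcaf642cc2c3339dcc7e4b4d33cac5693290ece597ef14004e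
  (block 649 44 56 1357 0x168bf585a66ad3a0d5179175868391f21951030e1afe0633bdc3b8ae254953a7ff2ede9bd8cb7874b19aa20dacb6044cb771569440249791e616c5a46244b4a162fc7fe0601ab95c7305976d6f3ccbfab9eb82008e313c8bde2176877e727ed4cef7e64c100005bb48e330d4b1761264250dd2c6c4be76c178de2c56359d194c7071b509d70bfd282f948ed35393033e72500358e72de44ec93e4c38e9baa734de538f9a0f7d1493b5ba60865ec9206c63613ffe1347e4f134d9af16b52172f9b80591b5011005832b499c174310c647b4373897043015f82af877f576df05213b71c8260e75d0f4d5240c5074373855e8b7721599d8f3e29774cc6be8d85ae4ac9c33e4457a5f3b0a963641a228c852c54f7c478deb57aa86b8a1f03686b5c0c60d3c2f919853a00db0745cb54c1b8415b9115955266edc98021a17a8c6e5cf06c203e077318fd54d7302cd98219b1abe77ec0c73f584c18222baa10b4eb28e3be84b8fc701af4eedbae8cc985c43192cebfb45b1deb4515668983be639626fd1b720a80b0e38c1626a0ffd7433759b583d4eea28364a41ef422b0ae5625979a7cf139ecc95355dd50ce64aa0cf8b3330c8171394e689f1f3ba130af8fbf51541af9df493fad92648284144034ab9aa91af68969726fd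91967b7efe6d587b44f9106a62a56350d6a16f53527ab5316f246eaceedc1d48835fb5d1a7763d24bc927b283e47037e31c69e532af1a7bc47d195b2060c373b33b2a910608685b895067feb993e2345af6ac46271e11f0482758089213b8aff4132910aaa9f43727d8d9a6028f2584ae87fc60d2ea5af3d309020e871c53102b6f8c4082dff65dce14fe93e2e16c3f05f6668326864fd788f4c20ad74fe95cecfaeb812b8cff73fd0ffdf8515b4cb9a1557e305522d35292d1bfb068cf8693dd4e7962ce653b53fc0418de0eda7fb913e69fc6ce4984417e7314be0d22ae28d7637ea07eedb676389f192f52a14410857538b9843a67871536aa6669caeaeaa67a24f0d4a47e61de180b7a6723c469149a5c78607adea30b843f4afd85ec1345f84e379f898833c9dc5c0f00971a8d4c1c575e0a4b75a50c3d849d6a85421f59edcccc66509db72474204cb1fbec533131591dc5d5b95b3aba298ad322fae027ca0db8f0346fdaa80747cac2cca3147e1d2dbf33475076d1410500863531c662c420a2441cda76e67459a0cf611ef17bdf4b469a6dce22a41ed40ec0480eac930866576e6a2b1527f463b0d0577b4c739850f8a9cf823bda0edca9235bc4ee2d1510469d3bcc7ee5200ca9489c7751c404b379fe37b65510a82a0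1d9af7aa7232026a4b4e24650fafbe42dd5a1084fc1a77c95bf8d25e9c48725ab4ec4aa76e51a6
  ((rung 337 44 401831046865)))) =
  rung 337 46 34982816668 := by
  decide +kernel

theorem ladder_661 :
  block 669 47 57 1402 0x18240259c0ec943350f3a4b60ad54df4394a625122c7d33fd88706dd4bb9a0b47a8ed77ffaa64d488a9ce8ed5224f2b96589f6558b446c27ae1a069080735c336966b8be7f6bfb52ffd4f223c85531dcae41a2022fd62722fcbab6a6064c599cc5c1dba9b4be845ef5d175c42d1aa47fb96c3c189610e50cb728f7ec17da8ff5d8551df21ea2f266b7e3482abd32334ef135d1e8516c969cb0b2a917759a31602b94b86a3c62db9eeaf3eb81f19fb695027ddeafc5d2c4ce7cb24f99155453df8be3a3bffdc48ee743309f5b463159382bfd38e68d3b328dd484f6ec112740cfa0768b4ec8cc948eeba7cc2a41e838cfdf8191dfc202056cf5c7f4d44fb8369818af3efa16a4dd5ef7a115e36abcb6920c3e20ecd34c9c7bd5aa8bc3b5beb2d2a178102ab3a5852cd76b0075180fd04741694d7401129ca5fb03b90709681557fda13f3405b45a910c8d33cdfedc604bf56950efb5cabb23ac6b8757270dbe6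f6adc9de695405d31af943382a039e55af6140cd6b11e9e9764e6ebe78e61d9341ba654ff27f6933e16e585cee13000832a151dac19b7bf2ebea8076cdd23f1e2b778af57524085fcbd830ecdae1e150f9cfe269a1af6238761fc8c9a94abec5b53a7ac70b5a7f88ed82304b55a11ba90aa81974c72f77f8f85283c066e9c596870f4dfdde2b4815e61ac61a5b6b9e5ccbb05acbcb1d5b5ded9502250ef4d92779be03ab3edd43330dbc1da3ed7ea2fdeb1331b70269b891f6ac6d8ee6a2868a1975951fa4629ee82678162c699ce33a5b151a76bcc6ef0cc1608a5192d8fac814eff793f6d3f769ac4c876bf8515706ade80b6db13680c485fe1fb71c95113a1f96a6b5bf877ef1f06ab61c0f5b6b598f303836197f0f1cd34880fca5f97ec135ef04a40b3301ae9b852a52853c825e1442056511b1501bef1b6c0888a5d25ba5fe3dedfc3d83c29ebf81edb0b4fac33d99596881f8411341cf95acd320d7844be80e3d6422e22770a70686602665ad90478a017c5c041ca6811d8a5bf963baf19723ba0152537820f4536e3dbced3230277be87d9911b88b1713777e516ebdaf8dca90cefb78d6377018db4e72dcff6948b326d1276c4215ec1d80f127777a186ab5a6ca9897590f07b74facb1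de2b10d4cd95792bf4ae76985e2135efd2e3b09f833f87c6e10c30f4d6d4732c0528e6e6bc99caac0fa71bf4fb582f88d1605022bca9a7f8973d5d559a9cba745c623ef6412a40cfae7e78da5f1ff13119328755d7a0e0106c837ba861105a508695825fd67d0177dbe393924cb192b59c42f1684b7159aebd5a0e2e09c9ddd58668d35075719cbf3e1d1bde961902a2b06e5868e98e83e1693e8be0ece38380c26c4639021378f6c0a80d0991e49622fa74e1822e4a0cd5ba4d6cb246d5f8099ebd46159c0b3955ea4f0d88a985f8e3a5
  (block 665 47 56 1397 0x105b725aaf139fddb42031507df05fa0b25a20c8cbe5aafdf2cb0253386c6204d4387adb1f5c68c1687f28ea52b98e5b25007493a01e0c5f7d3d3ad6cf90b83f2385947dc2cef1cffb97de571cc53f881b4e2ecb11accfda460a7f4512894f39aa4153af2396464e12a7ab7aad2b26ff8681e318dc3c17aed879754ddc50f7d188cee1c3815033d65df7c395f5ac12ae2e7c4c408fa6a5e38d6c13bb54f284a88095adea546bf7d22177272361b662a9ff08e35af364169713c5b458c5ca554f4da364631db149a590666c2c6a745012dbfb6e0ca75e7d178e6c28085cb225b007918027de40eab3cfdfe7517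e3e078e40b102c18262c7615dca7d5786b435886a985cc9c0f814bf8c6f6605a91b974c0e7c31a04619f66c63210d378584c83d54b5bf55436a0d91bba4067e37e718458fabdf177dc85069566e906ebcfe12ef179c952ddaacd8941157a2b81b3c065526bc33ef6310529fc54b4ed20f97d92011448c8c4e443a9ef2ae5c583d27b42d0d34d6bce2faac6670c666a8a4bec7f0de551e4d4ff4fcfadaaf9d845629b150b8b8c80a788e7e29d39f7ce664c9b0cd078a92856c81b38cb9a4bb6458138cdea8ef6bc01c4d1c88b68aa0eb619101df33f5299e0c61a2b19ea17e9e4ef01c749319a43124a1e9de83b778d7281a3573d9fffb4da2d3d10eceb29a8ad81cc2f60a6bbaa758be587fa9d6eeb75a95024da999b8f8798ed0b350247c4fa2da521f51800e83708ad83a5b5c78c4d1bf2e3b13b495b51deb927867c9f278e2bbfc8c28fcf5996d49af97f370d557f32e705059cbf489ddb0890849ba198f1328bc5b1e9dee8a783e947ba223adb587204431fcfea43879080181d43fb1d882d1e5744f94f73ff163af4c7b7b6b66e82f8d68e72600698568000e62e6b9335f84c85ba6b1ea291a59f6124c3774291025025c15e42ef694fdab7f25282bea823a4d1209e081bafde9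64972bbe08a88489c65204643f923434a50b28de8958dd20ab8feef13fe6f08a2cf5dcb88587615be4a7360643efa45efe8a328085c3aa40c96f26b909b7a91d5d4fbe9ae0ba4154b938cf4e4da78c8599f76666f0135f0a80c62fa187c2fbbd50e93bc6993801df27b820edaafa137772f247db2e42bd95ca63fb871d1975a3e76e75caee6c14aa3e66cdc5d94b6bd0f4d930ecb19f7a796cb8de586426fcba728077d945a869a9359351236116501d130eb8a17aaaca8be5ee4da58ba8b2d59f7969597105e13c54c25ccb1c46bc929d09cd754baa01fd9705ed5c9e88a0dc8e76033e030a893f2715ded2b6326c10838146b3ba29b0ba9f311367b32664748a370584ad0f7ba81c918f68412afbfc8ffc4cb60528aa693848e4b9334f99604da037f941278b04fa1bfd30d45bb6c626d74dbdefad75ad39ffdc38631542fb7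
  (block 661 46 56 1385 0x85420a08f53d3d1b4229fcd186c734e2a7d52d9dbf9d5381f89bd7ecfa82a2033b2c102c9c8dc1047e402055955164ef4eaffe135d4d34c7462f49cea425210d6e0fd52c9012abe457bfecc785a8ddb8c667759d31adba61d15ba247fcd2ddc3f512f1e234c699a7b9f3a218ac8a5747edcb3d3f31bf61ed76e7503ec77d6a0b1dd7b05abcc8344f8838ec46d1465f03c413f06ef196cb142fcc010eb33bb9ae239c73c1aeba40610271175b8e8588dfa28f35096c3ed824e0da515a45e7f9998410d0fb21bbabbfc0006ab7452236d86eedf00c30b9c8917041a1c071e395832973534a8faa83fa5aee7876d55d31b540d66308f74601cd3a83e5c1f923abe44a082c171b4c0dc0062c2ff36dfec04feafdb6d3ab5b4abfceb4ed6d24f883d6c1b54c8bc56ea1614c4c9ff85fa43db8447de8ad4cefa3e10672f855d3468f18f38651f27737909eb44dc2d33fdb36182eb2bbaee4ca98de63e14c0653880f627cb6f5eeedd2e3b733e69adc1e0804dcbbec7de157be934e58715c766b18feff1f9780f596b84a41e03820afabd098385dccfe63f6b7c67c9412548e6b5048a783b8adc356acd8a4bde9e6a3b73624ed0c7a84923c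fba1f3333d9d09f0582e47e84f8d663c5f6c5a31f6e50ebf955ca1e4cfbc3782902b640382e8324afe5320ac0f49237edadf84d9d67f18fd0527697e64e7e04ca2d8f9aedf60202060fb4f0ea5c329325de77a41173fbd50f3f652f028f336c5dd7dd1bd41957fb0f33e32f753aaadba7e64964a6cd96e2e222f7de740ed407df4eec23ea18de4ee60ca502dd72ee7c2a028b6f07ddb4918d50002c833aab033d4a48b4193bc02d59b10487ea6c3c6b95419f8ed20242d5f567293ce42925188175004668742e578d4a6d99904aaf28faaf4d3f265913751e46c1ab81dc7a132cffb3af81b7446a4da74c963ff08a187b858e64d66c243a6cd0115a5f71c8d834843b6879b92e4efa9b1f20e86a06d38b325c4590282e8f47902bf28a2b1e6f2041f805c7310b7f1d6250ff9a5a1f6ffd5e2855f4b045e4c774002f9c25a206ee1fb1b2159197406edce30acad8172bef0bb9a9f7fa929ebc6863ddb5dc4f48c4597758c3a8b3c091ca1293ab87a7c6787c1e415ae280b8be64a53788ebe87a64168fd7859632e200fdcc6bfae2c8bc00a7722ee79f8a6b9ddaafc4e7d4b57d3ab13cf418846d3b425fc7ffc2d764952bc60dcaad276400b49ade9062e08e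23bce0e76bd053ce4a35a5dfb828f8e11d2fe28de0b05c62ba48d336a629733577fc66ce19d1afa3b960ff92e65f35e0f13fa66928bdb4d2bcafacd58e87cc195d8601e23660558698647f61bfc1c998078385e9ffa948e5929298233cf700f1f3ffcbc719c1e9bd83543800fb416ebeafadf99eed76851d0697
  ((rung 337 46 34982816668)))) =
  rung 337 47 631219809440 := by
  decide +kernel

theorem ladder_673 :
  block 681 46 58 1432 0x11bfc2ab5a15d8cf0a916bda34a510ae6f423ac166aeee346ff40670885253aa9eef754c83f8ec7a2933731f56a9df13296866f49c0c60bd38d3e6a1a0c67f24eb3612de854ab94547e2c0870ff3b3b3d59bb4290069b646c13ee6a5f2426817de2d2c2a28797a5020a71d1379710d0f1a9022642b3f70815271e7a28e88ea575cc202f9e85c367769faaad74fc1f2d023bac93d0b0705682a97cb1d7666bf63983afe075af246ceb7b39b5540aaaa5287b95e525da7feaf00f1436bbad0f4b461354863ac26c2c569f4db6a63e4e4f78b22f0d0683bceb1d3805aa49d3c5769f107b486c8ab909ad6e0f914c18fbcb14c3684296cef145b607a96518bb43bcc0000d0de0464d0b5c9dfb55e681b5321c87d928b75e4188965cdcbc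c951c5a7378944b5dee77b2b909052765ac4776e728eb46bc9e80e1eba7be82917a0c98502ca8bfdf6aff1c46d7547a4c6b42932e38a149f8df41f39cabcec933af7a09450a2195363b6cc5b023708af818acd72d7dd96c168697f1ed8cbd20a3df99a61cb491e47ca4b73d01d4fe0ef1de9d6add75c44abe38baef4f76dd6810434a4084989beca72da3cc2631acd468d1238efd1fa37d577ef3b05797a930869d52db5b1beb6480b8f3f6e7a69e95e365edc592804a991c0febd82933318dcbd46db00e180ca6a2113116ebfde022f3a60d9b07b4209ca8000b651961359b858c2aa78041d961c5f04247b984f7184436808a98bdee5befdfd6adfd80a36277f200e1d5b7858ecd213f1b64e8b8c1003affad26d120642df9fa91786a762107e3734e01069ac85ccc73d07d85ba3c8f836fde68da3101790899c39df781c01900849918d66990149bb559fa2e9950d70d05aaf51b440bb7912342a573b02b30384af01fee657d87be2cff2c4713fcec746fe4eebbcde8905bfcf33fd3e2625d2e2d801da7d933a207a2f2ac6c944accfb0769dd229c8ca047d4db6cbb00d3cf42e6e06a70c55196616801f2e350cca61cfb7fe23771641747897a72a0b138cadd6f9bdb68a6462c1188a0f1727e601204c18d89a1edfef5cc93db5e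6a82844bdf11a9955207feca738e79f854e4d676b77d3b7ce442ef57c9f2aba7493fbd1ca78cf15e4365a65185718b40e13b0d213253104351f1e716ad5c2cb1ee2928f016de2f0a198ac643c307b8f00db600edd3a228094707e1ab52fe2c77b295e8d418b7f9f028a77c45fb28743c6ac033d727ac2f5493293682bdbfac93b09bdc200234c4a7f7fd4bfbda2ff08e09065001f6fc668b2212c2fab060425fe8e73681ad5bd8a6e701bebe2ecdf8ac879a92ce30ae59e9b79fd9125307da00f0ab820876768789839c39ca8c26ef6197624908fc45f3e57dafe5cd313207d4b486a8a5de1a4639b3384e4cb234dccc1fbf5e52d904ad84ad4ed9f25b7e353d0df13ea15bdf611e330687ffcfd49221d57b547447ada2cb1e7df5e3ba1548d2d4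
  (block 677 45 58 1418 0x22f32719311fab987001b431b9b8cacfc75ade7e46595fb476b6ffe72489cb4c8010f939c63b96f7897fca63aa9fb159012a93da64a1d8e10dfee78e9e82c0fac969cb7e89805b17329898e83f4caeaf4a327f062d66677b1a98c74be9be3a39500bdab6b990a8ce37020185be5d51a02176423d790c662a3977364b5203c7d5c325cf4337dfdb6c074b4cf84185007868c4526acd77ccf1e209bbaa9f304e65a1c36efb9c67593049e3ea36fda108f6ead84ef723759dbb170c5c2523c48fa9873ab678c536e19820bf42a908ee0d2086f7b8f7b17c4047b0632a91ab7da6b07a682b34560f040926c5300d0bda6a1ca5d0e95ddf3b9269cdf3fcba4f7df5c126b5e395b8187e517c0536d882e51642cf3fc44ee6d1226a6a80ed2463a0d918a4f9e214072be4a5d04dca475c4dd08bc84f6f6766c610c355771a9ee19a71a545f4e50bc4043ccdb511680c38c91d41d40f4c16bbd19e04004459fd06d613ce8616c6906ce2698373deab6529fbff88a0b8c94354e8bfab0f5c70485a3b1cde572d8974305d7504e555ee6b4ad2919815d71e9341881aed5159ec9e3c19eca5914df7ce7c9b5d19d92114e3b668848dbf0d279b56886e20df87729584675443b2839b479608c9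e16e60061dfea8858af58b6495a325b2b245b3acc4ab4d2b70b1892dc3da6ef9ee40abebd2b356acb8068cd4247fa4f650d07d8d15a1113600d7cdd15a4a437a62771e152e24750c9a18953ab79200078bda5d5c51a73ddd460b0b73cdabe9fc29b21c53a08e8afdae45f54e53cfc440ea54324873d0a13b30beec608f8c2d14d29365a459018cb8338df19b9a15c7a21d8de5823fac8a299ed1c04263d336acdacd3c2b9f0a126e970ce4bd3bfb4df761195deda8ab973479c3925cd92f2151e8100820665dad35fea187983de8ba1c315c380aa19ac1b1a798c870126f184613ca5f412c77cd64f147f13c51da74e82d1bc81f352a0bea885df07328acfa333bd17c28f3c68ef15fa3da2de5fa8337a19e4e3865e420c151277d9766d957dc59366d4edde1a561aea4a02e42a5ccd898b6ebeb768f413c8bd0ae6ad79ce633f46c7a896992f51c14a9a0547ebc98fde5c9d9ec839347288b99b773ac69708a97600be7ebaac89cec17c9e8fb07f140cd8df161f5c044465e4eaf7f7baac87633a946599eef77f8bbc4f982b1ef23d8a4130b6a00e36f4524a2770d64c9b87db322e8ee317101fa954062f9c1b437eb3c0f78238f099f97f6df697647823abc61f2d89e77fcba095d2925ff0ebde3502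946d73aa531ae7c40462765ba0adc92b96a070475733f6823631944c6c64a21eb70e3dafeacf15638c7aefd336208887557edb67ce125d71d0826716058f4152b7d20ad38957920483f013570a08e99bd7682fe469280c1f7b97332e7f99f9ba4831dfb605c29f4a52c325fe5e501ee78317f39bdbe92a
  (block 673 48 57 1413 0x364ae87f16513516daa3f8f95a6e04e3209540a1e9354d9670f819924cae5b27ea49069c7c40c8578e4754e06863a05e782f37a94442f5c43a018ae37cbb8a9775dc47d6a5bef9b1efbbf1b93b71139697b0e3c87d7b6fda9bd6cfa42525ff707e274f1acbcbdd1bc13bba7554cd7517ae8d5335c01d098dad9881ed62fbadf78c43a7fc9c35c73fd6206aece75888fe54f4aa2d95a3f83befbc111e18a67892988c105d732d927e0f166c0dcbde87dbc1f15f7c1186de7a1414511f85ff7240c83b984881227b0a3e8b194ad69ef5d704dfb0c131646a6ac88a19809b842ce16a71dfd703b7ff2bf3fa69a871a1f1e6840b7b911557d06665293cc51408e917b6aed226f1c09a2f186dd97436f7a2fd3ca9209af0a62e27dd7cfd914ed9daf97c1084166c3628423213ad496e53742134f63835acd0f2e3d268fda6d9753b80de0c8f502a774bc68d27dc13d0a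72b538c3e26daefecdb1ebad4331d29d4b0d8d5de045315fd7e88e9ca66405af1bff98bf7d1796cd3a5d5098cfb177d6e772532170277c99622c2e4b6ac382d8bc136fd2a3434754c0f15280ab83d97ea123a2b1ba2c8792dda3e5c200bde752170085aab957d4dce4a4fad77fc462cffa4ce6f30d3368aff1cdd4328e3ec28192cd411d1f313f8b32cc54cb0ef836e1e2523b3f875389041de2fe1336e1f3fe8f623bbff192b113af0f1a8e0741c3479e70c4b529ba72c13b757ef9b15c9d8121c379c40997d12e1b2bfc766ee36c93d6beb012db399eabd386d43fb1ee23f111bf6e0ee36fda7efb38525b901856325ef92616cab0361b79e033203580c4c22f8c9dc002e53779f8a3a8a99ac2822e4837e5304d6a469f72aa8458cfa1932037552c95e569db0075d3b2b76bb06867ca86337a0c26226a1183e73abb30eb10f4108f8734c88d9b75b0cdfe60ec698fb17e022146f0f23b19ba6b391c75da6280c1264a3b994ad1ea8678c1d910d1b522f21006915b6a63a14d3e07f7e0873ee4a5772a881a899badf855b5a3b079349c3ccf42f02f51d84de08bf37c04e4e5de87b2db48a942df21aa6edd63a38a15aede04aae02e7dba516b657a581166283b89b04a5218ca5e2e5f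8fbf54f4a3088a64ee72f733bedc5130dc947e29fdd76f9a095caf0747e99e777b09e8a21229836a2c68433cc24f0f5cc5d745f1601a20a2ad7241e5468d18450955c15dcbed8de3d43aaa9950b8f229dc9542561cb7c4fcfced5136e4c424751f2e636ece5aa05b0e03f0b0a9f4ac6728dc08f4bdb1d0d3319fe8760c25546f4447986adab423b257a74e587cf3fcf860a0772eaa3a3dc0fc2e4a7c9cea69727c1a6f6fc751dbf1c2c62fd88b4edc37645fe0b2e681a630e7bf37d70f43aa3d2d59ce751f62f324e365d91928b57019db702e431d1b43dcd4523e37f2d1848164854667f244dba10c8e11d0cb23d8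
  ((rung 337 47 631219809440)))) =
  rung 361 46 34964758162 := by
  decide +kernel

theorem ladder_685 :
  block 693 47 59 1452 0x1728f2963ac5aa42804353355e257669f42cbc7302c69a6af0c1c102c4950f9dca1f9e681d3e244e2e218727c35ba543a4ec4349c2e92996b5d5feb3b5e7e13ecd31943a9673b6add0bee4330b813e5d18eb90b6185e62e2fdf6ad964c506e3ea04bfe20f237d53f870c559b4d139acd9e4c9e397b0a94e8dc106f8a297a1984a95046a7949de8ff4d4e3e494aa05602554c1baaf09f65c1ea7d3f05923012d685a6c27440697bb0776cb51585505d10c997afa644b25c70ce56fd6e4eba200b7ea2b4d82959f0f767b59a1c06205567b3f0c75751eb851bf7b6245e8bf09a0e2d547ca6c467227d319f80e468f9b29551ab9f37fd1145494d0d82bc47cf275dd7a943682f686d8ce2709a8a7e7a287969689986b30c04e9ff96be9d421a64c5ac17d478413d7fc871f98840ed35b6797235612e3659da9e232b16b1cdb3cbf2b296840f347183c711bb230dcf005cc59ec761a13e8c8996d0296a518ec4d0b6f2fef43baf4e78a23a19bfabf3ea64d3b66cb56f0886e02185328f6e5f43c28ed4d950a8407b381d16ebdf38c1565fa61753e5931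170015ae5dc14640543f2d22387c87f15e2cf5462eac3057c4d0ff9391bf22ca501dc371a75027f05707a38da635738af721039f488e672986b3e380096210a08524554603342d151ed4970cd1f346440140e522ab77a87aec1ecb0b6a6bb3558e9e7208115aea24de07ab24629d84e6af1dc802c2af677b325e5932414663fb1aa92b2ec23e9d39d75af2c327afb6ede5199ee4f26279fe7f72bbfb3e4c1ba90976cc034d01fc01be46489db9bf99687493141295526cc31967dff7d577743ecd7d24de006bbc0b6367e7f86cca3c8566f6f308d3ae0dfc320741b9fa0972b72735bf995a15b8e54d35752454e077e735def15fe1a9af4b8f248f079d274166c2200636d09c2fb7a011fbf81d23b1ac50d7114d2dd8acf6f27b1cdab510d1306376fae3dcc8c0f442a10dc4311abd7dc7fedd1daf83d75734734a2a5afa593ec0293b5fec714c22a671dbb9f1f91f1f34a55ca1b83c32d23097b1d74f541c48dc29f55776c31fca5740cbf604cc3ad680d673562846ef454fbfd54b68b00672d216c6527e56df741c56e8976cd3c660d76676a80da03b50cbafda7531908037ebc24bca161813f029ae74ab00fc548d21fa83afdcd93394f466414eec855bb5dca7a46ad0f8d3b0249fca02d20c3259ed486d76e3c1c5dcbd30f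61f5768a27c1f8e98481175c0f5d6e37313e2885c89928e67c1b3a9684f2225c53a4ee805629b1bfc5b64d0928d5f2752b46920089b12a24914a8be6aa04f9a1a655e1cb7576f135f8b5e6ba4b51c5180c340a5a6ab8581ac85eb83e74fcc5f55d8fc82a354a8b4301a47c9e0db44369e59d1d413bb1c8e269b868cba3132e83e0c3f8b10153fcd4933b57dae99ba86614afb710242897b4c407948dab9c5157aaa26d5619387a405b6c3547ea5afdff1e1ef3384ba7d1517dee8c2525
  (block 689 47 58 1447 0x164e1e94133fadb50af9b7c7951b24908ce116a440cb87c325a8d936b7ce13e361d45faf0c793037586eb2aa2609d847f77e80a8d302db33b1b7f6c159c0309344e19c2665f3e3443d82d915b4b952a530eb7f996f3eac23e58789ad744f21ddb4883fc04dc0a283efaea7f91d781796f2492501a7c922876a4235f82c7cc881e49441583cf1f843187673619bbfdb9f06db18cc11d5fea2c2f4f07acb378b39ba8464193a212cdc99cd283463daa844f4eaf4d06c2efa17a347bcad1a636f4fcbdf898eac992d1bc37f7d9cbba2d8c5aa0cf908967945a2948137055544180bfd42c7db179826f16823b96466bf6ea725056234afa62109182213a846cc0af2100366e62c40754a098ae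e7c7c79e513a46aa3647cd35d3e2ae0f0afdf32ea0822c13553643d6b74add4bf11916fd912fec6bc0b6849d6d17de64b4526129f2b7721f3868f6ad3cc09f764ed0fcddcb0ace636f7c2224ae1a690452719e6075d8ef874ba8cf0f90a9e5cbfeb196446b715ceeda7c9060dae4cd713846e1613cb2f21c1f879bf3bdea7391f61f160a651381ef1b7bdee2b79dccdc2558fe71b32fc9f4e38bb4f9e6e98eea154efb7d8a1f7bbf6b913c5f3a55612381a0a93c6f9ade49fe6bd9017fbebbac6424e31f01e93cd8b8e12215cb80e936d84b738460b61b58d348a14a1ebf3667d04493b6925b025a2c21cdfb33d0286a8f5e2814a44289979d3a0fea19e584e2b1ff2f3b45f22b62d2b48b863b1e073c9606286ce07c3c194ae356fce86b9b443529dcea4263bdaebb54f8b5dddf0c97dc2a20376307ae96e41b1d606787cf227f02cefb55faa97a0315a12df28a352c0eaa382176a15cd62830a83c325f2c41165114cd89889685f8061ffaf6152b6a6212a56592eec7cb59fc2c5b8c2dc028487460d3a18f3862dd321a4931343ac41a024c2b8d69cf16e3f071d4643e185271d3fd3e933a0913dab5a5344a27ffd77be17831ba65c04f83cf822163123186fe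814d1b5c0a9d249dfb0909bb384798f2306d5ea6a8d28491c36c44f51d831cbec8a2609d66274066af6a7d4efec3f1f2fab681f35934b1a6588931477dba71d9d9f30c24e56dba40cc33d2f4a76919e7f9ea43a6d9fef58194f71c93b3cb39828dc621eb95dd435fdb64dc5f75952f027ea38fbcc888c5a93295cfec9bd146ff215038a0a14129d0a9e11c5499c8dcc053c788177b99cd3affd9fa0196d06bea10a0eec7003a4905cef41e537555709e6f1b22afbb4f4b12995b4cc9f72f7a6d93472c9a07ed5990012d3961be41a7156b2ff9ab433a72237bfa5eac16a0b9ab14720380bdd548d4f80471b111ad320f07057fc309051a5912c8c40eed940b9892376cbf9421355ab0b5513ab19bc62861049835b2e34dee4319bc112eae4746b5eeacbe1b74d6c0e92d437aed5dc349bd55e741f6759f97568772be48da3cddf08d213a13b57ed6cba20c21dad4a025ea13b5b94bdb93747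
  (block 685 46 58 1435 0x47df3ba48201fc7959986b6d23c57f88ad7164199ac94a31a671b5fb81f0b781219cfa6602754cfe028c7d1cc6ef7cea8b0188f44f55b2846d170a85eec9a53290b4c9703556c703aff41aa47dc0e801882cc941bfdf9197a558671d3ff8f5e91df85b7bcbba2e091982a6c8988617f1cf49b4c5b6af44d2a31c31e5a502b4d40a8095619ae54053705f916916e58d99a083336e053269c0182ccc4f831c43d630c484e6bb99f46410df2715e20448407a061a17a21a7dd54c3c86daa419a1c74239849f0480c9c92b570f4b646af8b7ebede6d4c6db08f1e7f13c0b8e13c3404b74cb5423154e503aba22197703ec935bbd88ff1650b90a83ec4c25fab385ff64fbd3b84f946dc27e057ca8a214a14070c3dc5e6a0bd4e694247df3f11483731eace728e6099226be46040f66e4cdc538c51dfc6c42ff118bd337c624a0bfdf66814160e8e367cd421e01934559fc3ad9cea891eb3445ff893ced75392b406596ef7579fa8f0a33121c0b835f61963285e1db7f3e358d74c5c0258819d5a23224ef9af068465495e65851e738ec92218d3e67c2b6318e58b9169d7328b1de4f873abdfbb1360e33b013d4e1bd49fd4b1285aefb65e2b37bc98516f614e2ab6e4dfc0af4172539df79f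544b1e1bf438cb06d1d321619810773ede16da229e08ee1903d33471f9e4fa163feaa3aa0915aec185dfc05199456144a658316d3d11f245c125d5cec90284820919470d35b12f01c31010e2505593ac61787d4c9a9a0807acf3abfec174864e2ca6c69662991dafec081bf5cbae6cc8d3c936bb814a4fe75e5dcd52d91b58bcc3b366cfeae008eba1821bccf231bbcb9c0adc4c68678b106efce3f44010ceed72433656d4cd4aa2a895d6b6072aaa9175fd96641236d54fc36b5940195402d68a57061ff94d5bba8be626ed35e3449082bd1806d1b871a8c9e2a830e2026e8269098a79a229d6a21b18b72250bd8018d9053aaa0eb695d58a9bac9a272f1c91fd6a923e79db6b0dfdb26de6ebf9e752ea41a781376d2884cd3068a6549a18c9dae3ae7263c52cd5254ea7692d6cd8c2916adf2b1e0abbf27e4b3ee4ab211d1cfda0355129a37bcb0ad57639179e99fadc5e884e7bdd3a5ccbab68c5f39fc9431da4500c8a054563641ff2697824805fef47ff2711237f92a5a5765ef9761eb54e13dc082d6ada35e8faad6f8e86003b33ee423b02090a214ab6732344717ddd8b34eca8e648193d94f3bfe4f0123a60fbd5458f417690793dd81b46915f0eb5d1d5dfea658178146e4351e35c07e179b2273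f2bc2c862a3f9db20cd0547079e168340f130e1b0b2338e4614c68336df6acf603f328bfc8451551ef906437fd95170b61a0ee1a4127b680f6cf89c4e73e8c895f37073744d779f01cbfa772bae772f96a13843153746632499089b8814fdabc72d03326ea429174cf84be2e45e4f27b451658fb015b49bdbe207d2447d22
  ((rung 361 46 34964758162)))) =
  rung 361 47 630750414920 := by
  decide +kernel

theorem covers_ladder : Covers 33554432 (rung 361 47 630750414920) := by
  rw [← ladder_685, ← ladder_673, ← ladder_661, ← ladder_649, ← ladder_633, ← ladder_617, ←
    ladder_601, ← ladder_585, ← ladder_569, ← ladder_553, ← ladder_537, ← ladder_521, ←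
    ladder_505, ← ladder_489, ← ladder_469, ← ladder_449, ← ladder_429, ← ladder_409, ←
    ladder_389, ← ladder_365, ← ladder_341, ← ladder_317, ← ladder_289, ← ladder_257, ←
    ladder_221, ← ladder_181, ← ladder_129, ← ladder_26]
  iterate 193 refine Covers.block (by norm_num) ?_
  exact Covers.self _

theorem two_pow_le_rung : 2 ^ 693 ≤ rung 361 47 630750414920 := by
  decide +kernel

end PrimeLadder

theorem exists_prime_of_log_ge {p : ℕ} (h : 480 ≤ Real.log p) :
    ∃ q, q.Prime ∧ p < q ∧ q ≤ p + p.primeCounting := by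
  obtain ⟨q, hq, h1, h2⟩ := exists_prime_log_mem_Ioc h
  obtain hp | hp := lt_or_ge p 65536
  · have h3 : Real.log p ≤ 16 * Real.log 2 := by
      rcases Nat.eq_zero_or_pos p with rfl | h0
      · simp
        positivity
      · have := Real.log_le_log (by exact_mod_cast h0) (show (p : ℝ) ≤ 2 ^ 16 by
          norm_num
          exact_mod_cast hp.le)
        rw [Real.log_pow] at this
        exact_mod_cast this
    linarith [Real.log_two_lt_d9]
  have hp0 : (0 : ℝ) < p := by
    norm_cast
    omega
  have hq0 : (0 : ℝ) < q := by exact_mod_cast hq.pos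
  have hpi := le_primeCounting_mul_log hp
  refine ⟨q, hq, by exact_mod_cast (Real.log_lt_log_iff hp0 hq0).1 h1, ?_⟩
  have hL : 0 < Real.log p := by linarith
  rw [← Real.log_mul hp0.ne' (by positivity), Real.log_le_log_iff hq0 (by positivity)] at h2
  have h3 : 0.92 * p / Real.log p ≤ p.primeCounting := (div_le_iff₀ hL).2 hpi
  have h4 : (p : ℝ) * (1 + 0.92 / Real.log p) = p + 0.92 * p / Real.log p := by ring
  have h5 : (q : ℝ) ≤ p + p.primeCounting := by linarith
  exact_mod_cast h5

open PrimeLadder in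
theorem exists_prime_in_Ioc_pi (p : ℕ) (hp : p.Prime) :
    ∃ q, q.Prime ∧ p < q ∧ q ≤ p + Nat.primeCounting p := by
  have h0 := covers_two.trans (covers_67.trans covers_69109)
  obtain h1 | h1 := lt_or_ge p 33554432
  · exact h0 p hp.two_le (by omega)
  obtain h2 | h2 := lt_or_ge p (rung 361 47 630750414920)
  · exact covers_ladder p h1 h2
  · refine exists_prime_of_log_ge ?_
    have h3 := Real.log_le_log (by positivity)
      (show (2 : ℝ) ^ 693 ≤ p by exact_mod_cast two_pow_le_rung.trans h2)
    rw [Real.log_pow] at h3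
    have := Real.log_two_gt_d9
    push_cast at h3
    linarith
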